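/- Let K = Q(√-1) and p a prime with p ≥ 5. There exist Hermitian cusp forms χ_8, F_{10}, F_{12} of respective weights 8, 10, 12 such that: (1) the Hermitian Eisenstein series E_4, E_6 and χ_8, F_{10}, F_{12} are algebraically independent and the graded ring ⊕_{0 ≤ k ∈ 2Z} M_k^{(s)}(U_2(O_K), ν_k)_{Z_(p)} of symmetric even-weight Hermitian modular forms with p-integral coefficients equals Z_(p)[E_4, E_6, χ_8, F_{10}, F_{12}]; in particular every f ∈ M_k^{(s)}(U_2(O_K), ν_k)_{Z_(p)} (k even) equals P(E_4, E_6, χ_8, F_{10}, F_{12}) for a unique polynomial P over Z_(p); (2) the restrictions to the Siegel half-space satisfy E_4|_{S_2} = G_4, E_6|_{S_2} = G_6, χ_8|_{S_2} ≡ 0, F_{10}|_{S_2} = 6X_{10}, F_{12}|_{S_2} = X_{12}; (3) a_{χ_8}([[1, (−1−i)/2],[(−1+i)/2, 1]]) = 1, so ord_p(χ_8) = [[1, (−1−i)/2],[(−1+i)/2, 1]]. -/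

import Mathlib

open Complex Matrix
open scoped ComplexOrder

noncomputable section

/-- `√d_K` for an imaginary quadratic discriminant `d < 0`,
taken as `√|d| · i` in the upper half plane. -/
def sqrtD (d : ℤ) : ℂ := Real.sqrt (-d) * Complex.I

/-- The ring of integers `O_K = ℤ[(d + √d)/2]` of the imaginary quadratic field of
discriminant `d`, viewed as a subset of `ℂ`. -/
def ringInt (d : ℤ) : Set ℂ :=
  {z | ∃ a b : ℤ, z = (a : ℂ) + (b : ℂ) * (((d : ℂ) + sqrtD d) / 2)}

/-- The inverse different `D_K⁻¹ = O_K / √d_K`. -/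
def invDiff (d : ℤ) : Set ℂ := {z | sqrtD d * z ∈ ringInt d}

/-- The Hermitian upper half-space of degree 2:
`Z` with `(Z - ᵗZ̄)/(2i)` positive definite. -/
def HermitianUpperHalfSpace : Set (Matrix (Fin 2) (Fin 2) ℂ) :=
  {Z | ((Z - Zᴴ).map (fun w => w / (2 * Complex.I))).PosDef}

/-- The lattice `Λ₂(K)`: Hermitian matrices with integral diagonal and
`√d_K ·`(off-diagonal entries) in `O_K`. -/
def LambdaH (d : ℤ) : Set (Matrix (Fin 2) (Fin 2) ℂ) :=
  {H | H.IsHermitian ∧ (∀ i, ∃ n : ℤ, H i i = (n : ℂ)) ∧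
    ∀ i j, sqrtD d * H i j ∈ ringInt d}

/-- Semi-positive elements of `Λ₂(K)`, the index set of Fourier expansions. -/
def HermLattice (d : ℤ) : Set (Matrix (Fin 2) (Fin 2) ℂ) :=
  {H | H ∈ LambdaH d ∧ H.PosSemidef}

/-- The symplectic-form matrix `J₂ = [[0, -1], [1, 0]]` (2×2 blocks). -/
def J2 : Matrix (Fin 2 ⊕ Fin 2) (Fin 2 ⊕ Fin 2) ℂ :=
  Matrix.fromBlocks 0 (-1) 1 0

/-- The Hermitian modular group `U₂(O_K)`:
matrices with entries in `O_K` satisfying `ᵗM̄ J₂ M = J₂`. -/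
def HermitianModularGroup (d : ℤ) : Set (Matrix (Fin 2 ⊕ Fin 2) (Fin 2 ⊕ Fin 2) ℂ) :=
  {M | (∀ i j, M i j ∈ ringInt d) ∧ Mᴴ * J2 * M = J2}

/-- The fractional-linear action `Z ↦ (AZ + B)(CZ + D)⁻¹`. -/
def matAct (M : Matrix (Fin 2 ⊕ Fin 2) (Fin 2 ⊕ Fin 2) ℂ)
    (Z : Matrix (Fin 2) (Fin 2) ℂ) : Matrix (Fin 2) (Fin 2) ℂ :=
  (M.toBlocks₁₁ * Z + M.toBlocks₁₂) * (M.toBlocks₂₁ * Z + M.toBlocks₂₂)⁻¹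

/-- The character `ν_k`: `det^{k/2}` for `K = ℚ(√-1)` (i.e. `d = -4`, `k` even),
and `det^k` for `K = ℚ(√-3)` (i.e. `d = -3`). -/
def nuChar (d k : ℤ) (M : Matrix (Fin 2 ⊕ Fin 2) (Fin 2 ⊕ Fin 2) ℂ) : ℂ :=
  if d = -4 then M.det ^ (k / 2) else M.det ^ k

/-- A Hermitian modular form of degree 2, weight `k` and character `ν_k` for `U₂(O_K)`,
bundled with its Fourier expansion over the semi-positive part of `Λ₂(K)`. -/
structure HermitianModularForm (d k : ℤ) where
  toFun : Matrix (Fin 2) (Fin 2) ℂ → ℂ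
  coeff : Matrix (Fin 2) (Fin 2) ℂ → ℂ
  holo : DifferentiableOn ℂ (fun Z : Fin 2 → Fin 2 → ℂ => toFun (Matrix.of Z))
    {Z | Matrix.of Z ∈ HermitianUpperHalfSpace}
  transform : ∀ M ∈ HermitianModularGroup d, ∀ Z ∈ HermitianUpperHalfSpace,
    toFun (matAct M Z) =
      nuChar d k M * (M.toBlocks₂₁ * Z + M.toBlocks₂₂).det ^ k * toFun Z
  coeff_supported : ∀ H, coeff H ≠ 0 → H ∈ HermLattice d
  expansion : ∀ Z ∈ HermitianUpperHalfSpace,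
    HasSum (fun H : HermLattice d =>
      coeff H * Complex.exp (2 * Real.pi * Complex.I * ((H : Matrix (Fin 2) (Fin 2) ℂ) * Z).trace))
      (toFun Z)

/-- A Hermitian modular form is symmetric if `f(ᵗZ) = f(Z)`. -/
def IsSymmetricHMF {d k : ℤ} (f : HermitianModularForm d k) : Prop :=
  ∀ Z ∈ HermitianUpperHalfSpace, f.toFun Zᵀ = f.toFun Z

/-- `z` is a `p`-integral rational number: `z = a/b` with `p ∤ b`. -/
def IsPIntegral (p : ℕ) (z : ℂ) : Prop :=
  ∃ a b : ℤ, ¬ (p : ℤ) ∣ b ∧ (b : ℂ) * z = (a : ℂ)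

/-- `z ≡ w (mod p^l)` in the local ring `ℤ_(p)`, i.e. `(z - w)/p^l` is `p`-integral. -/
def ModCongr (p l : ℕ) (z w : ℂ) : Prop :=
  IsPIntegral p ((z - w) / (p : ℂ) ^ l)


/-- The lexicographic order on `Λ₂(K)` used to define `ord_p`:
compare first `tr H`, then the `(1,1)`-entry `m`, then (for off-diagonal entry
`(a + b i)/2`) first `a`, then `b`. -/
def lexLt (H H' : Matrix (Fin 2) (Fin 2) ℂ) : Prop :=
  H.trace.re < H'.trace.re ∨
    (H.trace = H'.trace ∧
      ((H 0 0).re < (H' 0 0).re ∨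
        (H 0 0 = H' 0 0 ∧
          ((H 0 1).re < (H' 0 1).re ∨
            ((H 0 1).re = (H' 0 1).re ∧ (H 0 1).im < (H' 0 1).im)))))

/-- The Siegel upper half-space of degree `n`: symmetric complex matrices with
positive definite imaginary part. -/
def SiegelUpperHalfSpace (n : ℕ) : Set (Matrix (Fin n) (Fin n) ℂ) :=
  {Z | Z.IsSymm ∧ ((Z - Zᴴ).map (fun w => w / (2 * Complex.I))).PosDef}

/-- The symplectic-form matrix over `ℤ` in degree `n`. -/
def Jn (n : ℕ) : Matrix (Fin n ⊕ Fin n) (Fin n ⊕ Fin n) ℤ :=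
  Matrix.fromBlocks 0 (-1) 1 0

/-- The Siegel modular group `Γ_n = Sp_n(ℤ)` (as a set of `2n × 2n` integer matrices). -/
def SiegelModularGroup (n : ℕ) : Set (Matrix (Fin n ⊕ Fin n) (Fin n ⊕ Fin n) ℤ) :=
  {M | Mᵀ * Jn n * M = Jn n}

/-- The fractional-linear action of an integral symplectic matrix on the Siegel
upper half-space. -/
def matActS {n : ℕ} (M : Matrix (Fin n ⊕ Fin n) (Fin n ⊕ Fin n) ℤ)
    (Z : Matrix (Fin n) (Fin n) ℂ) : Matrix (Fin n) (Fin n) ℂ :=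
  ((M.map (fun a => (a : ℂ))).toBlocks₁₁ * Z + (M.map (fun a => (a : ℂ))).toBlocks₁₂) *
    ((M.map (fun a => (a : ℂ))).toBlocks₂₁ * Z + (M.map (fun a => (a : ℂ))).toBlocks₂₂)⁻¹

/-- The index lattice of Fourier expansions of Siegel modular forms of level `N`:
semi-positive symmetric rational matrices `T` with `N·T` half-integral,
i.e. `T ∈ (1/N)Λ_n`. -/
def SiegelLattice (n : ℕ) (N : ℕ) : Set (Matrix (Fin n) (Fin n) ℚ) :=
  {T | T.IsSymm ∧ (∀ i, ∃ a : ℤ, (N : ℚ) * T i i = (a : ℚ)) ∧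
    (∀ i j, ∃ a : ℤ, 2 * (N : ℚ) * T i j = (a : ℚ)) ∧
    (T.map (fun q => (q : ℝ))).PosSemidef}

/-- A Siegel modular form of degree `n` and weight `k` for a subgroup
`Γ ⊆ Γ_n = Sp_n(ℤ)` of level `N`, bundled with its Fourier expansion. For the
full modular group take `Γ = SiegelModularGroup n` and `N = 1`. -/
structure SiegelModularForm (n : ℕ) (k : ℤ)
    (Γ : Set (Matrix (Fin n ⊕ Fin n) (Fin n ⊕ Fin n) ℤ)) (N : ℕ) where
  toFun : Matrix (Fin n) (Fin n) ℂ → ℂ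
  coeff : Matrix (Fin n) (Fin n) ℚ → ℂ
  holo : DifferentiableOn ℂ (fun Z : Fin n → Fin n → ℂ => toFun (Matrix.of Z))
    {Z | Matrix.of Z ∈ SiegelUpperHalfSpace n}
  transform : ∀ M ∈ Γ, ∀ Z ∈ SiegelUpperHalfSpace n,
    toFun (matActS M Z) =
      ((M.map (fun a => (a : ℂ))).toBlocks₂₁ * Z +
        (M.map (fun a => (a : ℂ))).toBlocks₂₂).det ^ k * toFun Z
  coeff_supported : ∀ T, coeff T ≠ 0 → T ∈ SiegelLattice n N
  expansion : ∀ Z ∈ SiegelUpperHalfSpace n,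
    HasSum (fun T : SiegelLattice n N =>
      coeff T * Complex.exp (2 * Real.pi * Complex.I *
        (((T : Matrix (Fin n) (Fin n) ℚ).map (fun q => (q : ℂ))) * Z).trace))
      (toFun Z)


/-- A Hermitian cusp form (degree 2, class number one field): the Fourier
coefficients vanish off the positive definite part of the lattice. -/
def IsCuspHMF {d k : ℤ} (f : HermitianModularForm d k) : Prop :=
  ∀ H, ¬ H.PosDef → f.coeff H = 0

/-- `H0 = ord_p f`: `H0` is the minimal element of `Λ₂(K)`, in the lexicographic
order `lexLt`, whose Fourier coefficient is not divisible by `p`. -/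
def IsOrdP (p : ℕ) {d k : ℤ} (f : HermitianModularForm d k)
    (H0 : Matrix (Fin 2) (Fin 2) ℂ) : Prop :=
  H0 ∈ HermLattice d ∧ ¬ ModCongr p 1 (f.coeff H0) 0 ∧
    ∀ H ∈ HermLattice d, lexLt H H0 → ModCongr p 1 (f.coeff H) 0

namespace HermMod
open Filter Topology

/-- Indices `(n, m, a)` of Fourier expansions in `τ₁, τ₂, z₁, …, z_d`. -/
abbrev Idx (d : ℕ) := ℕ × ℕ × (Fin d → ℤ)

/-- Points `(τ₁, τ₂, z)`. -/
abbrev Pt (d : ℕ) := ℂ × ℂ × (Fin d → ℂ)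

/-- The tube domain `Im τ₁ > 0`, `Im τ₂ > 0`, `|Im z|² < Im τ₁ · Im τ₂`. -/
def Dom (d : ℕ) : Set (Pt d) :=
  {w | 0 < w.1.im ∧ 0 < w.2.1.im ∧ ∑ i, (w.2.2 i).im ^ 2 < w.1.im * w.2.1.im}

/-- The cone `|a|² ≤ 4nm` of semi-positive indices. -/
def cone (d : ℕ) : AddSubmonoid (Idx d) where
  carrier := {x | ∑ i, x.2.2 i ^ 2 ≤ 4 * (x.1 : ℤ) * x.2.1}
  zero_mem' := by simp
  add_mem' := by
    rintro ⟨n, m, a⟩ ⟨n', m', a'⟩ h h'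
    simp only [Set.mem_ofPred_eq, Prod.mk_add_mk, Pi.add_apply] at *
    have cs := Finset.sum_mul_sq_le_sq_mul_sq Finset.univ a a'
    have e : ∑ i, (a i + a' i) ^ 2 = ∑ i, a i ^ 2 + 2 * ∑ i, a i * a' i + ∑ i, a' i ^ 2 := by
      rw [Finset.mul_sum, ← Finset.sum_add_distrib, ← Finset.sum_add_distrib]
      exact Finset.sum_congr rfl fun i _ => by ring
    have h1 : (∑ i, a i * a' i) ^ 2 ≤ (4 * (n : ℤ) * m) * (4 * n' * m') :=
      cs.trans (mul_le_mul h h' (Finset.sum_nonneg fun i _ => sq_nonneg _) (by positivity))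
    have h2 : ∑ i, a i * a' i ≤ 2 * (n : ℤ) * m' + 2 * n' * m := by
      refine abs_le_of_sq_le_sq' ?_ (by positivity) |>.2
      nlinarith [sq_nonneg ((n : ℤ) * m' - n' * m)]
    rw [e]
    push_cast
    nlinarith

theorem mem_cone {d : ℕ} {x : Idx d} :
    x ∈ cone d ↔ ∑ i, x.2.2 i ^ 2 ≤ 4 * (x.1 : ℤ) * x.2.1 := Iff.rfl

theorem abs_le_of_mem_cone {d : ℕ} {x : Idx d} (hx : x ∈ cone d) (i : Fin d) :
    |x.2.2 i| ≤ x.1 + x.2.1 := by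
  have h1 : x.2.2 i ^ 2 ≤ ∑ i, x.2.2 i ^ 2 :=
    Finset.single_le_sum (f := fun i => x.2.2 i ^ 2) (fun i _ => sq_nonneg _) (Finset.mem_univ i)
  have h2 := mem_cone.1 hx
  refine abs_le_of_sq_le_sq ?_ (by positivity)
  nlinarith [sq_nonneg ((x.1 : ℤ) - x.2.1)]

/-- The exponential `exp(2πi(nτ₁ + mτ₂ + a·z))`. -/
def ex {d : ℕ} (x : Idx d) (w : Pt d) : ℂ :=
  cexp (2 * Real.pi * I * (x.1 * w.1 + x.2.1 * w.2.1 + ∑ i, x.2.2 i * w.2.2 i))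

theorem ex_add {d : ℕ} (x y : Idx d) (w : Pt d) : ex (x + y) w = ex x w * ex y w := by
  rw [ex, ex, ex, ← Complex.exp_add]
  congr 1
  simp only [Prod.fst_add, Prod.snd_add, Pi.add_apply, Nat.cast_add, Int.cast_add, add_mul,
    Finset.sum_add_distrib]
  ring

theorem ex_zero {d : ℕ} (w : Pt d) : ex (0 : Idx d) w = 1 := by simp [ex]

/-- `f` has the absolutely convergent Fourier expansion with coefficients `c`. -/
structure IsExp {d : ℕ} (f : Pt d → ℂ) (c : Idx d → ℂ) : Prop where
  supp : ∀ x, c x ≠ 0 → x ∈ cone d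
  hasSum : ∀ w ∈ Dom d, HasSum (fun x => c x * ex x w) (f w)

namespace IsExp
variable {d : ℕ} {f f' : Pt d → ℂ} {c c' : Idx d → ℂ}

theorem congr (h : IsExp f c) (hf : ∀ w ∈ Dom d, f' w = f w) : IsExp f' c :=
  ⟨h.supp, fun w hw => by rw [hf w hw]; exact h.hasSum w hw⟩

theorem add (h : IsExp f c) (h' : IsExp f' c') : IsExp (f + f') (c + c') where
  supp x hx := by
    by_contra hn
    exact hx (by simp [not_imp_comm.1 (h.supp x) hn, not_imp_comm.1 (h'.supp x) hn])
  hasSum w hw := by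
    simpa [add_mul] using (h.hasSum w hw).add (h'.hasSum w hw)

theorem smul (h : IsExp f c) (r : ℂ) : IsExp (r • f) (r • c) where
  supp x hx := h.supp x fun h0 => hx (by simp [h0])
  hasSum w hw := by simpa [mul_assoc] using (h.hasSum w hw).mul_left r

theorem sub (h : IsExp f c) (h' : IsExp f' c') : IsExp (f - f') (c - c') := by
  have := h.add (h'.smul (-1))
  simpa [sub_eq_add_neg] using this

theorem one : IsExp (1 : Pt d → ℂ) (Pi.single 0 1) where
  supp x hx := by
    by_cases h : x = 0
    · rw [h]; exact zero_mem _
    · exact absurd (Pi.single_eq_of_ne h _) hx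
  hasSum w _ := by
    convert hasSum_single (0 : Idx d) ?_ using 1
    · simp [ex_zero]
    · intro x hx; simp [Pi.single_eq_of_ne hx]

theorem zero : IsExp (0 : Pt d → ℂ) 0 := ⟨fun x hx => absurd rfl hx, fun w _ => by simp [hasSum_zero]⟩

theorem hasSum_cone (h : IsExp f c) {w : Pt d} (hw : w ∈ Dom d) :
    HasSum (fun x : cone d => c x * ex (x : Idx d) w) (f w) :=
  (hasSum_subtype_iff_of_support_subset (f := fun x => c x * ex x w) (s := (cone d : Set (Idx d)))
    fun x hx => h.supp x fun h0 => hx (by simp [h0])).2 (h.hasSum w hw)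

end IsExp

theorem finite_antidiagonal {d : ℕ} (x : cone d) :
    {p : cone d × cone d | p.1 + p.2 = x}.Finite := by
  have key : {y : Idx d | y ∈ cone d ∧ y.1 ≤ x.1.1 ∧ y.2.1 ≤ x.1.2.1}.Finite := by
    refine ((Set.finite_Iic x.1.1).prod ((Set.finite_Iic x.1.2.1).prod
      (Set.Finite.pi' fun _ : Fin d =>
        Set.finite_Icc (-((x.1.1 : ℤ) + x.1.2.1)) ((x.1.1 : ℤ) + x.1.2.1)))).subset ?_
    rintro ⟨n, m, a⟩ ⟨hy, hn, hm⟩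
    refine ⟨hn, hm, fun i => ?_⟩
    have := abs_le.1 (abs_le_of_mem_cone hy i)
    simp only at this hn hm
    constructor <;> [have := this.1; have := this.2] <;> simp only <;> omega
  have key' : {y : cone d | y.1.1 ≤ x.1.1 ∧ y.1.2.1 ≤ x.1.2.1}.Finite := by
    refine Set.Finite.of_finite_image (f := Subtype.val) (key.subset ?_)
      Subtype.val_injective.injOn
    rintro _ ⟨y, hy, rfl⟩
    exact ⟨y.2, hy⟩
  refine (key'.prod key').subset ?_
  rintro ⟨y, z⟩ rfl
  exact ⟨⟨Nat.le_add_right _ _, Nat.le_add_right _ _⟩, ⟨Nat.le_add_left _ _, Nat.le_add_left _ _⟩⟩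

instance {d : ℕ} : Finset.HasAntidiagonal (cone d) where
  antidiagonal x := (finite_antidiagonal x).toFinset
  mem_antidiagonal := by simp

open Classical in
/-- Convolution of coefficients over the cone. -/
def coneConv {d : ℕ} (c c' : Idx d → ℂ) (x : Idx d) : ℂ :=
  if h : x ∈ cone d then ∑ p ∈ Finset.HasAntidiagonal.antidiagonal (⟨x, h⟩ : cone d), c p.1 * c' p.2 else 0

theorem coneConv_mul_ex {d : ℕ} (c c' : Idx d → ℂ) (x : cone d) (w : Pt d) :
    coneConv c c' x * ex (x : Idx d) w = ∑ p ∈ Finset.HasAntidiagonal.antidiagonal x,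
      (c p.1 * ex (p.1 : Idx d) w) * (c' p.2 * ex (p.2 : Idx d) w) := by
  rw [coneConv, dif_pos x.2, Finset.sum_mul]
  refine Finset.sum_congr rfl fun p hp => ?_
  rw [Finset.HasAntidiagonal.mem_antidiagonal] at hp
  have h : (x : Idx d) = (p.1 : Idx d) + p.2 := by rw [← hp, AddSubmonoid.coe_add]
  rw [h, ex_add]
  ring

theorem IsExp.mul {d : ℕ} {f f' : Pt d → ℂ} {c c' : Idx d → ℂ} (h : IsExp f c) (h' : IsExp f' c') :
    IsExp (f * f') (coneConv c c') := by
  have supp : ∀ x, coneConv c c' x ≠ 0 → x ∈ cone d := fun x hx => by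
    by_contra hn
    exact hx (dif_neg hn)
  refine ⟨supp, fun w hw => ?_⟩
  have s := h.hasSum_cone hw
  have s' := h'.hasSum_cone hw
  have m := summable_mul_of_summable_norm s.summable.norm s'.summable.norm
  have t' := s.summable.tsum_mul_tsum_eq_tsum_sum_antidiagonal s'.summable m
  rw [s.tsum_eq, s'.tsum_eq] at t'
  have u := (summable_sum_mul_antidiagonal_of_summable_mul
    (f := fun x : cone d => c x * ex (x : Idx d) w)
    (g := fun x : cone d => c' x * ex (x : Idx d) w) m).hasSum
  rw [← t'] at u
  refine (hasSum_subtype_iff_of_support_subset (f := fun x => coneConv c c' x * ex x w)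
    (s := (cone d : Set (Idx d))) fun x hx => supp x fun h0 => hx (by simp [h0])).1 ?_
  exact u.congr_fun fun x => coneConv_mul_ex c c' x w

theorem coneConv_mem {d : ℕ} {R : Subring ℂ} {c c' : Idx d → ℂ} (h : ∀ x, c x ∈ R)
    (h' : ∀ x, c' x ∈ R) (x : Idx d) : coneConv c c' x ∈ R := by
  unfold coneConv
  split_ifs
  · exact sum_mem fun p _ => mul_mem (h _) (h' _)
  · exact zero_mem _

/-- Existence of a Fourier expansion with coefficients in `R`. -/
def HasExp {d : ℕ} (R : Subring ℂ) (f : Pt d → ℂ) : Prop := ∃ c, IsExp f c ∧ ∀ x, c x ∈ R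

namespace HasExp
variable {d : ℕ} {R : Subring ℂ} {f f' : Pt d → ℂ}

theorem add (h : HasExp R f) (h' : HasExp R f') : HasExp R (f + f') := by
  obtain ⟨c, h, hc⟩ := h
  obtain ⟨c', h', hc'⟩ := h'
  exact ⟨_, h.add h', fun x => add_mem (hc x) (hc' x)⟩

theorem mul (h : HasExp R f) (h' : HasExp R f') : HasExp R (f * f') := by
  obtain ⟨c, h, hc⟩ := h
  obtain ⟨c', h', hc'⟩ := h'
  exact ⟨_, h.mul h', coneConv_mem hc hc'⟩

theorem smul (h : HasExp R f) {r : ℂ} (hr : r ∈ R) : HasExp R (r • f) := by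
  obtain ⟨c, h, hc⟩ := h
  exact ⟨_, h.smul r, fun x => mul_mem hr (hc x)⟩

theorem one : HasExp R (1 : Pt d → ℂ) :=
  ⟨_, IsExp.one, fun x => by
    by_cases h : x = 0
    · subst h; simp
    · simp [Pi.single_eq_of_ne h]⟩

theorem sub (h : HasExp R f) (h' : HasExp R f') : HasExp R (f - f') := by
  have := h.add (h'.smul (r := -1) (by simp))
  simpa [sub_eq_add_neg] using this

end HasExp

theorem integral_exp_int (k : ℤ) :
    ∫ x in (0 : ℝ)..1, cexp (2 * Real.pi * I * (k * x)) = if k = 0 then 1 else 0 := by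
  split_ifs with h
  · simp [h]
  · have hk : (2 * Real.pi * I * k : ℂ) ≠ 0 := by
      simp [Real.pi_ne_zero, h]
    have := integral_exp_mul_complex (a := 0) (b := 1) hk
    simp only [← mul_assoc]
    rw [this]
    have e1 : cexp (2 * Real.pi * I * k * (1 : ℝ)) = 1 := by
      rw [Complex.exp_eq_one_iff]; exact ⟨k, by push_cast; ring⟩
    rw [e1]; simp

theorem tsum_fiber_eq_zero {ι : Type*} [Countable ι] {a : ι → ℂ} (ha : Summable fun i => ‖a i‖) (k : ι → ℤ)
    (h : ∀ x : ℝ, ∑' i, a i * cexp (2 * Real.pi * I * (k i * x)) = 0) (K : ℤ) :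
    ∑' i, (if k i = K then a i else 0) = 0 := by
  let F : ι → C(ℝ, ℂ) := fun i =>
    ⟨fun x => a i * cexp (2 * Real.pi * I * ((k i - K : ℤ) * x)), by fun_prop⟩
  have hF : ∀ i x, ‖F i x‖ = ‖a i‖ := fun i x => by
    simp only [F, ContinuousMap.coe_mk, norm_mul]
    rw [show (2 * Real.pi * I * ((k i - K : ℤ) * x) : ℂ)
      = ((2 * Real.pi * ((k i - K : ℤ) * x) : ℝ) : ℂ) * I by push_cast; ring,
      Complex.norm_exp_ofReal_mul_I, mul_one]
  have key := intervalIntegral.hasSum_intervalIntegral_of_summable_norm (a := 0) (b := 1) (f := F)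
    (ha.of_nonneg_of_le (fun i => norm_nonneg _) fun i => by
      rw [ContinuousMap.norm_le _ (norm_nonneg _)]
      intro x; exact (hF i x).le)
  have e1 : ∀ i, ∫ x in (0 : ℝ)..1, F i x = if k i = K then a i else 0 := fun i => by
    simp only [F, ContinuousMap.coe_mk, intervalIntegral.integral_const_mul, integral_exp_int]
    simp [sub_eq_zero]
  have e2 : ∀ x : ℝ, ∑' i, F i x = 0 := fun x => by
    have : ∀ i, F i x = a i * cexp (2 * Real.pi * I * (k i * x))
        * cexp (-(2 * Real.pi * I * (K * x))) := fun i => by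
      simp only [F, ContinuousMap.coe_mk, mul_assoc, ← Complex.exp_add]
      push_cast; ring_nf
    simp only [this, tsum_mul_right, h, zero_mul]
  simp only [e1, e2] at key
  simpa using key.tsum_eq

theorem tsum_multifiber_eq_zero {ι : Type*} [Countable ι] (r : ℕ) : ∀ {a : ι → ℂ} (_ : Summable fun i => ‖a i‖)
    (k : ι → Fin r → ℤ)
    (_ : ∀ x : Fin r → ℝ, ∑' i, a i * cexp (2 * Real.pi * I * ∑ j, (k i j : ℂ) * (x j : ℂ)) = 0)
    (K : Fin r → ℤ), ∑' i, (if k i = K then a i else 0) = 0 := by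
  induction r with
  | zero =>
    intro a ha k h K
    simpa [Subsingleton.elim _ K] using h 0
  | succ r ih =>
    intro a ha k h K
    have step := ih (a := fun i => if k i 0 = K 0 then a i else 0)
      (ha.of_nonneg_of_le (fun i => norm_nonneg _) fun i => by split_ifs <;> simp)
      (fun i => Fin.tail (k i)) (fun x => by
        have := tsum_fiber_eq_zero
          (a := fun i => a i * cexp (2 * Real.pi * I * ∑ j, (Fin.tail (k i) j : ℂ) * (x j : ℂ)))
          (by
            refine ha.congr fun i => ?_
            rw [norm_mul, show (2 * Real.pi * I * ∑ j, (Fin.tail (k i) j : ℂ) * (x j : ℂ) : ℂ)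
              = ((2 * Real.pi * ∑ j, Fin.tail (k i) j * x j : ℝ) : ℂ) * I by push_cast; ring,
              Complex.norm_exp_ofReal_mul_I, mul_one])
          (fun i => k i 0) (fun y => by
            rw [← h (Fin.cons y x)]
            refine tsum_congr fun i => ?_
            rw [mul_assoc, ← Complex.exp_add, Fin.sum_univ_succ]
            simp only [Fin.cons_zero, Fin.cons_succ, Fin.tail]
            ring_nf) (K 0)
        refine (tsum_congr fun i => ?_).trans this
        split_ifs <;> simp) (Fin.tail K)
    refine (tsum_congr fun i => ?_).trans step
    have : k i = K ↔ Fin.tail (k i) = Fin.tail K ∧ k i 0 = K 0 := by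
      rw [← Fin.cons_self_tail (k i), ← Fin.cons_self_tail K, Fin.cons_inj]
      simp [and_comm]
    by_cases h1 : Fin.tail (k i) = Fin.tail K <;> by_cases h2 : k i 0 = K 0 <;> simp [this, h1, h2]

/-- The base point `(i, i, 0)`. -/
def basePt (d : ℕ) : Pt d := (I, I, 0)

theorem ex_shift {d : ℕ} (x : Idx d) (w u : Pt d) : ex x (w + u) = ex x w * ex x u := by
  rw [ex, ex, ex, ← Complex.exp_add]
  congr 1
  simp only [Prod.fst_add, Prod.snd_add, Pi.add_apply, mul_add, Finset.sum_add_distrib]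
  ring

theorem Dom.shift {d : ℕ} {w : Pt d} (hw : w ∈ Dom d) (s t : ℝ) (u : Fin d → ℝ) :
    w + ((s : ℂ), (t : ℂ), fun i => (u i : ℂ)) ∈ Dom d := by
  simpa [Dom] using hw

theorem basePt_mem (d : ℕ) : basePt d ∈ Dom d := by simp [basePt, Dom]

theorem ex_ne_zero {d : ℕ} (x : Idx d) (w : Pt d) : ex x w ≠ 0 := Complex.exp_ne_zero _

/-- Coefficients of an absolutely convergent expansion vanishing along the real translates of a point
vanish. -/
theorem IsExp.eq_zero {d : ℕ} {f : Pt d → ℂ} {c : Idx d → ℂ} (h : IsExp f c)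
    (hf : ∀ w ∈ Dom d, f w = 0) : c = 0 := by
  ext X
  have hs := (h.hasSum _ (basePt_mem d)).summable.norm
  let k : Idx d → Fin (d + 2) → ℤ := fun x => Fin.cons (x.1 : ℤ) (Fin.cons (x.2.1 : ℤ) x.2.2)
  have hk : ∀ x, k x = k X ↔ x = X := fun x => by
    simp only [k, Fin.cons_inj, Nat.cast_inj]
    rw [Prod.ext_iff, Prod.ext_iff]
  have := tsum_multifiber_eq_zero (d + 2) hs k (fun y => by
    have hw := Dom.shift (basePt_mem d) (y 0) (y 1) (fun i => y i.succ.succ)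
    rw [← hf _ hw, ← (h.hasSum _ hw).tsum_eq]
    refine tsum_congr fun x => ?_
    rw [ex_shift, mul_assoc]
    congr 2
    rw [ex]
    congr 2
    simp [k, Fin.sum_univ_succ]
    ring) (k X)
  simp only [hk, tsum_ite_eq] at this
  simpa [ex_ne_zero] using this

theorem IsExp.unique {d : ℕ} {f : Pt d → ℂ} {c c' : Idx d → ℂ} (h : IsExp f c) (h' : IsExp f c') :
    c = c' := by
  have := (h.sub h').eq_zero (by simp)
  exact sub_eq_zero.1 this

theorem IsExp.eqOn_zero {d : ℕ} {f : Pt d → ℂ} (h : IsExp f 0) : ∀ w ∈ Dom d, f w = 0 :=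
  fun w hw => (h.hasSum w hw).unique (by simp [hasSum_zero])

end HermMod

namespace HermMod
open Filter Topology

theorem tendsto_exp_taylor (β : ℂ) (J : ℕ) :
    Tendsto (fun u : ℂ => (cexp (β * u) - ∑ l ∈ Finset.range J, (β * u) ^ l / l.factorial) / u ^ J)
      (𝓝[≠] 0) (𝓝 (β ^ J / J.factorial)) := by
  rw [tendsto_iff_norm_sub_tendsto_zero]
  have lim : Tendsto (fun u : ℂ => ‖β‖ ^ (J + 1) * ‖u‖ * Real.exp ‖β * u‖) (𝓝[≠] 0) (𝓝 0) := by
    have : ContinuousAt (fun u : ℂ => ‖β‖ ^ (J + 1) * ‖u‖ * Real.exp ‖β * u‖) 0 := by fun_prop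
    simpa using this.tendsto.mono_left nhdsWithin_le_nhds
  refine squeeze_zero' (Eventually.of_forall fun _ => norm_nonneg _) ?_ lim
  filter_upwards [self_mem_nhdsWithin] with u hu
  have hu : u ≠ 0 := hu
  have h := Complex.norm_exp_sub_sum_le_norm_mul_exp (β * u) (J + 1)
  rw [Finset.sum_range_succ] at h
  have e : (cexp (β * u) - ∑ l ∈ Finset.range J, (β * u) ^ l / l.factorial) / u ^ J
      - β ^ J / J.factorial = (cexp (β * u) - (∑ l ∈ Finset.range J, (β * u) ^ l / l.factorial
        + (β * u) ^ J / J.factorial)) / u ^ J := by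
    field_simp
    ring
  rw [e, norm_div, norm_pow, div_le_iff₀ (by positivity)]
  refine h.trans (le_of_eq ?_)
  rw [norm_mul]; ring

theorem abs_pow_le_exp (J : ℕ) {r : ℝ} (hr : 0 < r) (x : ℝ) (hx : 0 ≤ x) :
    x ^ J ≤ J.factorial / r ^ J * Real.exp (r * x) := by
  have := Real.pow_div_factorial_le_exp (x := r * x) (by positivity) J
  rw [div_le_iff₀ (by positivity), mul_pow] at this
  rw [div_mul_eq_mul_div, le_div_iff₀ (by positivity)]
  linarith

theorem summable_mul_pow {ι : Type*} {a : ι → ℂ} {β : ι → ℤ} {r : ℝ} (hr : 0 < r)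
    (hs : Summable fun i => ‖a i‖ * Real.exp (r * |(β i : ℝ)|)) (l : ℕ) :
    Summable fun i => a i * (β i : ℂ) ^ l := by
  refine Summable.of_norm_bounded (hs.mul_left (l.factorial / r ^ l)) fun i => ?_
  rw [norm_mul, norm_pow, Complex.norm_intCast]
  have := abs_pow_le_exp l hr |(β i : ℝ)| (abs_nonneg _)
  calc ‖a i‖ * |(β i : ℝ)| ^ l ≤ ‖a i‖ * _ := mul_le_mul_of_nonneg_left this (norm_nonneg _)
    _ = _ := by ring

theorem tendsto_taylor {α ι : Type*} {L : Filter α} {u : α → ℂ} {A : α → ι → ℂ} {a : ι → ℂ}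
    {D : ι → ℝ} {β : ι → ℤ} {r : ℝ} (hr : 0 < r) (hu : Tendsto u L (𝓝[≠] 0))
    (hA : ∀ i, Tendsto (fun t => A t i) L (𝓝 (a i))) (hD : ∀ᶠ t in L, ∀ i, ‖A t i‖ ≤ D i)
    (hs : Summable fun i => D i * Real.exp (r * |(β i : ℝ)|)) (J : ℕ)
    (h : ∀ᶠ t in L, ∀ l < J, ∑' i, A t i * (β i : ℂ) ^ l = 0) :
    Tendsto (fun t => (∑' i, A t i * cexp (β i * u t)) / u t ^ J) L
      (𝓝 (∑' i, a i * ((β i : ℂ) ^ J / J.factorial))) := by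
  have hun : Tendsto (fun t => ‖u t‖) L (𝓝 0) := by
    simpa using (hu.mono_right nhdsWithin_le_nhds).norm
  have main : Tendsto (fun t => ∑' i, A t i * ((cexp (β i * u t) -
      ∑ l ∈ Finset.range J, (β i * u t) ^ l / l.factorial) / u t ^ J))
      L (𝓝 (∑' i, a i * ((β i : ℂ) ^ J / J.factorial))) := by
    refine tendsto_tsum_of_dominated_convergence
      (hs.mul_left (J.factorial / (r / 2) ^ J))
      (fun i => (hA i).mul ((tendsto_exp_taylor _ J).comp hu)) ?_
    filter_upwards [hun.eventually_lt_const (half_pos hr),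
      (tendsto_nhdsWithin_iff.1 hu).2, hD] with t hut hu0 hDt i
    have hu0 : u t ≠ 0 := hu0
    have h1 := Complex.norm_exp_sub_sum_le_norm_mul_exp (β i * u t) J
    have h2 := abs_pow_le_exp J (half_pos hr) |(β i : ℝ)| (abs_nonneg _)
    rw [norm_mul, norm_div, norm_pow]
    have h3 : ‖(β i * u t : ℂ)‖ ≤ r / 2 * |(β i : ℝ)| := by
      rw [norm_mul, Complex.norm_intCast, mul_comm]
      exact mul_le_mul_of_nonneg_right hut.le (abs_nonneg _)
    have h4 : ‖cexp (β i * u t) - ∑ l ∈ Finset.range J, (β i * u t) ^ l / l.factorial‖ / ‖u t‖ ^ J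
        ≤ |(β i : ℝ)| ^ J * Real.exp (r / 2 * |(β i : ℝ)|) := by
      rw [div_le_iff₀ (by positivity)]
      refine h1.trans ?_
      rw [norm_mul, mul_pow, Complex.norm_intCast, mul_right_comm]
      rw [norm_mul, Complex.norm_intCast] at h3
      gcongr
    have h5 : 0 ≤ D i := (norm_nonneg _).trans (hDt i)
    calc _ ≤ D i * (|(β i : ℝ)| ^ J * Real.exp (r / 2 * |(β i : ℝ)|)) := by
          gcongr
          exact hDt i
      _ ≤ D i * ((J.factorial / (r / 2) ^ J * Real.exp (r / 2 * |(β i : ℝ)|)) *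
          Real.exp (r / 2 * |(β i : ℝ)|)) := by gcongr
      _ = D i * (J.factorial / (r / 2) ^ J * (Real.exp (r / 2 * |(β i : ℝ)| +
          r / 2 * |(β i : ℝ)|))) := by rw [Real.exp_add]; ring
      _ = _ := by ring_nf
  refine main.congr' ?_
  filter_upwards [hun.eventually_lt_const hr, hD, h] with t hut hDt ht
  have hs' : Summable fun i => ‖A t i‖ * Real.exp (r * |(β i : ℝ)|) :=
    Summable.of_nonneg_of_le (fun i => by positivity)
      (fun i => mul_le_mul_of_nonneg_right (hDt i) (Real.exp_pos _).le) hs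
  have sE : Summable fun i => A t i * cexp (β i * u t) := by
    refine Summable.of_norm_bounded hs' fun i => ?_
    rw [norm_mul]
    gcongr
    refine (Complex.norm_exp_le_exp_norm _).trans (Real.exp_le_exp.2 ?_)
    rw [norm_mul, Complex.norm_intCast, mul_comm]
    gcongr
  have sT : ∀ l, Summable fun i => A t i * ((β i * u t) ^ l / l.factorial) := fun l =>
    ((summable_mul_pow hr hs' l).mul_right (u t ^ l / l.factorial)).congr fun i => by ring
  have zT : ∑' i, ∑ l ∈ Finset.range J, A t i * ((β i * u t) ^ l / l.factorial) = 0 := by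
    rw [Summable.tsum_finsetSum fun l _ => sT l]
    refine Finset.sum_eq_zero fun l hl => ?_
    rw [show (fun i => A t i * ((β i * u t) ^ l / l.factorial) : ι → ℂ)
      = fun i => A t i * (β i : ℂ) ^ l * (u t ^ l / l.factorial) by ext; ring, tsum_mul_right,
      ht l (Finset.mem_range.1 hl), zero_mul]
  rw [← sub_zero (∑' i, A t i * cexp (β i * u t)), ← zT,
    ← sE.tsum_sub (summable_sum fun l _ => sT l), ← tsum_div_const]
  refine tsum_congr fun i => ?_
  rw [← Finset.mul_sum, ← mul_sub, mul_div_assoc]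

/-- The point with extra coordinate `v`. -/
def consPt {d : ℕ} (v : ℂ) (w : Pt d) : Pt (d + 1) := (w.1, w.2.1, Fin.cons v w.2.2)

/-- The index with extra coordinate `b`. -/
def consIdx {d : ℕ} (b : ℤ) (y : Idx d) : Idx (d + 1) := (y.1, y.2.1, Fin.cons b y.2.2)

/-- Splitting off the first elliptic coordinate. -/
def consIdxEquiv (d : ℕ) : Idx d × ℤ ≃ Idx (d + 1) where
  toFun p := consIdx p.2 p.1
  invFun x := ((x.1, x.2.1, Fin.tail x.2.2), x.2.2 0)
  left_inv p := by simp [consIdx]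
  right_inv x := by simp [consIdx, Fin.cons_self_tail]

theorem ex_cons {d : ℕ} (b : ℤ) (y : Idx d) (v : ℂ) (w : Pt d) :
    ex (consIdx b y) (consPt v w) = ex y w * cexp (2 * Real.pi * I * (b * v)) := by
  rw [ex, ex, ← Complex.exp_add]
  congr 1
  simp only [consIdx, consPt, Fin.sum_univ_succ, Fin.cons_zero, Fin.cons_succ]
  ring

theorem consPt_mem {d : ℕ} {v : ℂ} {w : Pt d} : consPt v w ∈ Dom (d + 1) ↔ 0 < w.1.im ∧ 0 < w.2.1.im
    ∧ v.im ^ 2 + ∑ i, (w.2.2 i).im ^ 2 < w.1.im * w.2.1.im := by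
  simp [Dom, consPt, Fin.sum_univ_succ]

theorem consPt_zero_mem {d : ℕ} {w : Pt d} (hw : w ∈ Dom d) : consPt 0 w ∈ Dom (d + 1) := by
  rw [consPt_mem]; simpa [Dom] using hw

theorem exists_im_shift {d : ℕ} {w : Pt d} (hw : w ∈ Dom d) :
    ∃ s : ℝ, 0 < s ∧ (w.1 - s * I, w.2.1 - s * I, w.2.2) ∈ Dom d := by
  obtain ⟨h1, h2, h3⟩ := hw
  have h0 : 0 ≤ ∑ i, (w.2.2 i).im ^ 2 := Finset.sum_nonneg fun i _ => sq_nonneg _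
  obtain ⟨s, hs⟩ : ∃ s, s = (w.1.im * w.2.1.im - ∑ i, (w.2.2 i).im ^ 2) / (2 * (w.1.im + w.2.1.im)) :=
    ⟨_, rfl⟩
  have hs0 : 0 < s := by rw [hs]; exact div_pos (by linarith) (by positivity)
  rw [eq_div_iff (by positivity)] at hs
  refine ⟨s, hs0, ?_⟩
  simp only [Dom, Set.mem_ofPred_eq, sub_im, mul_im, ofReal_re, I_im, mul_one, ofReal_im, I_re,
    mul_zero, add_zero]
  refine ⟨?_, ?_, ?_⟩ <;> nlinarith

theorem IsExp.summable_im {d : ℕ} {f : Pt d → ℂ} {c : Idx d → ℂ} (h : IsExp f c)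
    {w : Pt d} (hw : w ∈ Dom d) : ∃ r : ℝ, 0 < r ∧
      Summable fun x : Idx d => ‖c x * ex x w‖ * Real.exp (r * (x.1 + x.2.1)) := by
  obtain ⟨s, hs, hs'⟩ := exists_im_shift hw
  refine ⟨2 * Real.pi * s, by positivity, ?_⟩
  refine (h.hasSum _ hs').summable.norm.congr fun x => ?_
  rw [norm_mul, norm_mul, mul_assoc, ex, ex, Complex.norm_exp, Complex.norm_exp, ← Real.exp_add]
  congr 2
  simp
  ring

theorem norm_ex_le {d : ℕ} {x : Idx d} (hx : ∀ i, |x.2.2 i| ≤ x.1 + x.2.1) (u : Pt d) :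
    ‖ex x u‖ ≤ Real.exp (2 * Real.pi * (d + 2) * ‖u‖ * (x.1 + x.2.1)) := by
  rw [ex, Complex.norm_exp]
  refine Real.exp_le_exp.2 ?_
  have e : (2 * Real.pi * I * (x.1 * u.1 + x.2.1 * u.2.1 + ∑ i, x.2.2 i * u.2.2 i) : ℂ).re
      = 2 * Real.pi * (x.1 * (-u.1.im) + x.2.1 * (-u.2.1.im) + ∑ i, x.2.2 i * (-(u.2.2 i).im)) := by
    simp
    ring
  rw [e, mul_assoc (2 * Real.pi) _ _, mul_assoc (2 * Real.pi) _ _]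
  refine mul_le_mul_of_nonneg_left ?_ (by positivity)
  have b1 : -u.1.im ≤ ‖u‖ := (neg_le_abs _).trans ((Complex.abs_im_le_norm _).trans (norm_fst_le u))
  have b2 : -u.2.1.im ≤ ‖u‖ := (neg_le_abs _).trans ((Complex.abs_im_le_norm _).trans
    ((norm_fst_le u.2).trans (norm_snd_le u)))
  have b3 : ∑ i, (x.2.2 i : ℝ) * (-(u.2.2 i).im) ≤ ∑ _i : Fin d, ((x.1 : ℝ) + x.2.1) * ‖u‖ := by
    refine Finset.sum_le_sum fun i _ => (le_abs_self _).trans ?_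
    rw [abs_mul, abs_neg]
    have h1 : |(x.2.2 i : ℝ)| ≤ (x.1 : ℝ) + x.2.1 := by exact_mod_cast hx i
    have h2 : |(u.2.2 i).im| ≤ ‖u‖ := (Complex.abs_im_le_norm _).trans
      ((norm_le_pi_norm u.2.2 i).trans ((norm_snd_le u.2).trans (norm_snd_le u)))
    gcongr
  rw [Finset.sum_const, Finset.card_univ, Fintype.card_fin, nsmul_eq_mul] at b3
  have := mul_le_mul_of_nonneg_left b1 (Nat.cast_nonneg (α := ℝ) x.1)
  have := mul_le_mul_of_nonneg_left b2 (Nat.cast_nonneg (α := ℝ) x.2.1)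
  nlinarith [norm_nonneg u, Nat.cast_nonneg (α := ℝ) x.1, Nat.cast_nonneg (α := ℝ) x.2.1]

theorem isOpen_Dom (d : ℕ) : IsOpen (Dom d) := by
  have h1 : Continuous fun w : Pt d => w.1.im := by fun_prop
  have h2 : Continuous fun w : Pt d => w.2.1.im := by fun_prop
  have h3 : Continuous fun w : Pt d => ∑ i, (w.2.2 i).im ^ 2 := by fun_prop
  exact (isOpen_lt continuous_const h1).inter ((isOpen_lt continuous_const h2).inter
    (isOpen_lt h3 (h1.mul h2)))

theorem continuous_consPt {d : ℕ} : Continuous fun p : ℂ × Pt d => consPt p.1 p.2 := by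
  refine (by fun_prop : Continuous fun p : ℂ × Pt d => p.2.1).prodMk
    ((by fun_prop : Continuous fun p : ℂ × Pt d => p.2.2.1).prodMk ?_)
  refine continuous_pi fun i => ?_
  refine Fin.cases ?_ (fun i => ?_) i
  · simpa using continuous_fst
  · simp only [Fin.cons_succ]
    fun_prop

/-- The moments `∑_b b^l c(n, m, (b, a))`. -/
def mom {d : ℕ} (c : Idx (d + 1) → ℂ) (l : ℕ) (y : Idx d) : ℂ :=
  ∑ b ∈ Finset.Icc (-((y.1 : ℤ) + y.2.1)) (y.1 + y.2.1), (b : ℂ) ^ l * c (consIdx b y)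

theorem mem_Icc_of_cons_mem {d : ℕ} {b : ℤ} {y : Idx d} (h : consIdx b y ∈ cone (d + 1)) :
    b ∈ Finset.Icc (-((y.1 : ℤ) + y.2.1)) (y.1 + y.2.1) := by
  have := abs_le_of_mem_cone h 0
  rw [Finset.mem_Icc, ← abs_le]
  simpa [consIdx] using this

theorem hasSum_mom {d : ℕ} {c : Idx (d + 1) → ℂ} (hc : ∀ x, c x ≠ 0 → x ∈ cone (d + 1)) (l : ℕ)
    (y : Idx d) : HasSum (fun b : ℤ => (b : ℂ) ^ l * c (consIdx b y)) (mom c l y) := by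
  refine hasSum_sum_of_ne_finset_zero fun b hb => ?_
  by_contra h0
  exact hb (mem_Icc_of_cons_mem (hc _ (right_ne_zero_of_mul h0)))

theorem mom_supp {d : ℕ} {c : Idx (d + 1) → ℂ} (hc : ∀ x, c x ≠ 0 → x ∈ cone (d + 1)) (l : ℕ)
    (y : Idx d) (h : mom c l y ≠ 0) : y ∈ cone d := by
  obtain ⟨b, -, hb⟩ := Finset.exists_ne_zero_of_sum_ne_zero h
  have := mem_cone.1 (hc _ (right_ne_zero_of_mul hb))
  simp only [consIdx, Fin.sum_univ_succ, Fin.cons_zero, Fin.cons_succ] at this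
  rw [mem_cone]
  nlinarith [sq_nonneg b]

/-- `f` vanishes to order at least `J` along `v = 0`, with leading coefficient `g`. -/
def LeadV {d : ℕ} (J : ℕ) (f : Pt (d + 1) → ℂ) (g : Pt d → ℂ) : Prop :=
  ∀ w ∈ Dom d, Tendsto (fun p : ℂ × Pt d => f (consPt p.1 p.2) / (2 * Real.pi * I * p.1) ^ J)
    (𝓝[≠] 0 ×ˢ 𝓝 w) (𝓝 (g w))

theorem IsExp.summable_line {d : ℕ} {f : Pt (d + 1) → ℂ} {c : Idx (d + 1) → ℂ} (h : IsExp f c)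
    {w : Pt d} (hw : w ∈ Dom d) : ∃ r : ℝ, 0 < r ∧
      Summable fun p : Idx d × ℤ => ‖c (consIdx p.2 p.1) * ex p.1 w‖ *
        Real.exp (r * (p.1.1 + p.1.2.1)) := by
  obtain ⟨r, hr, hs⟩ := h.summable_im (consPt_zero_mem hw)
  rw [← (consIdxEquiv d).summable_iff] at hs
  refine ⟨r, hr, hs.congr fun p => ?_⟩
  simp only [Function.comp_apply, consIdxEquiv, Equiv.coe_fn_mk, ex_cons]
  simp [consIdx]

theorem abs_le_of_cons_ne_zero {d : ℕ} {c : Idx (d + 1) → ℂ} (hc : ∀ x, c x ≠ 0 → x ∈ cone (d + 1))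
    {b : ℤ} {y : Idx d} (h : c (consIdx b y) ≠ 0) :
    |(b : ℝ)| ≤ y.1 + y.2.1 ∧ ∀ i, |y.2.2 i| ≤ y.1 + y.2.1 := by
  have h1 := abs_le_of_mem_cone (hc _ h)
  refine ⟨?_, fun i => ?_⟩
  · have := h1 0
    simp only [consIdx, Fin.cons_zero] at this
    exact_mod_cast this
  · simpa [consIdx] using h1 i.succ

theorem IsExp.hasSum_moment {d : ℕ} {f : Pt (d + 1) → ℂ} {c : Idx (d + 1) → ℂ} (h : IsExp f c)
    {w : Pt d} (hw : w ∈ Dom d) (l : ℕ) :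
    HasSum (fun y => mom c l y * ex y w)
      (∑' p : Idx d × ℤ, (c (consIdx p.2 p.1) * ex p.1 w) * (p.2 : ℂ) ^ l) := by
  obtain ⟨r, hr, hs⟩ := h.summable_line hw
  have hs : Summable fun p : Idx d × ℤ => ‖c (consIdx p.2 p.1) * ex p.1 w‖ *
      Real.exp (r * |(p.2 : ℝ)|) := by
    refine Summable.of_nonneg_of_le (fun p => by positivity) (fun p => ?_) hs
    by_cases h0 : c (consIdx p.2 p.1) = 0
    · simp [h0]
    · have := (abs_le_of_cons_ne_zero h.supp h0).1
      gcongr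
  refine (summable_mul_pow hr hs l).hasSum.prod_fiberwise fun y => ?_
  refine ((hasSum_mom h.supp l y).mul_right (ex y w)).congr_fun fun b => ?_
  ring

theorem IsExp.lead {d : ℕ} {f : Pt (d + 1) → ℂ} {c : Idx (d + 1) → ℂ} (h : IsExp f c) {J : ℕ}
    (hJ : ∀ l < J, mom c l = 0) :
    ∃ g, IsExp g (fun y => mom c J y / J.factorial) ∧ LeadV J f g := by
  refine ⟨fun w => ∑' y, mom c J y / J.factorial * ex y w, ⟨fun y hy => mom_supp h.supp J y
    fun h0 => hy (by simp [h0]), fun w hw => ?_⟩, fun w hw => ?_⟩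
  · refine Summable.hasSum ?_
    refine ((h.hasSum_moment hw J).summable.mul_right (1 / (J.factorial : ℂ))).congr fun y => ?_
    ring
  · obtain ⟨r, hr, hs⟩ := h.summable_line hw
    have tw : Tendsto (fun p : ℂ × Pt d => p.2) (𝓝[≠] 0 ×ˢ 𝓝 w) (𝓝 w) := tendsto_snd
    have tv : Tendsto (fun p : ℂ × Pt d => p.1) (𝓝[≠] 0 ×ˢ 𝓝 w) (𝓝[≠] 0) := tendsto_fst
    have hpi : (2 * Real.pi * I : ℂ) ≠ 0 := by simp [Real.pi_ne_zero]
    have tu : Tendsto (fun p : ℂ × Pt d => 2 * Real.pi * I * p.1) (𝓝[≠] 0 ×ˢ 𝓝 w) (𝓝[≠] 0) := by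
      have t : Tendsto (fun v : ℂ => 2 * Real.pi * I * v) (𝓝[≠] 0) (𝓝[≠] 0) := by
        refine tendsto_nhdsWithin_iff.2 ⟨?_, ?_⟩
        · have : ContinuousAt (fun v : ℂ => 2 * Real.pi * I * v) 0 := by fun_prop
          simpa using this.tendsto.mono_left nhdsWithin_le_nhds
        · filter_upwards [self_mem_nhdsWithin] with v hv
          exact mul_ne_zero hpi hv
      exact t.comp tv
    have hDom : ∀ᶠ p : ℂ × Pt d in 𝓝[≠] 0 ×ˢ 𝓝 w, p.2 ∈ Dom d :=
      tw.eventually ((isOpen_Dom d).mem_nhds hw)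
    have hDom' : ∀ᶠ p : ℂ × Pt d in 𝓝[≠] 0 ×ˢ 𝓝 w, consPt p.1 p.2 ∈ Dom (d + 1) := by
      have : Tendsto (fun p : ℂ × Pt d => consPt p.1 p.2) (𝓝 0 ×ˢ 𝓝 w) (𝓝 (consPt 0 w)) := by
        rw [← nhds_prod_eq]
        exact continuous_consPt.tendsto (0, w)
      exact (this.mono_left (Filter.prod_mono_left _ nhdsWithin_le_nhds)).eventually
        ((isOpen_Dom _).mem_nhds (consPt_zero_mem hw))
    have hsmall : ∀ᶠ p : ℂ × Pt d in 𝓝[≠] 0 ×ˢ 𝓝 w,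
        2 * Real.pi * (d + 2) * ‖p.2 - w‖ < r / 2 := by
      have : Tendsto (fun p : ℂ × Pt d => 2 * Real.pi * (d + 2) * ‖p.2 - w‖) (𝓝[≠] 0 ×ˢ 𝓝 w)
          (𝓝 (2 * Real.pi * (d + 2) * ‖w - w‖)) := (tw.sub_const w).norm.const_mul _
      rw [sub_self, norm_zero, mul_zero] at this
      exact this.eventually_lt_const (half_pos hr)
    have := tendsto_taylor (A := fun p (q : Idx d × ℤ) => c (consIdx q.2 q.1) * ex q.1 p.2)
      (a := fun q => c (consIdx q.2 q.1) * ex q.1 w)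
      (D := fun q => ‖c (consIdx q.2 q.1) * ex q.1 w‖ * Real.exp (r / 2 * (q.1.1 + q.1.2.1)))
      (β := fun q => q.2) (half_pos hr) tu (fun q => by
        refine Tendsto.const_mul _ ?_
        have : Continuous fun u : Pt d => ex q.1 u := by unfold ex; fun_prop
        exact (this.tendsto w).comp tw) (by
        filter_upwards [hsmall] with p hp q
        by_cases h0 : c (consIdx q.2 q.1) = 0
        · simp [h0]
        have h1 := norm_ex_le (abs_le_of_cons_ne_zero h.supp h0).2 (p.2 - w)
        rw [← add_sub_cancel w p.2, ex_shift, ← mul_assoc, norm_mul _ (ex _ _)]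
        refine mul_le_mul_of_nonneg_left (h1.trans ?_) (norm_nonneg _)
        gcongr) (by
        refine Summable.of_nonneg_of_le (fun q => by positivity) (fun q => ?_) hs
        by_cases h0 : c (consIdx q.2 q.1) = 0
        · simp [h0]
        have := (abs_le_of_cons_ne_zero h.supp h0).1
        rw [mul_assoc, ← Real.exp_add]
        gcongr
        linarith [mul_le_mul_of_nonneg_left this (half_pos hr).le]) J (by
        filter_upwards [hDom] with p hp l hl
        rw [← (h.hasSum_moment hp l).tsum_eq, hJ l hl]; simp)
    have e : ∑' p : Idx d × ℤ, (c (consIdx p.2 p.1) * ex p.1 w) * ((p.2 : ℂ) ^ J / J.factorial)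
        = ∑' y, mom c J y / J.factorial * ex y w := by
      simp only [← mul_div_assoc]
      rw [tsum_div_const, ← (h.hasSum_moment hw J).tsum_eq, ← tsum_div_const]
      exact tsum_congr fun y => by ring
    rw [e] at this
    refine this.congr' ?_
    filter_upwards [hDom'] with p hp
    have h1 := h.hasSum _ hp
    rw [← (consIdxEquiv d).hasSum_iff] at h1
    rw [← h1.tsum_eq]
    congr 1
    refine tsum_congr fun q => ?_
    simp only [Function.comp_apply, consIdxEquiv, Equiv.coe_fn_mk, ex_cons]
    rw [mul_assoc]
    congr 3
    ring

theorem LeadV.line {d J : ℕ} {f : Pt (d + 1) → ℂ} {g : Pt d → ℂ} (h : LeadV J f g) {w : Pt d}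
    (hw : w ∈ Dom d) :
    Tendsto (fun v : ℂ => f (consPt v w) / (2 * Real.pi * I * v) ^ J) (𝓝[≠] 0) (𝓝 (g w)) :=
  (h w hw).comp (tendsto_id.prodMk (tendsto_const_nhds))

theorem IsExp.mom_eq_zero {d : ℕ} {f : Pt (d + 1) → ℂ} {c : Idx (d + 1) → ℂ} (h : IsExp f c) {J : ℕ}
    {g : Pt d → ℂ} (hg : LeadV J f g) : ∀ l < J, mom c l = 0 := by
  intro l
  induction l using Nat.strong_induction_on with
  | _ l ih =>
    intro hl
    obtain ⟨g', hg', hl'⟩ := h.lead fun l' h' => ih l' h' (h'.trans hl)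
    have z : ∀ w ∈ Dom d, g' w = 0 := fun w hw => by
      refine tendsto_nhds_unique (hl'.line hw) ?_
      have t : Tendsto (fun v : ℂ => (2 * Real.pi * I * v) ^ (J - l)) (𝓝[≠] 0) (𝓝 0) := by
        have : ContinuousAt (fun v : ℂ => (2 * Real.pi * I * v) ^ (J - l)) 0 := by fun_prop
        have := this.tendsto.mono_left (nhdsWithin_le_nhds (s := {0}ᶜ))
        simpa [Nat.sub_ne_zero_of_lt hl] using this
      have := (hg.line hw).mul t
      rw [mul_zero] at this
      refine this.congr' ?_
      filter_upwards [self_mem_nhdsWithin] with v hv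
      have hv : (2 * Real.pi * I * v : ℂ) ≠ 0 := by
        simpa [Real.pi_ne_zero] using hv
      rw [div_mul_eq_mul_div, div_eq_div_iff (pow_ne_zero _ hv) (pow_ne_zero _ hv), mul_assoc,
        ← pow_add, Nat.sub_add_cancel hl.le]
    have := hg'.eq_zero z
    ext y
    have := congrFun this y
    simpa [Nat.factorial_ne_zero] using this

theorem IsExp.leadV {d : ℕ} {f : Pt (d + 1) → ℂ} {c : Idx (d + 1) → ℂ} (h : IsExp f c) {J : ℕ}
    {g : Pt d → ℂ} (hg : LeadV J f g) : IsExp g (fun y => mom c J y / J.factorial) := by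
  obtain ⟨g', hg', hl'⟩ := h.lead (h.mom_eq_zero hg)
  exact hg'.congr fun w hw => tendsto_nhds_unique (hg.line hw) (hl'.line hw)

theorem IsExp.leadV_succ {d : ℕ} {f : Pt (d + 1) → ℂ} {c : Idx (d + 1) → ℂ} (h : IsExp f c) {J : ℕ}
    {g : Pt d → ℂ} (hg : LeadV J f g) (h0 : ∀ w ∈ Dom d, g w = 0) :
    ∃ g', LeadV (J + 1) f g' := by
  have hz : mom c J = 0 := by
    ext y
    have := congrFun ((h.leadV hg).eq_zero h0) y
    simpa [Nat.factorial_ne_zero] using this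
  obtain ⟨g', -, h'⟩ := h.lead (J := J + 1) fun l hl => by
    rcases Nat.lt_succ_iff_lt_or_eq.1 hl with hl | rfl
    · exact h.mom_eq_zero hg l hl
    · exact hz
  exact ⟨g', h'⟩

theorem mom_mem {d : ℕ} {R : Subring ℂ} {c : Idx (d + 1) → ℂ} (hc : ∀ x, c x ∈ R) {J : ℕ}
    (hJ : ∀ l < J, mom c l = 0) (y : Idx d) : mom c J y / J.factorial ∈ R := by
  have key : mom c J y = J.factorial * ∑ b ∈ Finset.Icc (-((y.1 : ℤ) + y.2.1)) (y.1 + y.2.1),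
      ((Ring.choose b J : ℤ) : ℂ) * c (consIdx b y) := by
    have e : ∀ b : ℤ, (J.factorial : ℂ) * ((Ring.choose b J : ℤ) : ℂ)
        = ∑ l ∈ Finset.range (J + 1), ((descPochhammer ℤ J).coeff l : ℂ) * (b : ℂ) ^ l := fun b => by
      have h1 := Ring.descPochhammer_eq_factorial_smul_choose b J
      rw [nsmul_eq_mul, ← Polynomial.eval_eq_smeval, Polynomial.eval_eq_sum_range,
        descPochhammer_natDegree] at h1
      exact_mod_cast h1.symm
    have h1 : (descPochhammer ℤ J).coeff J = 1 := by
      have := monic_descPochhammer ℤ J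
      rwa [Polynomial.Monic, Polynomial.leadingCoeff, descPochhammer_natDegree] at this
    have h2 : ∀ l, ∑ b ∈ Finset.Icc (-((y.1 : ℤ) + y.2.1)) (y.1 + y.2.1),
        ((descPochhammer ℤ J).coeff l : ℂ) * (b : ℂ) ^ l * c (consIdx b y)
        = ((descPochhammer ℤ J).coeff l : ℂ) * mom c l y := fun l => by
      simp only [mom, Finset.mul_sum, mul_assoc]
    rw [Finset.mul_sum]
    simp only [← mul_assoc, e, Finset.sum_mul]
    rw [Finset.sum_comm]
    simp only [h2]
    rw [Finset.sum_range_succ, Finset.sum_eq_zero, h1]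
    · simp
    · intro l hl
      rw [hJ l (Finset.mem_range.1 hl)]
      simp
  rw [key, mul_div_cancel_left₀ _ (by exact_mod_cast Nat.factorial_ne_zero J)]
  exact sum_mem fun b _ => mul_mem (by simp) (hc _)

namespace LeadV
variable {d J J' : ℕ} {f f' : Pt (d + 1) → ℂ} {g g' : Pt d → ℂ}

theorem mul (h : LeadV J f g) (h' : LeadV J' f' g') : LeadV (J + J') (f * f') (g * g') :=
  fun w hw => ((h w hw).mul (h' w hw)).congr fun v => by
    rw [Pi.mul_apply, pow_add, div_mul_div_comm]

theorem smul (h : LeadV J f g) (r : ℂ) : LeadV J (r • f) (r • g) :=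
  fun w hw => ((h w hw).const_mul r).congr fun v => by
    rw [Pi.smul_apply, smul_eq_mul, mul_div_assoc]

theorem add (h : LeadV J f g) (h' : LeadV J f' g') : LeadV J (f + f') (g + g') :=
  fun w hw => ((h w hw).add (h' w hw)).congr fun v => by
    rw [Pi.add_apply, add_div]

theorem sub (h : LeadV J f g) (h' : LeadV J f' g') : LeadV J (f - f') (g - g') :=
  fun w hw => ((h w hw).sub (h' w hw)).congr fun v => by
    rw [Pi.sub_apply, sub_div]

theorem one : LeadV 0 (1 : Pt (d + 1) → ℂ) 1 := fun w _ => by simp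

end LeadV

end HermMod

namespace HermMod
open Filter Topology

/-- The inversion in `τ₁`. -/
def invPt {d : ℕ} (w : Pt d) : Pt d :=
  (-1 / w.1, w.2.1 - (∑ i, w.2.2 i ^ 2) / w.1, fun i => w.2.2 i / w.1)

/-- Exchange of `τ₁` and `τ₂`. -/
def swapPt {d : ℕ} (w : Pt d) : Pt d := (w.2.1, w.1, w.2.2)

/-- Sign change of one elliptic coordinate. -/
def flipPt {d : ℕ} (i : Fin d) (w : Pt d) : Pt d :=
  (w.1, w.2.1, Function.update w.2.2 i (-(w.2.2 i)))

/-- The elliptic translation by `τ₂` in one coordinate. -/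
def transPt {d : ℕ} (i : Fin d) (w : Pt d) : Pt d :=
  (w.1 + 2 * w.2.2 i + w.2.1, w.2.1, Function.update w.2.2 i (w.2.2 i + w.2.1))

theorem invPt_mem {d : ℕ} {w : Pt d} (hw : w ∈ Dom d) : invPt w ∈ Dom d := by
  obtain ⟨⟨x, y⟩, t, z⟩ := w
  obtain ⟨h1, h2, h3⟩ := hw
  simp only at h1 h2 h3
  have hN : 0 < x * x + y * y := by nlinarith [mul_self_nonneg x, mul_pos h1 h1]
  have e1 : ((-1 : ℂ) / ⟨x, y⟩).im = y / (x * x + y * y) := by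
    simp [Complex.div_im, Complex.normSq_mk, neg_div]
  have e2 : ∀ i, (z i / ⟨x, y⟩).im ^ 2
      = ((z i).im * x - (z i).re * y) ^ 2 / (x * x + y * y) ^ 2 := fun i => by
    simp only [Complex.div_im, Complex.normSq_mk]
    rw [← sub_div, div_pow]
  have e3 : ((∑ i, z i ^ 2) / (⟨x, y⟩ : ℂ)).im = (∑ i, (2 * (z i).re * (z i).im * x
      - ((z i).re ^ 2 - (z i).im ^ 2) * y)) / (x * x + y * y) := by
    rw [Finset.sum_div, Complex.im_sum, Finset.sum_div]
    refine Finset.sum_congr rfl fun i _ => ?_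
    simp only [Complex.div_im, Complex.normSq_mk, pow_two, Complex.mul_re, Complex.mul_im]
    ring
  have key : (y / (x * x + y * y)) * (t.im - (∑ i, (2 * (z i).re * (z i).im * x
      - ((z i).re ^ 2 - (z i).im ^ 2) * y)) / (x * x + y * y))
      - ∑ i, ((z i).im * x - (z i).re * y) ^ 2 / (x * x + y * y) ^ 2
      = (y * t.im - ∑ i, (z i).im ^ 2) / (x * x + y * y) := by
    have : ∑ i, ((z i).im * x - (z i).re * y) ^ 2 = (x * x + y * y) * ∑ i, (z i).im ^ 2
        - y * ∑ i, (2 * (z i).re * (z i).im * x - ((z i).re ^ 2 - (z i).im ^ 2) * y) := by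
      rw [Finset.mul_sum, Finset.mul_sum, ← Finset.sum_sub_distrib]
      exact Finset.sum_congr rfl fun i _ => by ring
    rw [← Finset.sum_div, this]
    generalize ∑ i, (2 * (z i).re * (z i).im * x - ((z i).re ^ 2 - (z i).im ^ 2) * y) = S
    generalize ∑ i, (z i).im ^ 2 = T
    field_simp
    ring
  have hpos : 0 < (y * t.im - ∑ i, (z i).im ^ 2) / (x * x + y * y) := div_pos (by linarith) hN
  rw [← key] at hpos
  have hy : 0 < y / (x * x + y * y) := div_pos h1 hN
  have hs : 0 ≤ ∑ i, ((z i).im * x - (z i).re * y) ^ 2 / (x * x + y * y) ^ 2 :=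
    Finset.sum_nonneg fun i _ => by positivity
  simp only [Dom, invPt, Set.mem_ofPred_eq, e1, e2, sub_im, e3]
  exact ⟨hy, pos_of_mul_pos_right (by linarith) hy.le, by linarith⟩

theorem swapPt_mem {d : ℕ} {w : Pt d} (hw : w ∈ Dom d) : swapPt w ∈ Dom d :=
  ⟨hw.2.1, hw.1, by rw [mul_comm]; exact hw.2.2⟩

theorem flipPt_mem {d : ℕ} {w : Pt d} (hw : w ∈ Dom d) (i : Fin d) : flipPt i w ∈ Dom d := by
  refine ⟨hw.1, hw.2.1, lt_of_eq_of_lt (Finset.sum_congr rfl fun j _ => ?_) hw.2.2⟩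
  by_cases h : j = i
  · subst h; simp [flipPt]
  · simp [flipPt, h]

theorem transPt_mem {d : ℕ} {w : Pt d} (hw : w ∈ Dom d) (i : Fin d) : transPt i w ∈ Dom d := by
  obtain ⟨h1, h2, h3⟩ := hw
  have e : ∑ j, (Function.update w.2.2 i (w.2.2 i + w.2.1) j).im ^ 2
      = ∑ j, (w.2.2 j).im ^ 2 + (2 * (w.2.2 i).im * w.2.1.im + w.2.1.im ^ 2) := by
    rw [← Finset.add_sum_erase _ _ (Finset.mem_univ i),
      ← Finset.add_sum_erase _ (fun j => (w.2.2 j).im ^ 2) (Finset.mem_univ i),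
      Finset.sum_congr rfl fun j hj => by rw [Function.update_of_ne (Finset.ne_of_mem_erase hj)]]
    simp
    ring
  have h4 : (w.2.2 i).im ^ 2 ≤ ∑ j, (w.2.2 j).im ^ 2 :=
    Finset.single_le_sum (f := fun j => (w.2.2 j).im ^ 2) (fun _ _ => sq_nonneg _) (Finset.mem_univ i)
  have h5 : ∑ j, (w.2.2 j).im ^ 2 + (2 * (w.2.2 i).im * w.2.1.im + w.2.1.im ^ 2) <
      (w.1.im + 2 * (w.2.2 i).im + w.2.1.im) * w.2.1.im := by nlinarith
  simp only [Dom, transPt, Set.mem_ofPred_eq, e]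
  refine ⟨?_, h2, by simpa using h5⟩
  have : 0 < (w.1.im + 2 * (w.2.2 i).im + w.2.1.im) * w.2.1.im := by
    refine lt_of_le_of_lt ?_ h5
    nlinarith [sq_nonneg ((w.2.2 i).im + w.2.1.im)]
  simpa using pos_of_mul_pos_left this h2.le

/-- The transformation laws of a modular form of weight `k` in the coordinates `(τ₁, τ₂, z)`. -/
structure Mod (d : ℕ) (k : ℤ) (f : Pt d → ℂ) : Prop where
  inv : ∀ w ∈ Dom d, f (invPt w) = w.1 ^ k * f w
  swap : ∀ w ∈ Dom d, f (swapPt w) = f w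
  flip : ∀ i, ∀ w ∈ Dom d, f (flipPt i w) = f w
  trans : ∀ i, ∀ w ∈ Dom d, f (transPt i w) = f w

theorem Dom.ne_zero {d : ℕ} {w : Pt d} (hw : w ∈ Dom d) : w.1 ≠ 0 := fun h => by
  have := hw.1
  rw [h] at this
  simp at this

namespace Mod
variable {d : ℕ} {k k' : ℤ} {f f' : Pt d → ℂ}

theorem add (h : Mod d k f) (h' : Mod d k f') : Mod d k (f + f') where
  inv w hw := by simp only [Pi.add_apply, h.inv w hw, h'.inv w hw, mul_add]
  swap w hw := by simp only [Pi.add_apply, h.swap w hw, h'.swap w hw]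
  flip i w hw := by simp only [Pi.add_apply, h.flip i w hw, h'.flip i w hw]
  trans i w hw := by simp only [Pi.add_apply, h.trans i w hw, h'.trans i w hw]

theorem smul (h : Mod d k f) (r : ℂ) : Mod d k (r • f) where
  inv w hw := by simp only [Pi.smul_apply, smul_eq_mul, h.inv w hw]; ring
  swap w hw := by simp only [Pi.smul_apply, h.swap w hw]
  flip i w hw := by simp only [Pi.smul_apply, h.flip i w hw]
  trans i w hw := by simp only [Pi.smul_apply, h.trans i w hw]

theorem sub (h : Mod d k f) (h' : Mod d k f') : Mod d k (f - f') := by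
  have := h.add (h'.smul (-1))
  simpa [sub_eq_add_neg] using this

theorem mul (h : Mod d k f) (h' : Mod d k' f') : Mod d (k + k') (f * f') where
  inv w hw := by
    simp only [Pi.mul_apply, h.inv w hw, h'.inv w hw, zpow_add₀ (Dom.ne_zero hw)]; ring
  swap w hw := by simp only [Pi.mul_apply, h.swap w hw, h'.swap w hw]
  flip i w hw := by simp only [Pi.mul_apply, h.flip i w hw, h'.flip i w hw]
  trans i w hw := by simp only [Pi.mul_apply, h.trans i w hw, h'.trans i w hw]

theorem one : Mod d 0 (1 : Pt d → ℂ) where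
  inv w hw := by simp
  swap w hw := by simp
  flip i w hw := by simp
  trans i w hw := by simp

end Mod

theorem consPt_swap {d : ℕ} (v : ℂ) (w : Pt d) : consPt v (swapPt w) = swapPt (consPt v w) := rfl

theorem consPt_flip {d : ℕ} (v : ℂ) (i : Fin d) (w : Pt d) :
    consPt v (flipPt i w) = flipPt i.succ (consPt v w) := by
  simp [consPt, flipPt, Fin.cons_update]

theorem consPt_flip_zero {d : ℕ} (v : ℂ) (w : Pt d) :
    consPt (-v) w = flipPt 0 (consPt v w) := by
  simp [consPt, flipPt, Fin.update_cons_zero]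

theorem consPt_trans {d : ℕ} (v : ℂ) (i : Fin d) (w : Pt d) :
    consPt v (transPt i w) = transPt i.succ (consPt v w) := by
  simp [consPt, transPt, Fin.cons_update]

theorem consPt_inv {d : ℕ} (v : ℂ) (w : Pt d) :
    invPt (consPt v w) = consPt (v / w.1) ((invPt w).1, (invPt w).2.1 - v ^ 2 / w.1, (invPt w).2.2) := by
  simp only [consPt, invPt, Fin.sum_univ_succ, Fin.cons_zero, Fin.cons_succ, Prod.mk.injEq, true_and]
  refine ⟨by ring, ?_⟩
  ext i
  refine Fin.cases ?_ (fun i => ?_) i <;> simp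

theorem eventually_consPt_mem {d : ℕ} {w : Pt d} (hw : w ∈ Dom d) :
    ∀ᶠ v : ℂ in 𝓝[≠] 0, consPt v w ∈ Dom (d + 1) := by
  have : Continuous fun v : ℂ => consPt v w := continuous_consPt.comp (by fun_prop : Continuous fun v : ℂ => (v, w))
  exact nhdsWithin_le_nhds ((this.tendsto 0).eventually ((isOpen_Dom _).mem_nhds (consPt_zero_mem hw)))

theorem LeadV.mod {d J : ℕ} {k : ℤ} {f : Pt (d + 1) → ℂ} {g : Pt d → ℂ} (hl : LeadV J f g)
    (h : Mod (d + 1) k f) : Mod d (k + J) g where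
  inv w hw := by
    have hw0 := Dom.ne_zero hw
    have t : Tendsto (fun v : ℂ => (v / w.1, (((invPt w).1, (invPt w).2.1 - v ^ 2 / w.1, (invPt w).2.2) : Pt d)))
        (𝓝[≠] 0) (𝓝[≠] 0 ×ˢ 𝓝 (invPt w)) := by
      refine Tendsto.prodMk (tendsto_nhdsWithin_iff.2 ⟨?_, ?_⟩) ?_
      · have : ContinuousAt (fun v : ℂ => v / w.1) 0 := by fun_prop
        simpa using this.tendsto.mono_left nhdsWithin_le_nhds
      · filter_upwards [self_mem_nhdsWithin] with v hv
        exact div_ne_zero hv hw0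
      · have : ContinuousAt (fun v : ℂ => (((invPt w).1, (invPt w).2.1 - v ^ 2 / w.1,
          (invPt w).2.2) : Pt d)) 0 := by fun_prop
        simpa using this.tendsto.mono_left nhdsWithin_le_nhds
    have h1 := (hl _ (invPt_mem hw)).comp t
    have h2 := (hl.line hw).const_mul (w.1 ^ (k + J : ℤ))
    refine tendsto_nhds_unique h1 (h2.congr' ?_)
    filter_upwards [eventually_consPt_mem hw] with v hv
    simp only [Function.comp_apply]
    rw [← consPt_inv, h.inv _ hv, zpow_add₀ hw0, zpow_natCast]
    simp only [consPt]
    rw [mul_div_assoc' _ v, div_pow, div_div_eq_mul_div]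
    ring
  swap w hw := by
    refine tendsto_nhds_unique (hl.line (swapPt_mem hw)) ((hl.line hw).congr' ?_)
    filter_upwards [eventually_consPt_mem hw] with v hv
    rw [consPt_swap, h.swap _ hv]
  flip i w hw := by
    refine tendsto_nhds_unique (hl.line (flipPt_mem hw i)) ((hl.line hw).congr' ?_)
    filter_upwards [eventually_consPt_mem hw] with v hv
    rw [consPt_flip, h.flip _ _ hv]
  trans i w hw := by
    refine tendsto_nhds_unique (hl.line (transPt_mem hw i)) ((hl.line hw).congr' ?_)
    filter_upwards [eventually_consPt_mem hw] with v hv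
    rw [consPt_trans, h.trans _ _ hv]

theorem LeadV.eq_zero_of_odd {d J : ℕ} {k : ℤ} {f : Pt (d + 1) → ℂ} {g : Pt d → ℂ} (hl : LeadV J f g)
    (h : Mod (d + 1) k f) (hJ : Odd J) : ∀ w ∈ Dom d, g w = 0 := fun w hw => by
  have t : Tendsto (fun v : ℂ => -v) (𝓝[≠] 0) (𝓝[≠] 0) := by
    refine tendsto_nhdsWithin_iff.2 ⟨?_, ?_⟩
    · have : ContinuousAt (fun v : ℂ => -v) 0 := by fun_prop
      simpa using this.tendsto.mono_left nhdsWithin_le_nhds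
    · filter_upwards [self_mem_nhdsWithin] with v hv
      exact neg_ne_zero.2 hv
  have h1 := (hl.line hw).comp t
  have : g w = -g w := by
    refine tendsto_nhds_unique h1 ((hl.line hw).neg.congr' ?_)
    filter_upwards [eventually_consPt_mem hw] with v hv
    simp only [Function.comp_apply]
    rw [consPt_flip_zero, h.flip _ _ hv, mul_neg, hJ.neg_pow, div_neg]
  exact self_eq_neg.1 this

/-- A modular form of weight `k` with Fourier coefficients in `R`. -/
structure Form (d : ℕ) (k : ℤ) (R : Subring ℂ) (f : Pt d → ℂ) : Prop where
  mod : Mod d k f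
  exp : HasExp R f

namespace Form
variable {d : ℕ} {k k' : ℤ} {R : Subring ℂ} {f f' : Pt d → ℂ}

theorem add (h : Form d k R f) (h' : Form d k R f') : Form d k R (f + f') :=
  ⟨h.mod.add h'.mod, h.exp.add h'.exp⟩

theorem sub (h : Form d k R f) (h' : Form d k R f') : Form d k R (f - f') :=
  ⟨h.mod.sub h'.mod, h.exp.sub h'.exp⟩

theorem smul (h : Form d k R f) {r : ℂ} (hr : r ∈ R) : Form d k R (r • f) :=
  ⟨h.mod.smul r, h.exp.smul hr⟩

theorem mul (h : Form d k R f) (h' : Form d k' R f') : Form d (k + k') R (f * f') :=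
  ⟨h.mod.mul h'.mod, h.exp.mul h'.exp⟩

theorem one : Form d 0 R 1 := ⟨.one, .one⟩

theorem lead {J : ℕ} {f : Pt (d + 1) → ℂ} {g : Pt d → ℂ} (h : Form (d + 1) k R f)
    (hl : LeadV J f g) : Form d (k + J) R g := by
  obtain ⟨c, hc, hR⟩ := h.exp
  exact ⟨hl.mod h.mod, _, hc.leadV hl, mom_mem hR (hc.mom_eq_zero hl)⟩

theorem lead_zero {f : Pt (d + 1) → ℂ} (h : Form (d + 1) k R f) :
    LeadV 0 f (fun w => f (consPt 0 w)) := by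
  obtain ⟨c, hc, hR⟩ := h.exp
  obtain ⟨g, hg, hl⟩ := hc.lead (J := 0) (by simp)
  have e : ∀ w ∈ Dom d, g w = f (consPt 0 w) := fun w hw => by
    have h1 := hg.hasSum w hw
    have h2 := hc.hasSum_moment hw 0
    simp only [Nat.factorial_zero, Nat.cast_one, div_one] at h1
    have h3 := hc.hasSum _ (consPt_zero_mem hw)
    rw [← (consIdxEquiv d).hasSum_iff] at h3
    rw [h1.unique h2, ← h3.tsum_eq]
    refine tsum_congr fun p => ?_
    simp [Function.comp_apply, consIdxEquiv, Equiv.coe_fn_mk, ex_cons]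
  intro w hw
  simpa only [e w hw] using hl w hw

end Form
end HermMod

namespace HermMod
open Filter Topology

theorem IsExp.coeff_comp {d : ℕ} {f : Pt d → ℂ} {c : Idx d → ℂ} (h : IsExp f c) {σ : Pt d → Pt d}
    (hσ : ∀ w ∈ Dom d, σ w ∈ Dom d) (hf : ∀ w ∈ Dom d, f (σ w) = f w) {E : cone d → cone d}
    (hE : E.Injective) (he : ∀ (x : cone d) w, ex (x : Idx d) (σ w) = ex (E x : Idx d) w) (x : cone d) :
    c (E x) = c x := by
  have hE' : (fun x => (E x : Idx d)).Injective := Subtype.val_injective.comp hE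
  have h1 : IsExp f (Function.extend (fun x => (E x : Idx d)) (fun x => c x) 0) := by
    refine ⟨fun y hy => ?_, fun w hw => ?_⟩
    · by_cases hx : ∃ x, (E x : Idx d) = y
      · obtain ⟨x, rfl⟩ := hx; exact (E x).2
      · exact absurd (Function.extend_apply' _ _ _ hx) hy
    · have h2 := h.hasSum_cone (hσ w hw)
      rw [hf w hw] at h2
      rw [← hasSum_extend_zero hE'] at h2
      refine h2.congr_fun fun y => ?_
      by_cases hx : ∃ x, (E x : Idx d) = y
      · obtain ⟨x, rfl⟩ := hx
        rw [hE'.extend_apply, hE'.extend_apply, he]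
      · rw [Function.extend_apply' _ _ _ hx, Function.extend_apply' _ _ _ hx]
        simp
  rw [h.unique h1, hE'.extend_apply, ← h.unique h1]

theorem IsExp.coeff_comp_idx {d : ℕ} {f : Pt d → ℂ} {c : Idx d → ℂ} (h : IsExp f c) {σ : Pt d → Pt d}
    (hσ : ∀ w ∈ Dom d, σ w ∈ Dom d) (hf : ∀ w ∈ Dom d, f (σ w) = f w) {E : Idx d → Idx d}
    (hE : E.Injective) (hc : ∀ x, E x ∈ cone d ↔ x ∈ cone d) (he : ∀ x w, ex x (σ w) = ex (E x) w)
    (x : Idx d) : c (E x) = c x := by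
  by_cases hx : x ∈ cone d
  · exact h.coeff_comp hσ hf (E := fun x => ⟨E x, (hc x).2 x.2⟩)
      (fun a b hab => Subtype.ext (hE (congrArg Subtype.val hab))) (fun x w => he x w) ⟨x, hx⟩
  · rw [not_imp_comm.1 (h.supp x) hx, not_imp_comm.1 (h.supp (E x)) (by rwa [hc])]

theorem coeff_swap {d : ℕ} {k : ℤ} {f : Pt d → ℂ} {c : Idx d → ℂ} (h : IsExp f c) (hf : Mod d k f)
    (n m : ℕ) (a : Fin d → ℤ) : c (m, n, a) = c (n, m, a) :=
  h.coeff_comp_idx (fun _ => swapPt_mem) hf.swap (E := fun x => (x.2.1, x.1, x.2.2))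
    (fun x y hxy => by
      simp only [Prod.mk.injEq] at hxy
      exact Prod.ext hxy.2.1 (Prod.ext hxy.1 hxy.2.2))
    (fun x => by simp only [mem_cone]; rw [mul_assoc, mul_comm (x.2.1 : ℤ), mul_assoc])
    (fun x w => by simp only [ex, swapPt]; congr 2; ring) (n, m, a)

theorem coeff_flip_zero {d : ℕ} {k : ℤ} {f : Pt (d + 1) → ℂ} {c : Idx (d + 1) → ℂ} (h : IsExp f c)
    (hf : Mod (d + 1) k f) (b : ℤ) (y : Idx d) : c (consIdx (-b) y) = c (consIdx b y) := by
  have := h.coeff_comp_idx (fun _ hw => flipPt_mem hw 0) (hf.flip 0)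
    (E := fun x => (x.1, x.2.1, Function.update x.2.2 0 (-x.2.2 0)))
    (fun x y hxy => by
      simp only [Prod.mk.injEq] at hxy
      refine Prod.ext hxy.1 (Prod.ext hxy.2.1 (funext fun i => ?_))
      have := congrFun hxy.2.2 i
      by_cases hi : i = 0
      · subst hi; simpa using this
      · simpa [hi] using this)
    (fun x => by
      simp only [mem_cone, Fin.sum_univ_succ]
      simp)
    (fun x w => by
      simp only [ex, flipPt, Fin.sum_univ_succ]
      simp) (consIdx b y)
  rw [← this]
  simp [consIdx, Fin.update_cons_zero]

theorem coeff_trans {k : ℤ} {f : Pt 1 → ℂ} {c : Idx 1 → ℂ} (h : IsExp f c)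
    (hf : Mod 1 k f) {n m : ℕ} {a : ℤ} (hx : consIdx a (n, m, 0) ∈ cone 1) :
    c (consIdx (a + 2 * m) ((n + m + a : ℤ).toNat, m, 0)) = c (consIdx a (n, m, 0)) := by
  have pos : ∀ x : cone 1, 0 ≤ (x.1.1 + x.1.2.1 + x.1.2.2 0 : ℤ) := fun x => by
    have := (abs_le.1 (abs_le_of_mem_cone x.2 0)).1
    linarith
  have key := h.coeff_comp (fun _ hw => transPt_mem hw 0) (hf.trans 0)
    (E := fun x => ⟨(x.1.1, (x.1.1 + x.1.2.1 + x.1.2.2 0 : ℤ).toNat, fun _ => x.1.2.2 0 + 2 * x.1.1), by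
      rw [mem_cone]
      have h1 := mem_cone.1 x.2
      simp only [Fin.sum_univ_one, Int.toNat_of_nonneg (pos x)] at h1 ⊢
      linarith⟩)
    (fun x y hxy => by
      have hp := pos x
      have hp' := pos y
      obtain ⟨⟨n, m, a⟩, hx⟩ := x
      obtain ⟨⟨n', m', a'⟩, hy⟩ := y
      simp only [Subtype.mk.injEq, Prod.mk.injEq] at hxy hp hp' ⊢
      obtain ⟨rfl, h2, h3⟩ := hxy
      have h4 := congrFun h3 0
      have h5 : a = a' := funext fun i => by
        rw [Subsingleton.elim i 0]; simpa using h4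
      subst h5
      refine ⟨rfl, ?_, rfl⟩
      omega)
    (fun x w => by
      have hp : (((x.1.1 + x.1.2.1 + x.1.2.2 0 : ℤ).toNat : ℕ) : ℂ) = x.1.1 + x.1.2.1 + x.1.2.2 0 := by
        have := Int.toNat_of_nonneg (pos x)
        exact_mod_cast congrArg (Int.cast (R := ℂ)) this
      simp only [ex, transPt, Fin.sum_univ_one, hp, Function.update_self]
      congr 2
      push_cast
      ring)
  have hx' : consIdx a (m, n, 0) ∈ cone 1 := by
    rw [mem_cone] at hx ⊢
    simp only [consIdx] at hx ⊢
    linarith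
  have := key ⟨_, hx'⟩
  simp only [consIdx, Fin.cons_zero] at this
  rw [show consIdx a (n, m, (0 : Fin 0 → ℤ)) = (n, m, (Fin.cons a 0 : Fin 1 → ℤ)) from rfl,
    ← coeff_swap h hf n m, ← this, coeff_swap h hf, show (m + n + a : ℤ) = n + m + a by ring]
  simp only [consIdx]
  congr 3
  ext i
  fin_cases i
  simp

theorem eq_zero_of_moments {S : Finset ℤ} {C : ℤ → ℂ}
    (h : ∀ l < S.card, ∑ b ∈ S, (b : ℂ) ^ l * C b = 0) : ∀ b ∈ S, C b = 0 := by
  intro b₀ hb₀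
  let p : Polynomial ℂ := ∏ b ∈ S.erase b₀, (Polynomial.X - Polynomial.C (b : ℂ))
  have hd : p.natDegree = (S.erase b₀).card := Polynomial.natDegree_finsetProd_X_sub_C_eq_card _ _
  have h1 : ∑ b ∈ S, p.eval (b : ℂ) * C b = 0 := by
    simp only [Polynomial.eval_eq_sum_range, Finset.sum_mul]
    rw [Finset.sum_comm]
    refine Finset.sum_eq_zero fun l hl => ?_
    simp only [mul_assoc]
    rw [← Finset.mul_sum, h l, mul_zero]
    have := Finset.card_erase_lt_of_mem hb₀
    rw [Finset.mem_range, hd] at hl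
    omega
  rw [Finset.sum_eq_single_of_mem b₀ hb₀] at h1
  · refine (mul_eq_zero.1 h1).resolve_left ?_
    rw [Polynomial.eval_prod]
    refine Finset.prod_ne_zero_iff.2 ?_
    intro b hb
    rw [Polynomial.eval_sub, Polynomial.eval_X, Polynomial.eval_C, sub_ne_zero]
    exact_mod_cast (Finset.ne_of_mem_erase hb).symm
  · intro b hb hne
    have : p.eval (b : ℂ) = 0 := by
      rw [Polynomial.eval_prod]
      exact Finset.prod_eq_zero (Finset.mem_erase.2 ⟨hne, hb⟩) (by simp)
    rw [this, zero_mul]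

theorem coeff_eq_zero_of_moments {d : ℕ} {c : Idx (d + 1) → ℂ} (hc : ∀ x, c x ≠ 0 → x ∈ cone (d + 1))
    (h : ∀ l, mom c l = 0) : c = 0 := by
  ext x
  obtain ⟨p, rfl⟩ := (consIdxEquiv d).surjective x
  by_contra h0
  have := eq_zero_of_moments (S := Finset.Icc (-((p.1.1 : ℤ) + p.1.2.1)) (p.1.1 + p.1.2.1))
    (C := fun b => c (consIdx b p.1)) (fun l _ => congrFun (h l) p.1) p.2 (mem_Icc_of_cons_mem (hc _ h0))
  exact h0 this

/-- A Fourier–Jacobi coefficient of index `m` vanishing to order more than `2m` is zero. -/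
theorem row_eq_zero {k : ℤ} {g : Pt 1 → ℂ} {c : Idx 1 → ℂ} (h : IsExp g c) (hg : Mod 1 k g) {B m : ℕ}
    (hB : ∀ l < B, mom c l = 0) (hm : 2 * m < B) (n : ℕ) : ∀ a, c (consIdx a (n, m, 0)) = 0 := by
  induction n using Nat.strong_induction_on with
  | _ n ih =>
    have out : ∀ a : ℤ, a < -m → c (consIdx a (n, m, 0)) = 0 := fun a ha => by
      by_contra h0
      have hx := h.supp _ h0
      have h1 := coeff_trans h hg hx
      have h2 := (abs_le.1 (abs_le_of_mem_cone hx 0)).1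
      simp only [consIdx, Fin.cons_zero] at h2
      rw [ih _ (by omega)] at h1
      exact h0 h1.symm
    have out' : ∀ a : ℤ, a ∉ Finset.Icc (-(m : ℤ)) m → c (consIdx a (n, m, 0)) = 0 := fun a ha => by
      rw [Finset.mem_Icc, not_and_or, not_le, not_le] at ha
      rcases ha with ha | ha
      · exact out a ha
      · rw [← coeff_flip_zero h hg]; exact out _ (by linarith)
    intro a
    by_cases ha : a ∈ Finset.Icc (-(m : ℤ)) m
    · refine eq_zero_of_moments (S := Finset.Icc (-(m : ℤ)) m) (C := fun a => c (consIdx a (n, m, 0)))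
        (fun l hl => ?_) a ha
      rw [Int.card_Icc] at hl
      have := congrFun (hB l (by omega)) (n, m, 0)
      rw [mom, Pi.zero_apply] at this
      rw [← this]
      refine Finset.sum_subset (Finset.Icc_subset_Icc (by simp) (by simp)) fun b _ hb => ?_
      rw [out' b hb, mul_zero]
    · exact out' a ha

/-- The quarter turn of the elliptic coordinates. -/
def rotPt (w : Pt 2) : Pt 2 := (w.1, w.2.1, ![w.2.2 1, -w.2.2 0])

theorem rotPt_mem {w : Pt 2} (hw : w ∈ Dom 2) : rotPt w ∈ Dom 2 := by
  refine ⟨hw.1, hw.2.1, lt_of_eq_of_lt ?_ hw.2.2⟩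
  simp [rotPt, Fin.sum_univ_two, add_comm]

theorem coeff_rot {f : Pt 2 → ℂ} {c : Idx 2 → ℂ} (h : IsExp f c)
    (hf : ∀ w ∈ Dom 2, f (rotPt w) = f w) (n m : ℕ) (a b : ℤ) :
    c (n, m, ![-a, b]) = c (n, m, ![b, a]) :=
  h.coeff_comp_idx (fun _ => rotPt_mem) hf (E := fun x => (x.1, x.2.1, ![-x.2.2 1, x.2.2 0]))
    (fun x y hxy => by
      simp only [Prod.mk.injEq] at hxy
      refine Prod.ext hxy.1 (Prod.ext hxy.2.1 (funext fun i => ?_))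
      have h0 := congrFun hxy.2.2 0
      have h1 := congrFun hxy.2.2 1
      fin_cases i
      · simpa using h1
      · simpa using h0)
    (fun x => by simp [mem_cone, Fin.sum_univ_two, add_comm])
    (fun x w => by
      simp only [ex, rotPt, Fin.sum_univ_two]
      congr 2
      simp
      ring) (n, m, ![b, a])

theorem mom_mom_eq_zero {f : Pt 2 → ℂ} {c : Idx 2 → ℂ} (h : IsExp f c)
    (hf : ∀ w ∈ Dom 2, f (rotPt w) = f w) {J : ℕ} (hJ : ∀ l < J, mom c l = 0) (r : ℂ) (l : ℕ)
    (hl : l < J) : mom (fun y => mom c J y / r) l = 0 := by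
  ext ⟨n, m, z⟩
  have e1 : ∀ a b : ℤ, c (consIdx b (consIdx a (n, m, z))) = c (n, m, ![b, a]) := fun a b => by
    simp only [consIdx]
    congr 3
    ext i
    fin_cases i <;> simp
  have e2 : ∀ b : ℤ, ∑ a ∈ Finset.Icc (-((n : ℤ) + m)) (n + m), (a : ℂ) ^ l * c (n, m, ![b, a]) = 0 :=
      fun b => by
    have h1 := congrFun (hJ l hl) (consIdx b (n, m, z))
    simp only [mom, Pi.zero_apply, e1] at h1
    simp only [consIdx] at h1
    rw [← mul_zero ((-1 : ℂ) ^ l), ← h1, Finset.mul_sum]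
    refine Finset.sum_nbij' (fun a => -a) (fun a => -a) ?_ ?_ (by simp) (by simp) ?_
    · intro a ha; simp only [Finset.mem_Icc] at ha ⊢; omega
    · intro a ha; simp only [Finset.mem_Icc] at ha ⊢; omega
    · intro a _
      rw [coeff_rot h hf, ← mul_assoc, ← mul_pow]
      simp
  simp only [mom, Pi.zero_apply, e1]
  simp only [consIdx, div_eq_mul_inv, ← mul_assoc]
  rw [← Finset.sum_mul]
  simp only [Finset.mul_sum]
  rw [Finset.sum_comm]
  refine mul_eq_zero_of_left (Finset.sum_eq_zero fun b _ => ?_) _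
  have := e2 b
  calc _ = (b : ℂ) ^ J * ∑ a ∈ Finset.Icc (-((n : ℤ) + m)) (n + m), (a : ℂ) ^ l * c (n, m, ![b, a]) := by
        rw [Finset.mul_sum]
        exact Finset.sum_congr rfl fun a _ => by ring
    _ = 0 := by rw [this, mul_zero]

end HermMod

namespace HermMod
open Filter Topology
open scoped MatrixGroups UpperHalfPlane ModularForm
open UpperHalfPlane (qExpansion)
open Function.Periodic (qParam)

/-- Power series that are `q`-expansions of level one modular forms of weight `k`. -/
def LevelOne (k : ℤ) (ψ : PowerSeries ℂ) : Prop := ∃ F : ModularForm 𝒮ℒ k, qExpansion 1 F = ψ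

theorem qParam_one_pow (τ : ℂ) (n : ℕ) : qParam 1 τ ^ n = cexp (2 * Real.pi * I * (n * τ)) := by
  rw [qParam, ← Complex.exp_nat_mul]
  congr 1
  push_cast
  ring

theorem levelOne_of_hasSum {k : ℤ} {F : ℍ → ℂ} {c : ℕ → ℂ}
    (hF : ∀ τ : ℍ, HasSum (fun n => c n • qParam 1 τ ^ n) (F τ))
    (hS : ∀ τ : ℍ, F (ModularGroup.S • τ) = (τ : ℂ) ^ k * F τ) :
    ∃ G : ModularForm 𝒮ℒ k, (∀ τ, G τ = F τ) ∧ qExpansion 1 G = PowerSeries.mk c := by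
  have hd : DifferentiableOn ℂ (fun τ : ℂ => ∑' n, c n * qParam 1 τ ^ n) {z | 0 < z.im} := by
    intro τ₀ h0
    have h0' : 0 < τ₀.im := h0
    let τ₁ : ℍ := ⟨⟨0, τ₀.im / 2⟩, half_pos h0'⟩
    have hu := (hF τ₁).summable.norm
    have hmem : {z : ℂ | τ₀.im / 2 < z.im} ∈ 𝓝 τ₀ :=
      (isOpen_lt continuous_const Complex.continuous_im).mem_nhds (by simpa using h0')
    refine DifferentiableAt.differentiableWithinAt ?_
    refine (differentiableOn_tsum_of_summable_norm hu (F := fun n (τ : ℂ) => c n * qParam 1 τ ^ n)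
      (fun n => ?_) (isOpen_lt continuous_const Complex.continuous_im) fun n w hw => ?_).differentiableAt hmem
    · simp only [qParam_one_pow]
      fun_prop
    · rw [norm_mul, norm_smul]
      refine mul_le_mul_of_nonneg_left ?_ (norm_nonneg _)
      rw [qParam_one_pow, qParam_one_pow, Complex.norm_exp, Complex.norm_exp, Real.exp_le_exp]
      have hw' : τ₀.im / 2 ≤ w.im := le_of_lt hw
      have e : ∀ z : ℂ, (2 * Real.pi * I * (n * z)).re = -(2 * Real.pi * n) * z.im := fun z => by
        simp [mul_assoc]
      rw [e, e]
      have : (τ₁ : ℂ).im = τ₀.im / 2 := rfl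
      rw [this, neg_mul, neg_mul, neg_le_neg_iff]
      exact mul_le_mul_of_nonneg_left hw' (by positivity)
  have hFs : ∀ τ : ℍ, F τ = ∑' n, c n * qParam 1 τ ^ n := fun τ => by
    simpa using (hF τ).tsum_eq.symm
  have hT : ∀ τ : ℍ, F ((1 : ℝ) +ᵥ τ) = F τ := fun τ => by
    rw [hFs, hFs]
    congr 1
    ext n
    rw [qParam_one_pow, qParam_one_pow]
    congr 1
    rw [UpperHalfPlane.coe_vadd, Complex.exp_eq_exp_iff_exists_int]
    exact ⟨n, by push_cast; ring⟩
  have hγ : ∀ γ : SL(2, ℤ), F ∣[k] γ = F := by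
    refine SlashInvariantForm.slash_action_generators_SL2Z ?_ ?_
    · ext τ
      rw [ModularForm.SL_slash_apply, hS]
      have : UpperHalfPlane.denom ModularGroup.S τ = (τ : ℂ) := by
        simp
      rw [this, mul_right_comm, ← zpow_add₀ τ.ne_zero]
      simp
    · ext τ
      rw [ModularForm.SL_slash_apply, UpperHalfPlane.modular_T_smul, hT]
      have : UpperHalfPlane.denom ModularGroup.T τ = 1 := by
        rw [ModularGroup.denom_apply]
        simp [ModularGroup.T]
      rw [this]
      simp
  have hb : UpperHalfPlane.IsBoundedAtImInfty F :=
    UpperHalfPlane.isBoundedAtImInfty_of_hasSum_qExpansion one_pos hF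
  let G : ModularForm 𝒮ℒ k :=
    { toFun := F
      slash_action_eq' := fun _ ⟨γ, hg⟩ => hg ▸ hγ γ
      holo' := by
        rw [UpperHalfPlane.mdifferentiable_iff]
        refine hd.congr fun z hz => ?_
        change F _ = _
        rw [hFs, UpperHalfPlane.ofComplex_apply_of_im_pos hz]
      bdd_at_cusps' := fun {c} hc => by
        rw [Subgroup.IsArithmetic.isCusp_iff_isCusp_SL2Z] at hc
        rw [OnePoint.isBoundedAt_iff_forall_SL2Z hc]
        intro γ _
        rw [hγ γ]
        exact hb }
  refine ⟨G, fun τ => rfl, ?_⟩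
  ext n
  rw [PowerSeries.coeff_mk]
  exact (ModularFormClass.qExpansion_coeff_unique (f := G) one_pos one_mem_strictPeriods_SL hF n).symm

/-- The coefficient series of `q₂^m`. -/
def row (c : Idx 0 → ℂ) (m : ℕ) : PowerSeries ℂ := PowerSeries.mk fun n => c (n, m, 0)

theorem IsExp.row_hasSum {h : Pt 0 → ℂ} {c : Idx 0 → ℂ} (hc : IsExp h c) (m : ℕ) (τ : ℍ) :
    HasSum (fun n => c (n, m, 0) • qParam 1 (τ : ℂ) ^ n) (∑' n, c (n, m, 0) * qParam 1 (τ : ℂ) ^ n) := by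
  have hw : (((τ : ℂ), I, 0) : Pt 0) ∈ Dom 0 := by
    refine ⟨τ.im_pos, by simp, by simpa using τ.im_pos⟩
  have h1 := (hc.hasSum _ hw).summable
  have h2 := h1.comp_injective (i := fun n : ℕ => ((n, m, 0) : Idx 0)) (fun a b hab => by simpa using hab)
  have h3 := h2.mul_right (cexp (2 * Real.pi * I * (m * I)))⁻¹
  refine (h3.congr fun n => ?_).hasSum
  simp only [Function.comp, ex, smul_eq_mul, qParam_one_pow]
  rw [mul_assoc, ← Complex.exp_neg, ← Complex.exp_add]
  congr 2
  simp
  ring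

theorem row_levelOne {k : ℤ} {h : Pt 0 → ℂ} {c : Idx 0 → ℂ} (hc : IsExp h c) (hm : Mod 0 k h) (m : ℕ) :
    ∃ G : ModularForm 𝒮ℒ k, (∀ τ : ℍ, G τ = ∑' n, c (n, m, 0) * qParam 1 (τ : ℂ) ^ n) ∧
      qExpansion 1 G = row c m := by
  refine levelOne_of_hasSum (hc.row_hasSum m) fun τ => ?_
  have hS : ((ModularGroup.S • τ : ℍ) : ℂ) = -1 / (τ : ℂ) := by
    rw [UpperHalfPlane.modular_S_smul]
    simp [neg_div, inv_neg]
  set τ' := ModularGroup.S • τ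
  have hdom : ∀ (σ : ℍ) (x : ℝ), (((σ : ℂ), I + x, 0) : Pt 0) ∈ Dom 0 := fun σ x =>
    ⟨σ.im_pos, by simp, by simpa using σ.im_pos⟩
  have e : ∀ (σ : ℍ) (x : ℝ) (p : Idx 0), c p * ex p ((σ : ℂ), I + x, 0)
      = c p * ex p ((σ : ℂ), I, 0) * cexp (2 * Real.pi * I * (((p.2.1 : ℤ) : ℂ) * x)) := fun σ x p => by
    rw [mul_assoc, ex, ex, ← Complex.exp_add]
    congr 2
    simp
    ring
  have hs : ∀ σ : ℍ, Summable fun p : Idx 0 => c p * ex p ((σ : ℂ), I, 0) := fun σ => by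
    simpa using (hc.hasSum _ (hdom σ 0)).summable
  have key := tsum_fiber_eq_zero
    (a := fun p : Idx 0 => c p * ex p ((τ' : ℂ), I, 0) - (τ : ℂ) ^ k * (c p * ex p ((τ : ℂ), I, 0)))
    ((hs τ').sub ((hs τ).mul_left _)).norm (fun p => (p.2.1 : ℤ)) (fun x => by
      have h1 := (hc.hasSum _ (hdom τ' x))
      have h2 := (hc.hasSum _ (hdom τ x)).mul_left ((τ : ℂ) ^ k)
      have h3 := (h1.sub h2).tsum_eq
      have h4 : h ((τ' : ℂ), I + x, 0) = (τ : ℂ) ^ k * h ((τ : ℂ), I + x, 0) := by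
        rw [← hm.inv _ (hdom τ x)]
        simp [invPt, hS]
        congr
        ext i
        exact i.elim0
      rw [h4, sub_self] at h3
      rw [← h3]
      refine tsum_congr fun p => ?_
      rw [e, e]
      ring) m
  have ef : ∀ σ : ℍ, (∑' n, c (n, m, 0) * qParam 1 (σ : ℂ) ^ n) * cexp (2 * Real.pi * I * (m * I))
      = ∑' p : Idx 0, if (p.2.1 : ℤ) = m then c p * ex p ((σ : ℂ), I, 0) else 0 := fun σ => by
    have hi : Function.Injective (fun n : ℕ => ((n, m, 0) : Idx 0)) := fun a b hab => by simpa using hab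
    rw [← hi.tsum_eq (f := fun p : Idx 0 => if (p.2.1 : ℤ) = m then c p * ex p ((σ : ℂ), I, 0) else 0),
      ← tsum_mul_right]
    · refine tsum_congr fun n => ?_
      rw [if_pos rfl, qParam_one_pow, mul_assoc, ex, ← Complex.exp_add]
      congr 2
      simp
      ring
    · rintro ⟨n, m', z⟩ hp
      simp only [Function.mem_support, ne_eq, ite_eq_right_iff, Classical.not_imp] at hp
      refine ⟨n, ?_⟩
      have : m' = m := by exact_mod_cast hp.1
      rw [this, Subsingleton.elim z 0]
  have hsi : ∀ σ : ℍ, Summable fun p : Idx 0 => if (p.2.1 : ℤ) = m then c p * ex p ((σ : ℂ), I, 0) else 0 :=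
    fun σ => by
      refine ((hs σ).indicator {p | (p.2.1 : ℤ) = m}).congr fun p => ?_
      simp [Set.indicator_apply]
  have hne : cexp (2 * Real.pi * I * (m * I)) ≠ 0 := Complex.exp_ne_zero _
  refine mul_right_cancel₀ hne ?_
  rw [mul_assoc _ (tsum _) _, ef, ef, ← tsum_mul_left, ← sub_eq_zero, ← Summable.tsum_sub (hsi τ') ((hsi τ).mul_left _)]
  refine Eq.trans ?_ key
  refine tsum_congr fun p => ?_
  split_ifs <;> simp

end HermMod

namespace HermMod
open Filter Topology
open scoped MatrixGroups UpperHalfPlane ModularForm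
open UpperHalfPlane (qExpansion)
open Function.Periodic (qParam)

/-- The `q`-expansion of the Eisenstein series of weight 4. -/
def e4 : PowerSeries ℂ := qExpansion 1 ModularForm.E₄

/-- The `q`-expansion of the Eisenstein series of weight 6. -/
def e6 : PowerSeries ℂ := qExpansion 1 ModularForm.E₆

/-- The `q`-expansion of the discriminant. -/
def dq : PowerSeries ℂ := qExpansion 1 ModularForm.discriminant

/-- All coefficients of `ψ` lie in `R`. -/
def CoefIn (R : Subring ℂ) (ψ : PowerSeries ℂ) : Prop := ∀ n, PowerSeries.coeff n ψ ∈ R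

namespace CoefIn
variable {R : Subring ℂ} {ψ φ : PowerSeries ℂ}

theorem mul (h : CoefIn R ψ) (h' : CoefIn R φ) : CoefIn R (ψ * φ) := fun n => by
  rw [PowerSeries.coeff_mul]
  exact sum_mem fun p _ => mul_mem (h _) (h' _)

theorem one : CoefIn R 1 := fun n => by
  rw [PowerSeries.coeff_one]
  split_ifs
  exacts [one_mem _, zero_mem _]

theorem pow (h : CoefIn R ψ) (m : ℕ) : CoefIn R (ψ ^ m) := by
  induction m with
  | zero => simpa using one
  | succ m ih => rw [pow_succ]; exact ih.mul h

theorem sub (h : CoefIn R ψ) (h' : CoefIn R φ) : CoefIn R (ψ - φ) := fun n => by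
  rw [map_sub]
  exact sub_mem (h n) (h' n)

theorem smul (h : CoefIn R ψ) {r : ℂ} (hr : r ∈ R) : CoefIn R (r • ψ) := fun n => by
  rw [PowerSeries.coeff_smul]
  exact mul_mem hr (h n)

end CoefIn

theorem coeff_zero_e4 : PowerSeries.coeff 0 e4 = 1 := EisensteinSeries.E_qExpansion_coeff_zero _ ⟨2, rfl⟩

theorem coeff_zero_e6 : PowerSeries.coeff 0 e6 = 1 := EisensteinSeries.E_qExpansion_coeff_zero _ ⟨3, rfl⟩

theorem coeff_zero_dq : PowerSeries.coeff 0 dq = 0 := by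
  have := PowerSeries.coeff_of_lt_order (φ := dq) 0
    (by rw [dq, ModularForm.discriminant_qExpansion_order]; simp)
  exact this

theorem coeff_one_dq : PowerSeries.coeff 1 dq = 1 := ModularForm.discriminant_qExpansion_coeff_one

theorem constantCoeff_e4 : PowerSeries.constantCoeff e4 = 1 := by
  rw [← PowerSeries.coeff_zero_eq_constantCoeff_apply, coeff_zero_e4]

theorem constantCoeff_e6 : PowerSeries.constantCoeff e6 = 1 := by
  rw [← PowerSeries.coeff_zero_eq_constantCoeff_apply, coeff_zero_e6]

theorem LevelOne.e4 : LevelOne 4 e4 := ⟨ModularForm.E₄, rfl⟩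

theorem LevelOne.e6 : LevelOne 6 e6 := ⟨ModularForm.E₆, rfl⟩

namespace LevelOne
variable {k k' : ℤ} {ψ φ : PowerSeries ℂ}

theorem add (h : LevelOne k ψ) (h' : LevelOne k φ) : LevelOne k (ψ + φ) := by
  obtain ⟨F, rfl⟩ := h
  obtain ⟨G, rfl⟩ := h'
  exact ⟨F + G, ModularForm.qExpansion_add one_pos one_mem_strictPeriods_SL F G⟩

theorem smul (h : LevelOne k ψ) (r : ℂ) : LevelOne k (r • ψ) := by
  obtain ⟨F, rfl⟩ := h
  exact ⟨r • F, ModularForm.qExpansion_smul one_pos one_mem_strictPeriods_SL r F⟩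

theorem sub (h : LevelOne k ψ) (h' : LevelOne k φ) : LevelOne k (ψ - φ) := by
  simpa [sub_eq_add_neg] using h.add (h'.smul (-1))

theorem mul (h : LevelOne k ψ) (h' : LevelOne k' φ) : LevelOne (k + k') (ψ * φ) := by
  obtain ⟨F, rfl⟩ := h
  obtain ⟨G, rfl⟩ := h'
  exact ⟨F.mul G, ModularForm.qExpansion_mul_coe one_pos one_mem_strictPeriods_SL F G⟩

theorem one : LevelOne 0 1 := ⟨1, ModularForm.qExpansion_one⟩

theorem pow (h : LevelOne k ψ) (m : ℕ) : LevelOne (m * k) (ψ ^ m) := by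
  induction m with
  | zero => simpa using one
  | succ m ih =>
    rw [pow_succ, show ((m + 1 : ℕ) : ℤ) * k = m * k + k by push_cast; ring]
    exact ih.mul h

theorem qExpansion_zero : qExpansion 1 (0 : ModularForm 𝒮ℒ k) = 0 :=
  (ModularForm.qExpansion_eq_zero_iff one_pos one_mem_strictPeriods_SL _).2 rfl

theorem eq_zero_of_neg (h : LevelOne k ψ) (hk : k < 0) : ψ = 0 := by
  obtain ⟨F, rfl⟩ := h
  have : F = 0 := DFunLike.coe_injective (ModularFormClass.levelOne_neg_weight_eq_zero hk F)
  rw [this, qExpansion_zero]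

theorem eq_zero_of_odd (h : LevelOne k ψ) (hk : Odd k) : ψ = 0 := by
  obtain ⟨F, rfl⟩ := h
  rw [ModularForm.levelOne_odd_weight_eq_zero hk F, qExpansion_zero]

theorem eq_zero_of_two (h : LevelOne 2 ψ) : ψ = 0 := by
  obtain ⟨F, rfl⟩ := h
  have : F = 0 := rank_zero_iff_forall_zero.1 ModularForm.levelOne_weight_two_rank_zero F
  rw [this, qExpansion_zero]

theorem exists_dq_mul (h : LevelOne k ψ) (h0 : PowerSeries.coeff 0 ψ = 0) :
    ∃ φ, LevelOne (k - 12) φ ∧ ψ = dq * φ := by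
  obtain ⟨F, rfl⟩ := h
  exact ⟨_, ⟨_, rfl⟩, ModularForm.qExpansion_eq_qExpansion_discriminant_mul F h0⟩

theorem eq_of_zero (h : LevelOne 0 ψ) : ψ = PowerSeries.coeff 0 ψ • 1 := by
  have h1 := h.sub (one.smul (PowerSeries.coeff 0 ψ))
  obtain ⟨φ, hφ, he⟩ := h1.exists_dq_mul (by simp)
  rw [hφ.eq_zero_of_neg (by norm_num), mul_zero] at he
  exact sub_eq_zero.1 he

theorem eq_zero_of_lt (h : LevelOne k ψ) (hk : k < 12) (h0 : PowerSeries.coeff 0 ψ = 0) : ψ = 0 := by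
  obtain ⟨φ, hφ, rfl⟩ := h.exists_dq_mul h0
  rw [hφ.eq_zero_of_neg (by omega), mul_zero]

theorem eq_e4 (h : LevelOne 4 ψ) (h0 : PowerSeries.coeff 0 ψ = 1) : ψ = HermMod.e4 :=
  sub_eq_zero.1 ((h.sub .e4).eq_zero_of_lt (by norm_num) (by rw [map_sub, h0, coeff_zero_e4, sub_self]))

theorem eq_e6 (h : LevelOne 6 ψ) (h0 : PowerSeries.coeff 0 ψ = 1) : ψ = HermMod.e6 :=
  sub_eq_zero.1 ((h.sub .e6).eq_zero_of_lt (by norm_num) (by rw [map_sub, h0, coeff_zero_e6, sub_self]))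

theorem exists_dq_pow_mul (h : LevelOne k ψ) {C : ℕ} (h0 : ∀ n < C, PowerSeries.coeff n ψ = 0) :
    ∃ φ, LevelOne (k - 12 * C) φ ∧ ψ = dq ^ C * φ := by
  induction C with
  | zero => exact ⟨ψ, by simpa using h, by simp⟩
  | succ C ih =>
    obtain ⟨φ, hφ, he⟩ := ih fun n hn => h0 n (by omega)
    have hX : dq = PowerSeries.X * PowerSeries.mk fun n => PowerSeries.coeff (n + 1) dq := by
      ext n
      cases n with
      | zero => simpa using coeff_zero_dq
      | succ n => simp [PowerSeries.coeff_succ_X_mul]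
    have h1 : PowerSeries.coeff 0 φ = 0 := by
      have := h0 C (by omega)
      rw [he, hX, mul_pow, mul_assoc, PowerSeries.coeff_X_pow_mul', if_pos le_rfl, Nat.sub_self,
        PowerSeries.coeff_mul] at this
      simpa [coeff_one_dq] using this
    obtain ⟨φ', hφ', he'⟩ := hφ.exists_dq_mul h1
    refine ⟨φ', ?_, ?_⟩
    · convert hφ' using 1
      push_cast
      ring
    · rw [he, he', pow_succ, mul_assoc]

end LevelOne

theorem dq_eq : dq = (1728 : ℂ)⁻¹ • (e4 ^ 3 - e6 ^ 2) := by
  have h12 : LevelOne 12 (e4 ^ 3 - e6 ^ 2) := by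
    have h1 := LevelOne.e4.pow 3
    have h2 := LevelOne.e6.pow 2
    norm_num at h1 h2
    exact h1.sub h2
  obtain ⟨φ, hφ, he⟩ := h12.exists_dq_mul (by
    simp [map_sub, map_pow, constantCoeff_e4, constantCoeff_e6])
  have h0 := hφ.eq_of_zero
  have h1 : PowerSeries.coeff 1 (e4 ^ 3 - e6 ^ 2) = 1728 := by
    have a : PowerSeries.coeff 1 e4 = 240 := ModularForm.E₄_qExpansion_coeff_one
    have b : PowerSeries.coeff 1 e6 = -504 := ModularForm.E₆_qExpansion_coeff_one
    norm_num [pow_succ, PowerSeries.coeff_mul, Finset.Nat.antidiagonal_succ, a, b, coeff_zero_e4, coeff_zero_e6]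
  have h2 : PowerSeries.coeff 0 φ = 1728 := by
    rw [he, PowerSeries.coeff_mul] at h1
    simpa [Finset.Nat.antidiagonal_succ, coeff_zero_dq, coeff_one_dq] using h1
  rw [he, h0, h2]
  ext n
  simp

theorem CoefIn.of_dq_mul {R : Subring ℂ} (hd : CoefIn R dq) {φ : PowerSeries ℂ} (h : CoefIn R (dq * φ)) :
    CoefIn R φ := fun n => by
  induction n using Nat.strong_induction_on with
  | _ n ih =>
    have h1 := h (n + 1)
    rw [PowerSeries.coeff_mul, Finset.Nat.sum_antidiagonal_eq_sum_range_succ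
      (fun i j => PowerSeries.coeff i dq * PowerSeries.coeff j φ), Finset.sum_range_succ',
      Finset.sum_range_succ'] at h1
    simp only [zero_add, coeff_zero_dq, zero_mul, add_zero, coeff_one_dq, one_mul, Nat.add_sub_cancel] at h1
    rw [add_mem_cancel_left] at h1
    · exact h1
    · exact sum_mem fun i hi => mul_mem (hd _) (ih _ (by
        have := Finset.mem_range.1 hi
        omega))

theorem CoefIn.dq {R : Subring ℂ} (h6 : (6 : ℂ)⁻¹ ∈ R) (h4 : CoefIn R e4) (h6' : CoefIn R e6) :
    CoefIn R dq := by
  rw [dq_eq]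
  refine ((h4.pow 3).sub (h6'.pow 2)).smul ?_
  have : (1728 : ℂ)⁻¹ = ((6 : ℕ) : ℂ)⁻¹ ^ 3 * 6⁻¹ ^ 3 * 27 := by norm_num
  have h27 : (27 : ℂ) ∈ R := by exact_mod_cast natCast_mem R 27
  rw [this]
  push_cast
  exact mul_mem (mul_mem (pow_mem h6 3) (pow_mem h6 3)) h27

/-- Induction principle for level one forms over a ring containing `1/6`. -/
theorem LevelOne.induction {R : Subring ℂ} (h6 : (6 : ℂ)⁻¹ ∈ R) (hc4 : CoefIn R HermMod.e4) (hc6 : CoefIn R HermMod.e6)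
    {P : ℤ → PowerSeries ℂ → Prop} (zero : ∀ k, P k 0) (one : P 0 1)
    (smul : ∀ k ψ, ∀ r ∈ R, P k ψ → P k (r • ψ)) (add : ∀ k ψ φ, P k ψ → P k φ → P k (ψ + φ))
    (mul : ∀ k k' ψ φ, P k ψ → P k' φ → P (k + k') (ψ * φ)) (p4 : P 4 HermMod.e4) (p6 : P 6 HermMod.e6)
    {k : ℤ} {ψ : PowerSeries ℂ} (h : LevelOne k ψ) (hR : CoefIn R ψ) : P k ψ := by
  have pow : ∀ k ψ, P k ψ → ∀ m : ℕ, P (m * k) (ψ ^ m) := fun k ψ hψ m => by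
    induction m with
    | zero => simpa using one
    | succ m ih =>
      rw [pow_succ, show ((m + 1 : ℕ) : ℤ) * k = m * k + k by push_cast; ring]
      exact mul _ _ _ _ ih hψ
  have hd := CoefIn.dq h6 hc4 hc6
  have pd : P 12 HermMod.dq := by
    have h1 := pow _ _ p4 3
    have h2 := smul _ _ (-1) (neg_mem (one_mem R)) (pow _ _ p6 2)
    norm_num at h1 h2
    have h3 := add _ _ _ h1 h2
    rw [← sub_eq_add_neg] at h3
    have := smul _ _ (1728 : ℂ)⁻¹ (by
      have h27 : (27 : ℂ) ∈ R := by exact_mod_cast natCast_mem R 27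
      have := mul_mem (mul_mem (pow_mem h6 3) (pow_mem h6 3)) h27
      norm_num at this ⊢
      exact this) h3
    rwa [dq_eq]
  have main : ∀ N : ℕ, ∀ k : ℤ, k < N → ∀ ψ, LevelOne k ψ → CoefIn R ψ → P k ψ := by
    intro N
    induction N with
    | zero =>
      intro k hk ψ h _
      rw [h.eq_zero_of_neg (by simpa using hk)]
      exact zero k
    | succ N ih =>
      intro k hk ψ h hR
      rcases Int.even_or_odd k with he | ho
      swap
      · rw [h.eq_zero_of_odd ho]
        exact zero k
      by_cases hneg : k < 0
      · rw [h.eq_zero_of_neg hneg]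
        exact zero k
      by_cases h2 : k = 2
      · subst h2
        rw [h.eq_zero_of_two]
        exact zero 2
      obtain ⟨a, b, hab⟩ : ∃ a b : ℕ, k = a * 4 + b * 6 := by
        obtain ⟨r, hr⟩ := he
        rcases Int.even_or_odd r with ⟨s, hs⟩ | ⟨s, hs⟩
        · exact ⟨s.toNat, 0, by push_cast; omega⟩
        · exact ⟨(s - 1).toNat, 1, by push_cast; omega⟩
      have hm := (LevelOne.e4.pow a).mul (LevelOne.e6.pow b)
      rw [← hab] at hm
      have hmP := mul _ _ _ _ (pow _ _ p4 a) (pow _ _ p6 b)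
      rw [← hab] at hmP
      obtain ⟨φ, hφ, hφe⟩ := (h.sub (hm.smul (PowerSeries.coeff 0 ψ))).exists_dq_mul (by
        simp [map_pow, constantCoeff_e4, constantCoeff_e6])
      have hφR : CoefIn R φ := CoefIn.of_dq_mul hd (by
        rw [← hφe]
        exact hR.sub (((hc4.pow a).mul (hc6.pow b)).smul (hR 0)))
      have h3 := mul _ _ _ _ pd (ih (k - 12) (by push_cast at hk; omega) φ hφ hφR)
      rw [add_sub_cancel, ← hφe] at h3
      have h4 := add _ _ _ h3 (smul _ _ _ (hR 0) hmP)
      rwa [sub_add_cancel] at h4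
  exact main (k.toNat + 1) k (by push_cast; omega) ψ h hR

end HermMod

namespace HermMod
open Filter Topology

theorem mem_cone_zero (x : Idx 0) : x ∈ cone 0 := by
  rw [mem_cone]
  simp only [Finset.univ_eq_empty, Finset.sum_empty]
  positivity

/-- The rows of a product are the antidiagonal sums of products of rows. -/
theorem row_coneConv (c c' : Idx 0 → ℂ) (m : ℕ) :
    row (coneConv c c') m = ∑ p ∈ Finset.HasAntidiagonal.antidiagonal m, row c p.1 * row c' p.2 := by
  ext n
  simp only [row, map_sum, PowerSeries.coeff_mul, PowerSeries.coeff_mk, coneConv]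
  rw [dif_pos (mem_cone_zero _), ← Finset.sum_product']
  refine Finset.sum_nbij' (fun p => ((p.1.1.2.1, p.2.1.2.1), (p.1.1.1, p.2.1.1)))
    (fun q => (⟨(q.2.1, q.1.1, 0), mem_cone_zero _⟩, ⟨(q.2.2, q.1.2, 0), mem_cone_zero _⟩))
    ?_ ?_ ?_ ?_ ?_
  · intro p hp
    rw [Finset.HasAntidiagonal.mem_antidiagonal, Subtype.ext_iff] at hp
    have h1 := congrArg Prod.fst hp
    have h2 := congrArg (fun x : Idx 0 => x.2.1) hp
    simpa using ⟨h2, h1⟩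
  · intro q hq
    simp only [Finset.mem_product, Finset.HasAntidiagonal.mem_antidiagonal] at hq
    rw [Finset.HasAntidiagonal.mem_antidiagonal, Subtype.ext_iff]
    simp [hq.1, hq.2]
  · intro p _
    refine Prod.ext (Subtype.ext ?_) (Subtype.ext ?_)
    · exact Prod.ext rfl (Prod.ext rfl (Subsingleton.elim _ _))
    · exact Prod.ext rfl (Prod.ext rfl (Subsingleton.elim _ _))
  · intro q _
    rfl
  · intro p _
    congr 2
    · exact Prod.ext rfl (Prod.ext rfl (Subsingleton.elim _ _))
    · exact Prod.ext rfl (Prod.ext rfl (Subsingleton.elim _ _))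

theorem eq_zero_of_rows {c : Idx 0 → ℂ} (h : ∀ m, row c m = 0) : c = 0 := by
  funext ⟨n, m, a⟩
  have := congrArg (PowerSeries.coeff n) (h m)
  rw [Subsingleton.elim a 0]
  simpa [row] using this

theorem coeff_row_symm {k : ℤ} {h : Pt 0 → ℂ} {c : Idx 0 → ℂ} (hc : IsExp h c) (hm : Mod 0 k h)
    {C : ℕ} (hC : ∀ m < C, row c m = 0) (n : ℕ) (hn : n < C) : PowerSeries.coeff n (row c C) = 0 := by
  have := congrArg (PowerSeries.coeff C) (hC n hn)
  rw [row, PowerSeries.coeff_mk, coeff_swap hc hm]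
  simpa [row] using this

/-- A form of rank 0 whose first rows vanish is zero. -/
theorem rank_zero_vanish {k : ℤ} {h : Pt 0 → ℂ} {c : Idx 0 → ℂ} (hc : IsExp h c) (hm : Mod 0 k h)
    {C : ℕ} (hC : ∀ m < C, row c m = 0) (hk : k < 12 * C) : c = 0 := by
  refine eq_zero_of_rows fun m => ?_
  induction m using Nat.strong_induction_on with
  | _ m ih =>
    by_cases hmC : m < C
    · exact hC m hmC
    obtain ⟨G, -, hG⟩ := row_levelOne hc hm m
    obtain ⟨φ, hφ, he⟩ := LevelOne.exists_dq_pow_mul ⟨G, hG⟩ (coeff_row_symm hc hm ih)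
    rw [he, hφ.eq_zero_of_neg (by omega), mul_zero]

theorem row_mom_eq_zero {k : ℤ} {g : Pt 1 → ℂ} {c : Idx 1 → ℂ} (h : IsExp g c) (hg : Mod 1 k g)
    {B m : ℕ} (hB : ∀ l < B, mom c l = 0) (hm : 2 * m < B) (l : ℕ) (r : ℂ) :
    row (fun y => mom c l y / r) m = 0 := by
  ext n
  rw [row, PowerSeries.coeff_mk, mom, Finset.sum_eq_zero, zero_div, map_zero]
  intro a _
  rw [row_eq_zero h hg hB hm n a, mul_zero]

/-- A form of rank 1 vanishing to high order along the diagonal is zero. -/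
theorem rank_one_vanish {k : ℤ} {g : Pt 1 → ℂ} {c : Idx 1 → ℂ} (h : IsExp g c) (hg : Mod 1 k g)
    {B : ℕ} (hB : ∀ l < B, mom c l = 0) (hk : k < 5 * B) : c = 0 := by
  refine coeff_eq_zero_of_moments h.supp fun l => ?_
  induction l using Nat.strong_induction_on with
  | _ l ih =>
    by_cases hl : l < B
    · exact hB l hl
    obtain ⟨h0, hexp, hlead⟩ := h.lead ih
    have hz := rank_zero_vanish hexp (hlead.mod hg) (C := (l + 1) / 2)
      (fun m hm => row_mom_eq_zero h hg ih (by omega) l _) (by push_cast; omega)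
    funext y
    have := congrFun hz y
    simpa [Nat.factorial_ne_zero] using this

/-- A rotation invariant form of rank 2 vanishing to high order along the Siegel space is zero. -/
theorem rank_two_vanish {k : ℤ} {f : Pt 2 → ℂ} {c : Idx 2 → ℂ} (h : IsExp f c) (hf : Mod 2 k f)
    (hr : ∀ w ∈ Dom 2, f (rotPt w) = f w) {J : ℕ} (hJ : ∀ l < J, mom c l = 0) (hk : k < 4 * J) :
    c = 0 := by
  refine coeff_eq_zero_of_moments h.supp fun l => ?_
  induction l using Nat.strong_induction_on with
  | _ l ih =>
    by_cases hl : l < J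
    · exact hJ l hl
    obtain ⟨g, hexp, hlead⟩ := h.lead ih
    have hz := rank_one_vanish hexp (hlead.mod hf) (B := l)
      (fun m hm => mom_mom_eq_zero h hr ih _ m hm) (by omega)
    funext y
    have := congrFun hz y
    simpa [Nat.factorial_ne_zero] using this

/-- Iterated leading term of a form of rank 2. -/
def Lead3 (J B C : ℕ) (f : Pt 2 → ℂ) (ψ : PowerSeries ℂ) : Prop :=
  ∃ g h c, LeadV J f g ∧ LeadV B g h ∧ IsExp h c ∧ (∀ m < C, row c m = 0) ∧ row c C = ψ

namespace Lead3
variable {J B C J' B' C' : ℕ} {f f' : Pt 2 → ℂ} {ψ ψ' : PowerSeries ℂ}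

theorem mul (H : Lead3 J B C f ψ) (H' : Lead3 J' B' C' f' ψ') :
    Lead3 (J + J') (B + B') (C + C') (f * f') (ψ * ψ') := by
  obtain ⟨g, h, c, h1, h2, h3, h4, rfl⟩ := H
  obtain ⟨g', h', c', h1', h2', h3', h4', rfl⟩ := H'
  refine ⟨_, _, _, h1.mul h1', h2.mul h2', h3.mul h3', fun m hm => ?_, ?_⟩
  · rw [row_coneConv]
    refine Finset.sum_eq_zero fun p hp => ?_
    rw [Finset.HasAntidiagonal.mem_antidiagonal] at hp
    by_cases hp1 : p.1 < C
    · rw [h4 _ hp1, zero_mul]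
    · rw [h4' _ (by omega), mul_zero]
  · rw [row_coneConv, Finset.sum_eq_single (C, C')]
    · intro p hp hne
      rw [Finset.HasAntidiagonal.mem_antidiagonal] at hp
      by_cases hp1 : p.1 < C
      · rw [h4 _ hp1, zero_mul]
      · rw [h4' _ (by
          by_contra hc
          exact hne (Prod.ext (by simp only; omega) (by simp only; omega))), mul_zero]
    · intro hp
      exact absurd (Finset.HasAntidiagonal.mem_antidiagonal (a := (C, C')).2 rfl) hp

theorem row_add (c c' : Idx 0 → ℂ) (m : ℕ) : row (c + c') m = row c m + row c' m := by
  ext n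
  simp [row]

theorem row_smul (r : ℂ) (c : Idx 0 → ℂ) (m : ℕ) : row (r • c) m = r • row c m := by
  ext n
  simp [row]

theorem row_sub (c c' : Idx 0 → ℂ) (m : ℕ) : row (c - c') m = row c m - row c' m := by
  ext n
  simp [row]

theorem add (H : Lead3 J B C f ψ) (H' : Lead3 J B C f' ψ') : Lead3 J B C (f + f') (ψ + ψ') := by
  obtain ⟨g, h, c, h1, h2, h3, h4, rfl⟩ := H
  obtain ⟨g', h', c', h1', h2', h3', h4', rfl⟩ := H'
  refine ⟨_, _, _, h1.add h1', h2.add h2', h3.add h3', fun m hm => ?_, row_add _ _ _⟩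
  rw [row_add, h4 m hm, h4' m hm, add_zero]

theorem smul (H : Lead3 J B C f ψ) (r : ℂ) : Lead3 J B C (r • f) (r • ψ) := by
  obtain ⟨g, h, c, h1, h2, h3, h4, rfl⟩ := H
  refine ⟨_, _, _, h1.smul r, h2.smul r, h3.smul r, fun m hm => ?_, row_smul _ _ _⟩
  rw [row_smul, h4 m hm, smul_zero]

theorem one : Lead3 0 0 0 1 1 := by
  refine ⟨1, 1, _, .one, .one, .one, fun m hm => absurd hm (Nat.not_lt_zero m), ?_⟩
  ext n
  rw [row, PowerSeries.coeff_mk, PowerSeries.coeff_one, Pi.single_apply]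
  congr 1
  simp [Prod.ext_iff]

theorem pow (H : Lead3 J B C f ψ) (n : ℕ) : Lead3 (n * J) (n * B) (n * C) (f ^ n) (ψ ^ n) := by
  induction n with
  | zero => simpa using one
  | succ n ih => simpa [pow_succ, add_mul] using ih.mul H

end Lead3

/-- Forms of rank 2 invariant under the rotation. -/
structure Good (R : Subring ℂ) (k : ℤ) (f : Pt 2 → ℂ) : Prop where
  form : Form 2 k R f
  rot : ∀ w ∈ Dom 2, f (rotPt w) = f w

namespace Good
variable {R : Subring ℂ} {k k' : ℤ} {f f' : Pt 2 → ℂ}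

theorem add (h : Good R k f) (h' : Good R k f') : Good R k (f + f') :=
  ⟨h.1.add h'.1, fun w hw => by simp [h.2 w hw, h'.2 w hw]⟩

theorem sub (h : Good R k f) (h' : Good R k f') : Good R k (f - f') :=
  ⟨h.1.sub h'.1, fun w hw => by simp [h.2 w hw, h'.2 w hw]⟩

theorem smul (h : Good R k f) {r : ℂ} (hr : r ∈ R) : Good R k (r • f) :=
  ⟨h.1.smul hr, fun w hw => by simp [h.2 w hw]⟩

theorem mul (h : Good R k f) (h' : Good R k' f') : Good R (k + k') (f * f') :=
  ⟨h.1.mul h'.1, fun w hw => by simp [h.2 w hw, h'.2 w hw]⟩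

theorem zero : Good R k 0 :=
  ⟨⟨⟨by simp, by simp, by simp, by simp⟩, ⟨0, .zero, fun _ => zero_mem R⟩⟩, fun _ _ => rfl⟩

theorem one : Good R 0 1 := ⟨.one, fun _ _ => rfl⟩

theorem pow (h : Good R k f) (m : ℕ) : Good R (m * k) (f ^ m) := by
  induction m with
  | zero => simpa using one
  | succ m ih =>
    rw [pow_succ, show ((m + 1 : ℕ) : ℤ) * k = m * k + k by push_cast; ring]
    exact ih.mul h

end Good

/-- Polynomial expressions with coefficients in `R` in the components of `v`. -/
def Poly (R : Subring ℂ) {σ : Type*} (v : Pt 2 → σ → ℂ) (f : Pt 2 → ℂ) : Prop :=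
  ∃ P : MvPolynomial σ R, ∀ w ∈ Dom 2, f w = MvPolynomial.aeval (v w) P

namespace Poly
variable {R : Subring ℂ} {σ : Type*} {v : Pt 2 → σ → ℂ} {f f' : Pt 2 → ℂ}

theorem add (h : Poly R v f) (h' : Poly R v f') : Poly R v (f + f') := by
  obtain ⟨P, hP⟩ := h
  obtain ⟨Q, hQ⟩ := h'
  exact ⟨P + Q, fun w hw => by simp [hP w hw, hQ w hw]⟩

theorem mul (h : Poly R v f) (h' : Poly R v f') : Poly R v (f * f') := by
  obtain ⟨P, hP⟩ := h
  obtain ⟨Q, hQ⟩ := h'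
  exact ⟨P * Q, fun w hw => by simp [hP w hw, hQ w hw]⟩

theorem smul (h : Poly R v f) {r : ℂ} (hr : r ∈ R) : Poly R v (r • f) := by
  obtain ⟨P, hP⟩ := h
  exact ⟨MvPolynomial.C ⟨r, hr⟩ * P, fun w hw => by
    rw [Pi.smul_apply, hP w hw, map_mul, MvPolynomial.aeval_C]
    rfl⟩

theorem one : Poly R v 1 := ⟨1, by simp⟩

theorem zero : Poly R v 0 := ⟨0, by simp⟩

theorem pow (h : Poly R v f) (m : ℕ) : Poly R v (f ^ m) := by
  induction m with
  | zero => simpa using one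
  | succ m ih => rw [pow_succ]; exact ih.mul h

theorem proj (i : σ) : Poly R v (fun w => v w i) := ⟨.X i, by simp⟩

theorem congr (h : Poly R v f) (he : ∀ w ∈ Dom 2, f' w = f w) : Poly R v f' := by
  obtain ⟨P, hP⟩ := h
  exact ⟨P, fun w hw => by rw [he w hw, hP w hw]⟩

end Poly

/-- A system of generators with the expected leading terms. -/
structure GenSystem (R : Subring ℂ) (v : Pt 2 → Fin 5 → ℂ) : Prop where
  inv6 : (6 : ℂ)⁻¹ ∈ R
  c4 : CoefIn R e4
  c6 : CoefIn R e6
  g0 : Good R 4 (fun w => v w 0)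
  g1 : Good R 6 (fun w => v w 1)
  g2 : Good R 8 (fun w => v w 2)
  g3 : Good R 10 (fun w => v w 3)
  g4 : Good R 12 (fun w => v w 4)
  l0 : Lead3 0 0 0 (fun w => v w 0) e4
  l1 : Lead3 0 0 0 (fun w => v w 1) e6
  l2 : Lead3 2 2 1 (fun w => v w 2) dq
  l3 : Lead3 0 2 1 (fun w => v w 3) ((6 : ℂ) • dq)
  l4 : Lead3 0 0 1 (fun w => v w 4) ((12 : ℂ) • dq)

namespace GenSystem
variable {R : Subring ℂ} {v : Pt 2 → Fin 5 → ℂ}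

theorem lift_levelOne (S : GenSystem R v) {k : ℤ} {φ : PowerSeries ℂ} (h : LevelOne k φ) (hR : CoefIn R φ) :
    ∃ F, Good R k F ∧ Poly R v F ∧ Lead3 0 0 0 F φ := by
  refine LevelOne.induction (P := fun k φ => ∃ F, Good R k F ∧ Poly R v F ∧ Lead3 0 0 0 F φ)
    S.inv6 S.c4 S.c6 ?_ ?_ ?_ ?_ ?_ ?_ ?_ h hR
  · intro k
    exact ⟨0, .zero, .zero, by simpa using Lead3.one.smul 0⟩
  · exact ⟨1, Good.one, Poly.one, Lead3.one⟩
  · rintro k ψ r hr ⟨F, a, b, c⟩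
    exact ⟨_, a.smul hr, b.smul hr, c.smul r⟩
  · rintro k ψ φ ⟨F, a, b, c⟩ ⟨F', a', b', c'⟩
    exact ⟨_, a.add a', b.add b', c.add c'⟩
  · rintro k k' ψ φ ⟨F, a, b, c⟩ ⟨F', a', b', c'⟩
    exact ⟨_, a.mul a', b.mul b', by simpa only [Nat.add_zero] using c.mul c'⟩
  · exact ⟨fun w => v w 0, S.g0, Poly.proj 0, S.l0⟩
  · exact ⟨fun w => v w 1, S.g1, Poly.proj 1, S.l1⟩

theorem lift (S : GenSystem R v) {k : ℤ} {j b c : ℕ} (hjb : j ≤ b) (hbc : b ≤ c) {ψ : PowerSeries ℂ}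
    (h : LevelOne (k + 2 * j + 2 * b) ψ) (h0 : ∀ n < c, PowerSeries.coeff n ψ = 0) (hR : CoefIn R ψ) :
    ∃ F, Good R k F ∧ Poly R v F ∧ Lead3 (2 * j) (2 * b) c F ψ := by
  obtain ⟨φ, hφ, rfl⟩ := h.exists_dq_pow_mul h0
  have hd := CoefIn.dq S.inv6 S.c4 S.c6
  have hφR : ∀ n (φ : PowerSeries ℂ), CoefIn R (dq ^ n * φ) → CoefIn R φ := by
    intro n
    induction n with
    | zero => intro φ h; simpa using h
    | succ n ih =>
      intro φ h
      rw [pow_succ, mul_assoc] at h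
      exact hd.of_dq_mul (ih _ h)
  obtain ⟨F0, a0, b0, c0⟩ := S.lift_levelOne hφ (hφR _ _ hR)
  obtain ⟨p, rfl⟩ := Nat.exists_eq_add_of_le hjb
  obtain ⟨q, rfl⟩ := Nat.exists_eq_add_of_le hbc
  set r : ℂ := 6⁻¹ ^ p * (6⁻¹ * 6⁻¹ * 3) ^ q with hr
  have hrR : r ∈ R := by
    refine mul_mem (pow_mem S.inv6 _) (pow_mem (mul_mem (mul_mem S.inv6 S.inv6) ?_) _)
    exact_mod_cast natCast_mem R 3
  refine ⟨r • ((fun w => v w 2) ^ j * (fun w => v w 3) ^ p * (fun w => v w 4) ^ q * F0), ?_, ?_, ?_⟩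
  · have := (((((S.g2.pow j).mul (S.g3.pow p)).mul (S.g4.pow q)).mul a0).smul hrR)
    convert this using 1
    push_cast
    ring
  · exact (((((Poly.proj 2).pow j).mul ((Poly.proj 3).pow p)).mul ((Poly.proj 4).pow q)).mul b0).smul hrR
  · have := (((((S.l2.pow j).mul (S.l3.pow p)).mul (S.l4.pow q)).mul c0).smul r)
    convert this using 1
    · ring
    · ring
    · ring
    · rw [smul_pow, smul_pow]
      simp only [mul_smul_comm, smul_mul_assoc, smul_smul]
      rw [show r * (12 ^ q * 6 ^ p) = 1 from ?_, one_smul]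
      · ring
      · rw [hr]
        have : ∀ a b c d : ℂ, a ^ p * b ^ q * (c ^ q * d ^ p) = (a * d) ^ p * (b * c) ^ q := by
          intro a b c d
          rw [mul_pow, mul_pow]
          ring
        rw [this]
        norm_num

/-- The structure theorem: every form is a polynomial in the generators. -/
theorem poly (S : GenSystem R v) {k : ℤ} {f : Pt 2 → ℂ} (hf : Good R k f) : Poly R v f := by
  have main : ∀ (N J : ℕ), k < 4 * J + N → ∀ f g, Good R k f → LeadV J f g → Poly R v f := by
    intro N
    induction N with
    | zero =>
      intro J hJ f g hf hfg
      obtain ⟨c, hc, -⟩ := hf.form.exp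
      have := rank_two_vanish hc hf.form.mod hf.rot (hc.mom_eq_zero hfg) (by simpa using hJ)
      exact Poly.zero.congr (this ▸ hc).eqOn_zero
    | succ N ihN =>
      intro J hJ
      have mid : ∀ (M B : ℕ), k + J < 5 * B + M → ∀ f g h, Good R k f → LeadV J f g → LeadV B g h →
          Poly R v f := by
        intro M
        induction M with
        | zero =>
          intro B hB f g h hf hfg hgh
          obtain ⟨cf, hcf, -⟩ := hf.form.exp
          have hg := hf.form.lead hfg
          obtain ⟨c, hc, -⟩ := hg.exp
          have := rank_one_vanish hc hg.mod (hc.mom_eq_zero hgh) (by simpa using hB)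
          obtain ⟨g', hg'⟩ := hcf.leadV_succ hfg (this ▸ hc).eqOn_zero
          exact ihN (J + 1) (by push_cast at hJ ⊢; linarith) f g' hf hg'
        | succ M ihM =>
          intro B hB
          have low : ∀ (L C : ℕ), k + J + B < 12 * C + L → ∀ f g h c, Good R k f → LeadV J f g →
              LeadV B g h → IsExp h c → (∀ m < C, row c m = 0) → Poly R v f := by
            intro L
            induction L with
            | zero =>
              intro C hC f g h c hf hfg hgh hc hrow
              have hg := hf.form.lead hfg
              have hh := hg.lead hgh
              obtain ⟨cg, hcg, -⟩ := hg.exp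
              have := rank_zero_vanish hc hh.mod hrow (by simpa using hC)
              obtain ⟨h', hh'⟩ := hcg.leadV_succ hgh (this ▸ hc).eqOn_zero
              exact ihM (B + 1) (by push_cast at hB ⊢; linarith) f g h' hf hfg hh'
            | succ L ihL =>
              intro C hC f g h c hf hfg hgh hc hrow
              have next : ∀ f g h c, Good R k f → LeadV J f g → LeadV B g h → IsExp h c →
                  (∀ m < C, row c m = 0) → row c C = 0 → Poly R v f := by
                intro f g h c hf hfg hgh hc hrow h0
                refine ihL (C + 1) (by push_cast at hC ⊢; linarith) f g h c hf hfg hgh hc fun m hm => ?_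
                rcases Nat.lt_succ_iff_lt_or_eq.1 hm with h' | rfl
                · exact hrow m h'
                · exact h0
              have hg := hf.form.lead hfg
              have hh := hg.lead hgh
              obtain ⟨cf, hcf, -⟩ := hf.form.exp
              obtain ⟨cg, hcg, -⟩ := hg.exp
              have hzero : (∀ w ∈ Dom 0, h w = 0) → row c C = 0 := by
                intro hz
                rw [hc.eq_zero hz]
                ext n
                simp [row]
              have hcu := hc.unique (hcg.leadV hgh)
              have hcgu := hcg.unique (hcf.leadV hfg)
              by_cases h2C : 2 * C < B
              · refine next f g h c hf hfg hgh hc hrow ?_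
                rw [hcu]
                exact row_mom_eq_zero hcg hg.mod (hcg.mom_eq_zero hgh) h2C B _
              rcases Nat.even_or_odd J with ⟨j, hj⟩ | hodd
              swap
              · refine next f g h c hf hfg hgh hc hrow ?_
                rw [hcu, hcg.eq_zero (hfg.eq_zero_of_odd hf.form.mod hodd)]
                ext n
                simp [row, mom]
              rcases Nat.even_or_odd B with ⟨b, hb⟩ | hodd
              swap
              · exact next f g h c hf hfg hgh hc hrow (hzero (hgh.eq_zero_of_odd hg.mod hodd))
              by_cases hBJ : B < J
              · refine next f g h c hf hfg hgh hc hrow ?_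
                rw [hcu, hcgu, mom_mom_eq_zero hcf hf.rot (hcf.mom_eq_zero hfg) _ B hBJ]
                ext n
                simp [row]
              obtain ⟨c', hc', hcR⟩ := hh.exp
              obtain rfl := hc.unique hc'
              obtain ⟨G, -, hG⟩ := row_levelOne hc hh.mod C
              obtain ⟨F, hF, hFP, g', h', c', hF1, hF2, hF3, hF4, hF5⟩ :=
                S.lift (k := k) (j := j) (b := b) (c := C) (ψ := row c C) (by omega) (by omega)
                  (by
                    have hL : LevelOne (k + J + B) (row c C) := ⟨G, hG⟩
                    rwa [show k + J + B = k + 2 * j + 2 * b by rw [hj, hb]; push_cast; ring] at hL)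
                  (coeff_row_symm hc hh.mod hrow) (fun n => by
                    rw [row, PowerSeries.coeff_mk]
                    exact hcR _)
              rw [← two_mul] at hj hb
              subst hj hb
              have hsub := next (f - F) (g - g') (h - h') (c - c') (hf.sub hF) (hfg.sub hF1) (hgh.sub hF2)
                (hc.sub hF3) (fun m hm => by rw [Lead3.row_sub, hrow m hm, hF4 m hm, sub_zero])
                (by rw [Lead3.row_sub, hF5, sub_self])
              simpa using hsub.add hFP
          intro f g h hf hfg hgh
          obtain ⟨c, hc, -⟩ := ((hf.form.lead hfg).lead hgh).exp
          exact low (k + J + B + 1).toNat 0 (by push_cast; omega) f g h c hf hfg hgh hc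
            fun m hm => absurd hm (Nat.not_lt_zero m)
      intro f g hf hfg
      exact mid (k + J + 1).toNat 0 (by push_cast; omega) f g _ hf hfg (hf.form.lead hfg).lead_zero
  exact main (k + 1).toNat 0 (by push_cast; omega) f _ hf hf.form.lead_zero

end GenSystem
end HermMod

namespace HermMod
open Filter Topology
open scoped MatrixGroups UpperHalfPlane ModularForm
open UpperHalfPlane (qExpansion)
open Function.Periodic (qParam)

/-- `u` is a level one modular form of weight `k` with `q`-expansion `ψ`. -/
def IsLevelOne (k : ℤ) (ψ : PowerSeries ℂ) (u : ℍ → ℂ) : Prop :=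
  ∃ F : ModularForm 𝒮ℒ k, qExpansion 1 F = ψ ∧ ⇑F = u

namespace IsLevelOne
variable {k k' : ℤ} {ψ φ : PowerSeries ℂ} {u u' : ℍ → ℂ}

theorem add (h : IsLevelOne k ψ u) (h' : IsLevelOne k φ u') : IsLevelOne k (ψ + φ) (u + u') := by
  obtain ⟨F, rfl, rfl⟩ := h
  obtain ⟨G, rfl, rfl⟩ := h'
  exact ⟨F + G, ModularForm.qExpansion_add one_pos one_mem_strictPeriods_SL F G, rfl⟩

theorem smul (h : IsLevelOne k ψ u) (r : ℂ) : IsLevelOne k (r • ψ) (r • u) := by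
  obtain ⟨F, rfl, rfl⟩ := h
  exact ⟨r • F, ModularForm.qExpansion_smul one_pos one_mem_strictPeriods_SL r F, rfl⟩

theorem mul (h : IsLevelOne k ψ u) (h' : IsLevelOne k' φ u') : IsLevelOne (k + k') (ψ * φ) (u * u') := by
  obtain ⟨F, rfl, rfl⟩ := h
  obtain ⟨G, rfl, rfl⟩ := h'
  exact ⟨F.mul G, ModularForm.qExpansion_mul_coe one_pos one_mem_strictPeriods_SL F G, rfl⟩

theorem one : IsLevelOne 0 1 1 := ⟨1, ModularForm.qExpansion_one, rfl⟩

theorem pow (h : IsLevelOne k ψ u) (m : ℕ) : IsLevelOne (m * k) (ψ ^ m) (u ^ m) := by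
  induction m with
  | zero => simpa using one
  | succ m ih =>
    rw [pow_succ, pow_succ, show ((m + 1 : ℕ) : ℤ) * k = m * k + k by push_cast; ring]
    exact ih.mul h

theorem zero : IsLevelOne k 0 0 := ⟨0, LevelOne.qExpansion_zero, rfl⟩

theorem sum {ι : Type*} (s : Finset ι) {ψ : ι → PowerSeries ℂ} {u : ι → ℍ → ℂ}
    (h : ∀ i ∈ s, IsLevelOne k (ψ i) (u i)) : IsLevelOne k (∑ i ∈ s, ψ i) (∑ i ∈ s, u i) := by
  classical
  induction s using Finset.induction_on with
  | empty => simpa using zero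
  | insert i s hi ih =>
    rw [Finset.sum_insert hi, Finset.sum_insert hi]
    exact (h i (Finset.mem_insert_self i s)).add (ih fun j hj => h j (Finset.mem_insert_of_mem hj))

theorem eq_zero_iff (h : IsLevelOne k ψ u) : ψ = 0 ↔ u = 0 := by
  obtain ⟨F, rfl, rfl⟩ := h
  rw [ModularForm.qExpansion_eq_zero_iff one_pos one_mem_strictPeriods_SL]
  exact DFunLike.coe_injective.eq_iff' rfl |>.symm

theorem hasSum (h : IsLevelOne k ψ u) (τ : ℍ) :
    HasSum (fun n => PowerSeries.coeff n ψ • qParam 1 (τ : ℂ) ^ n) (u τ) := by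
  obtain ⟨F, rfl, rfl⟩ := h
  exact ModularForm.hasSum_qExpansion F one_pos one_mem_strictPeriods_SL τ

theorem smul_apply (h : IsLevelOne k ψ u) (γ : SL(2, ℤ)) (τ : ℍ) :
    u (γ • τ) = UpperHalfPlane.denom γ τ ^ k * u τ := by
  obtain ⟨F, -, rfl⟩ := h
  have hγ : (γ : GL (Fin 2) ℝ) ∈ 𝒮ℒ := ⟨γ, rfl⟩
  exact SlashInvariantForm.slash_action_eqn'' F hγ τ

theorem inv_apply (h : IsLevelOne k ψ u) (n : ℕ) (τ : ℍ) :
    u (ModularGroup.S • ModularGroup.T ^ n • τ) = ((τ : ℂ) + n) ^ k * u τ := by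
  have hT : ((ModularGroup.T ^ n • τ : ℍ) : ℂ) = τ + n := by
    rw [← zpow_natCast, UpperHalfPlane.modular_T_zpow_smul, UpperHalfPlane.coe_vadd]
    push_cast
    ring
  have hTu : u (ModularGroup.T ^ n • τ) = u τ := by
    rw [h.smul_apply, ← zpow_natCast, ModularGroup.denom_apply, ModularGroup.coe_T_zpow]
    simp
  rw [h.smul_apply, ModularGroup.denom_S, hT, hTu]

theorem e4 : IsLevelOne 4 e4 ModularForm.E₄ := ⟨ModularForm.E₄, rfl, rfl⟩

theorem e6 : IsLevelOne 6 e6 ModularForm.E₆ := ⟨ModularForm.E₆, rfl, rfl⟩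

end IsLevelOne

theorem E6_I : ModularForm.E₆ UpperHalfPlane.I = 0 := by
  have h := IsLevelOne.e6.inv_apply 0 UpperHalfPlane.I
  have hI : ModularGroup.S • UpperHalfPlane.I = UpperHalfPlane.I := by
    rw [UpperHalfPlane.modular_S_smul]
    ext
    simp
  rw [pow_zero, one_smul, hI] at h
  simp at h
  linear_combination h / 2

theorem E4_I : ModularForm.E₄ UpperHalfPlane.I ≠ 0 := fun h => by
  have := ModularForm.discriminant_eq_E₄_cube_sub_E₆_sq UpperHalfPlane.I
  rw [h, E6_I] at this
  exact ModularForm.discriminant_ne_zero _ (by simpa using this)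

/-- Forms of different weights are linearly independent. -/
theorem sum_weight_eq_zero {ι : Type*} (s : Finset ι) {wt : ι → ℕ} {ψ : ι → PowerSeries ℂ} {u : ι → ℍ → ℂ}
    (h : ∀ i ∈ s, IsLevelOne (wt i) (ψ i) (u i)) (h0 : ∑ i ∈ s, ψ i = 0) (k : ℕ) :
    ∑ i ∈ s with wt i = k, ψ i = 0 := by
  have hu : ∀ τ, ∑ i ∈ s, u i τ = 0 := fun τ => by
    have h1 := hasSum_sum (fun i hi => (h i hi).hasSum τ)
    refine h1.unique ?_
    convert hasSum_zero using 2 with n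
    rw [← Finset.sum_smul, ← map_sum, h0, map_zero, zero_smul]
  have hk : IsLevelOne k (∑ i ∈ s with wt i = k, ψ i) (∑ i ∈ s with wt i = k, u i) :=
    IsLevelOne.sum _ fun i hi => by
      have hi' := Finset.mem_filter.1 hi
      rw [← hi'.2]
      exact h i hi'.1
  rw [hk.eq_zero_iff]
  funext τ
  set P : Polynomial ℂ := ∑ i ∈ s, Polynomial.C (u i τ) * Polynomial.X ^ wt i with hP
  have hroot : ∀ n : ℕ, P.IsRoot ((τ : ℂ) + n) := fun n => by
    have := hu (ModularGroup.S • ModularGroup.T ^ n • τ)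
    rw [Polynomial.IsRoot, hP, Polynomial.eval_finsetSum]
    refine Eq.trans (Finset.sum_congr rfl fun i hi => ?_) this
    rw [(h i hi).inv_apply, Polynomial.eval_mul, Polynomial.eval_C, Polynomial.eval_pow,
      Polynomial.eval_X, zpow_natCast, mul_comm]
  have hP0 : P = 0 := by
    refine Polynomial.eq_zero_of_infinite_isRoot P (Set.infinite_of_injective_forall_mem
      (f := fun n : ℕ => (τ : ℂ) + n) (fun a b hab => ?_) hroot)
    exact Nat.cast_injective (add_left_cancel hab)
  have := congrArg (fun p => Polynomial.coeff p k) hP0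
  simp only [hP, Polynomial.finsetSum_coeff, Polynomial.coeff_C_mul, Polynomial.coeff_X_pow,
    Polynomial.coeff_zero] at this
  rw [Finset.sum_apply, Finset.sum_filter, Pi.zero_apply]
  refine Eq.trans (Finset.sum_congr rfl fun i _ => ?_) this
  simp [eq_comm (a := k)]

theorem isLevelOne_monomial (i j : ℕ) :
    IsLevelOne ((4 * i + 6 * j : ℕ) : ℤ) (e4 ^ i * e6 ^ j)
      ((ModularForm.E₄ : ℍ → ℂ) ^ i * (ModularForm.E₆ : ℍ → ℂ) ^ j) := by
  have := (IsLevelOne.e4.pow i).mul (IsLevelOne.e6.pow j)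
  convert this using 1
  push_cast
  ring

theorem e6_ne_zero : e6 ≠ 0 := fun h => by
  have := coeff_zero_e6
  rw [h, map_zero] at this
  exact zero_ne_one this

/-- The power series of the Eisenstein series of weights 4 and 6 are algebraically independent. -/
theorem e4_e6_independent (s : Finset (ℕ × ℕ)) {a : ℕ × ℕ → ℂ}
    (h : ∑ p ∈ s, a p • (e4 ^ p.1 * e6 ^ p.2) = 0) : ∀ p ∈ s, a p = 0 := by
  by_contra! hne
  obtain ⟨p0, hp0, hap0⟩ := hne
  have hk := sum_weight_eq_zero s (wt := fun p => 4 * p.1 + 6 * p.2)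
    (fun p _ => (isLevelOne_monomial p.1 p.2).smul (a p)) h (4 * p0.1 + 6 * p0.2)
  set t := (s.filter fun p => 4 * p.1 + 6 * p.2 = 4 * p0.1 + 6 * p0.2) with ht
  have htne : (t.filter fun p => a p ≠ 0).Nonempty := ⟨p0, by simp [ht, hp0, hap0]⟩
  obtain ⟨q, hq, hmin⟩ := Finset.exists_min_image _ (fun p => p.2) htne
  have hq' := Finset.mem_filter.1 hq
  have hfac : ∑ p ∈ t with a p ≠ 0, a p • (e4 ^ p.1 * e6 ^ p.2)
      = e6 ^ q.2 * ∑ p ∈ t with a p ≠ 0, a p • (e4 ^ p.1 * e6 ^ (p.2 - q.2)) := by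
    rw [Finset.mul_sum]
    refine Finset.sum_congr rfl fun p hp => ?_
    conv_lhs => rw [← Nat.sub_add_cancel (hmin p hp), pow_add]
    rw [mul_smul_comm]
    congr 1
    ring
  have hz : ∑ p ∈ t with a p ≠ 0, a p • (e4 ^ p.1 * e6 ^ (p.2 - q.2)) = 0 := by
    have h1 : ∑ p ∈ t with a p ≠ 0, a p • (e4 ^ p.1 * e6 ^ p.2) = 0 := by
      rw [Finset.sum_filter]
      refine Eq.trans (Finset.sum_congr rfl fun p _ => ?_) hk
      by_cases hp : a p = 0 <;> simp [hp]
    rw [hfac] at h1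
    exact (mul_eq_zero.1 h1).resolve_left (pow_ne_zero _ e6_ne_zero)
  have hL : IsLevelOne ((4 * q.1 : ℕ) : ℤ) (∑ p ∈ t with a p ≠ 0, a p • (e4 ^ p.1 * e6 ^ (p.2 - q.2)))
      (∑ p ∈ t with a p ≠ 0, a p •
        ((ModularForm.E₄ : ℍ → ℂ) ^ p.1 * (ModularForm.E₆ : ℍ → ℂ) ^ (p.2 - q.2))) := by
    refine IsLevelOne.sum _ fun p hp => ?_
    have hpq := hmin p hp
    have h1 := (Finset.mem_filter.1 (Finset.mem_filter.1 hp).1).2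
    have h2 := (Finset.mem_filter.1 hq'.1).2
    convert (isLevelOne_monomial p.1 (p.2 - q.2)).smul (a p) using 2
    omega
  have hev := congrFun (hL.eq_zero_iff.1 hz) UpperHalfPlane.I
  rw [Finset.sum_apply, Finset.sum_eq_single q] at hev
  · simp [E4_I] at hev
    exact hq'.2 hev
  · intro p hp hpq
    have h1 := (Finset.mem_filter.1 (Finset.mem_filter.1 hp).1).2
    have h2 := (Finset.mem_filter.1 hq'.1).2
    have h3 := hmin p hp
    have : p.2 - q.2 ≠ 0 := fun h0 => hpq (Prod.ext (by omega) (by omega))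
    simp [E6_I, this]
  · exact fun h => absurd hq h


theorem LeadV.mono {d J J' : ℕ} {f : Pt (d + 1) → ℂ} {g : Pt d → ℂ} (h : LeadV J' f g) (hJ : J < J') :
    LeadV J f 0 := fun w hw => by
  have h1 : Tendsto (fun p : ℂ × Pt d => (2 * Real.pi * I * p.1) ^ (J' - J)) (𝓝[≠] 0 ×ˢ 𝓝 w) (𝓝 0) := by
    have : Tendsto (fun v : ℂ => (2 * Real.pi * I * v) ^ (J' - J)) (𝓝[≠] 0) (𝓝 0) := by
      have hc : Continuous (fun v : ℂ => (2 * Real.pi * I * v) ^ (J' - J)) := by fun_prop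
      have := hc.tendsto 0
      rw [mul_zero, zero_pow (by omega)] at this
      exact this.mono_left nhdsWithin_le_nhds
    exact this.comp tendsto_fst
  have h2 := (h w hw).mul h1
  rw [mul_zero] at h2
  refine h2.congr' ?_
  have : ∀ᶠ p : ℂ × Pt d in 𝓝[≠] 0 ×ˢ 𝓝 w, p.1 ≠ 0 :=
    tendsto_fst.eventually (eventually_mem_nhdsWithin)
  filter_upwards [this] with p hp
  have hp' : 2 * Real.pi * I * p.1 ≠ 0 := mul_ne_zero (by simp [Real.pi_ne_zero]) hp
  rw [div_mul_eq_mul_div, div_eq_div_iff (pow_ne_zero _ hp') (pow_ne_zero _ hp'), mul_assoc, ← pow_add,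
    show J' - J + J = J' by omega]

namespace Lead3
variable {J B C : ℕ} {f : Pt 2 → ℂ} {ψ : PowerSeries ℂ}

theorem zero' : Lead3 J B C 0 0 := by
  have h : ∀ {d J}, LeadV J (0 : Pt (d + 1) → ℂ) (0 : Pt d → ℂ) := fun {d J} w _ => by
    simp
  exact ⟨0, 0, 0, h, h, IsExp.zero, fun _ _ => rfl, rfl⟩

theorem mono {J' B' C' : ℕ} (h : Lead3 J' B' C' f ψ)
    (hlt : toLex (J, toLex (B, C)) < toLex (J', toLex (B', C'))) : Lead3 J B C f 0 := by
  obtain ⟨g, h, c, h1, h2, h3, h4, h5⟩ := h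
  have hz : ∀ {d J}, LeadV J (0 : Pt (d + 1) → ℂ) (0 : Pt d → ℂ) := fun {d J} w _ => by
    simp
  rw [Prod.Lex.toLex_lt_toLex] at hlt
  obtain hJ | ⟨rfl, hlt⟩ := hlt
  · exact ⟨0, 0, 0, h1.mono hJ, hz, IsExp.zero, fun _ _ => rfl, rfl⟩
  obtain hB | ⟨rfl, hC⟩ := Prod.Lex.toLex_lt_toLex.1 hlt
  · exact ⟨g, 0, 0, h1, h2.mono hB, IsExp.zero, fun _ _ => rfl, rfl⟩
  · exact ⟨g, h, c, h1, h2, h3, fun m hm => h4 m (hm.trans hC), h4 C hC⟩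

theorem eq_zero (h : Lead3 J B C f ψ) (hf : ∀ w ∈ Dom 2, f w = 0) : ψ = 0 := by
  obtain ⟨g, h, c, h1, h2, h3, h4, rfl⟩ := h
  have hm : ∀ {d} (J : ℕ), mom (0 : Idx (d + 1) → ℂ) J = 0 := fun {d} J => by
    funext y
    simp [mom]
  have hf0 : IsExp f 0 := IsExp.zero.congr fun w hw => by simp [hf w hw]
  have hg := hf0.leadV h1
  simp only [hm, Pi.zero_apply, zero_div] at hg
  have hh := IsExp.leadV (c := 0) hg h2
  simp only [hm, Pi.zero_apply, zero_div] at hh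
  rw [h3.unique hh]
  ext
  simp [row]

theorem sum {ι : Type*} (s : Finset ι) {f : ι → Pt 2 → ℂ} {ψ : ι → PowerSeries ℂ}
    (h : ∀ i ∈ s, Lead3 J B C (f i) (ψ i)) : Lead3 J B C (∑ i ∈ s, f i) (∑ i ∈ s, ψ i) := by
  classical
  induction s using Finset.induction_on with
  | empty => simpa using zero'
  | insert i s hi ih =>
    rw [Finset.sum_insert hi, Finset.sum_insert hi]
    exact (h i (Finset.mem_insert_self i s)).add (ih fun j hj => h j (Finset.mem_insert_of_mem hj))

end Lead3

/-- The leading exponents of a monomial in the generators. -/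
def lexDeg (s : Fin 5 →₀ ℕ) : ℕ ×ₗ ℕ ×ₗ ℕ :=
  toLex (2 * s 2, toLex (2 * s 2 + 2 * s 3, s 2 + s 3 + s 4))

theorem GenSystem.lead_monomial {R : Subring ℂ} {v : Pt 2 → Fin 5 → ℂ} (S : GenSystem R v)
    (s : Fin 5 →₀ ℕ) :
    Lead3 (2 * s 2) (2 * s 2 + 2 * s 3) (s 2 + s 3 + s 4) (fun w => ∏ i, v w i ^ s i)
      (((6 : ℂ) ^ s 3 * 12 ^ s 4) • (e4 ^ s 0 * e6 ^ s 1) * dq ^ (s 2 + s 3 + s 4)) := by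
  have := ((((S.l0.pow (s 0)).mul (S.l1.pow (s 1))).mul (S.l2.pow (s 2))).mul (S.l3.pow (s 3))).mul
    (S.l4.pow (s 4))
  convert this using 1
  · ring
  · ring
  · ring
  · funext w
    simp [Fin.prod_univ_five]
  · rw [smul_pow, smul_pow]
    simp only [mul_smul_comm, smul_mul_assoc, smul_smul]
    rw [mul_comm ((12 : ℂ) ^ s 4)]
    congr 1
    ring

theorem dq_ne_zero : dq ≠ 0 := fun h => by
  have := coeff_one_dq
  rw [h, map_zero] at this
  exact zero_ne_one this

theorem GenSystem.independent {R : Subring ℂ} {v : Pt 2 → Fin 5 → ℂ} (S : GenSystem R v)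
    (P : MvPolynomial (Fin 5) ℂ) (hP : ∀ w ∈ Dom 2, MvPolynomial.eval (v w) P = 0) : P = 0 := by
  classical
  by_contra hne
  obtain ⟨s0, hs0, hmin⟩ := Finset.exists_min_image P.support lexDeg
    (Finset.nonempty_iff_ne_empty.2 fun h => hne (MvPolynomial.support_eq_empty.1 h))
  set C := s0 2 + s0 3 + s0 4 with hC
  have hterm : ∀ s ∈ P.support, Lead3 (2 * s0 2) (2 * s0 2 + 2 * s0 3) C
      (P.coeff s • fun w => ∏ i, v w i ^ s i)
      (if lexDeg s = lexDeg s0 then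
        (P.coeff s * (6 ^ s0 3 * 12 ^ s0 4)) • (e4 ^ s 0 * e6 ^ s 1) * dq ^ C else 0) := by
    intro s hs
    have h := (S.lead_monomial s).smul (P.coeff s)
    split_ifs with heq
    · have h1 := congrArg (fun x => (ofLex x).1) heq
      have h2 := congrArg (fun x => (ofLex (ofLex x).2).1) heq
      have h3 := congrArg (fun x => (ofLex (ofLex x).2).2) heq
      simp only [lexDeg, ofLex_toLex] at h1 h2 h3
      rw [h2, h1, h3, show s 3 = s0 3 by omega, show s 4 = s0 4 by omega] at h
      rwa [← smul_mul_assoc, smul_smul] at h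
    · exact h.mono (lt_of_le_of_ne (hmin s hs) (Ne.symm heq))
  have hsum := (Lead3.sum _ hterm).eq_zero fun w hw => by
    have := hP w hw
    rw [MvPolynomial.eval_eq'] at this
    simpa [Finset.sum_apply] using this
  rw [← Finset.sum_filter, ← Finset.sum_mul] at hsum
  have h0 := (mul_eq_zero.1 hsum).resolve_right (pow_ne_zero _ dq_ne_zero)
  set t := P.support.filter fun s => lexDeg s = lexDeg s0 with ht
  have hinj : Set.InjOn (fun s : Fin 5 →₀ ℕ => (s 0, s 1)) t := by
    intro s hs s' hs' h
    have hs1 := (Finset.mem_filter.1 hs).2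
    have hs2 := (Finset.mem_filter.1 hs').2
    rw [← hs2] at hs1
    have h1 := congrArg (fun x => (ofLex x).1) hs1
    have h2 := congrArg (fun x => (ofLex (ofLex x).2).1) hs1
    have h3 := congrArg (fun x => (ofLex (ofLex x).2).2) hs1
    simp only [lexDeg, ofLex_toLex] at h1 h2 h3
    simp only [Prod.mk.injEq] at h
    ext i
    fin_cases i <;> simp <;> omega
  have h1 := e4_e6_independent (t.image fun s => (s 0, s 1))
    (a := fun p => ∑ s ∈ t with (s 0, s 1) = p, P.coeff s * (6 ^ s0 3 * 12 ^ s0 4)) (by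
      rw [Finset.sum_image hinj, ← h0]
      refine Finset.sum_congr rfl fun s hs => ?_
      congr 1
      rw [Finset.sum_eq_single s]
      · intro s' hs' hne
        exact absurd (hinj (Finset.mem_filter.1 hs').1 hs (Finset.mem_filter.1 hs').2) hne
      · intro h
        simp [hs] at h) (s0 0, s0 1) (Finset.mem_image_of_mem _ (by simp [ht, hs0]))
  rw [Finset.sum_eq_single s0] at h1
  · have h2 := MvPolynomial.mem_support_iff.1 hs0
    simp [h2] at h1
  · intro s' hs' hne
    exact absurd (hinj (Finset.mem_filter.1 hs').1 (Finset.mem_filter.2 ⟨hs0, rfl⟩) (Finset.mem_filter.1 hs').2) hne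
  · intro h
    simp [ht, hs0] at h

end HermMod

namespace HermMod
open Filter Topology

/-- Grouping a family of exponentials by their exponents gives a Fourier expansion. -/
theorem isExp_of_family {d : ℕ} {ι : Type*} {s : ι → ℂ} {idx : ι → Idx d} {f : Pt d → ℂ}
    (hs : ∀ i, s i ≠ 0 → idx i ∈ cone d)
    (hf : ∀ w ∈ Dom d, HasSum (fun i => s i * ex (idx i) w) (f w)) :
    IsExp f (fun x => ∑' i : idx ⁻¹' {x}, s i) := by
  refine ⟨fun x hx => ?_, fun w hw => ?_⟩
  · obtain ⟨i, hi⟩ : ∃ i : idx ⁻¹' {x}, s i ≠ 0 := by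
      by_contra! h
      exact hx (by simp [h])
    have h2 : idx i = x := i.2
    rw [← h2]
    exact hs _ hi
  · refine ((hf w hw).tsum_fiberwise idx).congr_fun fun x => ?_
    rw [← tsum_mul_right]
    refine tsum_congr fun i => ?_
    have h2 : idx i = x := i.2
    rw [h2]

theorem tsum_mem_of_finite {ι : Type*} {R : Subring ℂ} {s : ι → ℂ} {t : Set ι} (ht : t.Finite)
    (hs : ∀ i, s i ∈ R) : ∑' i : t, s i ∈ R := by
  have := ht.fintype
  rw [tsum_fintype]
  exact sum_mem fun i _ => hs i

/-- Restriction to real values of the elliptic coordinates. -/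
theorem IsExp.spec {d : ℕ} {f : Pt d → ℂ} {c : Idx d → ℂ} (h : IsExp f c) (u : Fin d → ℝ) :
    IsExp (fun w : Pt 0 => f (w.1, w.2.1, fun i => (u i : ℂ)))
      (fun y => ∑' x : (fun x : Idx d => ((x.1, x.2.1, 0) : Idx 0)) ⁻¹' {y},
        c x * cexp (2 * Real.pi * I * ∑ i, ((x : Idx d).2.2 i) * (u i : ℂ))) := by
  refine isExp_of_family (s := fun x : Idx d => c x * cexp (2 * Real.pi * I * ∑ i, (x.2.2 i) * (u i : ℂ)))
    (fun x _ => mem_cone_zero _) fun w hw => ?_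
  refine (h.hasSum (w.1, w.2.1, fun i => (u i : ℂ)) ?_).congr_fun fun x => ?_
  · simpa [Dom] using hw
  · rw [mul_assoc, ex, ex, ← Complex.exp_add]
    congr 2
    simp
    ring

theorem Dom.smul {d : ℕ} {w : Pt d} (hw : w ∈ Dom d) {t : ℝ} (ht : 0 < t) : (t : ℂ) • w ∈ Dom d := by
  obtain ⟨h1, h2, h3⟩ := hw
  refine ⟨by simpa using mul_pos ht h1, by simpa using mul_pos ht h2, ?_⟩
  simp only [Prod.smul_fst, Prod.smul_snd, Pi.smul_apply, smul_eq_mul, im_ofReal_mul, mul_pow,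
    ← Finset.mul_sum]
  nlinarith [mul_lt_mul_of_pos_left h3 (mul_pos ht ht)]

theorem Dom.natCast_smul {d : ℕ} {w : Pt d} (hw : w ∈ Dom d) {N : ℕ} (hN : 0 < N) :
    (N : ℂ) • w ∈ Dom d := by
  simpa using Dom.smul hw (t := N) (by positivity)

theorem Dom.natCast_inv_smul {d : ℕ} {w : Pt d} (hw : w ∈ Dom d) {N : ℕ} (hN : 0 < N) :
    (N : ℂ)⁻¹ • w ∈ Dom d := by
  simpa using Dom.smul hw (t := (N : ℝ)⁻¹) (by positivity)

theorem ex_nsmul {d : ℕ} (N : ℕ) (x : Idx d) (w : Pt d) : ex (N • x) w = ex x ((N : ℂ) • w) := by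
  rw [ex, ex]
  congr 2
  simp
  congr 1
  · ring_nf
  · exact Finset.sum_congr rfl fun i _ => by ring

theorem nsmul_injective_idx {d N : ℕ} (hN : 0 < N) : Function.Injective (fun x : Idx d => N • x) := by
  intro x y h
  simp only [Prod.ext_iff, funext_iff, Prod.smul_fst, Prod.smul_snd, Pi.smul_apply] at h
  simp only [smul_eq_mul, nsmul_eq_mul] at h
  refine Prod.ext (Nat.eq_of_mul_eq_mul_left hN h.1) (Prod.ext (Nat.eq_of_mul_eq_mul_left hN h.2.1)
    (funext fun i => ?_))
  exact mul_left_cancel₀ (by exact_mod_cast hN.ne') (h.2.2 i)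

theorem nsmul_mem_cone {d N : ℕ} (hN : 0 < N) {x : Idx d} : N • x ∈ cone d ↔ x ∈ cone d := by
  rw [mem_cone, mem_cone]
  simp only [Prod.smul_fst, Prod.smul_snd, Pi.smul_apply]
  simp only [smul_eq_mul, nsmul_eq_mul, mul_pow, ← Finset.mul_sum]
  push_cast
  rw [show 4 * ((N : ℤ) * x.1) * (N * x.2.1) = N ^ 2 * (4 * x.1 * x.2.1) by ring]
  exact mul_le_mul_iff_right₀ (by positivity)

theorem IsExp.dilate {d N : ℕ} (hN : 0 < N) {f : Pt d → ℂ} {c : Idx d → ℂ} (h : IsExp f c) :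
    IsExp (fun w => f ((N : ℂ) • w)) (Function.extend (fun x => N • x) c 0) := by
  have hi := nsmul_injective_idx (d := d) hN
  refine ⟨fun y hy => ?_, fun w hw => ?_⟩
  · by_cases hx : ∃ x, N • x = y
    · obtain ⟨x, rfl⟩ := hx
      rw [hi.extend_apply] at hy
      exact (nsmul_mem_cone hN).2 (h.supp x hy)
    · exact absurd (Function.extend_apply' _ _ _ hx) hy
  · rw [← Function.Injective.hasSum_iff hi]
    · refine (h.hasSum _ (Dom.natCast_smul hw hN)).congr_fun fun x => ?_
      simp only [Function.comp_apply]
      rw [hi.extend_apply, ex_nsmul]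
    · intro y hy
      rw [Function.extend_apply' _ _ _ (by simpa using hy)]
      simp

theorem dvd_of_exp_eq_one {N : ℕ} (hN : 0 < N) {n : ℤ} (h : cexp (2 * Real.pi * I * (n * (N : ℂ)⁻¹)) = 1) :
    (N : ℤ) ∣ n := by
  obtain ⟨k, hk⟩ := Complex.exp_eq_one_iff.1 h
  have hN' : (N : ℂ) ≠ 0 := by exact_mod_cast hN.ne'
  have h2 : (n : ℂ) * (N : ℂ)⁻¹ = k := by
    have := Complex.two_pi_I_ne_zero
    refine mul_left_cancel₀ this ?_
    rw [hk]
    ring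
  refine ⟨k, ?_⟩
  have : (n : ℂ) = N * k := by
    rw [← h2]
    field_simp
  exact_mod_cast this

theorem IsExp.ex_shift_eq_one {d : ℕ} {f : Pt d → ℂ} {c : Idx d → ℂ} (h : IsExp f c) (s t : ℝ)
    (u : Fin d → ℝ) (hper : ∀ w ∈ Dom d, f (w + ((s : ℂ), (t : ℂ), fun i => (u i : ℂ))) = f w) {x : Idx d}
    (hx : c x ≠ 0) : ex x ((s : ℂ), (t : ℂ), fun i => (u i : ℂ)) = 1 := by
  have h2 : IsExp f (fun x => c x * ex x ((s : ℂ), (t : ℂ), fun i => (u i : ℂ))) := by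
    refine ⟨fun y hy => h.supp y (left_ne_zero_of_mul hy), fun w hw => ?_⟩
    rw [← hper w hw]
    refine (h.hasSum _ (Dom.shift hw s t u)).congr_fun fun y => ?_
    rw [ex_shift]
    ring
  have := congrFun (h.unique h2) x
  exact mul_left_cancel₀ hx (by simpa using this.symm)

theorem IsExp.undilate {d N : ℕ} (hN : 0 < N) {f : Pt d → ℂ} {c : Idx d → ℂ}
    (h : IsExp (fun w => f ((N : ℂ) • w)) c) (h1 : ∀ w ∈ Dom d, f (w + (1, 0, 0)) = f w)
    (h2 : ∀ w ∈ Dom d, f (w + (0, 1, 0)) = f w)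
    (h3 : ∀ i, ∀ w ∈ Dom d, f (w + (0, 0, Pi.single i 1)) = f w) :
    IsExp f (fun x => c (N • x)) := by
  have hN' : (N : ℂ) ≠ 0 := by exact_mod_cast hN.ne'
  have key : ∀ x, c x ≠ 0 → ∃ y, N • y = x := fun x hx => by
    have e1 := h.ex_shift_eq_one (N : ℝ)⁻¹ 0 0 (fun w hw => by
      convert h1 _ (Dom.natCast_smul hw hN) using 2
      rw [smul_add]
      congr 1
      ext <;> simp [hN']) hx
    have e2 := h.ex_shift_eq_one 0 (N : ℝ)⁻¹ 0 (fun w hw => by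
      convert h2 _ (Dom.natCast_smul hw hN) using 2
      rw [smul_add]
      congr 1
      ext <;> simp [hN']) hx
    have e3 := fun i => h.ex_shift_eq_one 0 0 (Pi.single i (N : ℝ)⁻¹) (fun w hw => by
      convert h3 i _ (Dom.natCast_smul hw hN) using 2
      rw [smul_add]
      congr 1
      ext j
      · simp
      · simp
      · by_cases hj : j = i
        · subst hj; simp [hN']
        · simp [hj]) hx
    obtain ⟨a, ha⟩ := dvd_of_exp_eq_one hN (n := x.1) (by simpa [ex] using e1)
    obtain ⟨b, hb⟩ := dvd_of_exp_eq_one hN (n := x.2.1) (by simpa [ex] using e2)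
    have h4 : ∀ i, ∃ t, x.2.2 i = N * t := fun i => by
      refine dvd_of_exp_eq_one hN (n := x.2.2 i) ?_
      have := e3 i
      rw [ex, Finset.sum_eq_single i (fun j _ hj => by simp [hj]) (by simp)] at this
      simpa using this
    choose t ht using h4
    have hN0 : (0 : ℤ) < N := by exact_mod_cast hN
    have ha0 : 0 ≤ a := by
      by_contra! hlt
      nlinarith [mul_neg_of_pos_of_neg hN0 hlt, Int.natCast_nonneg x.1]
    have hb0 : 0 ≤ b := by
      by_contra! hlt
      nlinarith [mul_neg_of_pos_of_neg hN0 hlt, Int.natCast_nonneg x.2.1]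
    lift a to ℕ using ha0
    lift b to ℕ using hb0
    refine ⟨(a, b, t), ?_⟩
    refine Prod.ext ?_ (Prod.ext ?_ (funext fun i => ?_))
    · simp only [Prod.smul_fst, smul_eq_mul]; exact_mod_cast ha.symm
    · simp only [Prod.smul_snd, Prod.smul_fst, smul_eq_mul]; exact_mod_cast hb.symm
    · simp [ht]
  refine ⟨fun x hx => (nsmul_mem_cone hN).1 (h.supp _ hx), fun w hw => ?_⟩
  have hw' := Dom.natCast_inv_smul hw hN
  have := h.hasSum _ hw'
  rw [smul_inv_smul₀ hN', ← Function.Injective.hasSum_iff (nsmul_injective_idx hN)] at this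
  · refine this.congr_fun fun x => ?_
    simp only [Function.comp_apply]
    rw [ex_nsmul, smul_inv_smul₀ hN']
  · intro y hy
    by_cases h0 : c y = 0
    · simp [h0]
    · exact absurd (key y h0) (by simpa using hy)

/-- The linear form in the exponent of `ex x`. -/
def exLin {d : ℕ} (x : Idx d) : Pt d →L[ℂ] ℂ :=
  (2 * Real.pi * I : ℂ) • ((x.1 : ℂ) • ContinuousLinearMap.fst ℂ ℂ (ℂ × (Fin d → ℂ)) +
    (x.2.1 : ℂ) • (ContinuousLinearMap.fst ℂ ℂ (Fin d → ℂ)).comp (ContinuousLinearMap.snd ℂ ℂ _) +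
    ∑ i, (x.2.2 i : ℂ) • ((ContinuousLinearMap.proj i : (Fin d → ℂ) →L[ℂ] ℂ).comp
      (ContinuousLinearMap.snd ℂ ℂ (Fin d → ℂ))).comp (ContinuousLinearMap.snd ℂ ℂ _))

theorem exLin_apply {d : ℕ} (x : Idx d) (w : Pt d) :
    exLin x w = 2 * Real.pi * I * (x.1 * w.1 + x.2.1 * w.2.1 + ∑ i, x.2.2 i * w.2.2 i) := by
  simp [exLin]
  ring

theorem hasFDerivAt_ex {d : ℕ} (x : Idx d) (w : Pt d) : HasFDerivAt (ex x) (ex x w • exLin x) w := by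
  have h := ((exLin x).hasFDerivAt (x := w)).cexp
  simp only [exLin_apply] at h
  exact h

theorem norm_exLin_le {d : ℕ} {x : Idx d} (hx : ∀ i, |x.2.2 i| ≤ x.1 + x.2.1) :
    ‖exLin x‖ ≤ 2 * Real.pi * (d + 2) * (x.1 + x.2.1) := by
  refine ContinuousLinearMap.opNorm_le_bound _ (by positivity) fun w => ?_
  rw [exLin_apply, norm_mul]
  have e : ‖(2 * Real.pi * I : ℂ)‖ = 2 * Real.pi := by
    simp [abs_of_pos Real.pi_pos]
  rw [e, mul_assoc (2 * Real.pi), mul_assoc (2 * Real.pi)]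
  refine mul_le_mul_of_nonneg_left ?_ (by positivity)
  have h1 : ‖w.1‖ ≤ ‖w‖ := norm_fst_le w
  have h2 : ‖w.2.1‖ ≤ ‖w‖ := (norm_fst_le w.2).trans (norm_snd_le w)
  have h3 : ∀ i, ‖w.2.2 i‖ ≤ ‖w‖ := fun i =>
    (norm_le_pi_norm _ i).trans ((norm_snd_le w.2).trans (norm_snd_le w))
  have h4 : ‖∑ i, (x.2.2 i : ℂ) * w.2.2 i‖ ≤ ∑ _i : Fin d, ((x.1 : ℝ) + x.2.1) * ‖w‖ := by
    refine (norm_sum_le _ _).trans (Finset.sum_le_sum fun i _ => ?_)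
    rw [norm_mul]
    refine mul_le_mul ?_ (h3 i) (norm_nonneg _) (by positivity)
    rw [Complex.norm_intCast]
    exact_mod_cast hx i
  have h5 : ‖(x.1 : ℂ) * w.1‖ ≤ x.1 * ‖w‖ := by
    rw [norm_mul, Complex.norm_natCast]
    gcongr
  have h6 : ‖(x.2.1 : ℂ) * w.2.1‖ ≤ x.2.1 * ‖w‖ := by
    rw [norm_mul, Complex.norm_natCast]
    gcongr
  refine (norm_add₃_le).trans ?_
  rw [Finset.sum_const, Finset.card_univ, Fintype.card_fin, nsmul_eq_mul] at h4
  have : 0 ≤ ((x.1 : ℝ) + x.2.1) * ‖w‖ := by positivity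
  linarith

/-- Fourier series are holomorphic. -/
theorem IsExp.differentiableOn {d : ℕ} {f : Pt d → ℂ} {c : Idx d → ℂ} (h : IsExp f c) :
    DifferentiableOn ℂ f (Dom d) := by
  intro w hw
  obtain ⟨r, hr, hs⟩ := h.summable_im hw
  obtain ⟨ε, hε, hball⟩ := Metric.isOpen_iff.1 (isOpen_Dom d) w hw
  set C : ℝ := 2 * Real.pi * (d + 2) with hC
  have hC0 : 0 < C := by positivity
  set δ := min ε (r / (2 * C)) with hδ
  have hδ0 : 0 < δ := lt_min hε (by positivity)
  have hx0 : ∀ x, c x ≠ 0 → ∀ i, |x.2.2 i| ≤ x.1 + x.2.1 := fun x hx i =>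
    abs_le_of_mem_cone (h.supp x hx) i
  have key : HasFDerivAt (fun y => ∑' x, c x * ex x y) (∑' x, c x • ex x w • exLin x) w := by
    refine hasFDerivAt_tsum_of_isPreconnected
      (u := fun x => C * (2 / r) * (‖c x * ex x w‖ * Real.exp (r * (x.1 + x.2.1))))
      (hs.mul_left _) (Metric.isOpen_ball (x := w) (ε := δ))
      (convex_ball w δ).isPreconnected (fun x y _ => (hasFDerivAt_ex x y).const_mul (c x))
      (fun x y hy => ?_) (Metric.mem_ball_self hδ0) (h.hasSum w hw).summable (Metric.mem_ball_self hδ0)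
    by_cases hc : c x = 0
    · simp [hc]
    have hx := hx0 x hc
    have e : ex x y = ex x w * ex x (y - w) := by
      rw [ex, ex, ex, ← Complex.exp_add]
      congr 1
      simp only [Prod.fst_sub, Prod.snd_sub, Pi.sub_apply, mul_sub, Finset.sum_sub_distrib]
      ring
    set t : ℝ := (x.1 : ℝ) + x.2.1 with ht
    have ht0 : 0 ≤ t := by positivity
    have hyw : ‖y - w‖ ≤ r / (2 * C) := by
      rw [← dist_eq_norm]
      exact (Metric.mem_ball.1 hy).le.trans (min_le_right _ _)
    have b1 : ‖ex x (y - w)‖ ≤ Real.exp (r / 2 * t) := by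
      refine (norm_ex_le hx _).trans (Real.exp_le_exp.2 ?_)
      refine mul_le_mul_of_nonneg_right ?_ ht0
      calc C * ‖y - w‖ ≤ C * (r / (2 * C)) := by gcongr
        _ = r / 2 := by field_simp
    have b2 : t ≤ 2 / r * Real.exp (r / 2 * t) := by
      have := Real.add_one_le_exp (r / 2 * t)
      calc t = 2 / r * (r / 2 * t) := by field_simp
        _ ≤ _ := by gcongr; linarith
    rw [norm_smul, norm_smul, e, norm_mul, norm_mul]
    calc ‖c x‖ * (‖ex x w‖ * ‖ex x (y - w)‖ * ‖exLin x‖)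
        ≤ ‖c x‖ * (‖ex x w‖ * Real.exp (r / 2 * t) * (C * (2 / r * Real.exp (r / 2 * t)))) := by
          gcongr
          exact (norm_exLin_le hx).trans (mul_le_mul_of_nonneg_left b2 hC0.le)
      _ = C * (2 / r) * (‖c x‖ * ‖ex x w‖ * (Real.exp (r / 2 * t) * Real.exp (r / 2 * t))) := by ring
      _ = _ := by
          rw [← Real.exp_add]
          congr 4
          ring
  refine (key.differentiableAt.congr_of_eventuallyEq ?_).differentiableWithinAt
  filter_upwards [(isOpen_Dom d).mem_nhds hw] with y hy
  exact (h.hasSum y hy).tsum_eq.symm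

end HermMod

namespace HermMod
open Filter Topology

theorem ex_norm_le_one {d : ℕ} {x : Idx d} (hx : x ∈ cone d) {w : Pt d} (hw : w ∈ Dom d) : ‖ex x w‖ ≤ 1 := by
  obtain ⟨h1, h2, h3⟩ := hw
  rw [mem_cone] at hx
  rw [ex, Complex.norm_exp, Real.exp_le_one_iff]
  have e : (2 * Real.pi * I * (x.1 * w.1 + x.2.1 * w.2.1 + ∑ i, x.2.2 i * w.2.2 i) : ℂ).re
      = -(2 * Real.pi * (x.1 * w.1.im + x.2.1 * w.2.1.im + ∑ i, x.2.2 i * (w.2.2 i).im)) := by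
    simp
  rw [e, neg_nonpos]
  refine mul_nonneg (by positivity) ?_
  have hx' : ∑ i, (x.2.2 i : ℝ) ^ 2 ≤ 4 * x.1 * x.2.1 := by exact_mod_cast hx
  have hc := Finset.sum_mul_sq_le_sq_mul_sq Finset.univ (fun i => (x.2.2 i : ℝ)) (fun i => (w.2.2 i).im)
  set S := ∑ i, (x.2.2 i : ℝ) * (w.2.2 i).im
  have h4 : S ^ 2 ≤ (x.1 * w.1.im + x.2.1 * w.2.1.im) ^ 2 := by
    have : S ^ 2 ≤ 4 * x.1 * x.2.1 * (w.1.im * w.2.1.im) :=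
      hc.trans (mul_le_mul hx' h3.le (Finset.sum_nonneg fun i _ => sq_nonneg _) (by positivity))
    nlinarith [sq_nonneg ((x.1 : ℝ) * w.1.im - x.2.1 * w.2.1.im)]
  have := sq_le_sq.1 h4
  rw [abs_of_nonneg (by positivity : (0:ℝ) ≤ x.1 * w.1.im + x.2.1 * w.2.1.im)] at this
  linarith [neg_abs_le S]

/-- The local factor of a theta characteristic. -/
def uc (μ σ X : ℤ) : ℂ := if 2 ∣ X - μ then I ^ (σ * X) else 0

/-- The coefficient of a theta series with characteristic `(μ₁, μ₂; σ₁, σ₂)`. -/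
def tc (μ₁ μ₂ σ₁ σ₂ : ℤ) (G : (ℤ × ℤ) × (ℤ × ℤ)) : ℂ :=
  uc μ₁ σ₁ G.1.1 * uc μ₁ σ₁ G.1.2 * (uc μ₂ σ₂ G.2.1 * uc μ₂ σ₂ G.2.2)

/-- The exponential in a Hermitian theta series. -/
def te (G : (ℤ × ℤ) × (ℤ × ℤ)) (w : Pt 2) : ℂ :=
  cexp (Real.pi * I / 4 * ((G.1.1 ^ 2 + G.1.2 ^ 2) * w.1 + (G.2.1 ^ 2 + G.2.2 ^ 2) * w.2.1 +
    2 * (G.1.1 * G.2.1 + G.1.2 * G.2.2) * w.2.2 1 - 2 * (G.1.1 * G.2.2 - G.1.2 * G.2.1) * w.2.2 0))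

/-- Hermitian theta constants for the Gaussian integers. -/
def theta (μ₁ μ₂ σ₁ σ₂ : ℤ) (w : Pt 2) : ℂ := ∑' G, tc μ₁ μ₂ σ₁ σ₂ G * te G w

theorem I_zpow_two_mul (n : ℤ) : (I : ℂ) ^ (2 * n) = (-1) ^ n := by
  rw [_root_.zpow_mul]
  norm_num

theorem I_zpow_four_mul (n : ℤ) : (I : ℂ) ^ (4 * n) = 1 := by
  rw [_root_.zpow_mul]
  norm_cast
  simp

theorem norm_uc_le (μ σ X : ℤ) : ‖uc μ σ X‖ ≤ 1 := by
  unfold uc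
  split_ifs <;> simp

theorem norm_tc_le (μ₁ μ₂ σ₁ σ₂ : ℤ) (G : (ℤ × ℤ) × (ℤ × ℤ)) : ‖tc μ₁ μ₂ σ₁ σ₂ G‖ ≤ 1 := by
  rw [tc, norm_mul, norm_mul, norm_mul]
  exact mul_le_one₀ (mul_le_one₀ (norm_uc_le _ _ _) (norm_nonneg _) (norm_uc_le _ _ _)) (by positivity)
    (mul_le_one₀ (norm_uc_le _ _ _) (norm_nonneg _) (norm_uc_le _ _ _))

/-- The exponent of `te` on the scale `1 / 8`. -/
def tidx (G : (ℤ × ℤ) × (ℤ × ℤ)) : Idx 2 :=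
  ((G.1.1 ^ 2 + G.1.2 ^ 2).toNat, (G.2.1 ^ 2 + G.2.2 ^ 2).toNat,
    ![-2 * (G.1.1 * G.2.2 - G.1.2 * G.2.1), 2 * (G.1.1 * G.2.1 + G.1.2 * G.2.2)])

theorem tidx_fst (G : (ℤ × ℤ) × (ℤ × ℤ)) : ((tidx G).1 : ℤ) = G.1.1 ^ 2 + G.1.2 ^ 2 :=
  Int.toNat_of_nonneg (by positivity)

theorem tidx_snd (G : (ℤ × ℤ) × (ℤ × ℤ)) : ((tidx G).2.1 : ℤ) = G.2.1 ^ 2 + G.2.2 ^ 2 :=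
  Int.toNat_of_nonneg (by positivity)

theorem tidx_mem_cone (G : (ℤ × ℤ) × (ℤ × ℤ)) : tidx G ∈ cone 2 := by
  rw [mem_cone, tidx_fst, tidx_snd, Fin.sum_univ_two]
  simp only [tidx, Matrix.cons_val_zero, Matrix.cons_val_one]
  apply le_of_eq
  ring

theorem te_eq_ex (G : (ℤ × ℤ) × (ℤ × ℤ)) (w : Pt 2) : te G w = ex (tidx G) ((8 : ℂ)⁻¹ • w) := by
  have h1 : ((tidx G).1 : ℂ) = G.1.1 ^ 2 + G.1.2 ^ 2 := by exact_mod_cast congrArg (Int.cast (R := ℂ)) (tidx_fst G)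
  have h2 : ((tidx G).2.1 : ℂ) = G.2.1 ^ 2 + G.2.2 ^ 2 := by exact_mod_cast congrArg (Int.cast (R := ℂ)) (tidx_snd G)
  rw [te, ex, h1, h2, Fin.sum_univ_two]
  congr 1
  simp [tidx]
  ring

theorem summable_gauss {r : ℝ} (hr : 0 < r) : Summable fun n : ℤ => Real.exp (-r * n ^ 2) := by
  have h := ((summable_jacobiTheta₂_term_iff 0 (I * (r / Real.pi : ℝ))).2 (by simpa using div_pos hr Real.pi_pos)).norm
  refine h.congr fun n => ?_
  rw [jacobiTheta₂_term, Complex.norm_exp]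
  congr 1
  have : (2 * Real.pi * I * n * 0 + Real.pi * I * n ^ 2 * (I * (r / Real.pi : ℝ)) : ℂ) = ((-r * n ^ 2 : ℝ) : ℂ) := by
    have hpi : (Real.pi : ℂ) ≠ 0 := by exact_mod_cast Real.pi_ne_zero
    push_cast
    field_simp
    ring_nf
    simp
  rw [this, ofReal_re]

theorem summable_norm_te {w : Pt 2} (hw : w ∈ Dom 2) : Summable fun G => ‖te G w‖ := by
  obtain ⟨s, hs, hs'⟩ := exists_im_shift hw
  have h1 := summable_gauss (r := Real.pi / 4 * s) (by positivity)
  have h0 : ∀ n : ℤ, 0 ≤ Real.exp (-(Real.pi / 4 * s) * n ^ 2) := fun n => (Real.exp_pos _).le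
  have h2 := h1.mul_of_nonneg h1 h0 h0
  have h3 := h2.mul_of_nonneg h2 (fun G => mul_nonneg (h0 _) (h0 _)) (fun G => mul_nonneg (h0 _) (h0 _))
  refine h3.of_nonneg_of_le (fun _ => norm_nonneg _) fun G => ?_
  have hb := ex_norm_le_one (tidx_mem_cone G) (Dom.natCast_inv_smul hs' (N := 8) (by norm_num))
  simp only [Nat.cast_ofNat] at hb
  rw [← te_eq_ex] at hb
  have e : te G w = te G (w.1 - s * I, w.2.1 - s * I, w.2.2) *
      cexp ((-(Real.pi / 4 * s) * (G.1.1 ^ 2 + G.1.2 ^ 2 + G.2.1 ^ 2 + G.2.2 ^ 2) : ℝ)) := by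
    rw [te, te, ← Complex.exp_add]
    congr 1
    push_cast
    ring_nf
    rw [I_sq]
    ring
  rw [e, norm_mul, Complex.norm_exp_ofReal, ← Real.exp_add, ← Real.exp_add, ← Real.exp_add]
  refine (mul_le_of_le_one_left (Real.exp_pos _).le hb).trans (le_of_eq ?_)
  congr 1
  ring

theorem hasSum_theta (μ₁ μ₂ σ₁ σ₂ : ℤ) {w : Pt 2} (hw : w ∈ Dom 2) :
    HasSum (fun G => tc μ₁ μ₂ σ₁ σ₂ G * te G w) (theta μ₁ μ₂ σ₁ σ₂ w) := by
  refine Summable.hasSum ((summable_norm_te hw).of_norm_bounded fun G => ?_)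
  rw [norm_mul]
  exact mul_le_of_le_one_left (norm_nonneg _) (norm_tc_le _ _ _ _ _)

theorem uc_neg (μ σ X : ℤ) : uc μ σ (-X) = (-1) ^ (σ * μ) * uc μ σ X := by
  unfold uc
  by_cases h : (2 : ℤ) ∣ X - μ
  · rw [if_pos h, if_pos (by omega)]
    obtain ⟨k, hk⟩ := h
    obtain rfl : X = μ + 2 * k := by omega
    rw [← I_zpow_two_mul, ← zpow_add₀ I_ne_zero]
    rw [show σ * -(μ + 2 * k) = 2 * (σ * μ) + σ * (μ + 2 * k) + 4 * (-(σ * μ) - σ * k) by ring,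
      zpow_add₀ I_ne_zero, I_zpow_four_mul, mul_one]
  · rw [if_neg h, if_neg (by omega), mul_zero]

theorem neg_one_zpow_mul_self (n : ℤ) : ((-1 : ℂ)) ^ n * (-1) ^ n = 1 := by
  rw [← zpow_add₀ (by norm_num), ← two_mul, _root_.zpow_mul]
  norm_num

theorem theta_congr_equiv {μ₁ μ₂ σ₁ σ₂ μ₁' μ₂' σ₁' σ₂' : ℤ} {w w' : Pt 2} {a : ℂ}
    (e : (ℤ × ℤ) × (ℤ × ℤ) ≃ (ℤ × ℤ) × (ℤ × ℤ))
    (h : ∀ G, tc μ₁ μ₂ σ₁ σ₂ (e G) * te (e G) w = a * (tc μ₁' μ₂' σ₁' σ₂' G * te G w')) :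
    theta μ₁ μ₂ σ₁ σ₂ w = a * theta μ₁' μ₂' σ₁' σ₂' w' := by
  rw [theta, theta, ← e.tsum_eq, ← tsum_mul_left]
  exact tsum_congr h

theorem theta_swap (μ₁ μ₂ σ₁ σ₂ : ℤ) (w : Pt 2) :
    theta μ₁ μ₂ σ₁ σ₂ (swapPt w) = theta μ₂ μ₁ σ₂ σ₁ w := by
  rw [← one_mul (theta μ₂ μ₁ σ₂ σ₁ w)]
  refine theta_congr_equiv ⟨fun G => ((G.2.2, G.2.1), (G.1.2, G.1.1)), fun G => ((G.2.2, G.2.1), (G.1.2, G.1.1)),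
    fun _ => rfl, fun _ => rfl⟩ fun G => ?_
  simp only [Equiv.coe_fn_mk, tc, te, swapPt]
  rw [one_mul]
  congr 1
  · ring
  · congr 1
    ring

theorem theta_flip_zero (μ₁ μ₂ σ₁ σ₂ : ℤ) (w : Pt 2) :
    theta μ₁ μ₂ σ₁ σ₂ (flipPt 0 w) = theta μ₁ μ₂ σ₁ σ₂ w := by
  rw [← one_mul (theta μ₁ μ₂ σ₁ σ₂ w)]
  refine theta_congr_equiv ⟨fun G => ((G.1.2, G.1.1), (G.2.2, G.2.1)), fun G => ((G.1.2, G.1.1), (G.2.2, G.2.1)),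
    fun _ => rfl, fun _ => rfl⟩ fun G => ?_
  simp only [Equiv.coe_fn_mk, tc, te, flipPt]
  rw [one_mul]
  congr 1
  · ring
  · congr 1
    simp
    ring_nf

theorem theta_rot (μ₁ μ₂ σ₁ σ₂ : ℤ) (w : Pt 2) :
    theta μ₁ μ₂ σ₁ σ₂ (rotPt w) = (-1) ^ (σ₁ * μ₁) * theta μ₁ μ₂ σ₁ σ₂ w := by
  refine theta_congr_equiv ⟨fun G => ((-G.1.2, G.1.1), G.2), fun G => ((G.1.2, -G.1.1), G.2),
    fun _ => by simp, fun _ => by simp⟩ fun G => ?_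
  simp only [Equiv.coe_fn_mk, tc, te, rotPt, uc_neg]
  rw [← mul_assoc ((-1 : ℂ) ^ _)]
  congr 1
  · ring
  · congr 1
    simp
    ring

theorem theta_trans (μ₁ μ₂ σ₁ σ₂ : ℤ) (w : Pt 2) :
    theta μ₁ μ₂ σ₁ σ₂ (transPt 1 w) = theta μ₁ (μ₁ + μ₂) (σ₁ - σ₂) σ₂ w := by
  rw [← one_mul (theta μ₁ (μ₁ + μ₂) _ _ w)]
  refine theta_congr_equiv ⟨fun G => (G.1, (G.2.1 - G.1.1, G.2.2 - G.1.2)),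
    fun G => (G.1, (G.2.1 + G.1.1, G.2.2 + G.1.2)), fun _ => by simp, fun _ => by simp⟩ fun G => ?_
  have key : ∀ X Y : ℤ, uc μ₁ σ₁ X * uc μ₂ σ₂ (Y - X) = uc μ₁ (σ₁ - σ₂) X * uc (μ₁ + μ₂) σ₂ Y := by
    intro X Y
    unfold uc
    by_cases h : (2 : ℤ) ∣ X - μ₁
    · rw [if_pos h, if_pos h]
      by_cases h2 : (2 : ℤ) ∣ Y - X - μ₂
      · rw [if_pos h2, if_pos (by omega), ← zpow_add₀ I_ne_zero, ← zpow_add₀ I_ne_zero]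
        congr 1
        ring
      · rw [if_neg h2, if_neg (by omega)]
        simp
    · rw [if_neg h, if_neg h]
      simp
  simp only [Equiv.coe_fn_mk, tc, te, transPt]
  rw [one_mul]
  congr 1
  · rw [mul_mul_mul_comm, key, key, mul_mul_mul_comm]
  · congr 1
    simp
    ring

theorem uc_add_two (μ σ X : ℤ) : uc (μ + 2) σ X = uc μ σ X := by
  unfold uc
  congr 1
  apply propext
  constructor <;> intro h <;> omega

theorem uc_mul_add_two (μ σ X Y : ℤ) : uc μ (σ + 2) X * uc μ (σ + 2) Y = uc μ σ X * uc μ σ Y := by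
  unfold uc
  by_cases h : (2 : ℤ) ∣ X - μ
  · rw [if_pos h, if_pos h]
    by_cases h2 : (2 : ℤ) ∣ Y - μ
    · rw [if_pos h2, if_pos h2, ← zpow_add₀ I_ne_zero, ← zpow_add₀ I_ne_zero]
      obtain ⟨k, hk⟩ : (2 : ℤ) ∣ X + Y := by omega
      rw [show (σ + 2) * X + (σ + 2) * Y = σ * X + σ * Y + 4 * k by linear_combination 2 * hk,
        zpow_add₀ I_ne_zero (σ * X + σ * Y), I_zpow_four_mul, mul_one]
    · rw [if_neg h2, if_neg h2, mul_zero, mul_zero]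
  · rw [if_neg h, if_neg h, zero_mul, zero_mul]

theorem theta_add_two₂ (μ₁ μ₂ σ₁ σ₂ : ℤ) : theta μ₁ (μ₂ + 2) σ₁ σ₂ = theta μ₁ μ₂ σ₁ σ₂ := by
  funext w
  simp only [theta, tc, uc_add_two]

theorem theta_add_two₃ (μ₁ μ₂ σ₁ σ₂ : ℤ) : theta μ₁ μ₂ (σ₁ + 2) σ₂ = theta μ₁ μ₂ σ₁ σ₂ := by
  funext w
  simp only [theta, tc, uc_mul_add_two]

theorem theta_add_two₄ (μ₁ μ₂ σ₁ σ₂ : ℤ) : theta μ₁ μ₂ σ₁ (σ₂ + 2) = theta μ₁ μ₂ σ₁ σ₂ := by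
  funext w
  simp only [theta, tc, uc_mul_add_two]

end HermMod

namespace HermMod
open Filter Topology

theorem theta_smul_of_tc {μ₁ μ₂ σ₁ σ₂ σ₁' σ₂' : ℤ} {w w' : Pt 2} {a : ℂ}
    (h : ∀ G : (ℤ × ℤ) × (ℤ × ℤ), 2 ∣ G.1.1 - μ₁ → 2 ∣ G.1.2 - μ₁ → 2 ∣ G.2.1 - μ₂ → 2 ∣ G.2.2 - μ₂ →
      I ^ (σ₁ * (G.1.1 + G.1.2) + σ₂ * (G.2.1 + G.2.2)) * te G w =
        a * (I ^ (σ₁' * (G.1.1 + G.1.2) + σ₂' * (G.2.1 + G.2.2)) * te G w')) :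
    theta μ₁ μ₂ σ₁ σ₂ w = a * theta μ₁ μ₂ σ₁' σ₂' w' := by
  refine theta_congr_equiv (Equiv.refl _) fun G => ?_
  simp only [Equiv.refl_apply, tc, uc]
  by_cases h1 : (2 : ℤ) ∣ G.1.1 - μ₁
  swap
  · simp [h1]
  by_cases h2 : (2 : ℤ) ∣ G.1.2 - μ₁
  swap
  · simp [h2]
  by_cases h3 : (2 : ℤ) ∣ G.2.1 - μ₂
  swap
  · simp [h3]
  by_cases h4 : (2 : ℤ) ∣ G.2.2 - μ₂
  swap
  · simp [h4]
  simp only [h1, h2, h3, h4, if_true, ← zpow_add₀ I_ne_zero]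
  convert h G h1 h2 h3 h4 using 3 <;> ring_nf

theorem cexp_pi_I_half_mul (n : ℤ) : cexp (Real.pi * I / 2 * n) = I ^ n := by
  rw [mul_comm, Complex.exp_int_mul]
  congr 1
  rw [show (Real.pi * I / 2 : ℂ) = (Real.pi / 2 : ℂ) * I by ring, Complex.exp_pi_div_two_mul_I]

theorem te_add (G : (ℤ × ℤ) × (ℤ × ℤ)) (w w' : Pt 2) : te G (w + w') = te G w * te G w' := by
  rw [te, te, te, ← Complex.exp_add]
  congr 1
  simp only [Prod.fst_add, Prod.snd_add, Pi.add_apply]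
  ring

theorem theta_period_zero (μ₂ σ₁ σ₂ : ℤ) (w : Pt 2) :
    theta 0 μ₂ σ₁ σ₂ (w + (1, 0, 0)) = theta 0 μ₂ (σ₁ + 1) σ₂ w := by
  rw [← one_mul (theta 0 μ₂ (σ₁ + 1) σ₂ w)]
  refine theta_smul_of_tc fun G h1 h2 _ _ => ?_
  obtain ⟨a, ha⟩ := h1
  obtain ⟨b, hb⟩ := h2
  have ha' : G.1.1 = 2 * a := by omega
  have hb' : G.1.2 = 2 * b := by omega
  have e : te G (1, 0, 0) = I ^ (2 * (a ^ 2 + b ^ 2)) := by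
    rw [te, ← cexp_pi_I_half_mul, ha', hb']
    congr 1
    push_cast
    simp
    ring
  obtain ⟨c, hc⟩ := Int.even_mul_pred_self a
  obtain ⟨d, hd⟩ := Int.even_mul_pred_self b
  rw [te_add, e, ha', hb', mul_comm (te G w), ← mul_assoc, ← mul_assoc, ← zpow_add₀ I_ne_zero, one_mul]
  rw [show σ₁ * (2 * a + 2 * b) + σ₂ * (G.2.1 + G.2.2) + 2 * (a ^ 2 + b ^ 2) =
    (σ₁ + 1) * (2 * a + 2 * b) + σ₂ * (G.2.1 + G.2.2) + 4 * (c + d) by linear_combination 2 * hc + 2 * hd,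
    zpow_add₀ I_ne_zero _ (4 * _), I_zpow_four_mul, mul_one]

theorem theta_period_one (μ₂ σ₁ σ₂ : ℤ) (w : Pt 2) :
    theta 1 μ₂ σ₁ σ₂ (w + (1, 0, 0)) = I * theta 1 μ₂ σ₁ σ₂ w := by
  refine theta_smul_of_tc fun G h1 h2 _ _ => ?_
  obtain ⟨a, ha⟩ := h1
  obtain ⟨b, hb⟩ := h2
  have ha' : G.1.1 = 2 * a + 1 := by omega
  have hb' : G.1.2 = 2 * b + 1 := by omega
  have e : te G (1, 0, 0) = I ^ (2 * (a * (a + 1)) + 2 * (b * (b + 1)) + 1) := by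
    rw [te, ← cexp_pi_I_half_mul, ha', hb']
    congr 1
    push_cast
    simp
    ring
  obtain ⟨c, hc⟩ := Int.even_mul_succ_self a
  obtain ⟨d, hd⟩ := Int.even_mul_succ_self b
  rw [te_add, e, hc, hd, show 2 * (c + c) + 2 * (d + d) + 1 = 4 * (c + d) + 1 by ring,
    zpow_add₀ I_ne_zero (4 * _), I_zpow_four_mul, one_mul, zpow_one]
  ring

theorem theta_period_z (μ₁ μ₂ σ₁ σ₂ : ℤ) (w : Pt 2) :
    theta μ₁ μ₂ σ₁ σ₂ (w + (0, 0, Pi.single 1 1)) =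
      (-1) ^ (μ₁ * μ₂) * theta μ₁ μ₂ (σ₁ + μ₂) (σ₂ + μ₁) w := by
  refine theta_smul_of_tc fun G h1 h2 h3 h4 => ?_
  obtain ⟨a, ha⟩ := h1
  obtain ⟨b, hb⟩ := h2
  obtain ⟨c, hc⟩ := h3
  obtain ⟨d, hd⟩ := h4
  have e : te G (0, 0, Pi.single 1 1) = I ^ (G.1.1 * G.2.1 + G.1.2 * G.2.2) := by
    rw [te, ← cexp_pi_I_half_mul]
    congr 1
    simp
    ring
  rw [te_add, e, mul_comm (te G w), ← mul_assoc, ← mul_assoc, ← zpow_add₀ I_ne_zero, ← I_zpow_two_mul,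
    ← zpow_add₀ I_ne_zero]
  congr 1
  rw [show σ₁ * (G.1.1 + G.1.2) + σ₂ * (G.2.1 + G.2.2) + (G.1.1 * G.2.1 + G.1.2 * G.2.2) =
    2 * (μ₁ * μ₂) + ((σ₁ + μ₂) * (G.1.1 + G.1.2) + (σ₂ + μ₁) * (G.2.1 + G.2.2)) +
      4 * (a * c + b * d - μ₁ * μ₂) by
      linear_combination (G.2.1 - μ₂) * ha + 2 * a * hc + (G.2.2 - μ₂) * hb + 2 * b * hd,
    zpow_add₀ I_ne_zero _ (4 * _), I_zpow_four_mul, mul_one]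

/-- One-dimensional theta series. -/
def vt (μ σ : ℤ) (α τ : ℂ) : ℂ := ∑' X : ℤ, uc μ σ X * cexp (Real.pi * I / 4 * (X ^ 2 * τ + 2 * X * α))

theorem vt_term (μ σ n : ℤ) (α τ : ℂ) :
    uc μ σ (2 * n + μ) * cexp (Real.pi * I / 4 * ((2 * n + μ : ℤ) ^ 2 * τ + 2 * (2 * n + μ : ℤ) * α)) =
      I ^ (σ * μ) * cexp (Real.pi * I / 4 * (μ ^ 2 * τ + 2 * μ * α)) *
        jacobiTheta₂_term n ((μ * τ + α + σ) / 2) τ := by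
  rw [uc, if_pos (by omega), mul_add, zpow_add₀ I_ne_zero, show σ * (2 * n) = 2 * (σ * n) by ring,
    ← cexp_pi_I_half_mul (2 * _), mul_comm _ (I ^ (σ * μ)), mul_assoc, mul_assoc (I ^ (σ * μ)), jacobiTheta₂_term,
    ← Complex.exp_add, ← Complex.exp_add]
  congr 2
  push_cast
  ring

theorem vt_injective (μ : ℤ) : Function.Injective fun n : ℤ => 2 * n + μ := fun a b h => by
  simp only at h
  omega

theorem uc_eq_zero_of_notMem {μ σ X : ℤ} (h : X ∉ Set.range fun n : ℤ => 2 * n + μ) : uc μ σ X = 0 := by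
  rw [uc, if_neg]
  rintro ⟨k, hk⟩
  exact h ⟨k, by simp only; omega⟩

theorem vt_summable (μ σ : ℤ) (α : ℂ) {τ : ℂ} (hτ : 0 < τ.im) :
    Summable fun X : ℤ => uc μ σ X * cexp (Real.pi * I / 4 * (X ^ 2 * τ + 2 * X * α)) := by
  rw [← (vt_injective μ).summable_iff]
  · refine (((summable_jacobiTheta₂_term_iff ((μ * τ + α + σ) / 2) τ).2 hτ).mul_left _).congr fun n =>
      (vt_term μ σ n α τ).symm
  · intro X hX
    rw [uc_eq_zero_of_notMem hX, zero_mul]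

theorem vt_eq (μ σ : ℤ) (α τ : ℂ) :
    vt μ σ α τ = I ^ (σ * μ) * cexp (Real.pi * I / 4 * (μ ^ 2 * τ + 2 * μ * α)) *
        jacobiTheta₂ ((μ * τ + α + σ) / 2) τ := by
  rw [vt, ← (vt_injective μ).tsum_eq, jacobiTheta₂, ← tsum_mul_left]
  · exact tsum_congr fun n => vt_term μ σ n α τ
  · intro X hX
    by_contra h
    exact hX (by simp only [uc_eq_zero_of_notMem h, zero_mul])

theorem vt_inv (μ σ : ℤ) (α : ℂ) {τ : ℂ} (hτ : 0 < τ.im) :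
    vt μ σ (α / τ) (-1 / τ) =
      I ^ (σ * μ) * (-I * τ) ^ (1 / 2 : ℂ) * cexp (Real.pi * I / 4 * (α ^ 2 / τ)) * vt σ (-μ) α τ := by
  have hτ0 : τ ≠ 0 := fun h => by simp [h] at hτ
  have hs : (-I * τ) ^ (1 / 2 : ℂ) ≠ 0 := by
    rw [Ne, Complex.cpow_eq_zero_iff]
    simp [hτ0]
  rw [vt_eq, vt_eq, jacobiTheta₂_functional_equation ((σ * τ + α + (-μ : ℤ)) / 2) τ]
  have e : (σ * τ + α + (-μ : ℤ)) / 2 / τ = (μ * (-1 / τ) + α / τ + σ) / 2 := by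
    push_cast
    field_simp
    ring
  rw [e]
  set T := jacobiTheta₂ ((μ * (-1 / τ) + α / τ + σ) / 2) (-1 / τ)
  set r := (-I * τ) ^ (1 / 2 : ℂ)
  have h2 : I ^ (σ * μ) * cexp (Real.pi * I / 4 * (μ ^ 2 * (-1 / τ) + 2 * μ * (α / τ))) =
      I ^ (σ * μ) * cexp (Real.pi * I / 4 * (α ^ 2 / τ)) * (I ^ (-μ * σ) *
        cexp (Real.pi * I / 4 * (σ ^ 2 * τ + 2 * σ * α)) *
        cexp (-Real.pi * I * ((σ * τ + α + (-μ : ℤ)) / 2) ^ 2 / τ)) := by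
    rw [mul_assoc (I ^ (σ * μ)), ← cexp_pi_I_half_mul (-μ * σ), ← Complex.exp_add, ← Complex.exp_add, ← Complex.exp_add]
    congr 2
    push_cast
    field_simp
    ring
  rw [h2]
  field_simp

theorem theta_eq_tsum_vt (μ₁ μ₂ σ₁ σ₂ : ℤ) {w : Pt 2} (hw : w ∈ Dom 2) :
    theta μ₁ μ₂ σ₁ σ₂ w = ∑' g : ℤ × ℤ, uc μ₂ σ₂ g.1 * uc μ₂ σ₂ g.2 *
      cexp (Real.pi * I / 4 * ((g.1 ^ 2 + g.2 ^ 2) * w.2.1)) *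
      (vt μ₁ σ₁ (w.2.2 1 * g.1 - w.2.2 0 * g.2) w.1 * vt μ₁ σ₁ (w.2.2 1 * g.2 + w.2.2 0 * g.1) w.1) := by
  have hs := (hasSum_theta μ₁ μ₂ σ₁ σ₂ hw).summable
  rw [theta, ← (Equiv.prodComm (ℤ × ℤ) (ℤ × ℤ)).tsum_eq, Summable.tsum_prod]
  · refine tsum_congr fun g => ?_
    rw [vt, vt, tsum_mul_tsum_of_summable_norm (vt_summable _ _ _ hw.1).norm (vt_summable _ _ _ hw.1).norm,
      ← tsum_mul_left]
    refine tsum_congr fun h => ?_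
    simp only [Equiv.prodComm_apply, Prod.swap, tc, te]
    have : ∀ a b c d e f g x : ℂ, e = f * (g * x) → a * b * (c * d) * e = c * d * f * (a * g * (b * x)) := by
      intro a b c d e f g x h
      rw [h]
      ring
    refine this _ _ _ _ _ _ _ _ ?_
    rw [← Complex.exp_add, ← Complex.exp_add]
    congr 1
    ring
  · exact (Equiv.summable_iff (Equiv.prodComm (ℤ × ℤ) (ℤ × ℤ))).2 hs

theorem theta_inv (μ₁ μ₂ σ₁ σ₂ : ℤ) {w : Pt 2} (hw : w ∈ Dom 2) :
    theta μ₁ μ₂ σ₁ σ₂ (invPt w) = (-1) ^ (σ₁ * μ₁) * (-I * w.1) * theta σ₁ μ₂ (-μ₁) σ₂ w := by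
  rw [theta_eq_tsum_vt _ _ _ _ (invPt_mem hw), theta_eq_tsum_vt _ _ _ _ hw, ← tsum_mul_left]
  refine tsum_congr fun g => ?_
  have h0 : w.1 ≠ 0 := Dom.ne_zero hw
  simp only [invPt, Fin.sum_univ_two]
  rw [show w.2.2 1 / w.1 * g.1 - w.2.2 0 / w.1 * g.2 = (w.2.2 1 * g.1 - w.2.2 0 * g.2) / w.1 by ring,
    show w.2.2 1 / w.1 * g.2 + w.2.2 0 / w.1 * g.1 = (w.2.2 1 * g.2 + w.2.2 0 * g.1) / w.1 by ring,
    vt_inv _ _ _ hw.1, vt_inv _ _ _ hw.1]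
  set A := w.2.2 1 * g.1 - w.2.2 0 * g.2 with hA
  set B := w.2.2 1 * g.2 + w.2.2 0 * g.1 with hB
  have hr : (-I * w.1) ^ (1 / 2 : ℂ) * (-I * w.1) ^ (1 / 2 : ℂ) = -I * w.1 := by
    rw [← Complex.cpow_add _ _ (by simp [h0])]
    norm_num
  have hI : (I : ℂ) ^ (σ₁ * μ₁) * I ^ (σ₁ * μ₁) = (-1) ^ (σ₁ * μ₁) := by
    rw [← zpow_add₀ I_ne_zero, ← two_mul, I_zpow_two_mul]
  have he : cexp (Real.pi * I / 4 * ((g.1 ^ 2 + g.2 ^ 2) * (w.2.1 - (w.2.2 0 ^ 2 + w.2.2 1 ^ 2) / w.1))) *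
      (cexp (Real.pi * I / 4 * (A ^ 2 / w.1)) * cexp (Real.pi * I / 4 * (B ^ 2 / w.1))) =
      cexp (Real.pi * I / 4 * ((g.1 ^ 2 + g.2 ^ 2) * w.2.1)) := by
    rw [← Complex.exp_add, ← Complex.exp_add, hA, hB]
    congr 1
    field_simp
    ring
  generalize (-I * w.1) ^ (1 / 2 : ℂ) = r at hr ⊢
  rw [← he, ← hr, ← hI]
  ring

end HermMod

namespace HermMod
open Filter Topology

/-- Squares of the theta constants. -/
def xs (μ₁ μ₂ σ₁ σ₂ : ℤ) (w : Pt 2) : ℂ := theta μ₁ μ₂ σ₁ σ₂ w ^ 2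

theorem xs_swap (μ₁ μ₂ σ₁ σ₂ : ℤ) (w : Pt 2) : xs μ₁ μ₂ σ₁ σ₂ (swapPt w) = xs μ₂ μ₁ σ₂ σ₁ w := by
  rw [xs, theta_swap, xs]

theorem xs_flip (μ₁ μ₂ σ₁ σ₂ : ℤ) (w : Pt 2) : xs μ₁ μ₂ σ₁ σ₂ (flipPt 0 w) = xs μ₁ μ₂ σ₁ σ₂ w := by
  rw [xs, theta_flip_zero, xs]

theorem neg_one_zpow_sq (n : ℤ) : ((-1 : ℂ) ^ n) ^ 2 = 1 := by
  rw [sq, neg_one_zpow_mul_self]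

theorem xs_rot (μ₁ μ₂ σ₁ σ₂ : ℤ) (w : Pt 2) : xs μ₁ μ₂ σ₁ σ₂ (rotPt w) = xs μ₁ μ₂ σ₁ σ₂ w := by
  rw [xs, theta_rot, xs, mul_pow, neg_one_zpow_sq, one_mul]

theorem xs_trans (μ₁ μ₂ σ₁ σ₂ : ℤ) (w : Pt 2) :
    xs μ₁ μ₂ σ₁ σ₂ (transPt 1 w) = xs μ₁ (μ₁ + μ₂) (σ₁ - σ₂) σ₂ w := by
  rw [xs, theta_trans, xs]

theorem xs_period_zero (μ₂ σ₁ σ₂ : ℤ) (w : Pt 2) :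
    xs 0 μ₂ σ₁ σ₂ (w + (1, 0, 0)) = xs 0 μ₂ (σ₁ + 1) σ₂ w := by
  rw [xs, theta_period_zero, xs]

theorem xs_period_one (μ₂ σ₁ σ₂ : ℤ) (w : Pt 2) :
    xs 1 μ₂ σ₁ σ₂ (w + (1, 0, 0)) = -xs 1 μ₂ σ₁ σ₂ w := by
  rw [xs, theta_period_one, xs, mul_pow, I_sq, neg_one_mul]

theorem xs_period_z (μ₁ μ₂ σ₁ σ₂ : ℤ) (w : Pt 2) :
    xs μ₁ μ₂ σ₁ σ₂ (w + (0, 0, Pi.single 1 1)) = xs μ₁ μ₂ (σ₁ + μ₂) (σ₂ + μ₁) w := by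
  rw [xs, theta_period_z, xs, mul_pow, neg_one_zpow_sq, one_mul]

theorem xs_inv (μ₁ μ₂ σ₁ σ₂ : ℤ) {w : Pt 2} (hw : w ∈ Dom 2) :
    xs μ₁ μ₂ σ₁ σ₂ (invPt w) = w.1 ^ 2 * -xs σ₁ μ₂ (-μ₁) σ₂ w := by
  rw [xs, theta_inv _ _ _ _ hw, xs, mul_pow, mul_pow, neg_one_zpow_sq, mul_pow, neg_sq, I_sq]
  ring

theorem xs_two₂ (μ₁ σ₁ σ₂ : ℤ) : xs μ₁ 2 σ₁ σ₂ = xs μ₁ 0 σ₁ σ₂ := by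
  funext w
  rw [xs, xs, ← theta_add_two₂ μ₁ 0, zero_add]

theorem xs_two₃ (μ₁ μ₂ σ₂ : ℤ) : xs μ₁ μ₂ 2 σ₂ = xs μ₁ μ₂ 0 σ₂ := by
  funext w
  rw [xs, xs, ← theta_add_two₃ μ₁ μ₂ 0, zero_add]

theorem xs_two₄ (μ₁ μ₂ σ₁ : ℤ) : xs μ₁ μ₂ σ₁ 2 = xs μ₁ μ₂ σ₁ 0 := by
  funext w
  rw [xs, xs, ← theta_add_two₄ μ₁ μ₂ σ₁ 0, zero_add]

theorem xs_neg_one₃ (μ₁ μ₂ σ₂ : ℤ) : xs μ₁ μ₂ (-1) σ₂ = xs μ₁ μ₂ 1 σ₂ := by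
  funext w
  rw [xs, xs, ← theta_add_two₃ μ₁ μ₂ (-1)]
  norm_num

/-- The squares of the ten even theta constants. -/
def xv (w : Pt 2) : Fin 10 → ℂ :=
  ![xs 0 0 0 0 w, xs 0 0 0 1 w, xs 0 0 1 0 w, xs 0 0 1 1 w, xs 0 1 0 0 w, xs 0 1 1 0 w, xs 1 0 0 0 w,
    xs 1 0 0 1 w, xs 1 1 0 0 w, xs 1 1 1 1 w]

/-- The six linear combinations of the squares that are permuted by the modular group. -/
def yv {A : Type*} [CommRing A] (x : Fin 10 → A) : Fin 6 → A :=
  ![x 0 + x 1 + x 2 + x 3 + x 4 - x 5 + x 6 - x 7 + x 8 - x 9,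
    x 0 + x 1 + x 2 + x 3 - x 4 + x 5 - x 6 + x 7 - x 8 + x 9,
    x 0 - x 1 - x 2 - x 3 + x 4 + x 5 + x 6 + x 7 + x 8 + x 9,
    -x 0 + x 1 - x 2 - x 3 - x 4 - x 5 + x 6 + x 7 - x 8 - x 9,
    -x 0 - x 1 + x 2 - x 3 + x 4 + x 5 - x 6 - x 7 - x 8 - x 9,
    -x 0 - x 1 - x 2 + x 3 - x 4 - x 5 - x 6 - x 7 + x 8 + x 9]

/-- Symmetric homogeneous operations in six variables, compatible with exponential expansions. -/
structure SymOp (R : Subring ℂ) (k : ℕ) (S : (Fin 6 → ℂ) → ℂ) : Prop where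
  hom : ∀ r y, S (fun a => r * y a) = r ^ k * S y
  perm : ∀ (e : Equiv.Perm (Fin 6)) y, S (fun a => y (e a)) = S y
  exp : ∀ y : Pt 2 → Fin 6 → ℂ, (∀ a, HasExp R (fun w => y w a)) → HasExp R (fun w => S (y w))

theorem yv_swap (w : Pt 2) :
    yv (xv (swapPt w)) = fun a => yv (xv w) (Equiv.swap 3 4 a) := by
  have h : xv (swapPt w) = ![xs 0 0 0 0 w, xs 0 0 1 0 w, xs 0 0 0 1 w, xs 0 0 1 1 w, xs 1 0 0 0 w,
      xs 1 0 0 1 w, xs 0 1 0 0 w, xs 0 1 1 0 w, xs 1 1 0 0 w, xs 1 1 1 1 w] := by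
    simp only [xv, xs_swap]
  rw [h]
  funext a
  fin_cases a <;> simp [yv, xv, Equiv.swap_apply_def] <;> ring

theorem yv_flip (w : Pt 2) : yv (xv (flipPt 0 w)) = yv (xv w) := by
  simp only [xv, xs_flip]

theorem yv_rot (w : Pt 2) : yv (xv (rotPt w)) = yv (xv w) := by
  simp only [xv, xs_rot]

theorem yv_trans (w : Pt 2) :
    yv (xv (transPt 1 w)) = fun a => yv (xv w) (Equiv.swap 3 5 a) := by
  have h : xv (transPt 1 w) = ![xs 0 0 0 0 w, xs 0 0 1 1 w, xs 0 0 1 0 w, xs 0 0 0 1 w, xs 0 1 0 0 w,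
      xs 0 1 1 0 w, xs 1 1 0 0 w, xs 1 1 1 1 w, xs 1 0 0 0 w, xs 1 0 0 1 w] := by
    simp only [xv, xs_trans, zero_add, add_zero, sub_zero, zero_sub, sub_self, xs_neg_one₃,
      one_add_one_eq_two, xs_two₂]
  rw [h]
  funext a
  fin_cases a <;> simp [yv, xv, Equiv.swap_apply_def] <;> ring

theorem yv_period (w : Pt 2) : yv (xv (w + (1, 0, 0))) =
    fun a => yv (xv w) ((Equiv.swap 0 1 * (Equiv.swap 2 4 * Equiv.swap 3 5) : Equiv.Perm (Fin 6)) a) := by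
  have h : xv (w + (1, 0, 0)) = ![xs 0 0 1 0 w, xs 0 0 1 1 w, xs 0 0 0 0 w, xs 0 0 0 1 w,
      xs 0 1 1 0 w, xs 0 1 0 0 w, -xs 1 0 0 0 w, -xs 1 0 0 1 w, -xs 1 1 0 0 w, -xs 1 1 1 1 w] := by
    simp only [xv, xs_period_zero, xs_period_one, zero_add, one_add_one_eq_two, xs_two₃]
  rw [h]
  funext a
  fin_cases a <;> simp [yv, xv, Equiv.swap_apply_def] <;> ring

theorem yv_period_z (w : Pt 2) :
    yv (xv (w + (0, 0, Pi.single 1 1))) = fun a => yv (xv w) (Equiv.swap 0 1 a) := by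
  have h : xv (w + (0, 0, Pi.single 1 1)) = ![xs 0 0 0 0 w, xs 0 0 0 1 w, xs 0 0 1 0 w, xs 0 0 1 1 w,
      xs 0 1 1 0 w, xs 0 1 0 0 w, xs 1 0 0 1 w, xs 1 0 0 0 w, xs 1 1 1 1 w, xs 1 1 0 0 w] := by
    simp only [xv, xs_period_z, zero_add, add_zero, one_add_one_eq_two, xs_two₃, xs_two₄]
  rw [h]
  funext a
  fin_cases a <;> simp [yv, xv, Equiv.swap_apply_def] <;> ring

theorem yv_inv {w : Pt 2} (hw : w ∈ Dom 2) : yv (xv (invPt w)) = fun a => w.1 ^ 2 *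
    yv (xv w) ((Equiv.swap 0 5 * (Equiv.swap 1 4 * Equiv.swap 2 3) : Equiv.Perm (Fin 6)) a) := by
  have h : xv (invPt w) = fun i => w.1 ^ 2 * ![-xs 0 0 0 0 w, -xs 0 0 0 1 w, -xs 1 0 0 0 w,
      -xs 1 0 0 1 w, -xs 0 1 0 0 w, -xs 1 1 0 0 w, -xs 0 0 1 0 w, -xs 0 0 1 1 w, -xs 0 1 1 0 w,
      -xs 1 1 1 1 w] i := by
    funext i
    fin_cases i <;> simp [xv, xs_inv _ _ _ _ hw, xs_neg_one₃]
  rw [h]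
  funext a
  fin_cases a <;> simp [yv, xv, Equiv.swap_apply_def] <;> ring

theorem uc_mul_mem (R : Subring ℂ) (μ σ X Y : ℤ) : uc μ σ X * uc μ σ Y ∈ R := by
  unfold uc
  by_cases h : (2 : ℤ) ∣ X - μ
  swap
  · simp [h, R.zero_mem]
  by_cases h2 : (2 : ℤ) ∣ Y - μ
  swap
  · simp [h2, R.zero_mem]
  rw [if_pos h, if_pos h2, ← zpow_add₀ I_ne_zero]
  obtain ⟨k, hk⟩ : (2 : ℤ) ∣ X + Y := by omega
  rw [← mul_add, hk, show σ * (2 * k) = 2 * (σ * k) by ring, I_zpow_two_mul]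
  rcases Int.even_or_odd (σ * k) with h | h
  · rw [h.neg_one_zpow]; exact R.one_mem
  · rw [h.neg_one_zpow]; exact R.neg_mem R.one_mem

theorem finite_tidx (x : Idx 2) : (tidx ⁻¹' {x}).Finite := by
  have hf : ((Set.Icc (-(x.1 : ℤ)) x.1 ×ˢ Set.Icc (-(x.1 : ℤ)) x.1) ×ˢ
      (Set.Icc (-(x.2.1 : ℤ)) x.2.1 ×ˢ Set.Icc (-(x.2.1 : ℤ)) x.2.1)).Finite :=
    ((Set.finite_Icc _ _).prod (Set.finite_Icc _ _)).prod ((Set.finite_Icc _ _).prod (Set.finite_Icc _ _))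
  refine hf.subset fun G hG => ?_
  obtain rfl : tidx G = x := hG
  rw [tidx_fst, tidx_snd]
  have key : ∀ a b : ℤ, -(a ^ 2 + b ^ 2) ≤ a ∧ a ≤ a ^ 2 + b ^ 2 := fun a b => by
    have := Int.le_self_sq a
    have h2 := Int.le_self_sq (-a)
    rw [neg_sq] at h2
    constructor <;> nlinarith [sq_nonneg b]
  refine ⟨⟨key _ _, ?_⟩, ⟨key _ _, ?_⟩⟩
  · simp only [Set.mem_Icc]; rw [add_comm]; exact key _ _
  · simp only [Set.mem_Icc]; rw [add_comm]; exact key _ _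

theorem hasExp_theta (R : Subring ℂ) (μ₁ μ₂ σ₁ σ₂ : ℤ) :
    HasExp R (fun w => theta μ₁ μ₂ σ₁ σ₂ (((8 : ℕ) : ℂ) • w)) := by
  refine ⟨_, isExp_of_family (s := tc μ₁ μ₂ σ₁ σ₂) (idx := tidx) (fun G _ => tidx_mem_cone G)
    fun w hw => ?_, fun x => tsum_mem_of_finite (finite_tidx x) fun G =>
      R.mul_mem (uc_mul_mem _ _ _ _ _) (uc_mul_mem _ _ _ _ _)⟩
  refine (hasSum_theta μ₁ μ₂ σ₁ σ₂ (Dom.natCast_smul hw (by norm_num : 0 < 8))).congr_fun fun G => ?_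
  rw [te_eq_ex, Nat.cast_ofNat, inv_smul_smul₀ (by norm_num)]

theorem HasExp.pow {d : ℕ} {R : Subring ℂ} {f : Pt d → ℂ} (h : HasExp R f) (n : ℕ) :
    HasExp R (fun w => f w ^ n) := by
  induction n with
  | zero => simp only [pow_zero]; exact HasExp.one
  | succ n ih => simp only [pow_succ]; exact ih.mul h

theorem hasExp_xs (R : Subring ℂ) (μ₁ μ₂ σ₁ σ₂ : ℤ) :
    HasExp R (fun w => xs μ₁ μ₂ σ₁ σ₂ (((8 : ℕ) : ℂ) • w)) :=
  (hasExp_theta R μ₁ μ₂ σ₁ σ₂).pow 2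

theorem HasExp.neg {d : ℕ} {R : Subring ℂ} {f : Pt d → ℂ} (h : HasExp R f) :
    HasExp R (fun w => -f w) := by
  have h2 := h.smul (R.neg_mem R.one_mem)
  rwa [neg_one_smul] at h2

theorem hasExp_xv (R : Subring ℂ) (i : Fin 10) : HasExp R (fun w => xv (((8 : ℕ) : ℂ) • w) i) := by
  fin_cases i <;> exact hasExp_xs R _ _ _ _

theorem hasExp_yv (R : Subring ℂ) (a : Fin 6) :
    HasExp R (fun w => yv (xv (((8 : ℕ) : ℂ) • w)) a) := by
  have h := hasExp_xv R
  fin_cases a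
  · exact ((((((((((h 0).add (h 1)).add (h 2)).add (h 3)).add (h 4)).sub (h 5)).add (h 6)).sub
      (h 7)).add (h 8)).sub (h 9))
  · exact ((((((((((h 0).add (h 1)).add (h 2)).add (h 3)).sub (h 4)).add (h 5)).sub (h 6)).add
      (h 7)).sub (h 8)).add (h 9))
  · exact ((((((((((h 0).sub (h 1)).sub (h 2)).sub (h 3)).add (h 4)).add (h 5)).add (h 6)).add
      (h 7)).add (h 8)).add (h 9))
  · exact ((((((((((h 0).neg.add (h 1)).sub (h 2)).sub (h 3)).sub (h 4)).sub (h 5)).add (h 6)).add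
      (h 7)).sub (h 8)).sub (h 9))
  · exact ((((((((((h 0).neg.sub (h 1)).add (h 2)).sub (h 3)).add (h 4)).add (h 5)).sub (h 6)).sub
      (h 7)).sub (h 8)).sub (h 9))
  · exact ((((((((((h 0).neg.sub (h 1)).sub (h 2)).add (h 3)).sub (h 4)).sub (h 5)).sub (h 6)).sub
      (h 7)).add (h 8)).add (h 9))

theorem yv_flip_one (w : Pt 2) : yv (xv (flipPt 1 w)) = yv (xv w) := by
  have h : flipPt 1 w = flipPt 0 (rotPt (rotPt w)) := by
    refine Prod.ext rfl (Prod.ext rfl ?_)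
    funext i
    fin_cases i <;> simp [flipPt, rotPt]
  rw [h, yv_flip, yv_rot, yv_rot]

theorem yv_trans_zero (w : Pt 2) :
    yv (xv (transPt 0 w)) = fun a => yv (xv w) (Equiv.swap 3 5 a) := by
  have h : flipPt 1 (rotPt (transPt 0 w)) = transPt 1 (flipPt 1 (rotPt w)) := by
    refine Prod.ext ?_ (Prod.ext rfl ?_)
    · simp [flipPt, rotPt, transPt]
    · funext i
      fin_cases i <;> simp [flipPt, rotPt, transPt]
  rw [← yv_rot, ← yv_flip_one, h, yv_trans, yv_flip_one, yv_rot]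

theorem yv_period_v (w : Pt 2) :
    yv (xv (w + (0, 0, Pi.single 0 1))) = fun a => yv (xv w) (Equiv.swap 0 1 a) := by
  have h : flipPt 1 (rotPt (w + (0, 0, Pi.single 0 1))) =
      flipPt 1 (rotPt w) + (0, 0, Pi.single 1 1) := by
    refine Prod.ext ?_ (Prod.ext ?_ ?_)
    · simp [flipPt, rotPt]
    · simp [flipPt, rotPt]
    · funext i
      fin_cases i <;> simp [flipPt, rotPt]
  rw [← yv_rot, ← yv_flip_one, h, yv_period_z, yv_flip_one, yv_rot]

/-- Symmetric functions of the six combinations are symmetric Hermitian modular forms. -/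
theorem SymOp.good {R : Subring ℂ} {k : ℕ} {S : (Fin 6 → ℂ) → ℂ} (hS : SymOp R k S) :
    Good R (2 * k) (fun w => S (yv (xv w))) := by
  have hswap : ∀ w, S (yv (xv (swapPt w))) = S (yv (xv w)) := fun w => by rw [yv_swap, hS.perm]
  have hper : ∀ w, S (yv (xv (w + (1, 0, 0)))) = S (yv (xv w)) := fun w => by rw [yv_period, hS.perm]
  refine ⟨⟨⟨fun w hw => ?_, fun w _ => hswap w, fun i w _ => ?_, fun i w _ => ?_⟩, ?_⟩,
    fun w _ => by simp only [yv_rot]⟩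
  · simp only [yv_inv hw]
    rw [hS.hom (w.1 ^ 2) fun a => yv (xv w) (_ : Fin 6), hS.perm, ← pow_mul]
    norm_cast
  · fin_cases i
    exacts [congrArg S (yv_flip w), congrArg S (yv_flip_one w)]
  · fin_cases i
    exacts [(congrArg S (yv_trans_zero w)).trans (hS.perm _ _),
      (congrArg S (yv_trans w)).trans (hS.perm _ _)]
  · obtain ⟨c, h, hc⟩ := hS.exp _ (hasExp_yv R)
    refine ⟨_, IsExp.undilate (f := fun w => S (yv (xv w))) (by norm_num : 0 < 8) h
      (fun w _ => hper w) (fun w _ => ?_) (fun i w _ => ?_), fun x => hc _⟩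
    · rw [← hswap, show swapPt (w + (0, 1, 0)) = swapPt w + (1, 0, 0) by
        refine Prod.ext ?_ (Prod.ext ?_ ?_) <;> simp [swapPt], hper, hswap]
    · fin_cases i
      exacts [(congrArg S (yv_period_v w)).trans (hS.perm _ _),
        (congrArg S (yv_period_z w)).trans (hS.perm _ _)]

/-- Power sums. -/
def psum (k : ℕ) (y : Fin 6 → ℂ) : ℂ := ∑ a, y a ^ k

/-- The fifth elementary symmetric function. -/
def esum (y : Fin 6 → ℂ) : ℂ := ∑ a, ∏ b, if b = a then 1 else y b

theorem HasExp.sum {d : ℕ} {R : Subring ℂ} {ι : Type*} (s : Finset ι) {f : ι → Pt d → ℂ}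
    (h : ∀ i, HasExp R (f i)) : HasExp R (fun w => ∑ i ∈ s, f i w) := by
  classical
  induction s using Finset.induction_on with
  | empty =>
    simp only [Finset.sum_empty]
    have h := (HasExp.one (R := R) (d := d)).smul R.zero_mem
    rw [zero_smul] at h
    exact h
  | insert i s hi ih =>
    simp only [Finset.sum_insert hi]
    exact (h i).add ih

theorem HasExp.prod {d : ℕ} {R : Subring ℂ} {ι : Type*} (s : Finset ι) {f : ι → Pt d → ℂ}
    (h : ∀ i, HasExp R (f i)) : HasExp R (fun w => ∏ i ∈ s, f i w) := by
  classical
  induction s using Finset.induction_on with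
  | empty => simp only [Finset.prod_empty]; exact HasExp.one
  | insert i s hi ih =>
    simp only [Finset.prod_insert hi]
    exact (h i).mul ih

theorem symOp_psum (R : Subring ℂ) (k : ℕ) : SymOp R k (psum k) := by
  refine ⟨fun r y => ?_, fun e y => ?_, fun y hy => ?_⟩
  · simp only [psum, mul_pow, Finset.mul_sum]
  · exact Equiv.sum_comp e fun a => y a ^ k
  · exact HasExp.sum _ fun a => (hy a).pow k

theorem symOp_esum (R : Subring ℂ) : SymOp R 5 esum := by
  refine ⟨fun r y => ?_, fun e y => ?_, fun y hy => ?_⟩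
  · simp only [esum, Fin.sum_univ_six, Fin.prod_univ_six, Fin.isValue, Fin.reduceEq, if_true, if_false]
    ring
  · rw [esum, esum, ← Equiv.sum_comp e fun a => ∏ b, if b = a then 1 else y b]
    refine Finset.sum_congr rfl fun a _ => ?_
    rw [← Equiv.prod_comp e fun b => if b = e a then 1 else y b]
    simp only [e.injective.eq_iff]
  · refine HasExp.sum _ fun a => HasExp.prod _ fun b => ?_
    split_ifs
    · exact HasExp.one
    · exact hy b

/-- Multiple of the cusp form of weight eight. -/
def f8 (y : Fin 6 → ℂ) : ℂ := 4 * psum 4 y - psum 2 y * psum 2 y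

/-- Multiple of the cusp form of weight ten. -/
def f10 (y : Fin 6 → ℂ) : ℂ := 12 * esum y + psum 2 y * psum 3 y

/-- Multiple of the cusp form of weight twelve. -/
def f12 (y : Fin 6 → ℂ) : ℂ :=
  48 * psum 6 y - 3 * (psum 2 y * (psum 2 y * psum 2 y)) - 8 * (psum 3 y * psum 3 y)

theorem SymOp.mul {R : Subring ℂ} {k l : ℕ} {S T : (Fin 6 → ℂ) → ℂ} (hS : SymOp R k S)
    (hT : SymOp R l T) : SymOp R (k + l) (fun y => S y * T y) := by
  refine ⟨fun r y => ?_, fun e y => ?_, fun y hy => (hS.exp y hy).mul (hT.exp y hy)⟩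
  · rw [hS.hom, hT.hom, pow_add]; ring
  · rw [hS.perm, hT.perm]

theorem SymOp.lin {R : Subring ℂ} {k : ℕ} {S T : (Fin 6 → ℂ) → ℂ} (hS : SymOp R k S)
    (hT : SymOp R k T) (a b : ℤ) : SymOp R k (fun y => a * S y + b * T y) := by
  refine ⟨fun r y => ?_, fun e y => ?_, fun y hy =>
    ((hS.exp y hy).smul (intCast_mem R a)).add ((hT.exp y hy).smul (intCast_mem R b))⟩
  · rw [hS.hom, hT.hom]; ring
  · rw [hS.perm, hT.perm]

theorem symOp_f8 (R : Subring ℂ) : SymOp R 4 f8 := by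
  convert (symOp_psum R 4).lin ((symOp_psum R 2).mul (symOp_psum R 2)) 4 (-1) using 2
  rw [f8]; push_cast; ring

theorem symOp_f10 (R : Subring ℂ) : SymOp R 5 f10 := by
  convert (symOp_esum R).lin ((symOp_psum R 2).mul (symOp_psum R 3)) 12 1 using 2
  rw [f10]; push_cast; ring

theorem symOp_f12 (R : Subring ℂ) : SymOp R 6 f12 := by
  have p2 := symOp_psum R 2
  have p3 := symOp_psum R 3
  convert ((symOp_psum R 6).lin (p2.mul (p2.mul p2)) 48 (-3)).lin (p3.mul p3) 1 (-8) using 2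
  rw [f12]; push_cast; ring

end HermMod

namespace HermMod
open Filter Topology

/-- Entry of a table of integers. -/
def lget (t : List (List ℤ)) (n m : ℕ) : ℤ := (t.getD n []).getD m 0

/-- The `5 × 5` table of a function. -/
def mkT (f : ℕ → ℕ → ℤ) : List (List ℤ) :=
  [[f 0 0, f 0 1, f 0 2, f 0 3, f 0 4], [f 1 0, f 1 1, f 1 2, f 1 3, f 1 4],
    [f 2 0, f 2 1, f 2 2, f 2 3, f 2 4], [f 3 0, f 3 1, f 3 2, f 3 3, f 3 4],
    [f 4 0, f 4 1, f 4 2, f 4 3, f 4 4]]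

theorem lget_mkT (f : ℕ → ℕ → ℤ) {n m : ℕ} (hn : n < 5) (hm : m < 5) : lget (mkT f) n m = f n m := by
  interval_cases n <;> interval_cases m <;> rfl

/-- Truncated product of tables. -/
def mulT (s t : List (List ℤ)) : List (List ℤ) :=
  mkT fun n m => ((List.range (n + 1)).map fun a =>
    ((List.range (m + 1)).map fun b => lget s a b * lget t (n - a) (m - b)).sum).sum

/-- Linear combination of tables. -/
def linT (a b : ℤ) (s t : List (List ℤ)) : List (List ℤ) :=
  mkT fun n m => a * lget s n m + b * lget t n m

/-- The first coefficients of a degenerate expansion are given by a table of integers. -/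
def Trunc (f : Pt 0 → ℂ) (t : List (List ℤ)) : Prop :=
  ∃ c, IsExp f c ∧ ∀ n < 5, ∀ m < 5, c (n, m, 0) = (lget t n m : ℂ)

theorem coneConv_zero (c c' : Idx 0 → ℂ) (n m : ℕ) :
    coneConv c c' (n, m, 0) = ∑ a ∈ Finset.range (n + 1), ∑ b ∈ Finset.range (m + 1),
      c (a, b, 0) * c' (n - a, m - b, 0) := by
  have h := congrArg (PowerSeries.coeff n) (row_coneConv c c' m)
  simp only [row, map_sum, PowerSeries.coeff_mul, PowerSeries.coeff_mk] at h
  rw [h, Finset.sum_comm, Finset.Nat.sum_antidiagonal_eq_sum_range_succ_mk]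
  refine Finset.sum_congr rfl fun a _ => ?_
  rw [Finset.Nat.sum_antidiagonal_eq_sum_range_succ_mk]

theorem list_sum_range (n : ℕ) (f : ℕ → ℤ) :
    ((List.range n).map f).sum = ∑ a ∈ Finset.range n, f a := rfl

theorem Trunc.mul {f g : Pt 0 → ℂ} {s t : List (List ℤ)} (hf : Trunc f s) (hg : Trunc g t) :
    Trunc (fun w => f w * g w) (mulT s t) := by
  obtain ⟨c, h, hc⟩ := hf
  obtain ⟨c', h', hc'⟩ := hg
  refine ⟨_, h.mul h', fun n hn m hm => ?_⟩
  rw [coneConv_zero, mulT, lget_mkT _ hn hm]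
  simp only [list_sum_range]
  push_cast
  refine Finset.sum_congr rfl fun a ha => Finset.sum_congr rfl fun b hb => ?_
  rw [Finset.mem_range] at ha hb
  rw [hc a (by omega) b (by omega), hc' (n - a) (by omega) (m - b) (by omega)]

theorem Trunc.lin {f g : Pt 0 → ℂ} {s t : List (List ℤ)} (hf : Trunc f s) (hg : Trunc g t) (a b : ℤ) :
    Trunc (fun w => a * f w + b * g w) (linT a b s t) := by
  obtain ⟨c, h, hc⟩ := hf
  obtain ⟨c', h', hc'⟩ := hg
  refine ⟨_, (h.smul (a : ℂ)).add (h'.smul (b : ℂ)), fun n hn m hm => ?_⟩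
  rw [linT, lget_mkT _ hn hm]
  rw [Pi.add_apply, Pi.smul_apply, Pi.smul_apply, hc n hn m hm, hc' n hn m hm]
  push_cast
  simp only [smul_eq_mul]

/-- The specialisation of the elliptic variables to two-division points. -/
def sp (r s : ℤ) (w : Pt 0) : Pt 2 :=
  (((4 : ℕ) : ℂ) * w.1, ((4 : ℕ) : ℂ) * w.2.1, fun i => ((![s / 2, r / 2] : Fin 2 → ℝ) i : ℂ))

theorem sp_mem (r s : ℤ) {w : Pt 0} (hw : w ∈ Dom 0) : sp r s w ∈ Dom 2 := by
  obtain ⟨h1, h2, h3⟩ := hw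
  have h1' : 0 < w.1.im := h1
  have h2' : 0 < w.2.1.im := h2
  have e1 : (sp r s w).1.im = 4 * w.1.im := by simp [sp]
  have e2 : (sp r s w).2.1.im = 4 * w.2.1.im := by simp [sp]
  have e3 : ∀ i, ((sp r s w).2.2 i).im = 0 := fun i => ofReal_im _
  refine ⟨by rw [e1]; positivity, by rw [e2]; positivity, ?_⟩
  rw [e1, e2]
  simp only [e3]
  simp
  positivity

/-- Exponent of the root of unity attached to a vector at a two-division point. -/
def pe (r s : ℤ) (G : (ℤ × ℤ) × (ℤ × ℤ)) : ℤ :=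
  (r * (G.1.1 * G.2.1 + G.1.2 * G.2.2) - s * (G.1.1 * G.2.2 - G.1.2 * G.2.1)) / 2

/-- Index of a vector in the degenerate expansion. -/
def didx (G : (ℤ × ℤ) × (ℤ × ℤ)) : Idx 0 :=
  (((G.1.1 ^ 2 + G.1.2 ^ 2) / 2).toNat, ((G.2.1 ^ 2 + G.2.2 ^ 2) / 2).toNat, 0)

theorem parity_of_uc {μ σ X : ℤ} (h : uc μ σ X ≠ 0) : (2 : ℤ) ∣ X - μ := by
  by_contra h'
  exact h (if_neg h')

theorem parity_of_tc {μ₁ μ₂ σ₁ σ₂ : ℤ} {G : (ℤ × ℤ) × (ℤ × ℤ)} (h : tc μ₁ μ₂ σ₁ σ₂ G ≠ 0) :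
    ((2 : ℤ) ∣ G.1.1 - μ₁ ∧ (2 : ℤ) ∣ G.1.2 - μ₁) ∧ ((2 : ℤ) ∣ G.2.1 - μ₂ ∧ (2 : ℤ) ∣ G.2.2 - μ₂) := by
  rw [tc, mul_ne_zero_iff, mul_ne_zero_iff, mul_ne_zero_iff] at h
  exact ⟨⟨parity_of_uc h.1.1, parity_of_uc h.1.2⟩, ⟨parity_of_uc h.2.1, parity_of_uc h.2.2⟩⟩

theorem even_sq_add_sq {μ X Y : ℤ} (hX : (2 : ℤ) ∣ X - μ) (hY : (2 : ℤ) ∣ Y - μ) :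
    ∃ n : ℕ, X ^ 2 + Y ^ 2 = 2 * n := by
  obtain ⟨a, ha⟩ := hX
  obtain ⟨b, hb⟩ := hY
  obtain rfl : X = 2 * a + μ := by omega
  obtain rfl : Y = 2 * b + μ := by omega
  have h0 : 0 ≤ (2 * a + μ) ^ 2 + (2 * b + μ) ^ 2 := by positivity
  refine ⟨(2 * a ^ 2 + 2 * a * μ + 2 * b ^ 2 + 2 * b * μ + μ ^ 2).toNat, ?_⟩
  rw [Int.toNat_of_nonneg (by nlinarith)]
  ring

theorem te_sp {μ₁ μ₂ : ℤ} (r s : ℤ) {G : (ℤ × ℤ) × (ℤ × ℤ)}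
    (h1 : (2 : ℤ) ∣ G.1.1 - μ₁ ∧ (2 : ℤ) ∣ G.1.2 - μ₁) (h2 : (2 : ℤ) ∣ G.2.1 - μ₂ ∧ (2 : ℤ) ∣ G.2.2 - μ₂)
    (w : Pt 0) : te G (sp r s w) = I ^ pe r s G * ex (didx G) w := by
  obtain ⟨n, hn⟩ := even_sq_add_sq h1.1 h1.2
  obtain ⟨m, hm⟩ := even_sq_add_sq h2.1 h2.2
  obtain ⟨⟨X, Y⟩, ⟨Z, W⟩⟩ := G
  dsimp only at *
  have hp : 2 * pe r s ((X, Y), (Z, W)) = r * (X * Z + Y * W) - s * (X * W - Y * Z) := by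
    rw [pe]
    refine Int.mul_ediv_cancel' ?_
    obtain ⟨a, ha⟩ := h1.1
    obtain ⟨b, hb⟩ := h1.2
    obtain ⟨e, he⟩ := h2.1
    obtain ⟨g, hg⟩ := h2.2
    obtain rfl : X = 2 * a + μ₁ := by omega
    obtain rfl : Y = 2 * b + μ₁ := by omega
    obtain rfl : Z = 2 * e + μ₂ := by omega
    obtain rfl : W = 2 * g + μ₂ := by omega
    refine dvd_sub (Dvd.dvd.mul_left ⟨2 * a * e + a * μ₂ + μ₁ * e + 2 * b * g + b * μ₂ + μ₁ * g +
      μ₁ * μ₂, by ring⟩ _) (Dvd.dvd.mul_left ⟨2 * a * g + a * μ₂ + μ₁ * g - 2 * b * e - b * μ₂ - μ₁ * e,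
        by ring⟩ _)
  have hd : didx ((X, Y), (Z, W)) = (n, m, 0) := by
    simp [didx, hn, hm]
  rw [hd, ← cexp_pi_I_half_mul, te, ex, ← Complex.exp_add]
  congr 1
  have hn' : ((X : ℂ) ^ 2 + Y ^ 2) = 2 * n := by exact_mod_cast hn
  have hm' : ((Z : ℂ) ^ 2 + W ^ 2) = 2 * m := by exact_mod_cast hm
  have hp' : 2 * (pe r s ((X, Y), (Z, W)) : ℂ) = r * (X * Z + Y * W) - s * (X * W - Y * Z) := by
    exact_mod_cast hp
  simp only [hn', hm', sp]
  simp
  linear_combination (-Real.pi * I / 4) * hp'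

/-- Vectors with given half norm and parity in the standard box. -/
def vecs (μ : ℤ) (n : ℕ) : List (ℤ × ℤ) :=
  (([-2, -1, 0, 1, 2] : List ℤ).product [-2, -1, 0, 1, 2]).filter fun v =>
    v.1 * v.1 + v.2 * v.2 = 2 * n ∧ (v.1 - μ) % 2 = 0 ∧ (v.2 - μ) % 2 = 0

theorem nodup_vecs (μ : ℤ) (n : ℕ) : (vecs μ n).Nodup := List.Nodup.filter _ (by decide)

theorem mem_vecs {μ : ℤ} {n : ℕ} (hn : n < 5) {v : ℤ × ℤ} : v ∈ vecs μ n ↔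
    v.1 ^ 2 + v.2 ^ 2 = 2 * n ∧ (2 : ℤ) ∣ v.1 - μ ∧ (2 : ℤ) ∣ v.2 - μ := by
  rw [vecs, List.mem_filter]
  simp only [decide_eq_true_eq, Int.dvd_iff_emod_eq_zero, ← sq, and_iff_right_iff_imp]
  rintro ⟨h, -⟩
  have key : ∀ x y : ℤ, x ^ 2 + y ^ 2 = 2 * n → x ∈ ([-2, -1, 0, 1, 2] : List ℤ) := fun x y h => by
    have h1 : -3 < x := by nlinarith [sq_nonneg y]
    have h2 : x < 3 := by nlinarith [sq_nonneg y]
    interval_cases x <;> simp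
  exact List.mem_product.2 ⟨key _ _ h, key v.2 v.1 (by rw [add_comm]; exact h)⟩

/-- Real and imaginary parts of powers of the imaginary unit. -/
def iparts (e : ℤ) : ℤ × ℤ :=
  if e % 4 = 0 then (1, 0) else if e % 4 = 1 then (0, 1) else if e % 4 = 2 then (-1, 0) else (0, -1)

theorem I_zpow_eq (e : ℤ) : (I : ℂ) ^ e = (iparts e).1 + (iparts e).2 * I := by
  have h : (I : ℂ) ^ e = I ^ (e % 4) := by
    conv_lhs => rw [← Int.emod_add_mul_ediv e 4, zpow_add₀ I_ne_zero, _root_.zpow_mul]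
    have : (I : ℂ) ^ (4 : ℤ) = 1 := by exact_mod_cast I_pow_four
    rw [this, _root_.one_zpow, mul_one]
  have h1 := Int.emod_nonneg e (by norm_num : (4 : ℤ) ≠ 0)
  have h2 := Int.emod_lt_of_pos e (by norm_num : (0 : ℤ) < 4)
  rw [h, iparts]
  generalize e % 4 = a at *
  interval_cases a
  · simp
  · simp
  · simpa using I_sq
  · have : (I : ℂ) ^ (3 : ℤ) = -I := by exact_mod_cast I_pow_three
    simp [this]

/-- Total exponent of the root of unity attached to a vector. -/
def te' (r s σ₁ σ₂ : ℤ) (G : (ℤ × ℤ) × (ℤ × ℤ)) : ℤ :=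
  σ₁ * (G.1.1 + G.1.2) + σ₂ * (G.2.1 + G.2.2) + pe r s G

/-- Table of a theta constant; real and imaginary parts. -/
def thEntry (r s μ₁ μ₂ σ₁ σ₂ : ℤ) (n m : ℕ) : List (ℤ × ℤ) :=
  ((vecs μ₁ n).product (vecs μ₂ m)).map fun G => iparts (te' r s σ₁ σ₂ G)

theorem trunc_theta (r s μ₁ μ₂ σ₁ σ₂ : ℤ) {t : List (List ℤ)}
    (h : ∀ n < 5, ∀ m < 5, (thEntry r s μ₁ μ₂ σ₁ σ₂ n m).sum = (lget t n m, 0)) :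
    Trunc (fun w => theta μ₁ μ₂ σ₁ σ₂ (sp r s w)) t := by
  refine ⟨_, isExp_of_family (s := fun G => tc μ₁ μ₂ σ₁ σ₂ G * I ^ pe r s G) (idx := didx)
    (fun G _ => mem_cone_zero _) fun w hw => ?_, fun n hn m hm => ?_⟩
  · refine (hasSum_theta μ₁ μ₂ σ₁ σ₂ (sp_mem r s hw)).congr_fun fun G => ?_
    by_cases h0 : tc μ₁ μ₂ σ₁ σ₂ G = 0
    · simp [h0]
    · rw [te_sp r s (parity_of_tc h0).1 (parity_of_tc h0).2, mul_assoc]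
  · have hnd : ((vecs μ₁ n).product (vecs μ₂ m)).Nodup := (nodup_vecs _ _).product (nodup_vecs _ _)
    have hmem : ∀ G, G ∈ (vecs μ₁ n).product (vecs μ₂ m) ↔ G.1 ∈ vecs μ₁ n ∧ G.2 ∈ vecs μ₂ m :=
      fun G => List.mem_product
    have hidx : ∀ G, G ∈ (vecs μ₁ n).product (vecs μ₂ m) → didx G = (n, m, 0) := fun G hG => by
      obtain ⟨h1, h2⟩ := (hmem G).1 hG
      rw [didx, ((mem_vecs hn).1 h1).1, ((mem_vecs hm).1 h2).1]
      simp
    rw [tsum_subtype (didx ⁻¹' {(n, m, 0)}) fun G => tc μ₁ μ₂ σ₁ σ₂ G * I ^ pe r s G,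
      tsum_eq_sum (s := ((vecs μ₁ n).product (vecs μ₂ m)).toFinset)]
    · have e1 : ∀ G ∈ ((vecs μ₁ n).product (vecs μ₂ m)).toFinset,
          (didx ⁻¹' {(n, m, 0)}).indicator (fun G => tc μ₁ μ₂ σ₁ σ₂ G * I ^ pe r s G) G =
            (iparts (te' r s σ₁ σ₂ G)).1 + (iparts (te' r s σ₁ σ₂ G)).2 * I := fun G hG => by
        rw [List.mem_toFinset] at hG
        rw [Set.indicator_of_mem (by exact hidx G hG), ← I_zpow_eq, tc]
        obtain ⟨h1, h2⟩ := (hmem G).1 hG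
        obtain ⟨-, p1, p2⟩ := (mem_vecs hn).1 h1
        obtain ⟨-, p3, p4⟩ := (mem_vecs hm).1 h2
        simp only [uc, p1, p2, p3, p4, if_true, te', zpow_add₀ I_ne_zero, mul_add]
      rw [Finset.sum_congr rfl e1, List.sum_toFinset _ hnd]
      have hs := h n hn m hm
      have key : ∀ l : List ((ℤ × ℤ) × (ℤ × ℤ)), (l.map fun G => ((iparts (te' r s σ₁ σ₂ G)).1 : ℂ) +
          (iparts (te' r s σ₁ σ₂ G)).2 * I).sum =
          ((l.map fun G => iparts (te' r s σ₁ σ₂ G)).sum.1 : ℂ) +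
            (l.map fun G => iparts (te' r s σ₁ σ₂ G)).sum.2 * I := fun l => by
        induction l with
        | nil => simp
        | cons a l ih =>
          simp only [List.map_cons, List.sum_cons, ih, Prod.fst_add, Prod.snd_add]
          push_cast
          ring
      rw [key]
      rw [thEntry] at hs
      rw [hs]
      simp
    · intro G hG
      by_cases hi : G ∈ didx ⁻¹' {(n, m, 0)}
      · rw [Set.indicator_of_mem hi]
        by_contra h0
        obtain ⟨h1, h2⟩ := parity_of_tc (left_ne_zero_of_mul h0)
        refine hG (List.mem_toFinset.2 ((hmem G).2 ⟨(mem_vecs hn).2 ⟨?_, h1⟩, (mem_vecs hm).2 ⟨?_, h2⟩⟩))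
        · obtain ⟨n', hn'⟩ := even_sq_add_sq h1.1 h1.2
          have := congrArg Prod.fst (hi : didx G = (n, m, 0))
          simp [didx, hn'] at this
          rw [hn', this]
        · obtain ⟨n', hn'⟩ := even_sq_add_sq h2.1 h2.2
          have := congrArg (fun x => x.2.1) (hi : didx G = (n, m, 0))
          simp [didx, hn'] at this
          rw [hn', this]
      · exact Set.indicator_of_notMem hi _

/-- Table of a theta constant. -/
def thT (r s μ₁ μ₂ σ₁ σ₂ : ℤ) : List (List ℤ) := mkT fun n m => (thEntry r s μ₁ μ₂ σ₁ σ₂ n m).sum.1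

theorem trunc_thT (r s μ₁ μ₂ σ₁ σ₂ : ℤ)
    (h : ∀ n < 5, ∀ m < 5, (thEntry r s μ₁ μ₂ σ₁ σ₂ n m).sum.2 = 0) :
    Trunc (fun w => theta μ₁ μ₂ σ₁ σ₂ (sp r s w)) (thT r s μ₁ μ₂ σ₁ σ₂) :=
  trunc_theta r s μ₁ μ₂ σ₁ σ₂ fun n hn m hm => Prod.ext (by rw [thT, lget_mkT _ hn hm]) (h n hn m hm)

/-- Table of the square of a theta constant. -/
def xsT (r s μ₁ μ₂ σ₁ σ₂ : ℤ) : List (List ℤ) := mulT (thT r s μ₁ μ₂ σ₁ σ₂) (thT r s μ₁ μ₂ σ₁ σ₂)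

/-- Tables of the squares of the ten even theta constants. -/
def xvT (r s : ℤ) : Fin 10 → List (List ℤ) :=
  ![xsT r s 0 0 0 0, xsT r s 0 0 0 1, xsT r s 0 0 1 0, xsT r s 0 0 1 1, xsT r s 0 1 0 0,
    xsT r s 0 1 1 0, xsT r s 1 0 0 0, xsT r s 1 0 0 1, xsT r s 1 1 0 0, xsT r s 1 1 1 1]

theorem trunc_xv {r s : ℤ} (hrs : (r, s) ∈ ([(0, 0), (1, 0), (1, 1)] : List (ℤ × ℤ))) (i : Fin 10) :
    Trunc (fun w => xv (sp r s w) i) (xvT r s i) := by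
  have key : ∀ μ₁ μ₂ σ₁ σ₂ : ℤ, (∀ n < 5, ∀ m < 5, (thEntry r s μ₁ μ₂ σ₁ σ₂ n m).sum.2 = 0) →
      Trunc (fun w => xs μ₁ μ₂ σ₁ σ₂ (sp r s w)) (xsT r s μ₁ μ₂ σ₁ σ₂) := fun μ₁ μ₂ σ₁ σ₂ h => by
    simp only [xs, sq]
    exact (trunc_thT r s μ₁ μ₂ σ₁ σ₂ h).mul (trunc_thT r s μ₁ μ₂ σ₁ σ₂ h)
  fin_cases hrs <;> fin_cases i <;> exact key _ _ _ _ (by decide +kernel)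

end HermMod

namespace HermMod
open Filter Topology

theorem Trunc.congr {f g : Pt 0 → ℂ} {t : List (List ℤ)} (h : Trunc f t) (hfg : ∀ w, f w = g w) :
    Trunc g t := by
  obtain rfl : f = g := funext hfg
  exact h

/-- Sum of tables with weights. -/
def sumT {k : ℕ} (a : Fin k → ℤ) (t : Fin k → List (List ℤ)) : List (List ℤ) :=
  mkT fun n m => ∑ i, a i * lget (t i) n m

theorem trunc_sum {k : ℕ} (a : Fin k → ℤ) {f : Fin k → Pt 0 → ℂ} {t : Fin k → List (List ℤ)}
    (h : ∀ i, Trunc (f i) (t i)) : Trunc (fun w => ∑ i, a i * f i w) (sumT a t) := by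
  choose c hc ht using h
  have key : ∀ s : Finset (Fin k), IsExp (fun w => ∑ i ∈ s, a i * f i w)
      (fun x => ∑ i ∈ s, a i * c i x) := fun s => by
    induction s using Finset.induction_on with
    | empty =>
      simp only [Finset.sum_empty]
      exact IsExp.zero
    | insert i s hi ih =>
      simp only [Finset.sum_insert hi]
      exact ((hc i).smul (a i : ℂ)).add ih
  refine ⟨_, key Finset.univ, fun n hn m hm => ?_⟩
  rw [sumT, lget_mkT _ hn hm]
  push_cast
  exact Finset.sum_congr rfl fun i _ => by rw [ht i n hn m hm]

/-- The coefficients of the six linear combinations. -/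
def ym : Fin 6 → Fin 10 → ℤ :=
  ![![1, 1, 1, 1, 1, -1, 1, -1, 1, -1], ![1, 1, 1, 1, -1, 1, -1, 1, -1, 1],
    ![1, -1, -1, -1, 1, 1, 1, 1, 1, 1], ![-1, 1, -1, -1, -1, -1, 1, 1, -1, -1],
    ![-1, -1, 1, -1, 1, 1, -1, -1, -1, -1], ![-1, -1, -1, 1, -1, -1, -1, -1, 1, 1]]

theorem yv_eq_sum (x : Fin 10 → ℂ) (a : Fin 6) : ∑ i, ym a i * x i = yv x a := by
  fin_cases a <;> simp [ym, yv, Fin.sum_univ_succ] <;> ring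

/-- Tables of the six combinations. -/
def yT (r s : ℤ) (a : Fin 6) : List (List ℤ) := sumT (ym a) (xvT r s)

theorem trunc_yv {r s : ℤ} (hrs : (r, s) ∈ ([(0, 0), (1, 0), (1, 1)] : List (ℤ × ℤ))) (a : Fin 6) :
    Trunc (fun w => yv (xv (sp r s w)) a) (yT r s a) :=
  (trunc_sum (ym a) (trunc_xv hrs)).congr fun _ => yv_eq_sum _ _

/-- Powers of tables with positive exponent. -/
def powT (t : List (List ℤ)) : ℕ → List (List ℤ)
  | 0 => t
  | n + 1 => mulT (powT t n) t

theorem Trunc.pow {f : Pt 0 → ℂ} {t : List (List ℤ)} (h : Trunc f t) (n : ℕ) :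
    Trunc (fun w => f w ^ (n + 1)) (powT t n) := by
  induction n with
  | zero => exact h.congr fun w => by rw [zero_add, pow_one]
  | succ n ih => exact (ih.mul h).congr fun w => (pow_succ _ _).symm

/-- Tables of power sums. -/
def psumT (k : ℕ) (y : Fin 6 → List (List ℤ)) : List (List ℤ) := sumT (fun _ => 1) fun a => powT (y a) k

theorem trunc_psum {y : Pt 0 → Fin 6 → ℂ} {t : Fin 6 → List (List ℤ)}
    (h : ∀ a, Trunc (fun w => y w a) (t a)) (k : ℕ) : Trunc (fun w => psum (k + 1) (y w)) (psumT k t) :=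
  (trunc_sum (fun _ => 1) fun a => (h a).pow k).congr fun w => by simp [psum]

/-- Table of the fifth elementary symmetric function. -/
def esumT (y : Fin 6 → List (List ℤ)) : List (List ℤ) :=
  linT 1 1 (mulT (mulT (y 0) (y 1)) (linT 1 1
      (mulT (mulT (y 2) (y 3)) (linT 1 1 (y 4) (y 5)))
      (mulT (mulT (y 4) (y 5)) (linT 1 1 (y 2) (y 3)))))
    (mulT (mulT (mulT (y 2) (y 3)) (mulT (y 4) (y 5))) (linT 1 1 (y 0) (y 1)))

theorem trunc_esum {y : Pt 0 → Fin 6 → ℂ} {t : Fin 6 → List (List ℤ)}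
    (h : ∀ a, Trunc (fun w => y w a) (t a)) : Trunc (fun w => esum (y w)) (esumT t) := by
  refine Trunc.congr (((((h 0).mul (h 1)).mul ((((h 2).mul (h 3)).mul ((h 4).lin (h 5) 1 1)).lin
    (((h 4).mul (h 5)).mul ((h 2).lin (h 3) 1 1)) 1 1))).lin
    ((((h 2).mul (h 3)).mul ((h 4).mul (h 5))).mul ((h 0).lin (h 1) 1 1)) 1 1) fun w => ?_
  simp only [esum, Fin.sum_univ_six, Fin.prod_univ_six, Fin.isValue, Fin.reduceEq, if_true, if_false,
    Int.cast_one]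
  ring

/-- Table of the form of weight eight. -/
def f8T (y : Fin 6 → List (List ℤ)) : List (List ℤ) :=
  linT 4 (-1) (psumT 3 y) (mulT (psumT 1 y) (psumT 1 y))

/-- Table of the form of weight ten. -/
def f10T (y : Fin 6 → List (List ℤ)) : List (List ℤ) :=
  linT 12 1 (esumT y) (mulT (psumT 1 y) (psumT 2 y))

/-- Table of the form of weight twelve. -/
def f12T (y : Fin 6 → List (List ℤ)) : List (List ℤ) :=
  linT 1 (-8) (linT 48 (-3) (psumT 5 y) (mulT (psumT 1 y) (mulT (psumT 1 y) (psumT 1 y))))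
    (mulT (psumT 2 y) (psumT 2 y))

theorem trunc_f8 {y : Pt 0 → Fin 6 → ℂ} {t : Fin 6 → List (List ℤ)}
    (h : ∀ a, Trunc (fun w => y w a) (t a)) : Trunc (fun w => f8 (y w)) (f8T t) := by
  refine ((trunc_psum h 3).lin ((trunc_psum h 1).mul (trunc_psum h 1)) 4 (-1)).congr fun w => ?_
  rw [f8]
  push_cast
  ring

theorem trunc_f10 {y : Pt 0 → Fin 6 → ℂ} {t : Fin 6 → List (List ℤ)}
    (h : ∀ a, Trunc (fun w => y w a) (t a)) : Trunc (fun w => f10 (y w)) (f10T t) := by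
  refine ((trunc_esum h).lin ((trunc_psum h 1).mul (trunc_psum h 2)) 12 1).congr fun w => ?_
  rw [f10]
  push_cast
  ring

theorem trunc_f12 {y : Pt 0 → Fin 6 → ℂ} {t : Fin 6 → List (List ℤ)}
    (h : ∀ a, Trunc (fun w => y w a) (t a)) : Trunc (fun w => f12 (y w)) (f12T t) := by
  have h2 := trunc_psum h 1
  refine (((trunc_psum h 5).lin (h2.mul (h2.mul h2)) 48 (-3)).lin
    ((trunc_psum h 2).mul (trunc_psum h 2)) 1 (-8)).congr fun w => ?_
  rw [f12]
  push_cast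
  ring

theorem f8T_values : lget (f8T (yT 0 0)) 0 0 = 0 ∧ lget (f8T (yT 1 1)) 4 4 = 2 ^ 18 * 3 ^ 4 * 16 := by
  decide +kernel

theorem f10T_values :
    lget (f10T (yT 0 0)) 0 0 = 0 ∧ lget (f10T (yT 1 0)) 4 4 = 2 ^ 18 * 3 ^ 5 * (-24) := by
  decide +kernel

theorem f12T_values : (lget (f12T (yT 0 0)) 0 0 = 0 ∧ lget (f12T (yT 0 0)) 4 0 = 0) ∧
    lget (f12T (yT 0 0)) 4 4 = 2 ^ 23 * 3 ^ 7 * 12 ∧ lget (f12T (yT 1 0)) 4 4 = 2 ^ 23 * 3 ^ 7 * 8 := by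
  decide +kernel

theorem coeff_trans_two {k : ℤ} {f : Pt 2 → ℂ} {c : Idx 2 → ℂ} (h : IsExp f c)
    (hf : Mod 2 k f) {n m : ℕ} {a b : ℤ} (hx : ((n, m, ![b, a]) : Idx 2) ∈ cone 2) :
    c (n, (n + m + a : ℤ).toNat, ![b, a + 2 * n]) = c (n, m, ![b, a]) := by
  have pos : ∀ x : cone 2, 0 ≤ (x.1.1 + x.1.2.1 + x.1.2.2 1 : ℤ) := fun x => by
    have := (abs_le.1 (abs_le_of_mem_cone x.2 1)).1
    linarith
  have key := h.coeff_comp (fun _ hw => transPt_mem hw 1) (hf.trans 1)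
    (E := fun x => ⟨(x.1.1, (x.1.1 + x.1.2.1 + x.1.2.2 1 : ℤ).toNat,
        ![x.1.2.2 0, x.1.2.2 1 + 2 * x.1.1]), by
      rw [mem_cone]
      have h1 := mem_cone.1 x.2
      simp only [Fin.sum_univ_two, Int.toNat_of_nonneg (pos x)] at h1 ⊢
      simp
      linarith⟩)
    (fun x y hxy => by
      have hp := pos x
      have hp' := pos y
      obtain ⟨⟨n, m, a⟩, hx⟩ := x
      obtain ⟨⟨n', m', a'⟩, hy⟩ := y
      simp only [Subtype.mk.injEq, Prod.mk.injEq] at hxy hp hp' ⊢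
      obtain ⟨rfl, h2, h3⟩ := hxy
      have h4 := congrFun h3 0
      have h5 := congrFun h3 1
      simp at h4 h5
      refine ⟨rfl, by omega, funext fun i => ?_⟩
      fin_cases i
      exacts [h4, h5])
    (fun x w => by
      have hp : (((x.1.1 + x.1.2.1 + x.1.2.2 1 : ℤ).toNat : ℕ) : ℂ) = x.1.1 + x.1.2.1 + x.1.2.2 1 := by
        have := Int.toNat_of_nonneg (pos x)
        exact_mod_cast congrArg (Int.cast (R := ℂ)) this
      simp only [ex, transPt, Fin.sum_univ_two, hp, Function.update_self]
      congr 2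
      simp
      ring)
  exact key ⟨_, hx⟩

/-- A form whose boundary coefficients vanish is a cusp form. -/
theorem Good.cusp {R : Subring ℂ} {k : ℤ} {f : Pt 2 → ℂ} {c : Idx 2 → ℂ} (hf : Good R k f) (h : IsExp f c)
    (h0 : ∀ n, c (n, 0, 0) = 0) (n m : ℕ) (a b : ℤ) (hs : a ^ 2 + b ^ 2 = 4 * n * m) :
    c (n, m, ![b, a]) = 0 := by
  induction hN : n + m using Nat.strong_induction_on generalizing n m a b with
  | _ N ih =>
    wlog hnm : n ≤ m generalizing n m
    · rw [← coeff_swap h hf.form.mod]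
      exact this m n (by rw [hs]; ring) (by omega) (by omega)
    rcases Nat.eq_zero_or_pos n with rfl | hn
    · have hs' : a ^ 2 + b ^ 2 = 0 := by simpa using hs
      have ha : a = 0 := (pow_eq_zero_iff two_ne_zero).1
        (by nlinarith [sq_nonneg a, sq_nonneg b] : a ^ 2 = 0)
      have hb : b = 0 := (pow_eq_zero_iff two_ne_zero).1
        (by nlinarith [sq_nonneg a, sq_nonneg b] : b ^ 2 = 0)
      subst ha hb
      rw [← coeff_swap h hf.form.mod, show (![0, 0] : Fin 2 → ℤ) = 0 by simp]
      exact h0 m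
    have step : ∀ a b : ℤ, a ^ 2 + b ^ 2 = 4 * n * m → a < -n → c (n, m, ![b, a]) = 0 := fun a b hs ha => by
      have hx : ((n, m, ![b, a]) : Idx 2) ∈ cone 2 := by
        rw [mem_cone]
        simp
        linarith
      have pos : 0 ≤ (n + m + a : ℤ) := by
        have := (abs_le.1 (abs_le_of_mem_cone hx 1)).1
        simp at this
        linarith
      rw [← coeff_trans_two h hf.form.mod hx]
      refine ih (n + (n + m + a : ℤ).toNat) (by omega) _ _ _ _ ?_ rfl
      rw [Int.toNat_of_nonneg pos]
      linarith
    have rot := coeff_rot h hf.rot n m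
    by_cases h1 : a < -n
    · exact step a b hs h1
    by_cases h2 : b < -n
    · rw [← rot]
      exact step b (-a) (by rw [← hs]; ring) h2
    by_cases h3 : (n : ℤ) < a
    · rw [← rot, ← rot]
      exact step (-a) (-b) (by rw [← hs]; ring) (by omega)
    by_cases h4 : (n : ℤ) < b
    · rw [← rot, ← rot, ← rot]
      exact step (-b) (- -a) (by rw [← hs]; ring) (by omega)
    have ha : a ^ 2 ≤ n ^ 2 := sq_le_sq' (by omega) (by omega)
    have hb : b ^ 2 ≤ n ^ 2 := sq_le_sq' (by omega) (by omega)
    have hn' : (0 : ℤ) < n := by exact_mod_cast hn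
    have hnm' : (n : ℤ) ≤ m := by exact_mod_cast hnm
    nlinarith

end HermMod

namespace HermMod
open Filter Topology

theorem IsExp.rowLevelOne {k : ℤ} {h : Pt 0 → ℂ} {c : Idx 0 → ℂ} (hc : IsExp h c) (hm : Mod 0 k h)
    (m : ℕ) : LevelOne k (row c m) := by
  obtain ⟨G, -, hG⟩ := row_levelOne hc hm m
  exact ⟨G, hG⟩

theorem LevelOne.eq_smul_dq {ψ : PowerSeries ℂ} (h : LevelOne 12 ψ) (h0 : PowerSeries.coeff 0 ψ = 0) :
    ψ = PowerSeries.coeff 1 ψ • dq := by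
  obtain ⟨φ, hφ, rfl⟩ := h.exists_dq_mul h0
  obtain ⟨r, hr⟩ : ∃ r : ℂ, φ = r • 1 := ⟨_, LevelOne.eq_of_zero (by simpa using hφ)⟩
  subst hr
  simp [coeff_one_dq]

theorem LevelOne.eq_zero_of_coeff {k : ℤ} {ψ : PowerSeries ℂ} (h : LevelOne k ψ) (hk : k < 24)
    (h0 : PowerSeries.coeff 0 ψ = 0) (h1 : PowerSeries.coeff 1 ψ = 0) : ψ = 0 := by
  obtain ⟨φ, hφ, rfl⟩ := h.exists_dq_pow_mul (C := 2) fun n hn => by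
    interval_cases n <;> assumption
  rw [hφ.eq_zero_of_neg (by push_cast; omega), mul_zero]

theorem Form.isExp_restrict {d : ℕ} {k : ℤ} {R : Subring ℂ} {f : Pt (d + 1) → ℂ} {c : Idx (d + 1) → ℂ}
    (hf : Form (d + 1) k R f) (h : IsExp f c) : IsExp (fun w => f (consPt 0 w)) (mom c 0) := by
  simpa using h.leadV hf.lead_zero

theorem Form.restrict {d : ℕ} {k : ℤ} {R : Subring ℂ} {f : Pt (d + 1) → ℂ}
    (hf : Form (d + 1) k R f) : Form d k R (fun w => f (consPt 0 w)) := by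
  simpa using hf.lead hf.lead_zero

/-- A form of weight less than twelve and rank 0 without constant term vanishes. -/
theorem rank_zero_eq_zero {k : ℤ} {h : Pt 0 → ℂ} {c : Idx 0 → ℂ} (hc : IsExp h c) (hm : Mod 0 k h)
    (hk : k < 12) (h0 : c (0, 0, 0) = 0) : c = 0 := by
  refine rank_zero_vanish hc hm (C := 1) (fun m hm' => ?_) (by simpa using hk)
  obtain rfl : m = 0 := by omega
  exact (hc.rowLevelOne hm 0).eq_zero_of_lt hk (by simpa [row] using h0)

theorem coeff_one_row_zero {k : ℤ} {h : Pt 0 → ℂ} {c : Idx 0 → ℂ} (hc : IsExp h c) (hm : Mod 0 k h)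
    (h0 : row c 0 = 0) : PowerSeries.coeff 0 (row c 1) = 0 :=
  coeff_row_symm hc hm (C := 1) (fun m hm' => by obtain rfl : m = 0 := by omega
                                                 exact h0) 0 (by norm_num)

/-- A form of weight less than twenty-four and rank 0 vanishes if its first coefficients do. -/
theorem rank_zero_eq_zero_of_coeff {k : ℤ} {h : Pt 0 → ℂ} {c : Idx 0 → ℂ} (hc : IsExp h c) (hm : Mod 0 k h)
    (hk : k < 24) (h0 : row c 0 = 0) (h1 : c (1, 1, 0) = 0) : c = 0 := by
  refine rank_zero_vanish hc hm (C := 2) (fun m hm' => ?_) (by simpa using hk)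
  interval_cases m
  · exact h0
  · exact (hc.rowLevelOne hm 1).eq_zero_of_coeff hk (coeff_one_row_zero hc hm h0)
      (by simpa [row] using h1)

theorem row_eq_smul_dq {h : Pt 0 → ℂ} {c : Idx 0 → ℂ} (hc : IsExp h c) (hm : Mod 0 12 h)
    (h0 : row c 0 = 0) : row c 1 = c (1, 1, 0) • dq := by
  rw [(hc.rowLevelOne hm 1).eq_smul_dq (coeff_one_row_zero hc hm h0)]
  simp [row]

theorem mom_one_eq_zero {d : ℕ} {k : ℤ} {g : Pt (d + 1) → ℂ} {c : Idx (d + 1) → ℂ} (h : IsExp g c)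
    (hg : Mod (d + 1) k g) (h0 : mom c 0 = 0) : mom c 1 = 0 := by
  obtain ⟨g', hg', hl⟩ := h.lead (J := 1) fun l hl => by
    obtain rfl : l = 0 := by omega
    exact h0
  have := hg'.eq_zero (hl.eq_zero_of_odd hg odd_one)
  funext y
  simpa using congrFun this y

/-- Forms of rank 1 and small weight without constant term vanish. -/
theorem rank_one_eq_zero {k : ℤ} {g : Pt 1 → ℂ} {c : Idx 1 → ℂ} (h : IsExp g c)
    {R : Subring ℂ} (hg : Form 1 k R g) (hk : k < 10) (h0 : c 0 = 0) : c = 0 := by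
  have hm : mom c 0 = 0 := by
    refine rank_zero_eq_zero (hg.isExp_restrict h) hg.restrict.mod (by omega) ?_
    simp [mom, consIdx]
    convert h0 using 1
    congr 3
    ext i
    fin_cases i
    rfl
  refine rank_one_vanish h hg.mod (B := 2) (fun l hl => ?_) (by simpa using hk)
  interval_cases l
  exacts [hm, mom_one_eq_zero h hg.mod hm]

theorem rank_one_lead {k : ℤ} {g : Pt 1 → ℂ} {c : Idx 1 → ℂ} (h : IsExp g c) {R : Subring ℂ}
    (hg : Form 1 k R g) (h0 : mom c 0 = 0) : ∃ g', LeadV 2 g g' ∧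
      IsExp g' (fun y => mom c 2 y / (2 : ℕ).factorial) ∧ Mod 0 (k + 2) g' ∧
      row (fun y => mom c 2 y / (2 : ℕ).factorial) 0 = 0 := by
  have hB : ∀ l < 2, mom c l = 0 := fun l hl => by
    interval_cases l
    exacts [h0, mom_one_eq_zero h hg.mod h0]
  obtain ⟨g', hg', hl⟩ := h.lead hB
  exact ⟨g', hl, hg', hl.mod hg.mod, row_mom_eq_zero h hg.mod hB (by norm_num) 2 _⟩

theorem rank_one_eq_zero_of_mom {k : ℤ} {g : Pt 1 → ℂ} {c : Idx 1 → ℂ} (h : IsExp g c) {R : Subring ℂ}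
    (hg : Form 1 k R g) (hk : k < 15) (h0 : mom c 0 = 0) (h2 : mom c 2 (1, 1, 0) = 0) : c = 0 := by
  obtain ⟨g', hl, hg', hm, hr⟩ := rank_one_lead h hg h0
  have := rank_zero_eq_zero_of_coeff hg' hm (by omega) hr (by rw [h2, zero_div])
  refine rank_one_vanish h hg.mod (B := 3) (fun l hl => ?_) (by simpa using hk)
  interval_cases l
  · exact h0
  · exact mom_one_eq_zero h hg.mod h0
  · funext y
    simpa using congrFun this y

theorem row_mom_zero {c : Idx 1 → ℂ} (hc : ∀ x, c x ≠ 0 → x ∈ cone 1)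
    (h0 : ∀ n, c (n, 0, 0) = 0) (l : ℕ) : row (mom c l) 0 = 0 := by
  ext n
  rw [row, PowerSeries.coeff_mk, mom, map_zero]
  refine Finset.sum_eq_zero fun b _ => mul_eq_zero_of_right _ ?_
  by_contra hb
  have := hc _ hb
  rw [mem_cone] at this
  simp [consIdx] at this
  refine hb ?_
  rw [← h0 n, this, consIdx]
  congr 3
  ext i
  fin_cases i
  rfl

theorem weight_ten_vanish {g : Pt 1 → ℂ} {c : Idx 1 → ℂ} (h : IsExp g c) {R : Subring ℂ}
    (hg : Form 1 10 R g) (h0 : ∀ n, c (n, 0, 0) = 0) : mom c 0 = 0 ∧ (mom c 2 (1, 1, 0) = 0 → c = 0) := by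
  have hr := row_mom_zero h.supp h0 0
  have hm : mom c 0 = 0 := by
    refine rank_zero_eq_zero (hg.isExp_restrict h) hg.restrict.mod (by norm_num) ?_
    simpa [row] using congrArg (PowerSeries.coeff 0) hr
  exact ⟨hm, rank_one_eq_zero_of_mom h hg (by norm_num) hm⟩

theorem weight_twelve_vanish {g : Pt 1 → ℂ} {c : Idx 1 → ℂ} (h : IsExp g c) {R : Subring ℂ}
    (hg : Form 1 12 R g) (h0 : ∀ n, c (n, 0, 0) = 0) (h1 : mom c 0 (1, 1, 0) = 0) : c = 0 := by
  have hr := row_mom_zero h.supp h0 0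
  have hm : mom c 0 = 0 :=
    rank_zero_eq_zero_of_coeff (hg.isExp_restrict h) hg.restrict.mod (by norm_num) hr h1
  refine rank_one_eq_zero_of_mom h hg (by norm_num) hm ?_
  obtain ⟨g', -, hg', hm', hr'⟩ := rank_one_lead h hg hm
  obtain ⟨φ, hφ, he⟩ := (hg'.rowLevelOne hm' 1).exists_dq_mul (coeff_one_row_zero hg' hm' hr')
  have hz : φ = 0 := LevelOne.eq_zero_of_two (by simpa using hφ)
  rw [hz, mul_zero] at he
  simpa [row] using congrArg (PowerSeries.coeff 1) he

/-- The coefficients of a cusp form at the indices with unit diagonal. -/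
theorem Good.unit_diag {R : Subring ℂ} {k : ℤ} {f : Pt 2 → ℂ} {c : Idx 2 → ℂ} (hf : Good R k f)
    (h : IsExp f c) (h0 : ∀ n, c (n, 0, 0) = 0) (a b : ℤ) :
    c (1, 1, ![b, a]) = if a ^ 2 + b ^ 2 = 0 then c (1, 1, ![0, 0]) else
      if a ^ 2 + b ^ 2 = 1 then c (1, 1, ![0, 1]) else
        if a ^ 2 + b ^ 2 = 2 then c (1, 1, ![-1, -1]) else 0 := by
  by_cases h4 : a ^ 2 + b ^ 2 = 4
  · rw [hf.cusp h h0 1 1 a b (by simpa using h4)]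
    simp [h4]
  by_cases h5 : a ^ 2 + b ^ 2 ≤ 4
  · have rot := coeff_rot h hf.rot 1 1
    have ha : a ≤ 2 := by nlinarith
    have ha' : -2 ≤ a := by nlinarith
    have hb : b ≤ 2 := by nlinarith
    have hb' : -2 ≤ b := by nlinarith
    have r1 := rot 1 0
    have r2 := rot 0 1
    have r4 := rot 0 (-1)
    have r5 := rot 1 1
    have r6 := rot 1 (-1)
    have r7 := rot (-1) 1
    norm_num at r1 r2 r4 r5 r6 r7
    have q4 := r4.trans r1
    have q5 := r5.symm.trans r6.symm
    have q7 := r7.symm.trans q5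
    interval_cases a <;> interval_cases b <;>
      first
        | exact absurd h5 (by decide)
        | exact absurd (by decide) h4
        | simp [r1, r2.symm, q4, r6.symm, q5, q7]
  · have : c (1, 1, ![b, a]) = 0 := by
      by_contra hn
      have := h.supp _ hn
      rw [mem_cone] at this
      simp at this
      omega
    rw [this, if_neg (by omega), if_neg (by omega), if_neg (by omega)]

end HermMod

namespace HermMod
open Filter Topology

theorem consIdx_consIdx (a b : ℤ) (n m : ℕ) :
    consIdx b (consIdx a ((n, m, 0) : Idx 0)) = (n, m, ![b, a]) := by
  simp only [consIdx]
  congr 2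
  ext i
  fin_cases i <;> rfl

theorem mom_mom_apply (c : Idx 2 → ℂ) (i j n m : ℕ) : mom (mom c i) j (n, m, 0)
    = ∑ a ∈ Finset.Icc (-((n : ℤ) + m)) (n + m), ∑ b ∈ Finset.Icc (-((n : ℤ) + m)) (n + m),
      (a : ℂ) ^ j * ((b : ℂ) ^ i * c (n, m, ![b, a])) := by
  simp only [mom, Finset.mul_sum]
  refine Finset.sum_congr rfl fun a _ => ?_
  refine Finset.sum_congr rfl fun b _ => ?_
  rw [consIdx_consIdx]

theorem sum_boundary {c : Idx 2 → ℂ} (hc : ∀ x, c x ≠ 0 → x ∈ cone 2) (n : ℕ) (g : ℤ → ℤ → ℂ → ℂ)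
    (hg : ∀ a b, g a b 0 = 0) :
    ∑ a ∈ Finset.Icc (-((n : ℤ) + (0 : ℕ))) (n + (0 : ℕ)), ∑ b ∈ Finset.Icc (-((n : ℤ) + (0 : ℕ))) (n + (0 : ℕ)),
      g a b (c (n, 0, ![b, a])) = g 0 0 (c (n, 0, 0)) := by
  have key : ∀ a b : ℤ, ¬ (a = 0 ∧ b = 0) → c (n, 0, ![b, a]) = 0 := fun a b hab => by
    by_contra h
    have := hc _ h
    rw [mem_cone] at this
    simp at this
    refine hab ⟨?_, ?_⟩ <;> nlinarith [sq_nonneg a, sq_nonneg b]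
  rw [Finset.sum_eq_single 0, Finset.sum_eq_single 0]
  · congr 4
    simp
  · intro b _ hb
    rw [key 0 b (by tauto), hg]
  · intro h
    simp at h
  · intro a _ ha
    refine Finset.sum_eq_zero fun b _ => ?_
    rw [key a b (by tauto), hg]
  · intro h
    simp at h

theorem mom_mom_boundary {c : Idx 2 → ℂ} (hc : ∀ x, c x ≠ 0 → x ∈ cone 2) (n : ℕ) :
    mom (mom c 0) 0 (n, 0, 0) = c (n, 0, 0) := by
  rw [mom_mom_apply, sum_boundary hc n (fun a b x => (a : ℂ) ^ 0 * ((b : ℂ) ^ 0 * x)) (by simp)]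
  simp

theorem Good.boundary_of_lt {R : Subring ℂ} {k : ℤ} {f : Pt 2 → ℂ} {c : Idx 2 → ℂ} (hf : Good R k f)
    (h : IsExp f c) (hk : k < 12) (h0 : c (0, 0, 0) = 0) (n : ℕ) : c (n, 0, 0) = 0 := by
  rw [← mom_mom_boundary h.supp] at h0 ⊢
  rw [rank_zero_eq_zero (hf.form.restrict.isExp_restrict (hf.form.isExp_restrict h))
    hf.form.restrict.restrict.mod hk h0]
  rfl

theorem Good.boundary_of_twelve {R : Subring ℂ} {f : Pt 2 → ℂ} {c : Idx 2 → ℂ} (hf : Good R 12 f)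
    (h : IsExp f c) (h0 : c (0, 0, 0) = 0) (h1 : c (1, 0, 0) = 0) (n : ℕ) : c (n, 0, 0) = 0 := by
  rw [← mom_mom_boundary h.supp] at h0 h1 ⊢
  have := ((hf.form.restrict.isExp_restrict (hf.form.isExp_restrict h)).rowLevelOne
    hf.form.restrict.restrict.mod 0).eq_zero_of_coeff (by norm_num) (by simpa [row] using h0)
    (by simpa [row] using h1)
  simpa [row] using congrArg (PowerSeries.coeff n) this

theorem exp_half (x : ℤ) : cexp (2 * Real.pi * I * (x / 2)) = (-1) ^ x := by
  rw [← Complex.exp_pi_mul_I, ← Complex.exp_int_mul]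
  congr 1
  ring

/-- The fibre of the degeneration map. -/
def fibreEquiv (n m : ℕ) :
    ℤ × ℤ ≃ (fun x : Idx 2 => ((x.1, x.2.1, 0) : Idx 0)) ⁻¹' {(n, m, 0)} where
  toFun p := ⟨(n, m, ![p.2, p.1]), rfl⟩
  invFun x := (x.1.2.2 1, x.1.2.2 0)
  left_inv p := rfl
  right_inv x := by
    obtain ⟨⟨n', m', a⟩, hx⟩ := x
    simp only [Set.mem_preimage, Set.mem_singleton_iff, Prod.mk.injEq] at hx
    obtain ⟨rfl, rfl, -⟩ := hx
    ext1
    simp only [Prod.mk.injEq, true_and]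
    ext i
    fin_cases i <;> rfl

theorem fibreEquiv_apply (n m : ℕ) (p : ℤ × ℤ) : (fibreEquiv n m p : Idx 2) = (n, m, ![p.2, p.1]) := rfl

theorem trunc_value {f : Pt 2 → ℂ} {c : Idx 2 → ℂ} (h : IsExp f c) {r s : ℤ} {t : List (List ℤ)}
    (ht : Trunc (fun w => f (sp r s w)) t) {n m : ℕ} (hn : n ≤ 1) (hm : m ≤ 1) :
    ∑ a ∈ Finset.Icc (-((n : ℤ) + m)) (n + m), ∑ b ∈ Finset.Icc (-((n : ℤ) + m)) (n + m),
      c (n, m, ![b, a]) * (-1) ^ (r * a + s * b) = (lget t (4 * n) (4 * m) : ℂ) := by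
  obtain ⟨c', h', hc'⟩ := ht
  have h1 := ((h.spec ![(s : ℝ) / 2, (r : ℝ) / 2]).dilate (N := 4) (by norm_num))
  rw [← hc' (4 * n) (by omega) (4 * m) (by omega), IsExp.unique h' h1]
  have e : ((4 * n, 4 * m, 0) : Idx 0) = 4 • (n, m, 0) := by
    ext i
    · simp
    · simp
    · exact i.elim0
  rw [e, (nsmul_injective_idx (d := 0) (N := 4) (by norm_num)).extend_apply,
    ← (fibreEquiv n m).tsum_eq, ← Finset.sum_product', tsum_eq_sum]
  · refine Finset.sum_congr rfl fun p _ => ?_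
    simp only [fibreEquiv_apply]
    congr 1
    rw [← exp_half]
    congr 2
    simp [Fin.sum_univ_two]
    ring
  · intro p hp
    by_contra hne
    have := h.supp _ (left_ne_zero_of_mul hne)
    have b0 := abs_le.1 (abs_le_of_mem_cone this 0)
    have b1 := abs_le.1 (abs_le_of_mem_cone this 1)
    simp only [fibreEquiv_apply, Matrix.cons_val_zero, Matrix.cons_val_one] at b0 b1
    refine hp ?_
    simp only [Finset.mem_product, Finset.mem_Icc]
    exact ⟨b1, b0⟩

theorem Icc_two : Finset.Icc (-(((1 : ℕ) : ℤ) + (1 : ℕ))) ((1 : ℕ) + (1 : ℕ)) = {-2, -1, 0, 1, 2} := by decide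

/-- Sums over the coefficients of a cusp form with unit diagonal. -/
theorem Good.sum_unit_diag {R : Subring ℂ} {k : ℤ} {f : Pt 2 → ℂ} {c : Idx 2 → ℂ} (hf : Good R k f)
    (h : IsExp f c) (h0 : ∀ n, c (n, 0, 0) = 0) (g : ℤ → ℤ → ℂ) :
    ∑ a ∈ Finset.Icc (-(((1 : ℕ) : ℤ) + (1 : ℕ))) ((1 : ℕ) + (1 : ℕ)),
      ∑ b ∈ Finset.Icc (-(((1 : ℕ) : ℤ) + (1 : ℕ))) ((1 : ℕ) + (1 : ℕ)), g a b * c (1, 1, ![b, a])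
    = g 0 0 * c (1, 1, ![0, 0]) + (g 0 1 + g 0 (-1) + g 1 0 + g (-1) 0) * c (1, 1, ![0, 1])
      + (g 1 1 + g 1 (-1) + g (-1) 1 + g (-1) (-1)) * c (1, 1, ![-1, -1]) := by
  have hu := hf.unit_diag h h0
  generalize c (1, 1, ![0, 0]) = δ at hu ⊢
  generalize c (1, 1, ![0, 1]) = β at hu ⊢
  generalize c (1, 1, ![-1, -1]) = γ at hu ⊢
  rw [Icc_two]
  simp [hu]
  ring

theorem Good.mom_mom_unit {R : Subring ℂ} {k : ℤ} {f : Pt 2 → ℂ} {c : Idx 2 → ℂ} (hf : Good R k f)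
    (h : IsExp f c) (h0 : ∀ n, c (n, 0, 0) = 0) :
    mom (mom c 0) 0 (1, 1, 0) = c (1, 1, ![0, 0]) + 4 * c (1, 1, ![0, 1]) + 4 * c (1, 1, ![-1, -1]) ∧
    mom (mom c 0) 2 (1, 1, 0) = 2 * c (1, 1, ![0, 1]) + 4 * c (1, 1, ![-1, -1]) ∧
    mom (mom c 2) 2 (1, 1, 0) = 4 * c (1, 1, ![-1, -1]) := by
  have key : ∀ i j, mom (mom c i) j (1, 1, 0) =
      ((0 : ℤ) : ℂ) ^ j * ((0 : ℤ) : ℂ) ^ i * c (1, 1, ![0, 0]) +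
      (((0 : ℤ) : ℂ) ^ j * ((1 : ℤ) : ℂ) ^ i + ((0 : ℤ) : ℂ) ^ j * ((-1 : ℤ) : ℂ) ^ i +
        ((1 : ℤ) : ℂ) ^ j * ((0 : ℤ) : ℂ) ^ i + ((-1 : ℤ) : ℂ) ^ j * ((0 : ℤ) : ℂ) ^ i) *
        c (1, 1, ![0, 1]) +
      (((1 : ℤ) : ℂ) ^ j * ((1 : ℤ) : ℂ) ^ i + ((1 : ℤ) : ℂ) ^ j * ((-1 : ℤ) : ℂ) ^ i +
        ((-1 : ℤ) : ℂ) ^ j * ((1 : ℤ) : ℂ) ^ i + ((-1 : ℤ) : ℂ) ^ j * ((-1 : ℤ) : ℂ) ^ i) *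
        c (1, 1, ![-1, -1]) := fun i j => by
    rw [mom_mom_apply]
    simp only [← mul_assoc]
    exact hf.sum_unit_diag h h0 (fun a b => (a : ℂ) ^ j * (b : ℂ) ^ i)
  rw [key, key, key]
  norm_num

theorem Good.trunc_unit {R : Subring ℂ} {k : ℤ} {f : Pt 2 → ℂ} {c : Idx 2 → ℂ} (hf : Good R k f)
    (h : IsExp f c) (h0 : ∀ n, c (n, 0, 0) = 0) {t : List (List ℤ)} :
    (Trunc (fun w => f (sp 0 0 w)) t →
      c (1, 1, ![0, 0]) + 4 * c (1, 1, ![0, 1]) + 4 * c (1, 1, ![-1, -1]) = lget t 4 4) ∧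
    (Trunc (fun w => f (sp 1 0 w)) t → c (1, 1, ![0, 0]) - 4 * c (1, 1, ![-1, -1]) = lget t 4 4) ∧
    (Trunc (fun w => f (sp 1 1 w)) t →
      c (1, 1, ![0, 0]) - 4 * c (1, 1, ![0, 1]) + 4 * c (1, 1, ![-1, -1]) = lget t 4 4) := by
  have key : ∀ r s : ℤ, Trunc (fun w => f (sp r s w)) t →
      (-1) ^ (r * 0 + s * 0) * c (1, 1, ![0, 0]) +
      ((-1) ^ (r * 0 + s * 1) + (-1) ^ (r * 0 + s * (-1)) + (-1) ^ (r * 1 + s * 0) +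
        (-1) ^ (r * (-1) + s * 0)) * c (1, 1, ![0, 1]) +
      ((-1) ^ (r * 1 + s * 1) + (-1) ^ (r * 1 + s * (-1)) + (-1) ^ (r * (-1) + s * 1) +
        (-1) ^ (r * (-1) + s * (-1))) * c (1, 1, ![-1, -1]) = (lget t 4 4 : ℂ) := fun r s ht => by
    have := trunc_value h ht le_rfl le_rfl
    simp only [mul_comm (c _)] at this
    rw [hf.sum_unit_diag h h0 (fun a b => (-1) ^ (r * a + s * b))] at this
    exact this
  refine ⟨fun ht => ?_, fun ht => ?_, fun ht => ?_⟩ <;> rw [← key _ _ ht] <;>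
    norm_num [_root_.zpow_neg, _root_.zpow_two] <;> ring

theorem trunc_boundary {f : Pt 2 → ℂ} {c : Idx 2 → ℂ} (h : IsExp f c) {t : List (List ℤ)}
    (ht : Trunc (fun w => f (sp 0 0 w)) t) {n : ℕ} (hn : n ≤ 1) : c (n, 0, 0) = lget t (4 * n) 0 := by
  have := trunc_value h ht hn (Nat.zero_le 1)
  rw [sum_boundary h.supp n (fun a b x => x * (-1) ^ (0 * a + 0 * b)) (by simp)] at this
  simpa using this

end HermMod

namespace HermMod
open Filter Topology

theorem consIdx_zero_boundary {d : ℕ} (n : ℕ) : consIdx (d := d) 0 (n, 0, 0) = (n, 0, 0) := by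
  refine Prod.ext rfl (Prod.ext rfl ?_)
  ext i
  refine Fin.cases ?_ (fun j => ?_) i <;> simp [consIdx]

theorem mom_boundary {d : ℕ} {c : Idx (d + 1) → ℂ} (hs : ∀ x, c x ≠ 0 → x ∈ cone (d + 1))
    (n : ℕ) : mom c 0 (n, 0, 0) = c (n, 0, 0) := by
  rw [mom, Finset.sum_eq_single 0]
  · rw [consIdx_zero_boundary]; simp
  · intro b _ hb
    have : c (consIdx b (n, 0, 0)) = 0 := by
      by_contra h
      have h1 := mem_cone.1 (hs _ h)
      simp only [consIdx, Fin.sum_univ_succ, Fin.cons_zero, Fin.cons_succ] at h1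
      simp at h1
      exact hb h1
    rw [this, mul_zero]
  · intro h
    exact absurd (by simp) h

/-- A rescaling of a form by an invertible constant. -/
theorem Good.exists_rescale {R : Subring ℂ} {k : ℤ} {f : Pt 2 → ℂ} (hf : Good R k f) {r : ℂ}
    (hr : r ∈ R) {c : Idx 2 → ℂ} (h : IsExp f c) :
    Good R k (r • f) ∧ IsExp (r • f) (r • c) ∧ ∀ x, (r • c) x ∈ R := by
  obtain ⟨c', h', hc'⟩ := hf.form.exp
  rw [← h.unique h'] at hc'
  exact ⟨hf.smul hr, h.smul r, fun x => mul_mem hr (hc' x)⟩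

theorem exists_chi_eight {R : Subring ℂ} (h6 : (6 : ℂ)⁻¹ ∈ R) : ∃ (f : Pt 2 → ℂ) (c : Idx 2 → ℂ),
    Good R 8 f ∧ IsExp f c ∧ (∀ x, c x ∈ R) ∧ (∀ n, c (n, 0, 0) = 0) ∧ mom c 0 = 0 ∧
      c (1, 1, ![-1, -1]) = 1 ∧ Lead3 2 2 1 f dq := by
  have hf0 : Good R 8 (fun w => f8 (yv (xv w))) := (symOp_f8 R).good
  obtain ⟨c0, h0, -⟩ := hf0.form.exp
  have b0 : c0 (0, 0, 0) = 0 := by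
    have := trunc_boundary h0 (trunc_f8 (trunc_yv (by simp))) (n := 0) (by norm_num)
    rwa [mul_zero, f8T_values.1, Int.cast_zero] at this
  have v := (hf0.trunc_unit h0 (hf0.boundary_of_lt h0 (by norm_num) b0)).2.2
    (trunc_f8 (trunc_yv (by simp)))
  rw [f8T_values.2] at v
  have hr : ((2 : ℂ) ^ 18 * 3 ^ 4)⁻¹ ∈ R := by
    have : ((2 : ℂ) ^ 18 * 3 ^ 4)⁻¹ = (6 : ℂ)⁻¹ ^ 18 * ((3 ^ 14 : ℕ) : ℂ) := by norm_num
    rw [this]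
    exact mul_mem (pow_mem h6 _) (natCast_mem R _)
  obtain ⟨hf, h, hR⟩ := hf0.exists_rescale hr h0
  refine ⟨_, _, hf, h, hR, ?_⟩
  have w : ∀ x, (((2 : ℂ) ^ 18 * 3 ^ 4)⁻¹ • c0) x = ((2 : ℂ) ^ 18 * 3 ^ 4)⁻¹ * c0 x := fun _ => rfl
  have v' : (((2 : ℂ) ^ 18 * 3 ^ 4)⁻¹ • c0) (1, 1, ![0, 0])
      - 4 * (((2 : ℂ) ^ 18 * 3 ^ 4)⁻¹ • c0) (1, 1, ![0, 1])
      + 4 * (((2 : ℂ) ^ 18 * 3 ^ 4)⁻¹ • c0) (1, 1, ![-1, -1]) = 16 := by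
    rw [w, w, w]
    push_cast at v
    linear_combination ((2 : ℂ) ^ 18 * 3 ^ 4)⁻¹ * v
  have b : (((2 : ℂ) ^ 18 * 3 ^ 4)⁻¹ • c0) (0, 0, 0) = 0 := by rw [w, b0, mul_zero]
  clear w
  generalize ((2 : ℂ) ^ 18 * 3 ^ 4)⁻¹ • c0 = c at *
  generalize ((2 : ℂ) ^ 18 * 3 ^ 4)⁻¹ • (fun w => f8 (yv (xv w))) = f at *
  have bd := hf.boundary_of_lt h (by norm_num) b
  have m0 : mom c 0 = 0 := rank_one_eq_zero (hf.form.isExp_restrict h) hf.form.restrict (by norm_num)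
    ((mom_boundary h.supp 0).trans b)
  have mm := hf.mom_mom_unit h bd
  rw [m0] at mm
  have z : ∀ l y, mom (0 : Idx 1 → ℂ) l y = 0 := fun l y => by simp [mom]
  rw [z, z] at mm
  have hg : c (1, 1, ![-1, -1]) = 1 := by
    linear_combination (v' + mm.1 - 4 * mm.2.1) / 16
  refine ⟨bd, m0, hg, ?_⟩
  have m1 := mom_one_eq_zero h hf.form.mod m0
  have hJ : ∀ l < 2, mom c l = 0 := fun l hl => by interval_cases l <;> assumption
  obtain ⟨g, hg1, hl1⟩ := h.lead hJ
  have hJ' := fun l hl => mom_mom_eq_zero h hf.rot hJ ((2 : ℕ).factorial) l hl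
  obtain ⟨g', hg2, hl2⟩ := hg1.lead hJ'
  have gm : Mod 1 (8 + (2 : ℕ)) g := hl1.mod hf.form.mod
  have gm' : Mod 0 (8 + (2 : ℕ) + (2 : ℕ)) g' := hl2.mod gm
  have r0 := row_mom_eq_zero (m := 0) hg1 gm hJ' (by norm_num) 2 ((2 : ℕ).factorial)
  refine ⟨g, g', _, hl1, hl2, hg2, fun m hm => ?_, ?_⟩
  · obtain rfl : m = 0 := by omega
    exact r0
  · rw [row_eq_smul_dq hg2 (by convert gm' using 1; norm_num) r0]
    have : mom (fun y => mom c 2 y / ((2 : ℕ).factorial : ℂ)) 2 (1, 1, 0)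
        = mom (mom c 2) 2 (1, 1, 0) / 2 := by
      simp only [mom, Finset.sum_div]
      refine Finset.sum_congr rfl fun b _ => ?_
      rw [mul_div_assoc, Finset.sum_div]
      simp [Nat.factorial]
    rw [this, mm.2.2, hg]
    norm_num [Nat.factorial]

theorem exists_f_ten {R : Subring ℂ} (h6 : (6 : ℂ)⁻¹ ∈ R) : ∃ (f : Pt 2 → ℂ) (c : Idx 2 → ℂ),
    Good R 10 f ∧ IsExp f c ∧ (∀ x, c x ∈ R) ∧ (∀ n, c (n, 0, 0) = 0) ∧
      mom (mom c 0) 2 (1, 1, 0) = 12 ∧ Lead3 0 2 1 f ((6 : ℂ) • dq) := by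
  have hf0 : Good R 10 (fun w => f10 (yv (xv w))) := (symOp_f10 R).good
  obtain ⟨c0, h0, -⟩ := hf0.form.exp
  have b0 : c0 (0, 0, 0) = 0 := by
    have := trunc_boundary h0 (trunc_f10 (trunc_yv (by simp))) (n := 0) (by norm_num)
    rwa [mul_zero, f10T_values.1, Int.cast_zero] at this
  have v := (hf0.trunc_unit h0 (hf0.boundary_of_lt h0 (by norm_num) b0)).2.1
    (trunc_f10 (trunc_yv (by simp)))
  rw [f10T_values.2] at v
  have hr : ((2 : ℂ) ^ 18 * 3 ^ 5)⁻¹ ∈ R := by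
    have : ((2 : ℂ) ^ 18 * 3 ^ 5)⁻¹ = (6 : ℂ)⁻¹ ^ 18 * ((3 ^ 13 : ℕ) : ℂ) := by norm_num
    rw [this]
    exact mul_mem (pow_mem h6 _) (natCast_mem R _)
  obtain ⟨hf, h, hR⟩ := hf0.exists_rescale hr h0
  refine ⟨_, _, hf, h, hR, ?_⟩
  have w : ∀ x, (((2 : ℂ) ^ 18 * 3 ^ 5)⁻¹ • c0) x = ((2 : ℂ) ^ 18 * 3 ^ 5)⁻¹ * c0 x := fun _ => rfl
  have v' : (((2 : ℂ) ^ 18 * 3 ^ 5)⁻¹ • c0) (1, 1, ![0, 0])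
      - 4 * (((2 : ℂ) ^ 18 * 3 ^ 5)⁻¹ • c0) (1, 1, ![-1, -1]) = -24 := by
    rw [w, w]
    push_cast at v
    linear_combination ((2 : ℂ) ^ 18 * 3 ^ 5)⁻¹ * v
  have b : (((2 : ℂ) ^ 18 * 3 ^ 5)⁻¹ • c0) (0, 0, 0) = 0 := by rw [w, b0, mul_zero]
  clear w
  generalize ((2 : ℂ) ^ 18 * 3 ^ 5)⁻¹ • c0 = c at *
  generalize ((2 : ℂ) ^ 18 * 3 ^ 5)⁻¹ • (fun w => f10 (yv (xv w))) = f at *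
  have bd := hf.boundary_of_lt h (by norm_num) b
  have hr1 := hf.form.isExp_restrict h
  have m0 : mom (mom c 0) 0 = 0 := (weight_ten_vanish hr1 hf.form.restrict
    fun n => (mom_boundary h.supp n).trans (bd n)).1
  have mm := hf.mom_mom_unit h bd
  rw [m0] at mm
  have m2 : mom (mom c 0) 2 (1, 1, 0) = 12 := by
    have h1 : (0 : ℂ) = _ := mm.1
    linear_combination mm.2.1 - h1 / 2 - v' / 2
  refine ⟨bd, m2, ?_⟩
  obtain ⟨g', hl, hg', hm', r0⟩ := rank_one_lead hr1 hf.form.restrict m0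
  refine ⟨_, g', _, hf.form.lead_zero, hl, hg', fun m hm => ?_, ?_⟩
  · obtain rfl : m = 0 := by omega
    exact r0
  · rw [row_eq_smul_dq hg' (by convert hm' using 1; norm_num) r0]
    simp only [m2]
    norm_num [Nat.factorial]

theorem exists_f_twelve {R : Subring ℂ} (h6 : (6 : ℂ)⁻¹ ∈ R) : ∃ (f : Pt 2 → ℂ) (c : Idx 2 → ℂ),
    Good R 12 f ∧ IsExp f c ∧ (∀ x, c x ∈ R) ∧ (∀ n, c (n, 0, 0) = 0) ∧
      mom (mom c 0) 0 (1, 1, 0) = 12 ∧ mom (mom c 0) 2 (1, 1, 0) = 2 ∧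
      Lead3 0 0 1 f ((12 : ℂ) • dq) := by
  have hf0 : Good R 12 (fun w => f12 (yv (xv w))) := (symOp_f12 R).good
  obtain ⟨c0, h0, -⟩ := hf0.form.exp
  have b0 : c0 (0, 0, 0) = 0 := by
    have := trunc_boundary h0 (trunc_f12 (trunc_yv (by simp))) (n := 0) (by norm_num)
    rwa [mul_zero, f12T_values.1.1, Int.cast_zero] at this
  have b1 : c0 (1, 0, 0) = 0 := by
    have := trunc_boundary h0 (trunc_f12 (trunc_yv (by simp))) (n := 1) (by norm_num)
    rwa [mul_one, f12T_values.1.2, Int.cast_zero] at this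
  have v := hf0.trunc_unit h0 (hf0.boundary_of_twelve h0 b0 b1) (t := f12T (yT 0 0))
  have v1 := v.1 (trunc_f12 (trunc_yv (by simp)))
  have v := hf0.trunc_unit h0 (hf0.boundary_of_twelve h0 b0 b1) (t := f12T (yT 1 0))
  have v2 := v.2.1 (trunc_f12 (trunc_yv (by simp)))
  rw [f12T_values.2.1] at v1
  rw [f12T_values.2.2] at v2
  have hr : ((2 : ℂ) ^ 23 * 3 ^ 7)⁻¹ ∈ R := by
    have : ((2 : ℂ) ^ 23 * 3 ^ 7)⁻¹ = (6 : ℂ)⁻¹ ^ 23 * ((3 ^ 16 : ℕ) : ℂ) := by norm_num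
    rw [this]
    exact mul_mem (pow_mem h6 _) (natCast_mem R _)
  obtain ⟨hf, h, hR⟩ := hf0.exists_rescale hr h0
  refine ⟨_, _, hf, h, hR, ?_⟩
  have w : ∀ x, (((2 : ℂ) ^ 23 * 3 ^ 7)⁻¹ • c0) x = ((2 : ℂ) ^ 23 * 3 ^ 7)⁻¹ * c0 x := fun _ => rfl
  have v1' : (((2 : ℂ) ^ 23 * 3 ^ 7)⁻¹ • c0) (1, 1, ![0, 0])
      + 4 * (((2 : ℂ) ^ 23 * 3 ^ 7)⁻¹ • c0) (1, 1, ![0, 1])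
      + 4 * (((2 : ℂ) ^ 23 * 3 ^ 7)⁻¹ • c0) (1, 1, ![-1, -1]) = 12 := by
    rw [w, w, w]
    push_cast at v1
    linear_combination ((2 : ℂ) ^ 23 * 3 ^ 7)⁻¹ * v1
  have v2' : (((2 : ℂ) ^ 23 * 3 ^ 7)⁻¹ • c0) (1, 1, ![0, 0])
      - 4 * (((2 : ℂ) ^ 23 * 3 ^ 7)⁻¹ • c0) (1, 1, ![-1, -1]) = 8 := by
    rw [w, w]
    push_cast at v2
    linear_combination ((2 : ℂ) ^ 23 * 3 ^ 7)⁻¹ * v2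
  have b : (((2 : ℂ) ^ 23 * 3 ^ 7)⁻¹ • c0) (0, 0, 0) = 0 := by rw [w, b0, mul_zero]
  have b' : (((2 : ℂ) ^ 23 * 3 ^ 7)⁻¹ • c0) (1, 0, 0) = 0 := by rw [w, b1, mul_zero]
  clear w
  clear v
  generalize ((2 : ℂ) ^ 23 * 3 ^ 7)⁻¹ • c0 = c at *
  generalize ((2 : ℂ) ^ 23 * 3 ^ 7)⁻¹ • (fun w => f12 (yv (xv w))) = f at *
  have bd := hf.boundary_of_twelve h b b'
  have hr1 := hf.form.isExp_restrict h
  have mm := hf.mom_mom_unit h bd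
  have m0 : mom (mom c 0) 0 (1, 1, 0) = 12 := mm.1.trans v1'
  have r0 : row (mom (mom c 0) 0) 0 = 0 :=
    row_mom_zero hr1.supp (fun n => (mom_boundary h.supp n).trans (bd n)) 0
  refine ⟨bd, m0, by linear_combination mm.2.1 + v1' / 2 - v2' / 2, ?_⟩
  refine ⟨_, _, _, hf.form.lead_zero, hf.form.restrict.lead_zero,
    hf.form.restrict.isExp_restrict hr1, fun m hm => ?_, ?_⟩
  · obtain rfl : m = 0 := by omega
    exact r0
  · rw [row_eq_smul_dq (hf.form.restrict.isExp_restrict hr1) hf.form.restrict.restrict.mod r0, m0]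

end HermMod

namespace HermMod
open Filter Topology

theorem isHermitian_two (a d : ℝ) (b : ℂ) : (!![(a : ℂ), b; star b, d]).IsHermitian := by
  ext i j
  fin_cases i <;> fin_cases j <;> simp

theorem quadratic_two (a d : ℝ) (b : ℂ) (x : Fin 2 → ℂ) :
    star x ⬝ᵥ (!![(a : ℂ), b; star b, d] *ᵥ x) =
      ((a * normSq (x 0) + d * normSq (x 1) + 2 * (star (x 0) * b * x 1).re : ℝ) : ℂ) := by
  apply Complex.ext <;>
    simp [dotProduct, Matrix.mulVec, Fin.sum_univ_two, normSq_apply] <;> ring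

theorem quadratic_two_mul (a d : ℝ) (b u v : ℂ) :
    a * (a * normSq u + d * normSq v + 2 * (star u * b * v).re) =
      normSq (a * u + b * v) + (a * d - normSq b) * normSq v := by
  simp [normSq_apply]
  ring

theorem posDef_two (a d : ℝ) (b : ℂ) :
    (!![(a : ℂ), b; star b, d]).PosDef ↔ 0 < a ∧ 0 < d ∧ normSq b < a * d := by
  constructor
  · intro h
    have h0 : (0 : ℂ) < a := h.diag_pos (i := 0)
    have h1 : (0 : ℂ) < d := h.diag_pos (i := 1)
    have h0' : 0 < a := by exact_mod_cast h0
    have h1' : 0 < d := by exact_mod_cast h1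
    refine ⟨h0', h1', ?_⟩
    have h2 := h.dotProduct_mulVec_pos (x := ![-b, a]) fun e => by
      have := congrFun e 1
      simp at this
      exact h0'.ne' this
    rw [quadratic_two] at h2
    have h3 : 0 < a * normSq (-b) + d * normSq (a : ℂ) + 2 * (star (-b) * b * a).re := by
      exact_mod_cast h2
    have h4 := mul_pos h0' h3
    rw [quadratic_two_mul] at h4
    have : (a : ℂ) * -b + b * a = 0 := by ring
    rw [this, normSq_zero, zero_add, normSq_ofReal] at h4
    have := pos_of_mul_pos_left h4 (by positivity)
    linarith
  · rintro ⟨h0, h1, h2⟩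
    refine .of_dotProduct_mulVec_pos (isHermitian_two a d b) fun x hx => ?_
    rw [quadratic_two]
    suffices 0 < a * normSq (x 0) + d * normSq (x 1) + 2 * (star (x 0) * b * x 1).re by
      exact_mod_cast this
    refine pos_of_mul_pos_right (a := a) ?_ h0.le
    rw [quadratic_two_mul]
    by_cases h : x 1 = 0
    · have : x 0 ≠ 0 := fun h' => hx (by ext i; fin_cases i <;> assumption)
      rw [h]
      simp only [mul_zero, add_zero, map_zero, map_mul]
      have := normSq_pos.2 this
      have h3 : 0 < normSq (a : ℂ) := normSq_pos.2 (by exact_mod_cast h0.ne')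
      positivity
    · have h3 := normSq_pos.2 h
      have h4 := normSq_nonneg ((a : ℂ) * x 0 + b * x 1)
      have h5 : 0 < a * d - normSq b := by linarith
      positivity

theorem posSemidef_two (a d : ℝ) (b : ℂ) :
    (!![(a : ℂ), b; star b, d]).PosSemidef ↔ 0 ≤ a ∧ 0 ≤ d ∧ normSq b ≤ a * d := by
  have add_eps : ∀ ε : ℝ, !![(a : ℂ), b; star b, d] + (ε : ℂ) • 1
      = !![((a + ε : ℝ) : ℂ), b; star b, ((d + ε : ℝ) : ℂ)] := fun ε => by
    ext i j
    fin_cases i <;> fin_cases j <;> simp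
  constructor
  · intro h
    have h0 : (0 : ℂ) ≤ a := h.diag_nonneg (i := 0)
    have h1 : (0 : ℂ) ≤ d := h.diag_nonneg (i := 1)
    refine ⟨by exact_mod_cast h0, by exact_mod_cast h1, ?_⟩
    have key : ∀ ε : ℝ, 0 < ε → normSq b ≤ (a + ε) * (d + ε) := fun ε hε => by
      have h2 : (!![(a : ℂ), b; star b, d] + (ε : ℂ) • (1 : Matrix (Fin 2) (Fin 2) ℂ)).PosDef := by
        refine PosDef.posSemidef_add h ?_
        have : ((ε : ℂ) • (1 : Matrix (Fin 2) (Fin 2) ℂ)) = !![(ε : ℂ), 0; star 0, ε] := by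
          ext i j
          fin_cases i <;> fin_cases j <;> simp
        rw [this, posDef_two]
        exact ⟨hε, hε, by simpa using mul_pos hε hε⟩
      rw [add_eps, posDef_two] at h2
      exact h2.2.2.le
    have t : Tendsto (fun ε : ℝ => (a + ε) * (d + ε)) (𝓝[>] 0) (𝓝 ((a + 0) * (d + 0))) :=
      (Continuous.tendsto (by fun_prop) 0).mono_left nhdsWithin_le_nhds
    simp only [add_zero] at t
    exact ge_of_tendsto t (eventually_nhdsWithin_of_forall fun ε hε => key ε hε)
  · rintro ⟨h0, h1, h2⟩
    refine .of_dotProduct_mulVec_nonneg (isHermitian_two a d b) fun x => ?_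
    rw [quadratic_two]
    suffices 0 ≤ a * normSq (x 0) + d * normSq (x 1) + 2 * (star (x 0) * b * x 1).re by
      exact_mod_cast this
    rcases h0.eq_or_lt with rfl | h0
    · have : b = 0 := by
        rw [zero_mul] at h2
        exact normSq_eq_zero.1 (le_antisymm h2 (normSq_nonneg _))
      have := normSq_nonneg (x 1)
      subst b
      simp
      positivity
    · refine nonneg_of_mul_nonneg_right (a := a) ?_ h0
      rw [quadratic_two_mul]
      have h3 := normSq_nonneg (x 1)
      have h4 := normSq_nonneg ((a : ℂ) * x 0 + b * x 1)
      have h5 : 0 ≤ a * d - normSq b := by linarith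
      positivity

/-- The `2 × 2` matrix with coordinates `w`. -/
def toMat (w : Pt 2) : Matrix (Fin 2) (Fin 2) ℂ :=
  !![w.1, w.2.2 1 + I * w.2.2 0; w.2.2 1 - I * w.2.2 0, w.2.1]

/-- The coordinates of a `2 × 2` matrix. -/
def ofMat (Z : Matrix (Fin 2) (Fin 2) ℂ) : Pt 2 :=
  (Z 0 0, Z 1 1, ![(Z 0 1 - Z 1 0) / (2 * I), (Z 0 1 + Z 1 0) / 2])

theorem toMat_ofMat (Z : Matrix (Fin 2) (Fin 2) ℂ) : toMat (ofMat Z) = Z := by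
  ext i j
  fin_cases i <;> fin_cases j <;> simp [toMat, ofMat] <;> field_simp <;> ring

theorem ofMat_toMat (w : Pt 2) : ofMat (toMat w) = w := by
  refine Prod.ext rfl (Prod.ext rfl ?_)
  ext i
  fin_cases i <;> simp [toMat, ofMat]
  field_simp
  ring

theorem imPart_toMat (w : Pt 2) : (toMat w - (toMat w)ᴴ).map (fun w => w / (2 * Complex.I)) =
    !![(w.1.im : ℂ), ⟨(w.2.2 1).im, (w.2.2 0).im⟩; star ⟨(w.2.2 1).im, (w.2.2 0).im⟩, w.2.1.im] := by
  have e : ∀ z : ℂ, z / (2 * I) = ⟨z.im / 2, -z.re / 2⟩ := fun z => by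
    rw [div_eq_iff (by simp)]
    apply Complex.ext <;> simp
  ext i j
  rw [Matrix.map_apply, e]
  apply Complex.ext <;> fin_cases i <;> fin_cases j <;> simp [toMat] <;> ring

theorem toMat_mem {w : Pt 2} : toMat w ∈ HermitianUpperHalfSpace ↔ w ∈ Dom 2 := by
  change ((toMat w - (toMat w)ᴴ).map (fun w => w / (2 * Complex.I))).PosDef ↔ _
  rw [imPart_toMat, posDef_two]
  simp [Dom, normSq_apply, Fin.sum_univ_two]
  intro _ _
  rw [← sq, ← sq, add_comm]

theorem ofMat_mem {Z : Matrix (Fin 2) (Fin 2) ℂ} : ofMat Z ∈ Dom 2 ↔ Z ∈ HermitianUpperHalfSpace := by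
  rw [← toMat_mem, toMat_ofMat]

end HermMod

namespace HermMod
open Filter Topology

theorem sqrtD_neg_four : sqrtD (-4) = 2 * I := by
  have : Real.sqrt 4 = 2 := by
    rw [show (4 : ℝ) = 2 ^ 2 by norm_num]
    exact Real.sqrt_sq (by norm_num)
  simp [sqrtD, this]

theorem mem_ringInt {z : ℂ} : z ∈ ringInt (-4) ↔ ∃ g : GaussianInt, z = g.toComplex := by
  rw [ringInt, Set.mem_ofPred_eq, sqrtD_neg_four]
  constructor
  · rintro ⟨a, b, rfl⟩
    refine ⟨⟨a - 2 * b, b⟩, ?_⟩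
    rw [GaussianInt.toComplex_def]
    push_cast
    ring
  · rintro ⟨⟨a, b⟩, rfl⟩
    refine ⟨a + 2 * b, b, ?_⟩
    rw [GaussianInt.toComplex_def]
    push_cast
    ring

/-- The Hermitian matrix with index `(n, m, (b, a))`. -/
def toH (x : Idx 2) : Matrix (Fin 2) (Fin 2) ℂ :=
  !![(x.1 : ℂ), (x.2.2 1 + x.2.2 0 * I) / 2; (x.2.2 1 - x.2.2 0 * I) / 2, x.2.1]

theorem toH_injective : Function.Injective toH := by
  rintro ⟨n, m, a⟩ ⟨n', m', a'⟩ h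
  have h00 := congrFun (congrFun h 0) 0
  have h11 := congrFun (congrFun h 1) 1
  have h01 := congrFun (congrFun h 0) 1
  simp [toH] at h00 h11 h01
  have hre := congrArg Complex.re h01
  have him := congrArg Complex.im h01
  simp at hre him
  refine Prod.ext h00 (Prod.ext h11 ?_)
  ext i
  fin_cases i
  · exact him
  · exact hre

theorem toH_eq (x : Idx 2) : toH x = !![((x.1 : ℝ) : ℂ), ((x.2.2 1 : ℂ) + x.2.2 0 * I) / 2;
    star (((x.2.2 1 : ℂ) + x.2.2 0 * I) / 2), ((x.2.1 : ℝ) : ℂ)] := by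
  ext i j
  fin_cases i <;> fin_cases j <;> simp [toH]
  ring

theorem normSq_half (a b : ℤ) : normSq (((a : ℂ) + b * I) / 2) = ((a ^ 2 + b ^ 2 : ℤ) : ℝ) / 4 := by
  rw [map_div₀, normSq_apply]
  norm_num [normSq_apply]
  ring

theorem toH_posSemidef (x : Idx 2) : (toH x).PosSemidef ↔ x ∈ cone 2 := by
  rw [toH_eq, posSemidef_two, normSq_half, mem_cone, Fin.sum_univ_two, div_le_iff₀ (by norm_num)]
  constructor
  · rintro ⟨_, _, h⟩
    have : x.2.2 1 ^ 2 + x.2.2 0 ^ 2 ≤ (x.1 : ℤ) * x.2.1 * 4 := by exact_mod_cast h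
    linarith
  · intro h
    refine ⟨by positivity, by positivity, ?_⟩
    have : x.2.2 1 ^ 2 + x.2.2 0 ^ 2 ≤ (x.1 : ℤ) * x.2.1 * 4 := by linarith
    exact_mod_cast this

theorem toH_posDef (x : Idx 2) :
    (toH x).PosDef ↔ x.2.2 1 ^ 2 + x.2.2 0 ^ 2 < 4 * (x.1 : ℤ) * x.2.1 := by
  rw [toH_eq, posDef_two, normSq_half, div_lt_iff₀ (by norm_num)]
  constructor
  · rintro ⟨_, _, h⟩
    have : x.2.2 1 ^ 2 + x.2.2 0 ^ 2 < (x.1 : ℤ) * x.2.1 * 4 := by exact_mod_cast h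
    linarith
  · intro h
    have h1 : 0 < (x.1 : ℤ) * x.2.1 := by nlinarith [sq_nonneg (x.2.2 1), sq_nonneg (x.2.2 0)]
    have h2 : 0 < x.1 * x.2.1 := by exact_mod_cast h1
    have h3 : 0 < x.1 := Nat.pos_of_mul_pos_right h2
    have h4 : 0 < x.2.1 := Nat.pos_of_mul_pos_left h2
    refine ⟨by exact_mod_cast h3, by exact_mod_cast h4, ?_⟩
    have : x.2.2 1 ^ 2 + x.2.2 0 ^ 2 < (x.1 : ℤ) * x.2.1 * 4 := by linarith
    exact_mod_cast this

theorem toH_mem_lambda (x : Idx 2) : toH x ∈ LambdaH (-4) := by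
  refine ⟨by rw [toH_eq]; exact isHermitian_two _ _ _, fun i => ?_, fun i j => ?_⟩
  · fin_cases i
    · exact ⟨x.1, by simp [toH]⟩
    · exact ⟨x.2.1, by simp [toH]⟩
  · rw [mem_ringInt, sqrtD_neg_four]
    fin_cases i <;> fin_cases j
    · exact ⟨⟨0, 2 * x.1⟩, by simp [toH, GaussianInt.toComplex_def]; ring⟩
    · refine ⟨⟨-x.2.2 0, x.2.2 1⟩, ?_⟩
      simp [toH, GaussianInt.toComplex_def]
      linear_combination (x.2.2 0 : ℂ) * I_sq
    · refine ⟨⟨x.2.2 0, x.2.2 1⟩, ?_⟩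
      simp [toH, GaussianInt.toComplex_def]
      linear_combination -(x.2.2 0 : ℂ) * I_sq
    · exact ⟨⟨0, 2 * x.2.1⟩, by simp [toH, GaussianInt.toComplex_def]; ring⟩

theorem exists_toH {H : Matrix (Fin 2) (Fin 2) ℂ} (h : H ∈ HermLattice (-4)) :
    ∃ x ∈ cone 2, toH x = H := by
  obtain ⟨⟨hh, hd, ho⟩, hp⟩ := h
  obtain ⟨n, hn⟩ := hd 0
  obtain ⟨m, hm⟩ := hd 1
  obtain ⟨⟨r, s⟩, hg⟩ := mem_ringInt.1 (ho 0 1)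
  rw [sqrtD_neg_four] at hg
  have hn0 : 0 ≤ n := by
    have := hp.diag_nonneg (i := 0)
    rw [hn] at this
    exact_mod_cast this
  have hm0 : 0 ≤ m := by
    have := hp.diag_nonneg (i := 1)
    rw [hm] at this
    exact_mod_cast this
  lift n to ℕ using hn0
  lift m to ℕ using hm0
  have h01 : H 0 1 = ((s : ℂ) + (-r : ℤ) * I) / 2 := by
    rw [GaussianInt.toComplex_def] at hg
    push_cast
    linear_combination (-I / 2) * hg + (H 0 1 - s / 2) * I_sq
  have e : toH (n, m, ![-r, s]) = H := by
    have h10 : H 1 0 = star (H 0 1) := (congrFun (congrFun hh 1) 0).symm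
    rw [toH_eq]
    ext i j
    fin_cases i <;> fin_cases j
    · simpa using hn.symm
    · simpa using h01.symm
    · simp [h10, h01]
    · simpa using hm.symm
  exact ⟨_, (toH_posSemidef _).1 (e ▸ hp), e⟩

theorem mem_hermLattice_toH {x : Idx 2} : toH x ∈ HermLattice (-4) ↔ x ∈ cone 2 :=
  ⟨fun h => (toH_posSemidef x).1 h.2, fun h => ⟨toH_mem_lambda x, (toH_posSemidef x).2 h⟩⟩

theorem exp_trace_toH (x : Idx 2) (w : Pt 2) :
    Complex.exp (2 * Real.pi * Complex.I * (toH x * toMat w).trace) = ex x w := by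
  rw [ex]
  congr 2
  simp [toH, toMat, Matrix.trace, Fin.sum_univ_two, Matrix.mul_apply]
  linear_combination (-(x.2.2 0 : ℂ) * w.2.2 0) * I_sq

theorem hasSum_hermLattice {C : Matrix (Fin 2) (Fin 2) ℂ → ℂ} (hC : ∀ H, C H ≠ 0 → H ∈ HermLattice (-4))
    (w : Pt 2) (s : ℂ) :
    HasSum (fun H : HermLattice (-4) => C H * Complex.exp (2 * Real.pi * Complex.I *
      ((H : Matrix (Fin 2) (Fin 2) ℂ) * toMat w).trace)) s ↔
    HasSum (fun x : Idx 2 => C (toH x) * ex x w) s := by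
  have h1 := hasSum_subtype_iff_of_support_subset (a := s)
    (f := fun H : Matrix (Fin 2) (Fin 2) ℂ => C H * Complex.exp (2 * Real.pi * Complex.I *
      (H * toMat w).trace)) (s := HermLattice (-4)) fun H hH => hC H (left_ne_zero_of_mul hH)
  refine h1.trans ?_
  rw [← toH_injective.hasSum_iff]
  · simp only [Function.comp_def, exp_trace_toH]
  · intro H hH
    rw [mul_eq_zero]
    left
    by_contra h
    obtain ⟨x, -, hx⟩ := exists_toH (hC H h)
    exact hH ⟨x, hx⟩

/-- The coordinate expansion of a Hermitian modular form. -/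
theorem isExp_hermitian {k : ℤ} (f : HermitianModularForm (-4) k) :
    IsExp (fun w => f.toFun (toMat w)) (fun x => f.coeff (toH x)) where
  supp x hx := mem_hermLattice_toH.1 (f.coeff_supported _ hx)
  hasSum w hw := (hasSum_hermLattice f.coeff_supported w _).1 (f.expansion _ (toMat_mem.2 hw))

/-- Fourier coefficients indexed by Hermitian matrices. -/
def coeffH (c : Idx 2 → ℂ) : Matrix (Fin 2) (Fin 2) ℂ → ℂ := Function.extend toH c 0

theorem coeffH_toH (c : Idx 2 → ℂ) (x : Idx 2) : coeffH c (toH x) = c x :=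
  toH_injective.extend_apply _ _ _

theorem coeffH_supp {f : Pt 2 → ℂ} {c : Idx 2 → ℂ} (h : IsExp f c) (H : Matrix (Fin 2) (Fin 2) ℂ)
    (hH : coeffH c H ≠ 0) : ∃ x ∈ cone 2, toH x = H := by
  by_cases e : ∃ x, toH x = H
  · obtain ⟨x, rfl⟩ := e
    rw [coeffH_toH] at hH
    exact ⟨x, h.supp x hH, rfl⟩
  · rw [coeffH, Function.extend_apply' _ _ _ e] at hH
    exact absurd rfl hH

theorem coeffH_mem {R : Subring ℂ} {c : Idx 2 → ℂ} (hc : ∀ x, c x ∈ R) (H : Matrix (Fin 2) (Fin 2) ℂ) :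
    coeffH c H ∈ R := by
  by_cases e : ∃ x, toH x = H
  · obtain ⟨x, rfl⟩ := e
    rw [coeffH_toH]
    exact hc x
  · rw [coeffH, Function.extend_apply' _ _ _ e]
    exact R.zero_mem

theorem coeffH_expansion {f : Pt 2 → ℂ} {c : Idx 2 → ℂ} (h : IsExp f c) {Z : Matrix (Fin 2) (Fin 2) ℂ}
    (hZ : Z ∈ HermitianUpperHalfSpace) : HasSum (fun H : HermLattice (-4) => coeffH c H *
      Complex.exp (2 * Real.pi * Complex.I * ((H : Matrix (Fin 2) (Fin 2) ℂ) * Z).trace))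
      (f (ofMat Z)) := by
  rw [← toMat_ofMat Z, hasSum_hermLattice fun H hH => ?_, toMat_ofMat]
  · simp only [coeffH_toH]
    exact h.hasSum _ (ofMat_mem.2 hZ)
  · obtain ⟨x, hx, rfl⟩ := coeffH_supp h H hH
    exact mem_hermLattice_toH.2 hx

theorem differentiableOn_ofMat {f : Pt 2 → ℂ} {c : Idx 2 → ℂ} (h : IsExp f c) :
    DifferentiableOn ℂ (fun Z : Fin 2 → Fin 2 → ℂ => f (ofMat (Matrix.of Z)))
      {Z | Matrix.of Z ∈ HermitianUpperHalfSpace} := by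
  refine h.differentiableOn.comp (t := Dom 2) ?_ fun Z hZ => ofMat_mem.2 hZ
  refine Differentiable.differentiableOn ?_
  simp only [ofMat, Matrix.of_apply]
  refine Differentiable.prodMk (by fun_prop) (Differentiable.prodMk (by fun_prop) ?_)
  rw [differentiable_pi]
  intro i
  fin_cases i
  · simp only [Fin.zero_eta, Matrix.cons_val_zero]
    fun_prop
  · simp only [Fin.mk_one, Matrix.cons_val_one, Matrix.cons_val_fin_one]
    fun_prop

end HermMod

namespace HermMod
open Filter Topology

/-- The block matrices of size four. -/
abbrev Mat4 := Matrix (Fin 2 ⊕ Fin 2) (Fin 2 ⊕ Fin 2) ℂ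

/-- The denominator `CZ + D`. -/
def den (M : Mat4) (Z : Matrix (Fin 2) (Fin 2) ℂ) : Matrix (Fin 2) (Fin 2) ℂ :=
  M.toBlocks₂₁ * Z + M.toBlocks₂₂

/-- The numerator `AZ + B`. -/
def num (M : Mat4) (Z : Matrix (Fin 2) (Fin 2) ℂ) : Matrix (Fin 2) (Fin 2) ℂ :=
  M.toBlocks₁₁ * Z + M.toBlocks₁₂

theorem matAct_eq (M : Mat4) (Z : Matrix (Fin 2) (Fin 2) ℂ) : matAct M Z = num M Z * (den M Z)⁻¹ := rfl

theorem num_den_mul (M N : Mat4) (Z : Matrix (Fin 2) (Fin 2) ℂ) :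
    num (M * N) Z = M.toBlocks₁₁ * num N Z + M.toBlocks₁₂ * den N Z ∧
    den (M * N) Z = M.toBlocks₂₁ * num N Z + M.toBlocks₂₂ * den N Z := by
  rw [← fromBlocks_toBlocks M, ← fromBlocks_toBlocks N, fromBlocks_multiply]
  simp only [num, den, toBlocks_fromBlocks₁₁, toBlocks_fromBlocks₁₂, toBlocks_fromBlocks₂₁,
    toBlocks_fromBlocks₂₂]
  constructor <;> noncomm_ring

/-- The block relations of the unitary group. -/
theorem block_relations {M : Mat4} (hM : Mᴴ * J2 * M = J2) :
    M.toBlocks₂₁ᴴ * M.toBlocks₁₁ = M.toBlocks₁₁ᴴ * M.toBlocks₂₁ ∧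
    M.toBlocks₂₁ᴴ * M.toBlocks₁₂ = M.toBlocks₁₁ᴴ * M.toBlocks₂₂ - 1 ∧
    M.toBlocks₂₂ᴴ * M.toBlocks₁₁ = M.toBlocks₁₂ᴴ * M.toBlocks₂₁ + 1 ∧
    M.toBlocks₂₂ᴴ * M.toBlocks₁₂ = M.toBlocks₁₂ᴴ * M.toBlocks₂₂ := by
  rw [← fromBlocks_toBlocks M, J2, fromBlocks_conjTranspose, fromBlocks_multiply,
    fromBlocks_multiply, fromBlocks_inj] at hM
  simp only [mul_zero, mul_one, mul_neg, zero_add, add_zero, neg_mul] at hM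
  obtain ⟨h1, h2, h3, h4⟩ := hM
  refine ⟨?_, ?_, ?_, ?_⟩
  · exact eq_of_sub_eq_zero (by rw [← h1]; abel)
  · rw [eq_sub_iff_add_eq, ← sub_eq_zero, sub_eq_add_neg, add_assoc, ← neg_eq_iff_add_eq_zero]
    rw [eq_neg_iff_add_eq_zero] at h2
    rw [eq_comm, ← sub_eq_zero, ← h2]
    abel
  · rw [← h3]; abel
  · exact eq_of_sub_eq_zero (by rw [← h4]; abel)

theorem den_num {M : Mat4} (hM : Mᴴ * J2 * M = J2) (Z : Matrix (Fin 2) (Fin 2) ℂ) :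
    (den M Z)ᴴ * num M Z - (num M Z)ᴴ * den M Z = Z - Zᴴ := by
  obtain ⟨h1, h2, h3, h4⟩ := block_relations hM
  rw [num, den, conjTranspose_add, conjTranspose_add, conjTranspose_mul, conjTranspose_mul]
  generalize M.toBlocks₁₁ = A at *
  generalize M.toBlocks₁₂ = B at *
  generalize M.toBlocks₂₁ = C at *
  generalize M.toBlocks₂₂ = D at *
  have e1 : (Zᴴ * Cᴴ + Dᴴ) * (A * Z + B) - (Zᴴ * Aᴴ + Bᴴ) * (C * Z + D) =
      Zᴴ * (Cᴴ * A - Aᴴ * C) * Z + Zᴴ * (Cᴴ * B - Aᴴ * D) + (Dᴴ * A - Bᴴ * C) * Z +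
        (Dᴴ * B - Bᴴ * D) := by noncomm_ring
  rw [e1, h1, h2, h3, h4]
  noncomm_ring

theorem imPart_eq_smul (Z : Matrix (Fin 2) (Fin 2) ℂ) :
    Z.map (fun w => w / (2 * Complex.I)) = (2 * I)⁻¹ • Z := by
  ext i j
  simp [div_eq_inv_mul]

theorem isUnit_den {M : Mat4} (hM : Mᴴ * J2 * M = J2) {Z : Matrix (Fin 2) (Fin 2) ℂ}
    (hZ : Z ∈ HermitianUpperHalfSpace) : IsUnit (den M Z).det := by
  rw [isUnit_iff_ne_zero]
  intro h0
  obtain ⟨v, hv, hv0⟩ := Matrix.exists_mulVec_eq_zero_iff.2 h0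
  have h1 := PosDef.dotProduct_mulVec_pos hZ hv
  rw [imPart_eq_smul, ← den_num hM, Matrix.smul_mulVec, Matrix.sub_mulVec, ← Matrix.mulVec_mulVec,
    ← Matrix.mulVec_mulVec, hv0, Matrix.mulVec_zero, sub_zero, dotProduct_smul,
    Matrix.dotProduct_mulVec, ← Matrix.star_mulVec, hv0] at h1
  simp at h1

theorem matAct_mem {M : Mat4} (hM : Mᴴ * J2 * M = J2) {Z : Matrix (Fin 2) (Fin 2) ℂ}
    (hZ : Z ∈ HermitianUpperHalfSpace) : matAct M Z ∈ HermitianUpperHalfSpace := by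
  have hu := isUnit_den hM hZ
  have hd : den M Z * (den M Z)⁻¹ = 1 := Matrix.mul_nonsing_inv _ hu
  have hd' : (den M Z)⁻¹ᴴ * (den M Z)ᴴ = 1 := by rw [← conjTranspose_mul, hd, conjTranspose_one]
  have e : matAct M Z - (matAct M Z)ᴴ = (den M Z)⁻¹ᴴ * (Z - Zᴴ) * (den M Z)⁻¹ := by
    rw [← den_num hM Z, matAct_eq, conjTranspose_mul, mul_sub, sub_mul]
    congr 1
    · rw [← mul_assoc, hd', one_mul]
    · rw [← mul_assoc, mul_assoc _ (den M Z), hd, mul_one]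
  change ((matAct M Z - (matAct M Z)ᴴ).map _).PosDef
  rw [e, imPart_eq_smul, ← Matrix.smul_mul, ← Matrix.mul_smul, ← imPart_eq_smul]
  refine PosDef.conjTranspose_mul_mul_same hZ ?_
  refine Matrix.mulVec_injective_of_isUnit ?_
  rw [Matrix.isUnit_iff_isUnit_det]
  exact (Matrix.isUnit_nonsing_inv_det _ hu)

theorem den_mul {M N : Mat4} (hN : Nᴴ * J2 * N = J2) {Z : Matrix (Fin 2) (Fin 2) ℂ}
    (hZ : Z ∈ HermitianUpperHalfSpace) : den (M * N) Z = den M (matAct N Z) * den N Z := by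
  have hd : (den N Z)⁻¹ * den N Z = 1 := Matrix.nonsing_inv_mul _ (isUnit_den hN hZ)
  rw [(num_den_mul M N Z).2, den.eq_1 M, add_mul, matAct_eq]
  simp only [mul_assoc, hd, mul_one]

theorem matAct_mul {M N : Mat4} (hN : Nᴴ * J2 * N = J2) {Z : Matrix (Fin 2) (Fin 2) ℂ}
    (hZ : Z ∈ HermitianUpperHalfSpace) : matAct (M * N) Z = matAct M (matAct N Z) := by
  have hd : (den N Z)⁻¹ * den N Z = 1 := Matrix.nonsing_inv_mul _ (isUnit_den hN hZ)
  have hn : num (M * N) Z = num M (matAct N Z) * den N Z := by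
    rw [(num_den_mul M N Z).1, num.eq_1 M, add_mul, matAct_eq]
    simp only [mul_assoc, hd, mul_one]
  rw [matAct_eq, hn, den_mul hN hZ, Matrix.mul_inv_rev, ← mul_assoc, mul_assoc _ (den N Z),
    Matrix.mul_nonsing_inv _ (isUnit_den hN hZ), mul_one, matAct_eq M]

theorem det_ne_zero_of_unitary {M : Mat4} (hM : Mᴴ * J2 * M = J2) : M.det ≠ 0 := by
  have h := congrArg Matrix.det hM
  have hJ : J2.det ≠ 0 := by
    have e : J2 * J2 = -1 := by
      rw [J2, fromBlocks_multiply, ← fromBlocks_one, fromBlocks_neg]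
      simp
    intro h0
    have := congrArg Matrix.det e
    rw [det_mul, h0, mul_zero, Matrix.det_neg] at this
    norm_num at this
  rw [det_mul] at h
  intro h0
  rw [h0, mul_zero] at h
  exact hJ h.symm

theorem unitary_mul {M N : Mat4} (hM : Mᴴ * J2 * M = J2) (hN : Nᴴ * J2 * N = J2) :
    (M * N)ᴴ * J2 * (M * N) = J2 := by
  calc (M * N)ᴴ * J2 * (M * N) = Nᴴ * (Mᴴ * J2 * M) * N := by
        rw [conjTranspose_mul]
        simp only [mul_assoc]
    _ = J2 := by rw [hM, hN]

/-- The transformation law of weight `k` under `M`. -/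
def Law (k : ℤ) (F : Matrix (Fin 2) (Fin 2) ℂ → ℂ) (M : Mat4) : Prop :=
  ∀ Z ∈ HermitianUpperHalfSpace, F (matAct M Z) = nuChar (-4) k M * (den M Z).det ^ k * F Z

theorem nuChar_mul {k : ℤ} (M N : Mat4) : nuChar (-4) k (M * N) = nuChar (-4) k M * nuChar (-4) k N := by
  simp [nuChar, det_mul, mul_zpow]

theorem nuChar_ne_zero {k : ℤ} {M : Mat4} (hM : Mᴴ * J2 * M = J2) : nuChar (-4) k M ≠ 0 := by
  simp [nuChar, zpow_ne_zero, det_ne_zero_of_unitary hM]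

theorem Law.mul {k : ℤ} {F : Matrix (Fin 2) (Fin 2) ℂ → ℂ} {M N : Mat4} (h : Law k F M)
    (h' : Law k F N) (hN : Nᴴ * J2 * N = J2) : Law k F (M * N) := fun Z hZ => by
  rw [matAct_mul hN hZ, h _ (matAct_mem hN hZ), h' Z hZ, den_mul hN hZ, nuChar_mul, det_mul, mul_zpow]
  ring

theorem Law.cancel {k : ℤ} {F : Matrix (Fin 2) (Fin 2) ℂ → ℂ} {M N : Mat4} (h : Law k F M)
    (h' : Law k F (M * N)) (hM : Mᴴ * J2 * M = J2) (hN : Nᴴ * J2 * N = J2) : Law k F N :=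
  fun Z hZ => by
  have h1 := h' Z hZ
  rw [matAct_mul hN hZ, h _ (matAct_mem hN hZ), den_mul hN hZ, nuChar_mul, det_mul, mul_zpow] at h1
  have h2 := nuChar_ne_zero (k := k) hM
  have h3 : (den M (matAct N Z)).det ^ k ≠ 0 :=
    zpow_ne_zero _ (isUnit_den hM (matAct_mem hN hZ)).ne_zero
  refine mul_left_cancel₀ (mul_ne_zero h2 h3) ?_
  rw [h1]
  ring

/-- The integral unitary matrices are closed under multiplication. -/
theorem group_mul {M N : Mat4} (hM : M ∈ HermitianModularGroup (-4))
    (hN : N ∈ HermitianModularGroup (-4)) : M * N ∈ HermitianModularGroup (-4) := by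
  refine ⟨fun i j => ?_, unitary_mul hM.2 hN.2⟩
  choose a ha using fun j => mem_ringInt.1 (hM.1 i j)
  choose b hb using fun i => mem_ringInt.1 (hN.1 i j)
  rw [mem_ringInt]
  refine ⟨∑ l, a l * b l, ?_⟩
  rw [map_sum, Matrix.mul_apply]
  exact Finset.sum_congr rfl fun l _ => by rw [ha, hb, map_mul]

theorem one_mem_group : (1 : Mat4) ∈ HermitianModularGroup (-4) := by
  refine ⟨fun i j => ?_, by simp⟩
  rw [mem_ringInt, Matrix.one_apply]
  split_ifs
  · exact ⟨1, by simp⟩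
  · exact ⟨0, by simp⟩

/-- The elements of the modular group satisfying a transformation law. -/
def lawMonoid (k : ℤ) (F : Matrix (Fin 2) (Fin 2) ℂ → ℂ) : Submonoid Mat4 where
  carrier := {M | M ∈ HermitianModularGroup (-4) ∧ Law k F M}
  one_mem' := ⟨one_mem_group, fun Z _ => by
    have h : (1 : Mat4) = fromBlocks 1 0 0 1 := fromBlocks_one.symm
    simp [matAct, den, nuChar, h, -fromBlocks_one]⟩
  mul_mem' h h' := ⟨group_mul h.1 h'.1, h.2.mul h'.2 h'.1.2⟩

end HermMod

namespace HermMod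
open Filter Topology

/-- The translation by `S`. -/
def gT (S : Matrix (Fin 2) (Fin 2) ℂ) : Mat4 := fromBlocks 1 S 0 1

/-- The block diagonal matrix with blocks `U`, `V`. -/
def gU (U V : Matrix (Fin 2) (Fin 2) ℂ) : Mat4 := fromBlocks U 0 0 V

/-- The partial inversion in the first variable. -/
def gJ : Mat4 := fromBlocks !![0, 0; 0, 1] !![-1, 0; 0, 0] !![1, 0; 0, 0] !![0, 0; 0, 1]

/-- A matrix with Gaussian integral entries. -/
def Integral2 (U : Matrix (Fin 2) (Fin 2) ℂ) : Prop := ∀ i j, U i j ∈ ringInt (-4)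

theorem zero_mem_ringInt : (0 : ℂ) ∈ ringInt (-4) := mem_ringInt.2 ⟨0, by simp⟩
theorem one_mem_ringInt : (1 : ℂ) ∈ ringInt (-4) := mem_ringInt.2 ⟨1, by simp⟩
theorem I_mem_ringInt : I ∈ ringInt (-4) := mem_ringInt.2 ⟨⟨0, 1⟩, by simp [GaussianInt.toComplex_def]⟩
theorem neg_mem_ringInt {z : ℂ} (h : z ∈ ringInt (-4)) : -z ∈ ringInt (-4) := by
  obtain ⟨g, rfl⟩ := mem_ringInt.1 h
  exact mem_ringInt.2 ⟨-g, by simp⟩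

theorem integral2_of {a b c d : ℂ} (ha : a ∈ ringInt (-4)) (hb : b ∈ ringInt (-4))
    (hc : c ∈ ringInt (-4)) (hd : d ∈ ringInt (-4)) : Integral2 !![a, b; c, d] := fun i j => by
  fin_cases i <;> fin_cases j <;> assumption

theorem integral2_zero : Integral2 0 := fun _ _ => zero_mem_ringInt
theorem integral2_one : Integral2 1 := by
  rw [Matrix.one_fin_two]
  exact integral2_of one_mem_ringInt zero_mem_ringInt zero_mem_ringInt one_mem_ringInt

theorem fromBlocks_integral {A B C D : Matrix (Fin 2) (Fin 2) ℂ} (hA : Integral2 A) (hB : Integral2 B)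
    (hC : Integral2 C) (hD : Integral2 D) (i j : Fin 2 ⊕ Fin 2) :
    fromBlocks A B C D i j ∈ ringInt (-4) := by
  rcases i with i | i <;> rcases j with j | j
  exacts [hA i j, hB i j, hC i j, hD i j]

theorem gT_mem {S : Matrix (Fin 2) (Fin 2) ℂ} (hS : Integral2 S) (h : S.IsHermitian) :
    gT S ∈ HermitianModularGroup (-4) := by
  refine ⟨fromBlocks_integral integral2_one hS integral2_zero integral2_one, ?_⟩
  rw [gT, J2, fromBlocks_conjTranspose, fromBlocks_multiply, fromBlocks_multiply]
  simp [h.eq]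

theorem gU_mem {U V : Matrix (Fin 2) (Fin 2) ℂ} (hU : Integral2 U) (hV : Integral2 V)
    (h : Uᴴ * V = 1) : gU U V ∈ HermitianModularGroup (-4) := by
  have h' : Vᴴ * U = 1 := by
    have := congrArg conjTranspose h
    simpa using this
  refine ⟨fromBlocks_integral hU integral2_zero integral2_zero hV, ?_⟩
  rw [gU, J2, fromBlocks_conjTranspose, fromBlocks_multiply, fromBlocks_multiply]
  simp [h, h']

theorem gJ_mem : gJ ∈ HermitianModularGroup (-4) := by
  refine ⟨fromBlocks_integral
    (integral2_of zero_mem_ringInt zero_mem_ringInt zero_mem_ringInt one_mem_ringInt)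
    (integral2_of (neg_mem_ringInt one_mem_ringInt) zero_mem_ringInt zero_mem_ringInt zero_mem_ringInt)
    (integral2_of one_mem_ringInt zero_mem_ringInt zero_mem_ringInt zero_mem_ringInt)
    (integral2_of zero_mem_ringInt zero_mem_ringInt zero_mem_ringInt one_mem_ringInt), ?_⟩
  rw [gJ, J2, fromBlocks_conjTranspose, fromBlocks_multiply, fromBlocks_multiply, fromBlocks_inj]
  refine ⟨?_, ?_, ?_, ?_⟩ <;> ext i j <;> fin_cases i <;> fin_cases j <;>
    simp [Matrix.mul_apply, Fin.sum_univ_two, Matrix.conjTranspose_apply]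

theorem matAct_gT (S Z : Matrix (Fin 2) (Fin 2) ℂ) : matAct (gT S) Z = Z + S := by
  simp [matAct, gT]

theorem den_gT (S Z : Matrix (Fin 2) (Fin 2) ℂ) : den (gT S) Z = 1 := by
  simp [den, gT]

theorem det_gT (S : Matrix (Fin 2) (Fin 2) ℂ) : (gT S).det = 1 := by
  simp [gT]

theorem matAct_gU {U V : Matrix (Fin 2) (Fin 2) ℂ} (h : Uᴴ * V = 1) (Z : Matrix (Fin 2) (Fin 2) ℂ) :
    matAct (gU U V) Z = U * Z * Uᴴ := by
  simp [matAct, gU, Matrix.inv_eq_left_inv h]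

theorem den_gU (U V Z : Matrix (Fin 2) (Fin 2) ℂ) : den (gU U V) Z = V := by
  simp [den, gU]

theorem det_gU (U V : Matrix (Fin 2) (Fin 2) ℂ) : (gU U V).det = U.det * V.det := by
  simp [gU]

theorem den_gJ (w : Pt 2) : (den gJ (toMat w)).det = w.1 := by
  simp [den, gJ, toMat, Matrix.det_fin_two]

theorem det_gJ : gJ.det = 1 := by
  rw [← Matrix.det_submatrix_equiv_self (finSumFinEquiv (m := 2) (n := 2)).symm,
    Matrix.det_succ_row_zero]
  simp [Fin.sum_univ_succ, Matrix.det_fin_three, gJ, finSumFinEquiv, Fin.addCases, Fin.succAbove]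

theorem matAct_gJ {w : Pt 2} (hw : w ∈ Dom 2) : matAct gJ (toMat w) = toMat (invPt w) := by
  have h0 := Dom.ne_zero hw
  have hd : IsUnit (den gJ (toMat w)).det := by rw [den_gJ]; exact h0.isUnit
  have e : num gJ (toMat w) = toMat (invPt w) * den gJ (toMat w) := by
    ext i j
    fin_cases i <;> fin_cases j <;>
      simp [num, den, gJ, toMat, invPt, Matrix.mul_apply, Fin.sum_univ_two] <;> field_simp <;>
      ring_nf <;> simp [I_sq] <;> ring
  rw [matAct_eq, e, Matrix.mul_assoc, Matrix.mul_nonsing_inv _ hd, Matrix.mul_one]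

/-- The exchange of the two coordinates. -/
def uSwap : Matrix (Fin 2) (Fin 2) ℂ := !![0, 1; 1, 0]

/-- The multiplication of the first coordinate by `i`. -/
def uRot : Matrix (Fin 2) (Fin 2) ℂ := !![I, 0; 0, 1]

/-- The elementary matrix adding `t` times the second coordinate to the first. -/
def uElem (t : ℂ) : Matrix (Fin 2) (Fin 2) ℂ := !![1, t; 0, 1]

/-- The contragredient of `uElem t`. -/
def vElem (t : ℂ) : Matrix (Fin 2) (Fin 2) ℂ := !![1, 0; -star t, 1]

theorem uSwap_inv : uSwapᴴ * uSwap = 1 := by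
  ext i j
  fin_cases i <;> fin_cases j <;> simp [uSwap, Matrix.mul_apply]

theorem uRot_inv : uRotᴴ * uRot = 1 := by
  ext i j
  fin_cases i <;> fin_cases j <;> simp [uRot, Matrix.mul_apply]

theorem uElem_inv (t : ℂ) : (uElem t)ᴴ * vElem t = 1 := by
  ext i j
  fin_cases i <;> fin_cases j <;> simp [uElem, vElem, Matrix.mul_apply]

theorem star_mem_ringInt {z : ℂ} (h : z ∈ ringInt (-4)) : star z ∈ ringInt (-4) := by
  obtain ⟨g, rfl⟩ := mem_ringInt.1 h
  exact mem_ringInt.2 ⟨star g, by simp⟩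

theorem gSwap_mem : gU uSwap uSwap ∈ HermitianModularGroup (-4) := by
  have h := integral2_of zero_mem_ringInt one_mem_ringInt one_mem_ringInt zero_mem_ringInt
  exact gU_mem h h uSwap_inv

theorem gRot_mem : gU uRot uRot ∈ HermitianModularGroup (-4) := by
  have h := integral2_of I_mem_ringInt zero_mem_ringInt zero_mem_ringInt one_mem_ringInt
  exact gU_mem h h uRot_inv

theorem gElem_mem {t : ℂ} (ht : t ∈ ringInt (-4)) :
    gU (uElem t) (vElem t) ∈ HermitianModularGroup (-4) :=
  gU_mem (integral2_of one_mem_ringInt ht zero_mem_ringInt one_mem_ringInt)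
    (integral2_of one_mem_ringInt zero_mem_ringInt (neg_mem_ringInt (star_mem_ringInt ht))
      one_mem_ringInt) (uElem_inv t)

theorem matAct_gSwap (w : Pt 2) :
    matAct (gU uSwap uSwap) (toMat w) = toMat (flipPt 0 (swapPt w)) := by
  rw [matAct_gU uSwap_inv]
  ext i j
  fin_cases i <;> fin_cases j <;>
    simp [uSwap, toMat, swapPt, flipPt, Matrix.mul_apply, Fin.sum_univ_two, sub_eq_add_neg]

theorem matAct_gRot (w : Pt 2) : matAct (gU uRot uRot) (toMat w) = toMat (rotPt w) := by
  rw [matAct_gU uRot_inv]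
  ext i j
  fin_cases i <;> fin_cases j <;>
    simp [uRot, toMat, rotPt, Matrix.mul_apply, Fin.sum_univ_two] <;> ring_nf <;> simp [I_sq]
  all_goals ring

theorem matAct_gElem_one (w : Pt 2) :
    matAct (gU (uElem 1) (vElem 1)) (toMat w) = toMat (transPt 1 w) := by
  rw [matAct_gU (uElem_inv 1)]
  ext i j
  fin_cases i <;> fin_cases j <;>
    simp [uElem, toMat, transPt, Matrix.mul_apply, Fin.sum_univ_two] <;> ring

theorem matAct_gElem_I (w : Pt 2) :
    matAct (gU (uElem I) (vElem I)) (toMat w) = toMat (transPt 0 w) := by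
  rw [matAct_gU (uElem_inv I)]
  ext i j
  fin_cases i <;> fin_cases j <;>
    simp [uElem, toMat, transPt, Matrix.mul_apply, Fin.sum_univ_two] <;> ring_nf <;> simp [I_sq] <;> ring

theorem toMat_transpose (w : Pt 2) : (toMat w)ᵀ = toMat (flipPt 0 w) := by
  ext i j
  fin_cases i <;> fin_cases j <;> simp [toMat, flipPt, sub_eq_add_neg]

end HermMod

namespace HermMod
open Filter Topology

theorem law_of_pt {k : ℤ} {f : Pt 2 → ℂ} {M : Mat4} (op : Pt 2 → Pt 2)
    (hop : ∀ w ∈ Dom 2, matAct M (toMat w) = toMat (op w))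
    (h : ∀ w ∈ Dom 2, f (op w) = nuChar (-4) k M * (den M (toMat w)).det ^ k * f w) :
    Law k (fun Z => f (ofMat Z)) M := fun Z hZ => by
  have hw := ofMat_mem.2 hZ
  have h1 := h _ hw
  rw [toMat_ofMat] at h1
  have h2 := hop _ hw
  rw [toMat_ofMat] at h2
  simp only [h2, ofMat_toMat, h1]

theorem lawMonoid_cancel {k : ℤ} {F : Matrix (Fin 2) (Fin 2) ℂ → ℂ} {M N : Mat4}
    (hM : M ∈ lawMonoid k F) (hMN : M * N ∈ lawMonoid k F) (hN : N ∈ HermitianModularGroup (-4)) :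
    N ∈ lawMonoid k F :=
  ⟨hN, hM.2.cancel hMN.2 hM.1.2 hN.2⟩

theorem exists_int_of_star_eq {g : GaussianInt} (h : star g.toComplex = g.toComplex) :
    g.toComplex = ((g.re : ℤ) : ℂ) := by
  have := congrArg Complex.im h
  have h2 : (g.im : ℝ) = 0 := by
    have h3 : -(g.im : ℝ) = g.im := by simpa using this
    linarith
  have h3 : (g.im : ℂ) = 0 := by exact_mod_cast h2
  rw [GaussianInt.toComplex_def, h3]
  simp

theorem toMat_add_hermitian {S : Matrix (Fin 2) (Fin 2) ℂ} (hS : Integral2 S) (h : S.IsHermitian) :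
    ∃ (s t : ℤ) (u : Fin 2 → ℤ), ∀ w, toMat w + S = toMat (w + ((s : ℂ), (t : ℂ), fun i => (u i : ℂ))) := by
  choose g hg using fun i j => mem_ringInt.1 (hS i j)
  have hs : ∀ i j, star (g j i).toComplex = (g i j).toComplex := fun i j => by
    rw [← hg, ← hg]; exact congrFun (congrFun h i) j
  refine ⟨(g 0 0).re, (g 1 1).re, ![(g 0 1).im, (g 0 1).re], fun w => ?_⟩
  have e0 := exists_int_of_star_eq (hs 0 0)
  have e1 := exists_int_of_star_eq (hs 1 1)
  have e2 := hs 1 0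
  ext i j
  fin_cases i <;> fin_cases j <;> simp only [Matrix.add_apply, hg]
  · simp [toMat, e0]
  · simp [toMat, GaussianInt.toComplex_def]; ring
  · simp [toMat, ← e2]
    simp [GaussianInt.toComplex_def]; ring
  · simp [toMat, e1]

theorem IsExp.add_int {d : ℕ} {f : Pt d → ℂ} {c : Idx d → ℂ} (h : IsExp f c) {w : Pt d} (hw : w ∈ Dom d)
    (s t : ℤ) (u : Fin d → ℤ) : f (w + ((s : ℂ), (t : ℂ), fun i => (u i : ℂ))) = f w := by
  have hw' : w + ((s : ℂ), (t : ℂ), fun i => (u i : ℂ)) ∈ Dom d := by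
    simpa using Dom.shift hw s t fun i => (u i : ℝ)
  refine (h.hasSum _ hw').unique ((h.hasSum w hw).congr_fun fun x => ?_)
  rw [ex_shift]
  have : ex x ((s : ℂ), (t : ℂ), fun i => (u i : ℂ)) = 1 := by
    rw [ex]
    refine Complex.exp_eq_one_iff.2 ⟨x.1 * s + x.2.1 * t + ∑ i, x.2.2 i * u i, ?_⟩
    push_cast
    ring
  rw [this, mul_one]

section
variable {R : Subring ℂ} {k : ℤ} {f : Pt 2 → ℂ}

theorem Good.gT_mem (hf : Good R k f) {S : Matrix (Fin 2) (Fin 2) ℂ} (hS : Integral2 S)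
    (h : S.IsHermitian) : gT S ∈ lawMonoid k (fun Z => f (ofMat Z)) := by
  obtain ⟨s, t, u, e⟩ := toMat_add_hermitian hS h
  obtain ⟨c, hc, -⟩ := hf.form.exp
  refine ⟨HermMod.gT_mem hS h, law_of_pt _ (fun w _ => (matAct_gT S _).trans (e w)) fun w hw => ?_⟩
  rw [hc.add_int hw, den_gT, nuChar, det_gT]
  simp

theorem Good.gSwap_mem (hf : Good R k f) (hk : Even k) :
    gU uSwap uSwap ∈ lawMonoid k (fun Z => f (ofMat Z)) := by
  refine ⟨HermMod.gSwap_mem, law_of_pt _ (fun w _ => matAct_gSwap w) fun w hw => ?_⟩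
  rw [hf.form.mod.flip 0 _ (swapPt_mem hw), hf.form.mod.swap w hw, den_gU, nuChar, det_gU]
  simp [uSwap, Matrix.det_fin_two, hk.neg_one_zpow]

theorem Good.gRot_mem (hf : Good R k f) (hk : Even k) :
    gU uRot uRot ∈ lawMonoid k (fun Z => f (ofMat Z)) := by
  refine ⟨HermMod.gRot_mem, law_of_pt _ (fun w _ => matAct_gRot w) fun w hw => ?_⟩
  obtain ⟨m, rfl⟩ := hk
  have e : (m + m) / 2 = m := by omega
  have h1 : (-1 : ℂ) ^ m * I ^ (m + m) = 1 := by
    rw [zpow_add₀ I_ne_zero, ← mul_zpow, ← mul_zpow]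
    simp
  rw [hf.rot w hw, den_gU, nuChar, det_gU, e]
  simp [uRot, Matrix.det_fin_two, h1]

theorem Good.gJ_mem (hf : Good R k f) : gJ ∈ lawMonoid k (fun Z => f (ofMat Z)) := by
  refine ⟨HermMod.gJ_mem, law_of_pt _ (fun w hw => matAct_gJ hw) fun w hw => ?_⟩
  rw [hf.form.mod.inv w hw, den_gJ, nuChar, det_gJ]
  simp

theorem Good.gElem_one_mem (hf : Good R k f) :
    gU (uElem 1) (vElem 1) ∈ lawMonoid k (fun Z => f (ofMat Z)) := by
  refine ⟨gElem_mem one_mem_ringInt, law_of_pt _ (fun w _ => matAct_gElem_one w) fun w hw => ?_⟩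
  rw [hf.form.mod.trans 1 w hw, den_gU, nuChar, det_gU]
  simp [uElem, vElem, Matrix.det_fin_two]

theorem Good.gElem_I_mem (hf : Good R k f) :
    gU (uElem I) (vElem I) ∈ lawMonoid k (fun Z => f (ofMat Z)) := by
  refine ⟨gElem_mem I_mem_ringInt, law_of_pt _ (fun w _ => matAct_gElem_I w) fun w hw => ?_⟩
  rw [hf.form.mod.trans 0 w hw, den_gU, nuChar, det_gU]
  simp [uElem, vElem, Matrix.det_fin_two]

theorem gElem_add (s t : ℂ) :
    gU (uElem (s + t)) (vElem (s + t)) = gU (uElem s) (vElem s) * gU (uElem t) (vElem t) := by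
  rw [gU, gU, gU, fromBlocks_multiply]
  simp only [Matrix.mul_zero, Matrix.zero_mul, add_zero, zero_add, fromBlocks_inj, true_and]
  constructor <;> ext i j <;> fin_cases i <;> fin_cases j <;>
    simp [uElem, vElem, Matrix.mul_apply, Fin.sum_univ_two, add_comm]

theorem gElem_zero : gU (uElem 0) (vElem 0) = 1 := by
  rw [gU, ← fromBlocks_one, fromBlocks_inj]
  refine ⟨?_, rfl, rfl, ?_⟩ <;> ext i j <;> fin_cases i <;> fin_cases j <;> simp [uElem, vElem]

theorem Good.gElem_mem (hf : Good R k f) {t : ℂ} (ht : t ∈ ringInt (-4)) :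
    gU (uElem t) (vElem t) ∈ lawMonoid k (fun Z => f (ofMat Z)) := by
  let A : AddSubgroup GaussianInt :=
    { carrier := {g | gU (uElem g.toComplex) (vElem g.toComplex) ∈ lawMonoid k (fun Z => f (ofMat Z))}
      zero_mem' := by
        rw [Set.mem_ofPred_eq, map_zero, gElem_zero]
        exact one_mem _
      add_mem' := fun {x y} hx hy => by
        rw [Set.mem_ofPred_eq, map_add, gElem_add]
        exact mul_mem hx hy
      neg_mem' := fun {x} hx => by
        refine lawMonoid_cancel hx ?_ (HermMod.gElem_mem (mem_ringInt.2 ⟨_, rfl⟩))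
        rw [← gElem_add, ← map_add, add_neg_cancel, map_zero, gElem_zero]
        exact one_mem _ }
  obtain ⟨g, rfl⟩ := mem_ringInt.1 ht
  have h1 : (1 : GaussianInt) ∈ A := by
    change gU (uElem (GaussianInt.toComplex 1)) (vElem (GaussianInt.toComplex 1)) ∈ lawMonoid k (fun Z => f (ofMat Z))
    rw [map_one]
    exact hf.gElem_one_mem
  have h2 : (⟨0, 1⟩ : GaussianInt) ∈ A := by
    change gU (uElem (GaussianInt.toComplex ⟨0, 1⟩)) (vElem (GaussianInt.toComplex ⟨0, 1⟩)) ∈ lawMonoid k (fun Z => f (ofMat Z))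
    have : GaussianInt.toComplex ⟨0, 1⟩ = I := by simp [GaussianInt.toComplex_def]
    rw [this]
    exact hf.gElem_I_mem
  have e : g = g.re • (1 : GaussianInt) + g.im • (⟨0, 1⟩ : GaussianInt) := by
    ext <;> simp
  have : g ∈ A := by
    rw [e]
    exact A.add_mem (A.zsmul_mem h1 _) (A.zsmul_mem h2 _)
  exact this
end

end HermMod

namespace HermMod
open Filter Topology

/-- A submonoid of the modular group containing the standard generators. -/
structure ContainsGens (Γ : Submonoid Mat4) : Prop where
  sub : ∀ M ∈ Γ, M ∈ HermitianModularGroup (-4)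
  trans : ∀ S, Integral2 S → S.IsHermitian → gT S ∈ Γ
  swap : gU uSwap uSwap ∈ Γ
  rot : gU uRot uRot ∈ Γ
  inv : gJ ∈ Γ
  elem : ∀ g : GaussianInt, gU (uElem g.toComplex) (vElem g.toComplex) ∈ Γ

/-- The column vector with given Gaussian integral entries. -/
def vec (a b c d : GaussianInt) : Fin 2 ⊕ Fin 2 → ℂ :=
  Sum.elim ![a.toComplex, b.toComplex] ![c.toComplex, d.toComplex]

theorem swap_vec (a b c d : GaussianInt) : gU uSwap uSwap *ᵥ vec a b c d = vec b a d c := by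
  rw [vec, gU, fromBlocks_mulVec]
  ext i
  rcases i with i | i <;> fin_cases i <;> simp [vec, uSwap]

theorem inv_vec (a b c d : GaussianInt) : gJ *ᵥ vec a b c d = vec (-c) b a d := by
  rw [vec, gJ, fromBlocks_mulVec]
  ext i
  rcases i with i | i <;> fin_cases i <;> simp [vec]

theorem rot_vec (a b c d : GaussianInt) :
    gU uRot uRot *ᵥ vec a b c d = vec (⟨0, 1⟩ * a) b (⟨0, 1⟩ * c) d := by
  have : GaussianInt.toComplex ⟨0, 1⟩ = I := by simp [GaussianInt.toComplex_def]
  rw [vec, gU, fromBlocks_mulVec]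
  ext i
  rcases i with i | i <;> fin_cases i <;> simp [vec, uRot, this, mul_comm]

theorem elem_vec (t a b c d : GaussianInt) :
    gU (uElem t.toComplex) (vElem t.toComplex) *ᵥ vec a b c d = vec (a + t * b) b c (d - star t * c) := by
  rw [vec, gU, fromBlocks_mulVec]
  ext i
  rcases i with i | i <;> fin_cases i <;> simp [vec, uElem, vElem]
  all_goals ring

theorem trans_vec (n : ℤ) (a b c d : GaussianInt) :
    gT !![(n : ℂ), 0; 0, 0] *ᵥ vec a b c d = vec (a + n * c) b c d := by
  rw [vec, gT, fromBlocks_mulVec]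
  ext i
  rcases i with i | i <;> fin_cases i <;> simp [vec, vecHead, vecTail, mul_comm]

theorem int_mem_ringInt (n : ℤ) : (n : ℂ) ∈ ringInt (-4) := mem_ringInt.2 ⟨n, by simp⟩

theorem natAbs_norm_lt {x y : GaussianInt} (h : x.norm < y.norm) : x.norm.natAbs < y.norm.natAbs := by
  have := GaussianInt.norm_nonneg x
  omega

section
variable {Γ : Submonoid Mat4}

theorem ContainsGens.trans_int (hΓ : ContainsGens Γ) (n : ℤ) : gT !![(n : ℂ), 0; 0, 0] ∈ Γ := by
  refine hΓ.trans _ (integral2_of (int_mem_ringInt n) zero_mem_ringInt zero_mem_ringInt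
    zero_mem_ringInt) ?_
  ext i j
  fin_cases i <;> fin_cases j <;> simp

theorem ContainsGens.exists_fourth_zero (hΓ : ContainsGens Γ) (a b c d : GaussianInt) :
    ∃ g ∈ Γ, ∃ a' b' c', g *ᵥ vec a b c d = vec a' b' c' 0 := by
  induction hn : d.norm.natAbs using Nat.strong_induction_on generalizing a b c d with
  | _ n ih =>
    by_cases hd : d = 0
    · exact ⟨1, one_mem _, a, b, c, by rw [hd, one_mulVec]⟩
    subst hn
    have hlt : (c % d).norm.natAbs < d.norm.natAbs := GaussianInt.natAbs_norm_mod_lt _ hd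
    obtain ⟨g, hg, a', b', c', e⟩ := ih _ hlt (b + star (c / d) * a) a d (c % d) rfl
    refine ⟨g * (gU (uElem (star (c / d)).toComplex) (vElem (star (c / d)).toComplex) *
      gU uSwap uSwap), mul_mem hg (mul_mem (hΓ.elem _) hΓ.swap), a', b', c', ?_⟩
    rw [← mulVec_mulVec, ← mulVec_mulVec, swap_vec, elem_vec, ← e, star_star,
      EuclideanDomain.mod_eq_sub_mul_div, mul_comm d]

theorem ContainsGens.exists_second_zero (hΓ : ContainsGens Γ) (a b : GaussianInt) :
    ∃ g ∈ Γ, ∃ a', g *ᵥ vec a b 0 0 = vec a' 0 0 0 := by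
  induction hn : b.norm.natAbs using Nat.strong_induction_on generalizing a b with
  | _ n ih =>
    by_cases hb : b = 0
    · exact ⟨1, one_mem _, a, by rw [hb, one_mulVec]⟩
    subst hn
    have hlt : (a % b).norm.natAbs < b.norm.natAbs := GaussianInt.natAbs_norm_mod_lt _ hb
    obtain ⟨g, hg, a', e⟩ := ih _ hlt b (a % b) rfl
    refine ⟨g * (gU uSwap uSwap *
      gU (uElem (-(a / b)).toComplex) (vElem (-(a / b)).toComplex)),
      mul_mem hg (mul_mem hΓ.swap (hΓ.elem _)), a', ?_⟩
    rw [← mulVec_mulVec, ← mulVec_mulVec, elem_vec, swap_vec, ← e, mul_zero, sub_zero,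
      EuclideanDomain.mod_eq_sub_mul_div]
    congr 2
    ring

theorem norm_descent {a c : GaussianInt} (h : star c * a = star a * c) (hc : c ≠ 0) :
    ∃ n : ℤ, (a + n * c).norm < c.norm := by
  have hN : 0 < c.norm := GaussianInt.norm_pos.2 hc
  have h1 := congrArg Zsqrtd.im h
  refine ⟨-((star c * a).re / c.norm), ?_⟩
  set r := (star c * a).re with hr
  have h2 := Int.emod_add_mul_ediv r c.norm
  have h3 := Int.emod_nonneg r hN.ne'
  have h4 := Int.emod_lt_of_pos r hN
  set q := r / c.norm
  set s := r % c.norm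
  have h5 : c.norm * (a + ((-q : ℤ) : GaussianInt) * c).norm = s * s := by
    have : s = r - c.norm * q := by linarith
    rw [this]
    simp [Zsqrtd.norm_def] at h1 hr ⊢
    rw [hr]
    have h1' : c.re * a.im = c.im * a.re := by linarith
    linear_combination ((c.re * a.im) - c.im * a.re) * h1'
  nlinarith

theorem ContainsGens.exists_third_zero (hΓ : ContainsGens Γ) (a c : GaussianInt)
    (h : star c * a = star a * c) :
    ∃ g ∈ Γ, g *ᵥ vec 0 1 0 0 = vec 0 1 0 0 ∧ ∃ a', ∀ b, g *ᵥ vec a b c 0 = vec a' b 0 0 := by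
  induction hn : c.norm.natAbs using Nat.strong_induction_on generalizing a c with
  | _ n ih =>
    by_cases hc : c = 0
    · exact ⟨1, one_mem _, by rw [one_mulVec], a, fun b => by rw [hc, one_mulVec]⟩
    subst hn
    obtain ⟨n, hlt⟩ := norm_descent h hc
    have h' : star (a + n * c) * (-c) = star (-c) * (a + n * c) := by
      simp only [star_add, star_mul', star_neg, star_intCast]
      linear_combination h
    obtain ⟨g, hg, e0, a', e⟩ := ih _ (natAbs_norm_lt hlt) (-c) (a + n * c) h' rfl
    refine ⟨g * (gJ * gT !![(n : ℂ), 0; 0, 0]), mul_mem hg (mul_mem hΓ.inv (hΓ.trans_int n)), ?_, a',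
      fun b => ?_⟩
    · rw [← mulVec_mulVec, ← mulVec_mulVec, trans_vec, inv_vec, mul_zero, zero_add, neg_zero, e0]
    · rw [← mulVec_mulVec, ← mulVec_mulVec, trans_vec, inv_vec, e]

theorem ContainsGens.exists_unit_normalize (hΓ : ContainsGens Γ) {u : GaussianInt} (hu : u.norm = 1) :
    ∃ g ∈ Γ, ∀ b, g *ᵥ vec u b 0 0 = vec 1 b 0 0 ∧ g *ᵥ vec 0 b 0 0 = vec 0 b 0 0 := by
  have hI : ∃ n : ℕ, (⟨0, 1⟩ : GaussianInt) ^ n * u = 1 := by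
    obtain ⟨x, y⟩ := u
    simp [Zsqrtd.norm_def] at hu
    have hx : x ^ 2 ≤ 1 := by nlinarith
    have hy : y ^ 2 ≤ 1 := by nlinarith
    have hx1 := abs_le.1 (abs_le_of_sq_le_sq (by linarith : x ^ 2 ≤ 1 ^ 2) (by norm_num))
    have hy1 := abs_le.1 (abs_le_of_sq_le_sq (by linarith : y ^ 2 ≤ 1 ^ 2) (by norm_num))
    obtain ⟨hx1, hx2⟩ := hx1
    obtain ⟨hy1, hy2⟩ := hy1
    interval_cases x <;> interval_cases y <;> simp at hu
    · exact ⟨2, by decide⟩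
    · exact ⟨1, by decide⟩
    · exact ⟨3, by decide⟩
    · exact ⟨0, by decide⟩
  obtain ⟨n, hn⟩ := hI
  refine ⟨gU uRot uRot ^ n, pow_mem hΓ.rot n, fun b => ?_⟩
  have key : ∀ (n : ℕ) (v : GaussianInt), gU uRot uRot ^ n *ᵥ vec v b 0 0 =
      vec ((⟨0, 1⟩ : GaussianInt) ^ n * v) b 0 0 := fun n => by
    induction n with
    | zero => intro v; simp
    | succ n ih =>
      intro v
      rw [pow_succ, ← mulVec_mulVec, rot_vec, mul_zero, ih, pow_succ, mul_assoc]
  exact ⟨by rw [key, hn], by rw [key, mul_zero]⟩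

end

end HermMod

namespace HermMod
open Filter Topology

theorem exists_col_eq_vec {M : Mat4} (hM : M ∈ HermitianModularGroup (-4)) (j : Fin 2 ⊕ Fin 2) :
    ∃ a b c d, M.col j = vec a b c d := by
  choose g hg using fun i => mem_ringInt.1 (hM.1 i j)
  refine ⟨g (.inl 0), g (.inl 1), g (.inr 0), g (.inr 1), ?_⟩
  ext i
  rcases i with i | i <;> fin_cases i <;> simp [vec, hg]

theorem col_mul_eq (g M : Mat4) (j : Fin 2 ⊕ Fin 2) : (g * M).col j = g *ᵥ M.col j := rfl

theorem col_isotropic {M : Mat4} (hM : M ∈ HermitianModularGroup (-4)) (j : Fin 2)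
    {a b c d : GaussianInt} (h : M.col (.inl j) = vec a b c d) :
    star c * a + star d * b = star a * c + star b * d := by
  have h1 := congrFun (congrFun (block_relations hM.2).1 j) j
  have e0 : M (.inl 0) (.inl j) = a.toComplex := congrFun h (.inl 0)
  have e1 : M (.inl 1) (.inl j) = b.toComplex := congrFun h (.inl 1)
  have e2 : M (.inr 0) (.inl j) = c.toComplex := congrFun h (.inr 0)
  have e3 : M (.inr 1) (.inl j) = d.toComplex := congrFun h (.inr 1)
  simp only [Matrix.mul_apply, Fin.sum_univ_two, conjTranspose_apply, toBlocks₁₁, toBlocks₂₁,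
    Matrix.of_apply, e0, e1, e2, e3] at h1
  apply GaussianInt.toComplex_inj.1
  simpa using h1

theorem norm_eq_one_of_mul {x y : GaussianInt} (h : x * y = 1) : y.norm = 1 := by
  have := congrArg Zsqrtd.norm h
  rw [Zsqrtd.norm_mul, Zsqrtd.norm_one] at this
  have h1 := GaussianInt.norm_nonneg x
  have h2 := GaussianInt.norm_nonneg y
  exact Int.eq_one_or_neg_one_of_mul_eq_one' this |>.elim (fun h => h.2) fun h => by omega

section
variable {Γ : Submonoid Mat4}

theorem ContainsGens.exists_col_zero (hΓ : ContainsGens Γ) {M : Mat4}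
    (hM : M ∈ HermitianModularGroup (-4)) : ∃ g ∈ Γ, (g * M).col (.inl 0) = vec 1 0 0 0 := by
  obtain ⟨a, b, c, d, e⟩ := exists_col_eq_vec hM (.inl 0)
  obtain ⟨g, hg, a, b, c, e'⟩ := hΓ.exists_fourth_zero a b c d
  rw [← e, ← col_mul_eq] at e'
  have h := col_isotropic (group_mul (hΓ.sub _ hg) hM) 0 e'
  simp only [star_zero, zero_mul, mul_zero, add_zero] at h
  obtain ⟨g₂, hg₂, -, a, e₂⟩ := hΓ.exists_third_zero a c h
  obtain ⟨g₃, hg₃, a, e₃⟩ := hΓ.exists_second_zero a b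
  have hg' : g₃ * (g₂ * g) ∈ Γ := mul_mem hg₃ (mul_mem hg₂ hg)
  have hN := group_mul (hΓ.sub _ hg') hM
  have e'' : (g₃ * (g₂ * g) * M).col (.inl 0) = vec a 0 0 0 := by
    rw [mul_assoc, mul_assoc, col_mul_eq, col_mul_eq, e', e₂, e₃]
  set N := g₃ * (g₂ * g) * M
  have h1 := congrFun (congrFun (block_relations hN.2).2.2.1 0) 0
  have f0 : N (.inl 0) (.inl 0) = a.toComplex := congrFun e'' (.inl 0)
  have f1 : N (.inl 1) (.inl 0) = 0 := by simpa [vec] using congrFun e'' (.inl 1)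
  have f2 : N (.inr 0) (.inl 0) = 0 := by simpa [vec] using congrFun e'' (.inr 0)
  have f3 : N (.inr 1) (.inl 0) = 0 := by simpa [vec] using congrFun e'' (.inr 1)
  obtain ⟨x, hx⟩ := mem_ringInt.1 (hN.1 (.inr 0) (.inr 0))
  simp only [Matrix.mul_apply, Matrix.add_apply, Fin.sum_univ_two, conjTranspose_apply, toBlocks₁₁,
    toBlocks₂₁, toBlocks₂₂, Matrix.of_apply, f0, f1, f2, f3, hx, Matrix.one_apply_eq, mul_zero,
    add_zero, zero_add] at h1
  have h2 : star x * a = 1 := by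
    apply GaussianInt.toComplex_inj.1
    simpa using h1
  obtain ⟨g₄, hg₄, e₄⟩ := hΓ.exists_unit_normalize (norm_eq_one_of_mul h2)
  refine ⟨g₄ * (g₃ * (g₂ * g)), mul_mem hg₄ hg', ?_⟩
  rw [mul_assoc, col_mul_eq]
  exact (congrArg _ e'').trans (e₄ 0).1

theorem third_row_of_col {M : Mat4} (hM : M ∈ HermitianModularGroup (-4))
    (h : M.col (.inl 0) = vec 1 0 0 0) (j : Fin 2) : M (.inr 0) (.inl j) = 0 := by
  have h1 := congrFun (congrFun (block_relations hM.2).1 0) j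
  have f0 : M (.inl 0) (.inl 0) = 1 := by simpa [vec] using congrFun h (.inl 0)
  have f1 : M (.inl 1) (.inl 0) = 0 := by simpa [vec] using congrFun h (.inl 1)
  have f2 : M (.inr 0) (.inl 0) = 0 := by simpa [vec] using congrFun h (.inr 0)
  have f3 : M (.inr 1) (.inl 0) = 0 := by simpa [vec] using congrFun h (.inr 1)
  simpa [Matrix.mul_apply, Fin.sum_univ_two, toBlocks₁₁, toBlocks₂₁, f0, f1, f2, f3] using h1.symm

theorem ContainsGens.exists_col_one (hΓ : ContainsGens Γ) {M : Mat4}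
    (hM : M ∈ HermitianModularGroup (-4)) (h0 : M.col (.inl 0) = vec 1 0 0 0) :
    ∃ g ∈ Γ, (g * M).col (.inl 0) = vec 1 0 0 0 ∧ (g * M).col (.inl 1) = vec 0 1 0 0 := by
  obtain ⟨a, b, c, d, e⟩ := exists_col_eq_vec hM (.inl 1)
  have hc : c = 0 := by
    have h := third_row_of_col hM h0 1
    have h' : M (.inr 0) (.inl 1) = c.toComplex := congrFun e (.inr 0)
    exact GaussianInt.toComplex_eq_zero.1 (h'.symm.trans h)
  subst hc
  have h := col_isotropic hM 1 e
  simp only [star_zero, zero_mul, mul_zero, zero_add] at h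
  obtain ⟨g, hg, eg, b', e'⟩ := hΓ.exists_third_zero b d h
  have hg' : gU uSwap uSwap * (g * gU uSwap uSwap) ∈ Γ := mul_mem hΓ.swap (mul_mem hg hΓ.swap)
  have hN := group_mul (hΓ.sub _ hg') hM
  have h0' : (gU uSwap uSwap * (g * gU uSwap uSwap) * M).col (.inl 0) = vec 1 0 0 0 := by
    rw [col_mul_eq, h0, ← mulVec_mulVec, ← mulVec_mulVec, swap_vec, eg, swap_vec]
  have h1' : (gU uSwap uSwap * (g * gU uSwap uSwap) * M).col (.inl 1) = vec a b' 0 0 := by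
    rw [col_mul_eq, e, ← mulVec_mulVec, ← mulVec_mulVec, swap_vec, e', swap_vec]
  set G := gU uSwap uSwap * (g * gU uSwap uSwap)
  set N := G * M
  have h1 := congrFun (congrFun (block_relations hN.2).2.2.1 1) 1
  have h2 := congrFun (congrFun (block_relations hN.2).2.2.1 1) 0
  have f0 : N (.inl 0) (.inl 0) = 1 := by simpa [vec] using congrFun h0' (.inl 0)
  have f1 : N (.inl 1) (.inl 0) = 0 := by simpa [vec] using congrFun h0' (.inl 1)
  have f2 : N (.inr 0) (.inl 0) = 0 := by simpa [vec] using congrFun h0' (.inr 0)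
  have f3 : N (.inr 1) (.inl 0) = 0 := by simpa [vec] using congrFun h0' (.inr 1)
  have g0 : N (.inl 0) (.inl 1) = a.toComplex := congrFun h1' (.inl 0)
  have g1 : N (.inl 1) (.inl 1) = b'.toComplex := congrFun h1' (.inl 1)
  have g2 : N (.inr 0) (.inl 1) = 0 := by simpa [vec] using congrFun h1' (.inr 0)
  have g3 : N (.inr 1) (.inl 1) = 0 := by simpa [vec] using congrFun h1' (.inr 1)
  have h3 : star (N (.inr 0) (.inr 1)) = 0 := by
    simpa [Matrix.mul_apply, Fin.sum_univ_two, toBlocks₁₁, toBlocks₂₁, toBlocks₂₂, f0, f1, f2, f3]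
      using h2
  obtain ⟨x, hx⟩ := mem_ringInt.1 (hN.1 (.inr 1) (.inr 1))
  simp only [Matrix.mul_apply, Matrix.add_apply, Fin.sum_univ_two, conjTranspose_apply, toBlocks₁₁,
    toBlocks₂₁, toBlocks₂₂, Matrix.of_apply, g0, g1, g2, g3, hx, h3, Matrix.one_apply_eq, mul_zero,
    add_zero, zero_add, zero_mul] at h1
  have h4 : star x * b' = 1 := by
    apply GaussianInt.toComplex_inj.1
    simpa using h1
  obtain ⟨g₄, hg₄, e₄⟩ := hΓ.exists_unit_normalize (norm_eq_one_of_mul h4)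
  refine ⟨gU (uElem (-a).toComplex) (vElem (-a).toComplex) * (gU uSwap uSwap *
    (g₄ * (gU uSwap uSwap * G))), mul_mem (hΓ.elem _) (mul_mem hΓ.swap
      (mul_mem hg₄ (mul_mem hΓ.swap hg'))), ?_, ?_⟩
  · simp only [mul_assoc]
    rw [col_mul_eq, col_mul_eq, col_mul_eq, col_mul_eq]
    change _ *ᵥ _ *ᵥ _ *ᵥ _ *ᵥ N.col _ = _
    rw [h0', swap_vec, (e₄ 1).2, swap_vec, elem_vec]
    simp
  · simp only [mul_assoc]
    rw [col_mul_eq, col_mul_eq, col_mul_eq, col_mul_eq]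
    change _ *ᵥ _ *ᵥ _ *ᵥ _ *ᵥ N.col _ = _
    rw [h1', swap_vec, (e₄ a).1, swap_vec, elem_vec]
    simp

theorem eq_gT_of_cols {M : Mat4} (hM : M ∈ HermitianModularGroup (-4))
    (h0 : M.col (.inl 0) = vec 1 0 0 0) (h1 : M.col (.inl 1) = vec 0 1 0 0) :
    ∃ S, Integral2 S ∧ S.IsHermitian ∧ M = gT S := by
  have f0 : M (.inl 0) (.inl 0) = 1 := by simpa [vec] using congrFun h0 (.inl 0)
  have f1 : M (.inl 1) (.inl 0) = 0 := by simpa [vec] using congrFun h0 (.inl 1)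
  have f2 : M (.inr 0) (.inl 0) = 0 := by simpa [vec] using congrFun h0 (.inr 0)
  have f3 : M (.inr 1) (.inl 0) = 0 := by simpa [vec] using congrFun h0 (.inr 1)
  have g0 : M (.inl 0) (.inl 1) = 0 := by simpa [vec] using congrFun h1 (.inl 0)
  have g1 : M (.inl 1) (.inl 1) = 1 := by simpa [vec] using congrFun h1 (.inl 1)
  have g2 : M (.inr 0) (.inl 1) = 0 := by simpa [vec] using congrFun h1 (.inr 0)
  have g3 : M (.inr 1) (.inl 1) = 0 := by simpa [vec] using congrFun h1 (.inr 1)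
  have hA : M.toBlocks₁₁ = 1 := by
    ext i j
    fin_cases i <;> fin_cases j <;> simp [toBlocks₁₁, f0, f1, g0, g1]
  have hC : M.toBlocks₂₁ = 0 := by
    ext i j
    fin_cases i <;> fin_cases j <;> simp [toBlocks₂₁, f2, f3, g2, g3]
  obtain ⟨-, -, h3, h4⟩ := block_relations hM.2
  rw [hA, hC, mul_one, mul_zero, zero_add] at h3
  have hD : M.toBlocks₂₂ = 1 := by
    rw [← conjTranspose_conjTranspose M.toBlocks₂₂, h3, conjTranspose_one]
  rw [hD, conjTranspose_one, one_mul, mul_one] at h4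
  refine ⟨M.toBlocks₁₂, fun i j => hM.1 _ _, h4.symm, ?_⟩
  have e := fromBlocks_toBlocks M
  rw [hA, hC, hD] at e
  exact e.symm

theorem ContainsGens.exists_mul_mem (hΓ : ContainsGens Γ) {M : Mat4}
    (hM : M ∈ HermitianModularGroup (-4)) : ∃ g ∈ Γ, g * M ∈ Γ := by
  obtain ⟨g, hg, e⟩ := hΓ.exists_col_zero hM
  obtain ⟨g', hg', e0, e1⟩ := hΓ.exists_col_one (group_mul (hΓ.sub _ hg) hM) e
  have hm := group_mul (hΓ.sub _ hg') (group_mul (hΓ.sub _ hg) hM)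
  obtain ⟨S, hS, hh, e2⟩ := eq_gT_of_cols hm e0 e1
  exact ⟨g' * g, mul_mem hg' hg, by rw [mul_assoc, e2]; exact hΓ.trans S hS hh⟩
end

theorem Good.law {R : Subring ℂ} {k : ℤ} {f : Pt 2 → ℂ} (hf : Good R k f) (hk : Even k) {M : Mat4}
    (hM : M ∈ HermitianModularGroup (-4)) : Law k (fun Z => f (ofMat Z)) M := by
  have hΓ : ContainsGens (lawMonoid k fun Z => f (ofMat Z)) :=
    ⟨fun M h => h.1, fun S hS h => hf.gT_mem hS h, hf.gSwap_mem hk, hf.gRot_mem hk, hf.gJ_mem,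
      fun g => hf.gElem_mem (mem_ringInt.2 ⟨g, rfl⟩)⟩
  obtain ⟨g, hg, h⟩ := hΓ.exists_mul_mem hM
  exact (lawMonoid_cancel hg h hM).2

end HermMod

namespace HermMod
open Filter Topology

/-- The Hermitian modular form attached to a function on the coordinate domain. -/
def Good.toHMF {R : Subring ℂ} {k : ℤ} {f : Pt 2 → ℂ} {c : Idx 2 → ℂ} (hf : Good R k f) (hk : Even k)
    (h : IsExp f c) : HermitianModularForm (-4) k where
  toFun Z := f (ofMat Z)
  coeff := coeffH c
  holo := differentiableOn_ofMat h
  transform M hM Z hZ := hf.law hk hM Z hZ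
  coeff_supported H hH := by
    obtain ⟨x, hx, rfl⟩ := coeffH_supp h H hH
    exact mem_hermLattice_toH.2 hx
  expansion Z hZ := coeffH_expansion h hZ

section
variable {R : Subring ℂ} {k : ℤ} {f : Pt 2 → ℂ} {c : Idx 2 → ℂ}

theorem Good.toHMF_symm (hf : Good R k f) (hk : Even k) (h : IsExp f c) :
    IsSymmetricHMF (hf.toHMF hk h) := fun Z hZ => by
  have hw := ofMat_mem.2 hZ
  change f (ofMat Zᵀ) = f (ofMat Z)
  conv_lhs => rw [← toMat_ofMat Z, toMat_transpose, ofMat_toMat]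
  exact hf.form.mod.flip 0 _ hw

theorem Good.toHMF_cusp (hf : Good R k f) (hk : Even k) (h : IsExp f c)
    (h0 : ∀ n, c (n, 0, 0) = 0) : IsCuspHMF (hf.toHMF hk h) := fun H hH => by
  change coeffH c H = 0
  by_contra hne
  obtain ⟨⟨n, m, a⟩, hx, rfl⟩ := coeffH_supp h H hne
  rw [coeffH_toH] at hne
  rw [toH_posDef] at hH
  rw [mem_cone, Fin.sum_univ_two] at hx
  refine hne ?_
  have e : a = ![a 0, a 1] := by ext i; fin_cases i <;> rfl
  rw [e]
  refine hf.cusp h h0 n m (a 1) (a 0) ?_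
  simp only at hH hx
  omega
end

theorem good_of_hermitian {R : Subring ℂ} {k : ℤ} (hk : Even k) (f : HermitianModularForm (-4) k)
    (hs : IsSymmetricHMF f) (hR : ∀ H, f.coeff H ∈ R) : Good R k (fun w => f.toFun (toMat w)) := by
  have hflip : ∀ w ∈ Dom 2, f.toFun (toMat (flipPt 0 w)) = f.toFun (toMat w) := fun w hw => by
    rw [← toMat_transpose]
    exact hs _ (toMat_mem.2 hw)
  have law : ∀ M ∈ HermitianModularGroup (-4), ∀ w ∈ Dom 2, f.toFun (matAct M (toMat w)) =
      nuChar (-4) k M * (den M (toMat w)).det ^ k * f.toFun (toMat w) := fun M hM w hw =>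
    f.transform M hM _ (toMat_mem.2 hw)
  have hrot : ∀ w ∈ Dom 2, f.toFun (toMat (rotPt w)) = f.toFun (toMat w) := fun w hw => by
    obtain ⟨m, rfl⟩ := hk
    have e : (m + m) / 2 = m := by omega
    have h1 : (-1 : ℂ) ^ m * I ^ (m + m) = 1 := by
      rw [zpow_add₀ I_ne_zero, ← mul_zpow, ← mul_zpow]
      simp
    rw [← matAct_gRot, law _ gRot_mem w hw, den_gU, nuChar, det_gU, e]
    simp [uRot, Matrix.det_fin_two, h1]
  refine ⟨⟨⟨fun w hw => ?_, fun w hw => ?_, fun i w hw => ?_, fun i w hw => ?_⟩,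
    _, isExp_hermitian f, fun x => hR _⟩, hrot⟩
  · rw [← matAct_gJ hw, law _ gJ_mem w hw, den_gJ, nuChar, det_gJ]
    simp
  · rw [← hflip _ (swapPt_mem hw), ← matAct_gSwap, law _ gSwap_mem w hw, den_gU, nuChar, det_gU]
    simp [uSwap, Matrix.det_fin_two, hk.neg_one_zpow]
  · fin_cases i
    · exact hflip w hw
    · have e : flipPt 1 w = flipPt 0 (rotPt (rotPt w)) := by
        ext i <;> simp [flipPt, rotPt]
        fin_cases i <;> simp
      change f.toFun (toMat (flipPt 1 w)) = _
      rw [e, hflip _ (rotPt_mem (rotPt_mem hw)), hrot _ (rotPt_mem hw), hrot w hw]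
  · fin_cases i
    · change f.toFun (toMat (transPt 0 w)) = _
      rw [← matAct_gElem_I, law _ (gElem_mem I_mem_ringInt) w hw, den_gU, nuChar, det_gU]
      simp [uElem, vElem, Matrix.det_fin_two]
    · change f.toFun (toMat (transPt 1 w)) = _
      rw [← matAct_gElem_one, law _ (gElem_mem one_mem_ringInt) w hw, den_gU, nuChar, det_gU]
      simp [uElem, vElem, Matrix.det_fin_two]

end HermMod

namespace HermMod
open Filter Topology

/-- The half integral matrix attached to an index. -/
def toT (x : Idx 1) : Matrix (Fin 2) (Fin 2) ℚ := !![(x.1 : ℚ), x.2.2 0 / 2; x.2.2 0 / 2, x.2.1]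

theorem toT_injective : Function.Injective toT := by
  rintro ⟨n, m, a⟩ ⟨n', m', a'⟩ h
  have h00 := congrFun (congrFun h 0) 0
  have h11 := congrFun (congrFun h 1) 1
  have h01 := congrFun (congrFun h 0) 1
  simp only [toT, Matrix.of_apply, Matrix.cons_val', Matrix.cons_val_zero, Matrix.cons_val_one,
    Nat.cast_inj, Matrix.cons_val_fin_one] at h00 h11 h01
  have h2 : (a 0 : ℚ) = a' 0 := by linarith
  have h3 : a = a' := by
    ext i
    fin_cases i
    exact_mod_cast h2
  rw [h00, h11, h3]

theorem exists_toT {T : Matrix (Fin 2) (Fin 2) ℚ} (h : T ∈ SiegelLattice 2 1) :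
    ∃ x ∈ cone 1, toT x = T := by
  obtain ⟨hs, hd, ho, hp⟩ := h
  obtain ⟨n, hn⟩ := hd 0
  obtain ⟨m, hm⟩ := hd 1
  obtain ⟨a, ha⟩ := ho 0 1
  have h10 : T 1 0 = T 0 1 := hs.apply 0 1
  simp only [Nat.cast_one, one_mul, mul_one] at hn hm ha
  have hn0 : 0 ≤ n := by
    have := hp.diag_nonneg (i := 0)
    rw [Matrix.map_apply, hn] at this
    exact_mod_cast this
  have hm0 : 0 ≤ m := by
    have := hp.diag_nonneg (i := 1)
    rw [Matrix.map_apply, hm] at this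
    exact_mod_cast this
  lift n to ℕ using hn0
  lift m to ℕ using hm0
  have h01 : T 0 1 = a / 2 := by linarith
  have hdet := hp.det_nonneg
  rw [Matrix.det_fin_two] at hdet
  simp only [Matrix.map_apply, h10, hn, hm, h01] at hdet
  refine ⟨(n, m, fun _ => a), ?_, ?_⟩
  · rw [mem_cone]
    have : (a : ℝ) ^ 2 ≤ 4 * n * m := by push_cast at hdet; linarith
    simpa using (by exact_mod_cast this : a ^ 2 ≤ 4 * (n : ℤ) * m)
  · ext i j
    fin_cases i <;> fin_cases j <;> simp [toT, h10, hn, hm, h01]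

theorem toMat_cons_zero (w : Pt 1) : toMat (consPt 0 w) = !![w.1, w.2.2 0; w.2.2 0, w.2.1] := by
  have : (Fin.cons (0 : ℂ) w.2.2 : Fin 2 → ℂ) 1 = w.2.2 0 := rfl
  simp [toMat, consPt, this]

theorem toMat_cons_zero_mem {w : Pt 1} (hw : w ∈ Dom 1) :
    toMat (consPt 0 w) ∈ SiegelUpperHalfSpace 2 := by
  refine ⟨?_, toMat_mem.2 (consPt_zero_mem hw)⟩
  rw [toMat_cons_zero]
  ext i j
  fin_cases i <;> fin_cases j <;> simp

theorem exists_siegel_pt {Z : Matrix (Fin 2) (Fin 2) ℂ} (hZ : Z ∈ SiegelUpperHalfSpace 2) :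
    ∃ w ∈ Dom 1, toMat (consPt 0 w) = Z := by
  have h10 : Z 1 0 = Z 0 1 := hZ.1.apply 0 1
  have e : toMat (consPt 0 (Z 0 0, Z 1 1, fun _ => Z 0 1)) = Z := by
    rw [toMat_cons_zero]
    ext i j
    fin_cases i <;> fin_cases j <;> simp [h10]
  refine ⟨_, ?_, e⟩
  have h : toMat (consPt 0 (Z 0 0, Z 1 1, fun _ => Z 0 1)) ∈ HermitianUpperHalfSpace := by
    rw [e]; exact hZ.2
  simpa [consPt, Dom, Fin.sum_univ_two] using toMat_mem.1 h

theorem exp_trace_toT (x : Idx 1) (w : Pt 1) :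
    Complex.exp (2 * Real.pi * Complex.I * ((toT x).map (fun q => (q : ℂ)) * toMat (consPt 0 w)).trace)
      = ex x w := by
  rw [ex, toMat_cons_zero]
  congr 2
  simp [toT, Matrix.trace, Fin.sum_univ_two, Matrix.mul_apply]
  ring

theorem hasSum_siegelLattice {C : Matrix (Fin 2) (Fin 2) ℚ → ℂ}
    (hC : ∀ T, C T ≠ 0 → T ∈ SiegelLattice 2 1) (w : Pt 1) (s : ℂ) :
    HasSum (fun T : SiegelLattice 2 1 => C T * Complex.exp (2 * Real.pi * Complex.I *
      ((T : Matrix (Fin 2) (Fin 2) ℚ).map (fun q => (q : ℂ)) * toMat (consPt 0 w)).trace)) s ↔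
    HasSum (fun x : Idx 1 => C (toT x) * ex x w) s := by
  have h1 := hasSum_subtype_iff_of_support_subset (a := s)
    (f := fun T : Matrix (Fin 2) (Fin 2) ℚ => C T * Complex.exp (2 * Real.pi * Complex.I *
      (T.map (fun q => (q : ℂ)) * toMat (consPt 0 w)).trace)) (s := SiegelLattice 2 1)
      fun T hT => hC T (left_ne_zero_of_mul hT)
  refine h1.trans ?_
  rw [← toT_injective.hasSum_iff]
  · simp only [Function.comp_def, exp_trace_toT]
  · intro T hT
    rw [mul_eq_zero]
    left
    by_contra h
    obtain ⟨x, -, hx⟩ := exists_toT (hC T h)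
    exact hT ⟨x, hx⟩

theorem isExp_siegel {k : ℤ} (f : SiegelModularForm 2 k (SiegelModularGroup 2) 1) :
    IsExp (fun w => f.toFun (toMat (consPt 0 w))) (fun x => f.coeff (toT x)) where
  supp x hx := by
    obtain ⟨y, hy, e⟩ := exists_toT (f.coeff_supported _ hx)
    rwa [← toT_injective e]
  hasSum w hw := (hasSum_siegelLattice f.coeff_supported w _).1
    (f.expansion _ (toMat_cons_zero_mem hw))

theorem siegel_law {k : ℤ} (f : SiegelModularForm 2 k (SiegelModularGroup 2) 1) {M : Mat4}
    (N : Matrix (Fin 2 ⊕ Fin 2) (Fin 2 ⊕ Fin 2) ℤ) (hN : Nᵀ * Jn 2 * N = Jn 2)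
    (hM : N.map (fun a => (a : ℂ)) = M) {w : Pt 1} (hw : w ∈ Dom 1) :
    f.toFun (matAct M (toMat (consPt 0 w))) =
      (den M (toMat (consPt 0 w))).det ^ k * f.toFun (toMat (consPt 0 w)) := by
  subst hM
  exact f.transform N hN _ (toMat_cons_zero_mem hw)

/-- The multiplication of the first coordinate by `-1`. -/
def uNeg : Matrix (Fin 2) (Fin 2) ℂ := !![-1, 0; 0, 1]

theorem uNeg_inv : uNegᴴ * uNeg = 1 := by
  ext i j
  fin_cases i <;> fin_cases j <;> simp [uNeg, Matrix.mul_apply]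

theorem matAct_gNeg (w : Pt 1) :
    matAct (gU uNeg uNeg) (toMat (consPt 0 w)) = toMat (consPt 0 (flipPt 0 w)) := by
  rw [matAct_gU uNeg_inv, toMat_cons_zero, toMat_cons_zero]
  ext i j
  fin_cases i <;> fin_cases j <;> simp [uNeg, flipPt, Matrix.mul_apply, Fin.sum_univ_two]

theorem form_of_siegel {k : ℤ} (hk : Even k) (f : SiegelModularForm 2 k (SiegelModularGroup 2) 1) :
    Form 1 k ⊤ (fun w => f.toFun (toMat (consPt 0 w))) := by
  refine ⟨⟨fun w hw => ?_, fun w hw => ?_, fun i w hw => ?_, fun i w hw => ?_⟩,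
    _, isExp_siegel f, fun _ => trivial⟩
  · have e : consPt 0 (invPt w) = invPt (consPt 0 w) := by
      rw [consPt_inv]
      simp
    rw [e, ← matAct_gJ (consPt_zero_mem hw), siegel_law f (fromBlocks !![0, 0; 0, 1] !![-1, 0; 0, 0]
      !![1, 0; 0, 0] !![0, 0; 0, 1]) (by decide) ?_ hw, den_gJ]
    · rfl
    · rw [gJ, fromBlocks_map, fromBlocks_inj]
      refine ⟨?_, ?_, ?_, ?_⟩ <;> ext i j <;> fin_cases i <;> fin_cases j <;> simp
  · have e : consPt 0 (swapPt w) = flipPt 0 (swapPt (consPt 0 w)) := by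
      rw [← consPt_swap, ← consPt_flip_zero, neg_zero]
    rw [e, ← matAct_gSwap, siegel_law f (fromBlocks !![0, 1; 1, 0] 0 0 !![0, 1; 1, 0])
      (by decide) ?_ hw, den_gU]
    · simp [uSwap, Matrix.det_fin_two, hk.neg_one_zpow]
    · rw [gU, fromBlocks_map, fromBlocks_inj]
      refine ⟨?_, ?_, ?_, ?_⟩ <;> ext i j <;> fin_cases i <;> fin_cases j <;> simp [uSwap]
  · obtain rfl : i = 0 := Subsingleton.elim _ _
    rw [← matAct_gNeg, siegel_law f (fromBlocks !![-1, 0; 0, 1] 0 0 !![-1, 0; 0, 1])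
      (by decide) ?_ hw, den_gU]
    · simp [uNeg, Matrix.det_fin_two, hk.neg_one_zpow]
    · rw [gU, fromBlocks_map, fromBlocks_inj]
      refine ⟨?_, ?_, ?_, ?_⟩ <;> ext i j <;> fin_cases i <;> fin_cases j <;> simp [uNeg]
  · obtain rfl : i = 0 := Subsingleton.elim _ _
    have e : consPt 0 (transPt 0 w) = transPt 1 (consPt 0 w) := consPt_trans 0 0 w
    rw [e, ← matAct_gElem_one, siegel_law f (fromBlocks !![1, 1; 0, 1] 0 0 !![1, 0; -1, 1])
      (by decide) ?_ hw, den_gU]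
    · simp [vElem, Matrix.det_fin_two]
    · rw [gU, fromBlocks_map, fromBlocks_inj]
      refine ⟨?_, ?_, ?_, ?_⟩ <;> ext i j <;> fin_cases i <;> fin_cases j <;> simp [uElem, vElem]

end HermMod

namespace HermMod
open Filter Topology

theorem mom_sub {d : ℕ} (c c' : Idx (d + 1) → ℂ) (l : ℕ) (y : Idx d) :
    mom (c - c') l y = mom c l y - mom c' l y := by
  simp only [mom, Pi.sub_apply, mul_sub, Finset.sum_sub_distrib]

theorem mom_smul {d : ℕ} (r : ℂ) (c : Idx (d + 1) → ℂ) (l : ℕ) (y : Idx d) :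
    mom (r • c) l y = r * mom c l y := by
  simp only [mom, Pi.smul_apply, smul_eq_mul, Finset.mul_sum]
  exact Finset.sum_congr rfl fun _ _ => by ring

theorem Form.top {d : ℕ} {k : ℤ} {R : Subring ℂ} {f : Pt d → ℂ} (h : Form d k R f) : Form d k ⊤ f :=
  ⟨h.mod, h.exp.choose, h.exp.choose_spec.1, fun _ => trivial⟩

theorem IsExp.eqOn_of_sub {d : ℕ} {f f' : Pt d → ℂ} {c c' : Idx d → ℂ} (h : IsExp f c)
    (h' : IsExp f' c') (e : c - c' = 0) : ∀ w ∈ Dom d, f w = f' w := by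
  have hs := h.sub h'
  rw [e] at hs
  exact fun w hw => sub_eq_zero.1 (hs.eqOn_zero w hw)

/-- Rank 1 forms of small weight are determined by their constant term. -/
theorem eqOn_of_coeff_zero {k : ℤ} {g g' : Pt 1 → ℂ} {c c' : Idx 1 → ℂ} (h : IsExp g c)
    (h' : IsExp g' c') (hg : Form 1 k ⊤ g) (hg' : Form 1 k ⊤ g') (hk : k < 10) (h0 : c 0 = c' 0) :
    ∀ w ∈ Dom 1, g w = g' w :=
  h.eqOn_of_sub h' (rank_one_eq_zero (h.sub h') (hg.sub hg') hk (sub_eq_zero.2 h0))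

theorem eqOn_weight_ten {g g' : Pt 1 → ℂ} {c c' : Idx 1 → ℂ} (h : IsExp g c)
    (h' : IsExp g' c') (hg : Form 1 10 ⊤ g) (hg' : Form 1 10 ⊤ g') (h0 : ∀ n, c (n, 0, 0) = 0)
    (h0' : ∀ n, c' (n, 0, 0) = 0) (hm : mom c 2 (1, 1, 0) = mom c' 2 (1, 1, 0)) :
    ∀ w ∈ Dom 1, g w = g' w := by
  refine h.eqOn_of_sub h' ((weight_ten_vanish (h.sub h') (hg.sub hg') fun n => ?_).2 ?_)
  · rw [Pi.sub_apply, h0, h0', sub_zero]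
  · rw [mom_sub, hm, sub_self]

theorem eqOn_weight_twelve {g g' : Pt 1 → ℂ} {c c' : Idx 1 → ℂ} (h : IsExp g c)
    (h' : IsExp g' c') (hg : Form 1 12 ⊤ g) (hg' : Form 1 12 ⊤ g') (h0 : ∀ n, c (n, 0, 0) = 0)
    (h0' : ∀ n, c' (n, 0, 0) = 0) (hm0 : mom c 0 (1, 1, 0) = 12) (hm2 : mom c 2 (1, 1, 0) = 2)
    (hm : mom c' 2 (1, 1, 0) = 2) : ∀ w ∈ Dom 1, g w = g' w := by
  set μ := mom c' 0 (1, 1, 0) / 12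
  have hz : c' - μ • c = 0 := by
    refine weight_twelve_vanish (h'.sub (h.smul μ)) (hg'.sub (hg.smul trivial)) (fun n => ?_) ?_
    · rw [Pi.sub_apply, Pi.smul_apply, h0, h0', smul_zero, sub_zero]
    · rw [mom_sub, mom_smul, hm0]
      simp only [μ]
      ring
  have hμ : μ = 1 := by
    have := mom_sub c' (μ • c) 2 (1, 1, 0)
    rw [hz, mom_smul, hm, hm2] at this
    have hz0 : mom (0 : Idx 1 → ℂ) 2 (1, 1, 0) = 0 := by simp [mom]
    rw [hz0] at this
    linear_combination this / 2
  refine h.eqOn_of_sub h' ?_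
  rw [hμ, one_smul] at hz
  rw [← neg_sub, hz, neg_zero]

theorem toT_zero : toT 0 = 0 := by
  ext i j
  fin_cases i <;> fin_cases j <;> simp [toT]

theorem toH_zero : toH 0 = 0 := by
  ext i j
  fin_cases i <;> fin_cases j <;> simp [toH]

theorem coeff_toT_boundary {k : ℤ} {f : SiegelModularForm 2 k (SiegelModularGroup 2) 1}
    (hf : ∀ T, ¬ (T.map (fun q => (q : ℝ))).PosDef → f.coeff T = 0) (n : ℕ) :
    f.coeff (toT (n, 0, 0)) = 0 := by
  refine hf _ fun h => ?_
  have := h.diag_pos (i := 1)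
  simp [toT] at this

/-- The second moment of a normalized Siegel cusp form at the first index. -/
theorem siegel_mom_two {k : ℤ} (hk : Even k) {f : SiegelModularForm 2 k (SiegelModularGroup 2) 1}
    (hf : ∀ T, ¬ (T.map (fun q => (q : ℝ))).PosDef → f.coeff T = 0)
    (h1 : f.coeff !![1, 1 / 2; 1 / 2, 1] = 1) :
    mom (fun x => f.coeff (toT x)) 2 (1, 1, 0) = 2 := by
  have hflip := fun b => coeff_flip_zero (isExp_siegel f) (form_of_siegel hk f).mod b (1, 1, 0)
  have e1 : f.coeff (toT (consIdx 1 (1, 1, 0))) = 1 := by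
    rw [← h1]
    congr 1
  have e2 : f.coeff (toT (consIdx 2 (1, 1, 0))) = 0 := by
    refine hf _ fun h => ?_
    have := h.det_pos
    simp [toT, consIdx, Matrix.det_fin_two] at this
  have f1 := hflip 1
  have f2 := hflip 2
  simp only [e1, e2] at f1 f2
  rw [mom, Icc_two]
  rw [Finset.sum_insert (by decide), Finset.sum_insert (by decide), Finset.sum_insert (by decide),
    Finset.sum_insert (by decide), Finset.sum_singleton]
  simp only [e1, e2, f1, f2]
  norm_num

theorem eqOn_siegel {F : Matrix (Fin 2) (Fin 2) ℂ → ℂ} {G : Matrix (Fin 2) (Fin 2) ℂ → ℂ}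
    (h : ∀ w ∈ Dom 1, F (toMat (consPt 0 w)) = G (toMat (consPt 0 w))) :
    ∀ Z ∈ SiegelUpperHalfSpace 2, F Z = G Z := by
  intro Z hZ
  obtain ⟨w, hw, rfl⟩ := exists_siegel_pt hZ
  exact h w hw

theorem restrict_eq_of_lt_ten {k : ℤ} (hk : Even k) (hk10 : k < 10) {E : HermitianModularForm (-4) k}
    (hE : IsSymmetricHMF E) (hE1 : E.coeff 0 = 1)
    {G : SiegelModularForm 2 k (SiegelModularGroup 2) 1} (hG1 : G.coeff 0 = 1) :
    ∀ Z ∈ SiegelUpperHalfSpace 2, E.toFun Z = G.toFun Z := by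
  have hg := (good_of_hermitian (R := ⊤) hk E hE fun _ => trivial).form
  refine eqOn_siegel (eqOn_of_coeff_zero (hg.isExp_restrict (isExp_hermitian E)) (isExp_siegel G)
    hg.restrict (form_of_siegel hk G) hk10 ?_)
  refine (mom_boundary (isExp_hermitian E).supp 0).trans ?_
  refine (congrArg E.coeff toH_zero).trans ?_
  rw [toT_zero, hE1, hG1]

/-- The common part of the computation of the leading terms of the Eisenstein series. -/
theorem exists_lead_of_coeff_zero {R : Subring ℂ} {k : ℤ} {f : Pt 2 → ℂ} {c : Idx 2 → ℂ}
    (hf : Good R k f) (h : IsExp f c) (hc : ∀ x, c x ∈ R) (h0 : c 0 = 1) :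
    ∃ ψ, LevelOne k ψ ∧ PowerSeries.coeff 0 ψ = 1 ∧ CoefIn R ψ ∧ Lead3 0 0 0 f ψ := by
  have h1 := hf.form.isExp_restrict h
  have h2 := hf.form.restrict.isExp_restrict h1
  have e : ∀ n, mom (mom c 0) 0 (n, 0, 0) = c (n, 0, 0) := fun n => by
    rw [mom_boundary h1.supp, mom_boundary h.supp]
  refine ⟨row (mom (mom c 0) 0) 0, h2.rowLevelOne hf.form.restrict.restrict.mod 0, ?_, fun n => ?_,
    _, _, _, hf.form.lead_zero, hf.form.restrict.lead_zero, h2, by simp, rfl⟩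
  · rw [row, PowerSeries.coeff_mk, e]
    exact h0
  · rw [row, PowerSeries.coeff_mk, e]
    exact hc _

end HermMod

namespace HermMod

/-- The ring of `p`-integral rational numbers inside `ℂ`. -/
def pInt {p : ℕ} (hp : p.Prime) : Subring ℂ where
  carrier := {z | IsPIntegral p z}
  mul_mem' := by
    rintro x y ⟨a, b, hb, h⟩ ⟨a', b', hb', h'⟩
    refine ⟨a * a', b * b', fun hd => ?_, ?_⟩
    · exact ((Nat.prime_iff_prime_int.1 hp).dvd_or_dvd hd).elim hb hb'
    · push_cast
      rw [← h, ← h']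
      ring
  add_mem' := by
    rintro x y ⟨a, b, hb, h⟩ ⟨a', b', hb', h'⟩
    refine ⟨a * b' + a' * b, b * b', fun hd => ?_, ?_⟩
    · exact ((Nat.prime_iff_prime_int.1 hp).dvd_or_dvd hd).elim hb hb'
    · push_cast
      rw [← h, ← h']
      ring
  neg_mem' := by
    rintro x ⟨a, b, hb, h⟩
    exact ⟨-a, b, hb, by push_cast; rw [← h]; ring⟩
  one_mem' := ⟨1, 1, (Nat.prime_iff_prime_int.1 hp).not_dvd_one, by simp⟩
  zero_mem' := ⟨0, 1, (Nat.prime_iff_prime_int.1 hp).not_dvd_one, by simp⟩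

theorem inv_six_mem {p : ℕ} (hp : p.Prime) (hp5 : 5 ≤ p) : (6 : ℂ)⁻¹ ∈ pInt hp := by
  refine ⟨1, 6, fun hd => ?_, by simp⟩
  have h6 : p ∣ 2 * 3 := by exact_mod_cast hd
  rcases (Nat.Prime.dvd_mul hp).1 h6 with h | h
  · exact absurd (Nat.le_of_dvd (by norm_num) h) (by omega)
  · exact absurd (Nat.le_of_dvd (by norm_num) h) (by omega)

theorem exists_rat {p : ℕ} (hp : p.Prime) (r : pInt hp) : ∃ q : ℚ, (q : ℂ) = r := by
  obtain ⟨z, a, b, hb, h⟩ := r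
  have hb0 : (b : ℂ) ≠ 0 := fun h0 => hb (by simp [Int.cast_eq_zero.1 h0])
  refine ⟨a / b, ?_⟩
  push_cast
  rw [← h]
  field_simp

/-- Polynomials with `p`-integral coefficients are rational polynomials. -/
theorem exists_rat_poly {p : ℕ} (hp : p.Prime) {σ : Type*} (P : MvPolynomial σ (pInt hp)) :
    ∃ Q : MvPolynomial σ ℚ,
      MvPolynomial.map (algebraMap ℚ ℂ) Q = MvPolynomial.map (algebraMap (pInt hp) ℂ) P := by
  induction P using MvPolynomial.induction_on with
  | C r =>
    obtain ⟨q, hq⟩ := exists_rat hp r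
    refine ⟨MvPolynomial.C q, ?_⟩
    rw [MvPolynomial.map_C, MvPolynomial.map_C]
    exact congrArg MvPolynomial.C hq
  | add P P' h h' =>
    obtain ⟨Q, hQ⟩ := h
    obtain ⟨Q', hQ'⟩ := h'
    exact ⟨Q + Q', by rw [map_add, map_add, hQ, hQ']⟩
  | mul_X P i h =>
    obtain ⟨Q, hQ⟩ := h
    exact ⟨Q * MvPolynomial.X i, by rw [map_mul, map_mul, hQ, MvPolynomial.map_X, MvPolynomial.map_X]⟩

theorem not_modCongr_one {p : ℕ} (hp : p.Prime) : ¬ ModCongr p 1 1 0 := by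
  rintro ⟨a, b, hb, h⟩
  have hp0 : (p : ℂ) ≠ 0 := Nat.cast_ne_zero.2 hp.ne_zero
  refine hb ⟨a, ?_⟩
  rw [sub_zero, pow_one] at h
  field_simp at h
  exact_mod_cast h

theorem modCongr_zero {p : ℕ} (hp : p.Prime) : ModCongr p 1 0 0 := by
  rw [ModCongr, sub_zero, zero_div]
  exact (pInt hp).zero_mem

/-- The index of the first nonzero coefficient of `χ₈`. -/
theorem toH_first : toH (1, 1, ![-1, -1]) = !![1, (-1 - I) / 2; (-1 + I) / 2, 1] := by
  ext i j
  fin_cases i <;> fin_cases j <;> simp [toH]; ring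

theorem not_posDef_of_lexLt {x : Idx 2} (h : lexLt (toH x) (toH (1, 1, ![-1, -1]))) :
    ¬ (toH x).PosDef := by
  obtain ⟨n, m, a⟩ := x
  rw [toH_posDef]
  intro hpos
  simp only [lexLt, toH, Matrix.trace_fin_two_of] at h
  simp at h hpos
  have hn : 0 < n := by
    rcases Nat.eq_zero_or_pos n with rfl | h0
    · simp at hpos; nlinarith [sq_nonneg (a 0), sq_nonneg (a 1)]
    · exact h0
  have hm : 0 < m := by
    rcases Nat.eq_zero_or_pos m with rfl | h0
    · simp at hpos; nlinarith [sq_nonneg (a 0), sq_nonneg (a 1)]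
    · exact h0
  rcases h with h | ⟨h, h' | ⟨h', h'' | ⟨h'', h3⟩⟩⟩
  · have : n + m < 2 := by exact_mod_cast h.trans_eq (by norm_num : (1 + 1 : ℝ) = (2 : ℕ))
    omega
  · omega
  all_goals
    have hm1 : m = 1 := by
      have : n + m = 2 := by exact_mod_cast h.trans (by norm_num : (1 + 1 : ℂ) = (2 : ℕ))
      omega
    subst h' hm1
    push_cast at hpos
  · have : a 1 < -1 := by
      have : (a 1 : ℝ) < -1 := by linarith
      exact_mod_cast this
    nlinarith [sq_nonneg (a 0)]
  · have h1 : a 1 = -1 := by exact_mod_cast h''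
    have : a 0 < -1 := by
      have : (a 0 : ℝ) < -1 := by linarith
      exact_mod_cast this
    rw [h1] at hpos
    nlinarith

theorem isOrdP_of_coeff {p : ℕ} (hp : p.Prime) {k : ℤ} {f : HermitianModularForm (-4) k}
    (hf : IsCuspHMF f) (h1 : f.coeff (toH (1, 1, ![-1, -1])) = 1) :
    IsOrdP p f (toH (1, 1, ![-1, -1])) := by
  refine ⟨f.coeff_supported _ (by rw [h1]; exact one_ne_zero), ?_, fun H hH hlt => ?_⟩
  · rw [h1]
    exact not_modCongr_one hp
  · obtain ⟨x, -, rfl⟩ := exists_toH hH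
    rw [hf _ (not_posDef_of_lexLt hlt)]
    exact modCongr_zero hp

theorem aeval_eq_of_map_eq {R : Subring ℂ} {σ : Type*} {Q : MvPolynomial σ ℚ} {P : MvPolynomial σ R}
    (h : MvPolynomial.map (algebraMap ℚ ℂ) Q = MvPolynomial.map (algebraMap R ℂ) P) (v : σ → ℂ) :
    MvPolynomial.aeval v Q = MvPolynomial.aeval v P := by
  rw [MvPolynomial.aeval_def, MvPolynomial.aeval_def, ← MvPolynomial.eval_map, h,
    MvPolynomial.eval_map]

/-- Existence and uniqueness of the polynomial expressing a form by a system of generators. -/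
theorem GenSystem.existsUnique {p : ℕ} {hp : p.Prime} {v : Pt 2 → Fin 5 → ℂ}
    (S : GenSystem (pInt hp) v) {k : ℤ} {f : Pt 2 → ℂ} (hf : Good (pInt hp) k f) :
    ∃! P : MvPolynomial (Fin 5) ℚ, (∀ m, IsPIntegral p ((P.coeff m : ℚ) : ℂ)) ∧
      ∀ w ∈ Dom 2, f w = MvPolynomial.aeval (v w) P := by
  obtain ⟨P, hP⟩ := S.poly hf
  obtain ⟨Q, hQ⟩ := exists_rat_poly hp P
  refine ⟨Q, ⟨fun m => ?_, fun w hw => ?_⟩, fun Q' hQ' => ?_⟩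
  · have := congrArg (MvPolynomial.coeff m) hQ
    rw [MvPolynomial.coeff_map, MvPolynomial.coeff_map] at this
    change ((Q.coeff m : ℚ) : ℂ) = ((P.coeff m : pInt hp) : ℂ) at this
    rw [this]
    exact (P.coeff m).2
  · rw [aeval_eq_of_map_eq hQ, hP w hw]
  · have h0 : MvPolynomial.map (algebraMap ℚ ℂ) (Q' - Q) = 0 := by
      refine S.independent _ fun w hw => ?_
      rw [MvPolynomial.eval_map, ← MvPolynomial.aeval_def, map_sub, ← hQ'.2 w hw,
        aeval_eq_of_map_eq hQ, ← hP w hw, sub_self]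
    have hinj := MvPolynomial.map_injective (σ := Fin 5) _ (algebraMap ℚ ℂ).injective
    exact sub_eq_zero.1 (hinj (by rw [h0, map_zero]))

theorem exists_lead_e4 {R : Subring ℂ} {f : HermitianModularForm (-4) 4} (hs : IsSymmetricHMF f)
    (hR : ∀ H, f.coeff H ∈ R) (h1 : f.coeff 0 = 1) :
    CoefIn R e4 ∧ Lead3 0 0 0 (fun w => f.toFun (toMat w)) e4 := by
  obtain ⟨ψ, hψ, h0, hc, hl⟩ := exists_lead_of_coeff_zero
    (good_of_hermitian (by decide) f hs hR) (isExp_hermitian f) (fun x => hR _)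
    ((congrArg f.coeff toH_zero).trans h1)
  rw [hψ.eq_e4 h0] at hc hl
  exact ⟨hc, hl⟩

theorem exists_lead_e6 {R : Subring ℂ} {f : HermitianModularForm (-4) 6} (hs : IsSymmetricHMF f)
    (hR : ∀ H, f.coeff H ∈ R) (h1 : f.coeff 0 = 1) :
    CoefIn R e6 ∧ Lead3 0 0 0 (fun w => f.toFun (toMat w)) e6 := by
  obtain ⟨ψ, hψ, h0, hc, hl⟩ := exists_lead_of_coeff_zero
    (good_of_hermitian (by decide) f hs hR) (isExp_hermitian f) (fun x => hR _)
    ((congrArg f.coeff toH_zero).trans h1)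
  rw [hψ.eq_e6 h0] at hc hl
  exact ⟨hc, hl⟩

end HermMod

open HermMod

/-- **Kikuta–Nagaoka structure theorem over ℚ(√-1)** (Theorem 4.4). Let
`p ≥ 5` be prime, `K = ℚ(√-1)` (`d_K = -4`), let `G₄, G₆, X₁₀, X₁₂` be the
standard normalized generators of the even-weight Siegel modular forms of
degree 2, and let `E₄, E₆` be the (normalized) Hermitian Eisenstein series of
weights 4, 6. Then there exist Hermitian cusp forms `χ₈, F₁₀, F₁₂` of weights
8, 10, 12 such that:
(1) `E₄, E₆, χ₈, F₁₀, F₁₂` are algebraically independent and generate the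
graded ring `⊕_{k even} M_k^{(s)}(U₂(O_K), ν_k)_{ℤ_(p)}` over `ℤ_(p)` — every
symmetric even-weight form with `p`-integral coefficients is a unique
`p`-integral polynomial in them;
(2) `E₄|_{S₂} = G₄`, `E₆|_{S₂} = G₆`, `χ₈|_{S₂} = 0`, `F₁₀|_{S₂} = 6X₁₀`,
`F₁₂|_{S₂} = X₁₂`;
(3) `a_{χ₈}([[1, (-1-i)/2], [(-1+i)/2, 1]]) = 1`, so
`ord_p(χ₈) = [[1, (-1-i)/2], [(-1+i)/2, 1]]`. -/
theorem kikuta_nagaoka_generators_sqrt_neg_one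
    (p : ℕ) (hp : Nat.Prime p) (hp5 : 5 ≤ p)
    (G4 : SiegelModularForm 2 4 (SiegelModularGroup 2) 1)
    (G6 : SiegelModularForm 2 6 (SiegelModularGroup 2) 1)
    (X10 : SiegelModularForm 2 10 (SiegelModularGroup 2) 1)
    (X12 : SiegelModularForm 2 12 (SiegelModularGroup 2) 1)
    (hG4norm : G4.coeff 0 = 1) (hG6norm : G6.coeff 0 = 1)
    (hX10cusp : ∀ T, ¬ (T.map (fun q => (q : ℝ))).PosDef → X10.coeff T = 0)
    (hX12cusp : ∀ T, ¬ (T.map (fun q => (q : ℝ))).PosDef → X12.coeff T = 0)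
    (hX10norm : X10.coeff !![1, 1/2; 1/2, 1] = 1)
    (hX12norm : X12.coeff !![1, 1/2; 1/2, 1] = 1)
    (E4 : HermitianModularForm (-4) 4) (E6 : HermitianModularForm (-4) 6)
    (hE4sym : IsSymmetricHMF E4) (hE6sym : IsSymmetricHMF E6)
    (hE4int : ∀ H, IsPIntegral p (E4.coeff H)) (hE6int : ∀ H, IsPIntegral p (E6.coeff H))
    (hE4norm : E4.coeff 0 = 1) (hE6norm : E6.coeff 0 = 1) :
    ∃ (χ8 : HermitianModularForm (-4) 8) (F10 : HermitianModularForm (-4) 10)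
      (F12 : HermitianModularForm (-4) 12),
      IsSymmetricHMF χ8 ∧ IsSymmetricHMF F10 ∧ IsSymmetricHMF F12 ∧
      IsCuspHMF χ8 ∧ IsCuspHMF F10 ∧ IsCuspHMF F12 ∧
      (∀ H, IsPIntegral p (χ8.coeff H)) ∧ (∀ H, IsPIntegral p (F10.coeff H)) ∧
      (∀ H, IsPIntegral p (F12.coeff H)) ∧
      -- (1) algebraic independence …
      (∀ P : MvPolynomial (Fin 5) ℂ,
        (∀ Z ∈ HermitianUpperHalfSpace,
          MvPolynomial.eval
            (![E4.toFun Z, E6.toFun Z, χ8.toFun Z, F10.toFun Z, F12.toFun Z]) P = 0) →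
        P = 0) ∧
      -- … and generation over ℤ_(p), with a unique polynomial for each form
      (∀ k : ℤ, Even k → ∀ f : HermitianModularForm (-4) k, IsSymmetricHMF f →
        (∀ H, IsPIntegral p (f.coeff H)) →
        ∃! P : MvPolynomial (Fin 5) ℚ,
          (∀ m, IsPIntegral p ((P.coeff m : ℚ) : ℂ)) ∧
          ∀ Z ∈ HermitianUpperHalfSpace,
            f.toFun Z =
              MvPolynomial.aeval
                (![E4.toFun Z, E6.toFun Z, χ8.toFun Z, F10.toFun Z, F12.toFun Z]) P) ∧
      -- (2) restrictions to the Siegel upper half-space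
      (∀ Z ∈ SiegelUpperHalfSpace 2,
        E4.toFun Z = G4.toFun Z ∧ E6.toFun Z = G6.toFun Z ∧ χ8.toFun Z = 0 ∧
        F10.toFun Z = 6 * X10.toFun Z ∧ F12.toFun Z = X12.toFun Z) ∧
      -- (3) normalization and order of χ₈
      χ8.coeff !![1, (-1 - Complex.I)/2; (-1 + Complex.I)/2, 1] = 1 ∧
      IsOrdP p χ8 !![1, (-1 - Complex.I)/2; (-1 + Complex.I)/2, 1] := by
  have h6 := inv_six_mem hp hp5
  obtain ⟨f8, c8, g8, x8, i8, b8, m8, n8, l8⟩ := exists_chi_eight h6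
  obtain ⟨f10, c10, g10, x10, i10, b10, m10, l10⟩ := exists_f_ten h6
  obtain ⟨f12, c12, g12, x12, i12, b12, m12, m12', l12⟩ := exists_f_twelve h6
  obtain ⟨ce4, le4⟩ := exists_lead_e4 (R := pInt hp) hE4sym hE4int hE4norm
  obtain ⟨ce6, le6⟩ := exists_lead_e6 (R := pInt hp) hE6sym hE6int hE6norm
  have S : GenSystem (pInt hp)
      (fun w => ![E4.toFun (toMat w), E6.toFun (toMat w), f8 w, f10 w, f12 w]) :=
    ⟨h6, ce4, ce6, good_of_hermitian (by decide) E4 hE4sym hE4int,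
      good_of_hermitian (by decide) E6 hE6sym hE6int, g8, g10, g12, le4, le6, l8, l10, l12⟩
  have hcusp := g8.toHMF_cusp (by decide) x8 b8
  have hnorm : (g8.toHMF (by decide) x8).coeff (toH (1, 1, ![-1, -1])) = 1 :=
    (coeffH_toH _ _).trans n8
  refine ⟨g8.toHMF (by decide) x8, g10.toHMF (by decide) x10, g12.toHMF (by decide) x12,
    g8.toHMF_symm _ x8, g10.toHMF_symm _ x10, g12.toHMF_symm _ x12, hcusp,
    g10.toHMF_cusp _ x10 b10, g12.toHMF_cusp _ x12 b12, coeffH_mem i8, coeffH_mem i10,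
    coeffH_mem i12, fun P hP => ?_, fun k hk f hs hf => ?_, fun Z hZ => ?_, ?_, ?_⟩
  · refine S.independent P fun w hw => ?_
    have := hP (toMat w) (toMat_mem.2 hw)
    change MvPolynomial.eval (![_, _, f8 (ofMat (toMat w)), f10 (ofMat (toMat w)),
      f12 (ofMat (toMat w))]) P = 0 at this
    rwa [ofMat_toMat] at this
  · have hiff : ∀ P : MvPolynomial (Fin 5) ℚ,
        (∀ w ∈ Dom 2, f.toFun (toMat w) = MvPolynomial.aeval
          (![E4.toFun (toMat w), E6.toFun (toMat w), f8 w, f10 w, f12 w]) P) ↔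
        ∀ Z ∈ HermitianUpperHalfSpace, f.toFun Z = MvPolynomial.aeval
          (![E4.toFun Z, E6.toFun Z, f8 (ofMat Z), f10 (ofMat Z), f12 (ofMat Z)]) P := by
      refine fun P => ⟨fun h Z hZ => ?_, fun h w hw => ?_⟩
      · simpa only [toMat_ofMat] using h (ofMat Z) (ofMat_mem.2 hZ)
      · simpa only [ofMat_toMat] using h (toMat w) (toMat_mem.2 hw)
    have := S.existsUnique (good_of_hermitian hk f hs hf)
    simp only [hiff] at this
    exact this
  · have r8 := g8.form.isExp_restrict x8
    rw [m8] at r8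
    have r10 := g10.form.isExp_restrict x10
    have r12 := g12.form.isExp_restrict x12
    have e10 := eqOn_weight_ten r10 ((isExp_siegel X10).smul 6) g10.form.restrict.top
      ((form_of_siegel (by decide) X10).smul trivial)
      (fun n => by rw [mom_boundary x10.supp, b10])
      (fun n => by rw [Pi.smul_apply, coeff_toT_boundary hX10cusp, smul_zero])
      (by rw [mom_smul, siegel_mom_two (by decide) hX10cusp hX10norm, m10]; norm_num)
    have e12 := eqOn_weight_twelve r12 (isExp_siegel X12) g12.form.restrict.top
      (form_of_siegel (by decide) X12) (fun n => by rw [mom_boundary x12.supp, b12])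
      (coeff_toT_boundary hX12cusp) m12 m12' (siegel_mom_two (by decide) hX12cusp hX12norm)
    refine ⟨restrict_eq_of_lt_ten (by decide) (by norm_num) hE4sym hE4norm hG4norm Z hZ,
      restrict_eq_of_lt_ten (by decide) (by norm_num) hE6sym hE6norm hG6norm Z hZ, ?_⟩
    obtain ⟨w, hw, rfl⟩ := exists_siegel_pt hZ
    change f8 (ofMat _) = 0 ∧ f10 (ofMat _) = _ ∧ f12 (ofMat _) = _
    rw [ofMat_toMat]
    exact ⟨r8.eqOn_zero w hw, e10 w hw, e12 w hw⟩
  · rw [← toH_first]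
    exact hnorm
  · rw [← toH_first]
    exact isOrdP_of_coeff hp hcusp hnorm

end
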